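/- For all reals χ, Δ > 1 and μ > 0 there exists n₀ such that the following holds for every n ≥ n₀. Let H be an 𝓕_cr(⌈χ⌉, √n/log n)-tiling on n vertices with crit(H) ≤ χ and maximum degree Δ(H) ≤ Δ. Then every graph G on n vertices with minimum degree δ(G) ≥ (1 − 1/χ + μ)n contains H as a subgraph; equivalently MT(n,H) ≤ (1 − 1/χ + μ)n. -/

import Mathlib

open scoped Classical

namespace Paper

noncomputable section

variable {V : Type} [Fintype V]

/-- The degree of a vertex, via `Set.ncard`. -/
def ndeg (G : SimpleGraph V) (v : V) : ℕ := (G.neighborSet v).ncard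

/-- A proper colouring with colours `0, …, k-1`. -/
def ProperCol (G : SimpleGraph V) (k : ℕ) (C : V → ℕ) : Prop :=
  (∀ v, C v < k) ∧ ∀ ⦃u v⦄, G.Adj u v → C u ≠ C v

/-- A topological colouring with colours `0, …, k-1`: every edge is monochromatic. -/
def TopCol (G : SimpleGraph V) (k : ℕ) (C : V → ℕ) : Prop :=
  (∀ v, C v < k) ∧ ∀ ⦃u v⦄, G.Adj u v → C u = C v

/-- The size of the `i`-th colour class of a colouring. -/
def classCard (C : V → ℕ) (i : ℕ) : ℕ := {v | C v = i}.ncard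

/-- The chromatic number, as a natural number. -/
def chromNum (G : SimpleGraph V) : ℕ := G.chromaticNumber.toNat

/-- The size of the smallest colour class of a colouring with `k` colours. -/
def minClassCard (C : V → ℕ) (k : ℕ) : ℕ := sInf {a | ∃ i < k, a = classCard C i}

/-- The minimum, over proper `χ(G)`-colourings, of the size of the smallest colour class. -/
def alphaNat (G : SimpleGraph V) : ℕ :=
  sInf {a | ∃ C, ProperCol G (chromNum G) C ∧ a = minClassCard C (chromNum G)}

/-- `α(G)`: minimum proportion of vertices in a single colour class over proper
`χ(G)`-colourings. -/
def alphaR (G : SimpleGraph V) : ℝ := (alphaNat G : ℝ) / (Fintype.card V : ℝ)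

/-- The critical chromatic number `crit(G) = (χ(G) − 1)/(1 − α(G))`. -/
def critR (G : SimpleGraph V) : ℝ := ((chromNum G : ℝ) - 1) / (1 - alphaR G)

/-- `𝒟(G)`: values `||φ⁻¹(0)| − |φ⁻¹(1)||` over proper `χ(G)`-colourings `φ`. -/
def DSet (G : SimpleGraph V) : Set ℕ :=
  {d | ∃ C, ProperCol G (chromNum G) C ∧
    d = ((classCard C 0 : ℤ) - (classCard C 1 : ℤ)).natAbs}

/-- The set `S ⊆ ℕ` has greatest common divisor `1`.  (Elements `0` are immaterial, and this
fails when `S ⊆ {0}`, matching the convention `gcd = ∞` in that case.) -/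
def GcdOne (S : Set ℕ) : Prop := ∃ T : Finset ℕ, ↑T ⊆ S ∧ T.gcd id = 1

/-- The orders of the connected components of `G`. -/
def compOrders (G : SimpleGraph V) : Set ℕ :=
  {m | ∃ c : G.ConnectedComponent, m = c.supp.ncard}

/-- Membership in the class `𝓕_cr`. -/
def IsFcr (G : SimpleGraph V) : Prop :=
  (G.chromaticNumber = 2 ∧ GcdOne (DSet G) ∧ GcdOne (compOrders G)) ∨
  (3 ≤ G.chromaticNumber ∧ GcdOne (DSet G))

/-- `H` is a tiling whose tiles satisfy the (isomorphism-invariant) predicate `tile`: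
the vertex set partitions into parts with no edges of `H` between distinct parts, each part
inducing a graph satisfying `tile`. -/
def IsTiling (H : SimpleGraph V) (tile : ∀ (W : Type) [Fintype W], SimpleGraph W → Prop) : Prop :=
  ∃ P : Set (Set V), Setoid.IsPartition P ∧
    (∀ p ∈ P, ∀ q ∈ P, p ≠ q → ∀ u ∈ p, ∀ v ∈ q, ¬ H.Adj u v) ∧
    ∀ p ∈ P, tile ↥p (H.induce p)

/-- Tiles of order at most `w`. -/
def TileLe (w : ℕ) (W : Type) [Fintype W] (F : SimpleGraph W) : Prop := Fintype.card W ≤ w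

/-- Tiles in `𝓕(k, w)`: properly `k`-colourable of order at most `w` (real bound `w`). -/
def TileCol (k : ℕ) (w : ℝ) (W : Type) [Fintype W] (F : SimpleGraph W) : Prop :=
  F.Colorable k ∧ (Fintype.card W : ℝ) ≤ w

/-- Tiles in `𝓕_cr(k, w)` (real bound `w`). -/
def TileFcr (k : ℕ) (w : ℝ) (W : Type) [Fintype W] (F : SimpleGraph W) : Prop :=
  IsFcr F ∧ F.Colorable k ∧ (Fintype.card W : ℝ) ≤ w

/-- Tiles in `𝓕_c(k, w)` (real bound `w`). -/
def TileFc (k : ℕ) (w : ℝ) (W : Type) [Fintype W] (F : SimpleGraph W) : Prop :=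
  GcdOne (compOrders F) ∧ F.Colorable k ∧ (Fintype.card W : ℝ) ≤ w

/-- Tiles isomorphic to a fixed graph `F₀`. -/
def TileIso {m : ℕ} (F₀ : SimpleGraph (Fin m)) (W : Type) [Fintype W]
    (F : SimpleGraph W) : Prop :=
  Nonempty (F ≃g F₀)

/-- `G` contains a copy of `H` as a (not necessarily induced) subgraph. -/
def ContainsCopy {V' : Type} (G : SimpleGraph V) (H : SimpleGraph V') : Prop :=
  ∃ f : V' → V, Function.Injective f ∧ ∀ ⦃u v⦄, H.Adj u v → G.Adj (f u) (f v)

/-- `H` is properly `(k, s)`-flexi-chromatic. -/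
def ProperlyFlexi (H : SimpleGraph V) (k s : ℕ) : Prop :=
  ∃ φ, ProperCol H k φ ∧ ∀ w : Fin k → ℤ, ∑ i, w i = 0 → (∀ i, |w i| ≤ (s : ℤ)) →
    ∃ φ', ProperCol H k φ' ∧
      ∀ i : Fin k, (classCard φ (i : ℕ) : ℤ) - classCard φ' (i : ℕ) = w i

/-- `H` is topologically `(k, s)`-flexi-chromatic. -/
def TopFlexi (H : SimpleGraph V) (k s : ℕ) : Prop :=
  ∃ φ, TopCol H k φ ∧ ∀ w : Fin k → ℤ, ∑ i, w i = 0 → (∀ i, |w i| ≤ (s : ℤ)) →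
    ∃ φ', TopCol H k φ' ∧
      ∀ i : Fin k, (classCard φ (i : ℕ) : ℤ) - classCard φ' (i : ℕ) = w i

/-- `A` is a union of connected components of `H` (the vertex set of a subtiling). -/
def CompClosed (H : SimpleGraph V) (A : Set V) : Prop :=
  ∀ ⦃u v⦄, H.Reachable u v → u ∈ A → v ∈ A

/-- `H` contains `t` pairwise disjoint properly `(k, s)`-flexi-chromatic subtilings together
with one further disjoint topologically `(ℓ, s')`-flexi-chromatic subtiling, each of order at
most `w'`. -/
def HasFlexiSubtilings (H : SimpleGraph V) (t ℓ k s s' w' : ℕ) : Prop :=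
  ∃ (A : Fin t → Set V) (B : Set V),
    (∀ i, CompClosed H (A i)) ∧ CompClosed H B ∧
    (∀ i j, i ≠ j → Disjoint (A i) (A j)) ∧ (∀ i, Disjoint (A i) B) ∧
    (∀ i, (A i).ncard ≤ w') ∧ B.ncard ≤ w' ∧
    (∀ i, ProperlyFlexi (H.induce (A i)) k s) ∧
    TopFlexi (H.induce B) ℓ s'

/-- `H ∈ ℋ(n, w, Δ; χ; t, ℓ, w')`. -/
def InH (H : SimpleGraph V) (n w : ℕ) (Δ χ : ℝ) (t ℓ w' : ℕ) : Prop :=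
  Fintype.card V ≤ n ∧ (∀ v, (ndeg H v : ℝ) ≤ Δ) ∧ IsTiling H (TileLe w) ∧
  critR H ≤ χ ∧ HasFlexiSubtilings H t ℓ ⌈χ⌉₊ (⌈χ⌉₊ * w) w w'

/-- The tight adjacency graph `T(J)` on the edge set `E` of a `k`-uniform hypergraph. -/
def TGraph (k : ℕ) (E : Set (Finset V)) : SimpleGraph ↥E :=
  SimpleGraph.fromRel fun e f => ((e : Finset V) ∩ (f : Finset V)).card = k - 1

/-- The number of tight components. -/
def tightCount (k : ℕ) (E : Set (Finset V)) : ℕ := Nat.card (TGraph k E).ConnectedComponent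

/-- The vertex support of a tight component. -/
def tcSupp (k : ℕ) (E : Set (Finset V)) (c : (TGraph k E).ConnectedComponent) : Set V :=
  {v | ∃ e : ↥E, (TGraph k E).connectedComponentMk e = c ∧ v ∈ (e : Finset V)}

/-- The loose adjacency graph `L(J)` on the tight components. -/
def LGraph (k : ℕ) (E : Set (Finset V)) : SimpleGraph (TGraph k E).ConnectedComponent :=
  SimpleGraph.fromRel fun c c' => (tcSupp k E c ∩ tcSupp k E c').Nonempty

/-- The number of loose components. -/
def looseCount (k : ℕ) (E : Set (Finset V)) : ℕ := Nat.card (LGraph k E).ConnectedComponent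

/-- `(t, ℓ)`-connectedness: some vertex-spanning subhypergraph has at most `t` tight
components and at most `ℓ` loose components. -/
def ConnectedTL (k : ℕ) (E : Set (Finset V)) (t ℓ : ℕ) : Prop :=
  ∃ E' ⊆ E, (∀ v : V, ∃ e ∈ E', v ∈ e) ∧ tightCount k E' ≤ t ∧ looseCount k E' ≤ ℓ

/-- Every vertex is linked to some edge. -/
def Linked (k : ℕ) (E : Set (Finset V)) : Prop :=
  ∀ v : V, ∃ f ∈ E, v ∉ f ∧ ∃ e ∈ E, v ∈ e ∧ (e ∩ f).card = k - 1

/-- `ω` is a fractional `F`-tiling of `G`. -/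
def IsFracTiling {α : Type} [Fintype α] (F : SimpleGraph α) (G : SimpleGraph V)
    (ω : (F →g G) → ℝ) : Prop :=
  (∀ θ, 0 ≤ ω θ ∧ ω θ ≤ 1) ∧
  ∀ v : V, (∑ᶠ θ : F →g G, ω θ * ({u | θ u = v}.ncard : ℝ)) ≤ 1

/-- The weight of a fractional tiling. -/
def fracWeight {α : Type} [Fintype α] (F : SimpleGraph α) (G : SimpleGraph V)
    (ω : (F →g G) → ℝ) : ℝ :=
  (Fintype.card α : ℝ) * ∑ᶠ θ : F →g G, ω θ

/-- For a rational `q > 1`, the numerator `a` in `q = ⌊q⌋ + a/b`. -/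
def aB (q : ℚ) : ℕ := (q - (⌊q⌋ : ℚ)).num.toNat

/-- For a rational `q > 1`, the denominator `b` in `q = ⌊q⌋ + a/b`. -/
def bB (q : ℚ) : ℕ := (q - (⌊q⌋ : ℚ)).den

/-- The bottle graph `B_q`: complete `⌈q⌉`-partite with one part of size `a` and the
remaining `⌈q⌉ − 1` parts of size `b`. -/
def Bgraph (q : ℚ) : SimpleGraph (Σ i : Fin ⌈q⌉₊, Fin (if (i : ℕ) = 0 then aB q else bB q)) :=
  SimpleGraph.completeMultipartiteGraph fun i : Fin ⌈q⌉₊ => Fin (if (i : ℕ) = 0 then aB q else bB q)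

/-- `G` is a `(q, ρ; t, ℓ)`-tiling framework. -/
def TilingFramework (G : SimpleGraph V) (q : ℚ) (ρ : ℝ) (t ℓ : ℕ) : Prop :=
  (∃ ω, IsFracTiling (Bgraph q) G ω ∧
      (1 - ρ) * (Fintype.card V : ℝ) ≤ fracWeight (Bgraph q) G ω) ∧
  ConnectedTL ⌈q⌉₊ (G.cliqueSet ⌈q⌉₊) t ℓ ∧
  Linked ⌈q⌉₊ (G.cliqueSet ⌈q⌉₊)

/-- `G'` (on the vertex set `S`) is an `(ε, d)`-approximation of `G`. -/
def IsApprox (G : SimpleGraph V) (ε d : ℝ) (S : Set V) (G' : SimpleGraph ↥S) : Prop :=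
  G' ≤ G.induce S ∧ (1 - ε) * (Fintype.card V : ℝ) ≤ (S.ncard : ℝ) ∧
  ∀ v : ↥S, (ndeg G (v : V) : ℝ) - d * (Fintype.card V : ℝ) ≤ (ndeg G' v : ℝ)

/-- `G` is `μ`-robustly a `(q, ρ; t, ℓ)`-tiling framework. -/
def RobustFramework (G : SimpleGraph V) (μ : ℝ) (q : ℚ) (ρ : ℝ) (t ℓ : ℕ) : Prop :=
  ∀ (S : Set V) (G' : SimpleGraph ↥S), IsApprox G μ μ S G' → TilingFramework G' q ρ t ℓ

/-- `α(χ) = 1 − (⌈χ⌉ − 1)/χ`. -/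
def alphaOf (χ : ℝ) : ℝ := 1 - ((⌈χ⌉₊ : ℝ) - 1) / χ

/-- The degree sequence of `G` is `(χ, μ)`-strong. -/
def DegSeqStrong (G : SimpleGraph V) (χ μ : ℝ) : Prop :=
  ∃ e : Fin (Fintype.card V) ≃ V,
    (∀ i j, i ≤ j → ndeg G (e i) ≤ ndeg G (e j)) ∧
    ∀ i : Fin (Fintype.card V), ((i : ℕ) + 1 : ℝ) ≤ (Fintype.card V : ℝ) / χ →
      (1 - 1 / χ - alphaOf χ) * (Fintype.card V : ℝ) + χ * alphaOf χ * ((i : ℕ) + 1) +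
          μ * (Fintype.card V : ℝ) ≤ (ndeg G (e i) : ℝ)

/-- `G` is uniformly `(ρ, d)`-dense. -/
def UniformlyDense (G : SimpleGraph V) (ρ d : ℝ) : Prop :=
  ∀ U : Set V, d * (U.ncard : ℝ) ^ 2 / 2 - ρ * (Fintype.card V : ℝ) ^ 2 ≤
    ((G.induce U).edgeSet.ncard : ℝ)

/-- `p`-approximately `(k, s)`-flexi-chromatic with central colouring `φ`, generic in the
kind of colouring `Col` (proper or topological). -/
def ApproxFlexiWith {V : Type} (Col : ℕ → (V → ℕ) → Prop) (k s p : ℕ) (φ : V → ℕ) : Prop :=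
  Col k φ ∧ ∀ w : Fin k → ℤ, ∑ i, w i = 0 → (∀ i, |w i| ≤ (s : ℤ)) →
    ∃ φ', Col k φ' ∧
      ∀ i : Fin k, |(classCard φ (i : ℕ) : ℤ) - classCard φ' (i : ℕ) - w i| ≤ (p : ℤ)

/-- The vertex support of a hypergraph edge set. -/
def hsupp (E : Set (Finset V)) : Set V := {v | ∃ e ∈ E, v ∈ e}

/-- The reachability graph `ℛ(T)` on the vertex set of `T`. -/
def RGraph (k : ℕ) (T : Set (Finset V)) : SimpleGraph ↥(hsupp T) :=
  SimpleGraph.fromRel fun x y => ∃ e ∈ T, ∃ f ∈ T,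
    (x : V) ∈ e ∧ (x : V) ∉ f ∧ (y : V) ∈ f ∧ (y : V) ∉ e ∧ (e ∩ f).card = k - 1

end

section Embedding
open Finset
set_option linter.unusedSectionVars false

variable {U V ι : Type} [Fintype U] [Fintype V] [Fintype ι]

/-- The neighbourhood of a vertex as a finset. -/
noncomputable def nb (G : SimpleGraph V) (x : V) : Finset V := univ.filter fun v => G.Adj x v

@[simp] lemma mem_nb {G : SimpleGraph V} {x v : V} : v ∈ nb G x ↔ G.Adj x v := by simp [nb]

lemma ndeg_eq_card_nb (G : SimpleGraph V) (x : V) : ndeg G x = #(nb G x) := by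
  rw [ndeg, ← Set.ncard_coe_finset]
  congr 1
  ext v
  simp

/-- The common neighbours in `Y` of the images of `S`. -/
noncomputable def cn (G : SimpleGraph V) (f : U → V) (S : Finset U) (Y : Finset V) : Finset V :=
  Y.filter fun v => ∀ x ∈ S, G.Adj (f x) v

/-- A reduced graph `R` with absolute-error regularity between adjacent clusters. -/
structure Reg (G : SimpleGraph V) (Cl : ι → Finset V) (R : SimpleGraph ι) (D : ι → ι → ℝ)
    (d ε m : ℝ) : Prop where
  disj : ∀ i j, i ≠ j → Disjoint (Cl i) (Cl j)
  dens : ∀ i j, R.Adj i j → d ≤ D i j ∧ D i j ≤ 1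
  reg : ∀ i j, R.Adj i j → ∀ Y ⊆ Cl j,
    (#((Cl i).filter fun x => ε * m < |(#(nb G x ∩ Y) : ℝ) - D i j * #Y|) : ℝ) ≤ ε * m
  low : ∀ i, m ≤ #(Cl i)
  up : ∀ i, (#(Cl i) : ℝ) ≤ 2 * m

/-- The common neighbourhood of the images of `S` in `Y` has about the expected size. -/
def Pass (G : SimpleGraph V) (f : U → V) (D : ι → ι → ℝ) (φ : U → ι) (e : ℝ) (S : Finset U)
    (b : U) (Y : Finset V) : Prop :=
  |(#(cn G f S Y) : ℝ) - (∏ x ∈ S, D (φ x) (φ b)) * #Y| ≤ #S * e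

lemma cn_subset (G : SimpleGraph V) (f : U → V) (S : Finset U) (Y : Finset V) :
    cn G f S Y ⊆ Y := filter_subset _ _

lemma cn_congr (G : SimpleGraph V) {f g : U → V} {S : Finset U} (h : ∀ x ∈ S, f x = g x)
    (Y : Finset V) : cn G f S Y = cn G g S Y := by
  apply filter_congr
  intro v _
  exact forall₂_congr fun x hx => by rw [h x hx]

lemma cn_empty (G : SimpleGraph V) (f : U → V) (Y : Finset V) : cn G f ∅ Y = Y := by
  simp [cn]

lemma cn_insert_update (G : SimpleGraph V) (f : U → V) {S : Finset U} {x : U} (hx : x ∉ S) (v : V)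
    (Y : Finset V) : cn G (Function.update f x v) (insert x S) Y = nb G v ∩ cn G f S Y := by
  have h : ∀ y ∈ S, Function.update f x v y = f y := fun y hy =>
    Function.update_of_ne (by rintro rfl; exact hx hy) _ _
  ext u
  simp only [cn, mem_filter, mem_insert, forall_eq_or_imp, Function.update_self, mem_inter, mem_nb]
  constructor
  · rintro ⟨h1, h2, h3⟩
    exact ⟨h2, h1, fun y hy => h y hy ▸ h3 y hy⟩
  · rintro ⟨h2, h1, h3⟩
    exact ⟨h1, h2, fun y hy => (h y hy).symm ▸ h3 y hy⟩

lemma pass_insert {G : SimpleGraph V} {f : U → V} {D : ι → ι → ℝ} {φ : U → ι} {e : ℝ}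
    {S : Finset U} {b : U} {Y : Finset V} {x : U} (hx : x ∉ S) {v : V}
    (h0 : 0 ≤ D (φ x) (φ b)) (h1 : D (φ x) (φ b) ≤ 1) 
    (hp : Pass G f D φ e S b Y)
    (hv : |(#(nb G v ∩ cn G f S Y) : ℝ) - D (φ x) (φ b) * #(cn G f S Y)| ≤ e) :
    Pass G (Function.update f x v) D φ e (insert x S) b Y := by
  unfold Pass at *
  rw [cn_insert_update G f hx, prod_insert hx, card_insert_of_notMem hx]
  push_cast
  set a : ℝ := (#(nb G v ∩ cn G f S Y) : ℝ)
  set c : ℝ := (#(cn G f S Y) : ℝ)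
  set p := ∏ x ∈ S, D (φ x) (φ b)
  set D' := D (φ x) (φ b)
  have h2 : |D' * (c - p * #Y)| ≤ #S * e := by
    rw [abs_mul, abs_of_nonneg h0]
    calc D' * |c - p * #Y| ≤ 1 * (#S * e) := by gcongr
      _ = _ := one_mul _
  calc |a - D' * p * #Y| = |(a - D' * c) + D' * (c - p * #Y)| := by ring_nf
    _ ≤ e + #S * e := (abs_add_le _ _).trans (add_le_add hv h2)
    _ = _ := by ring

lemma pass_empty (G : SimpleGraph V) (f : U → V) (D : ι → ι → ℝ) (φ : U → ι) (e : ℝ) (b : U)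
    (Y : Finset V) : Pass G f D φ e ∅ b Y := by
  simp [Pass, cn_empty]

lemma pass_congr {G : SimpleGraph V} {f g : U → V} {D : ι → ι → ℝ} {φ : U → ι} {e : ℝ}
    {S : Finset U} {b : U} {Y : Finset V} (h : ∀ x ∈ S, f x = g x) :
    Pass G f D φ e S b Y ↔ Pass G g D φ e S b Y := by
  unfold Pass
  rw [cn_congr G h]

/-- The state of a greedy embedding of the piece `T` after the vertices of `E` are embedded. -/
structure PieceInv (G : SimpleGraph V) (H : SimpleGraph U) (D : ι → ι → ℝ) (φ : U → ι)
    (d ε m γ κ : ℝ) (T BT : Finset U) (C0 : U → Finset V) {α : Type} (τ : Finset α) (bf : α → U)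
    (Y : α → Finset V) (ω : α → ℝ) (E : Finset U) (f : U → V) : Prop where
  inj : Set.InjOn f E
  mem : ∀ x ∈ E, f x ∈ C0 x
  edge : ∀ x ∈ E, ∀ y ∈ E, H.Adj x y → G.Adj (f x) (f y)
  cand : ∀ y ∈ T, y ∉ E → γ * (d / 2) ^ #(nb H y ∩ E) * m ≤ #(cn G f (nb H y ∩ E) (C0 y))
  test : ∀ b ∈ BT, (∑ t ∈ τ.filter fun t => bf t = b ∧
    ¬ Pass G f D φ (ε * m) (nb H b ∩ E) b (Y t), ω t) ≤ κ * #(nb H b ∩ E)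

lemma piece_step {G : SimpleGraph V} {H : SimpleGraph U} {Cl : ι → Finset V} {R : SimpleGraph ι}
    {D : ι → ι → ℝ} {d ε m γ : ℝ} (hR : Reg G Cl R D d ε m) (Δ' : ℕ)
    (hdeg : ∀ x, #(nb H x) ≤ Δ') {T BT : Finset U} {φ : U → ι}
    (hom : ∀ x ∈ T, ∀ y ∈ T, H.Adj x y → R.Adj (φ x) (φ y))
    (homB : ∀ x ∈ T, ∀ b ∈ BT, H.Adj x b → R.Adj (φ x) (φ b))
    (sep : ∀ x ∈ T, ∀ b ∈ BT, ∀ b' ∈ BT, H.Adj x b → H.Adj x b' → b = b')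
    {C0 : U → Finset V} (hC0 : ∀ x ∈ T, C0 x ⊆ Cl (φ x))
    {α : Type} {τ : Finset α} {bf : α → U} {Y : α → Finset V} {ω : α → ℝ}
    (hbf : ∀ t ∈ τ, bf t ∈ BT) (hY : ∀ t ∈ τ, Y t ⊆ Cl (φ (bf t))) (hω : ∀ t ∈ τ, 0 ≤ ω t)
    (hω1 : ∀ b ∈ BT, ∑ t ∈ τ.filter (fun t => bf t = b), ω t ≤ 1)
    (hw : (#T : ℝ) ≤ γ * (d / 2) ^ Δ' * m / 4)
    (hε : 4 * (Δ' + 1) * ε ≤ γ * (d / 2) ^ (Δ' + 1))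
    (hd : 0 < d) (hd1 : d ≤ 1) (hγ : 0 < γ) (hm : 0 < m) (hε0 : 0 ≤ ε)
    {E : Finset U} (hE : E ⊆ T) {x : U} (hxT : x ∈ T) (hxE : x ∉ E) {f : U → V}
    (hf : PieceInv G H D φ d ε m γ (2 * ε / (γ * (d / 2) ^ Δ')) T BT C0 τ bf Y ω E f) :
    ∃ v, PieceInv G H D φ d ε m γ (2 * ε / (γ * (d / 2) ^ Δ')) T BT C0 τ bf Y ω (insert x E)
      (Function.update f x v) := by
  set γ1 := γ * (d / 2) ^ Δ' with hγ1
  have hγ1pos : 0 < γ1 := by positivity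
  have hpow : ∀ y ∈ T, y ∉ E → γ1 * m ≤ #(cn G f (nb H y ∩ E) (C0 y)) := by
    intro y hy hyE
    refine le_trans ?_ (hf.cand y hy hyE)
    have : (d / 2) ^ Δ' ≤ (d / 2) ^ #(nb H y ∩ E) :=
      pow_le_pow_of_le_one (by positivity) (by linarith)
        ((card_le_card inter_subset_left).trans (hdeg y))
    rw [hγ1]
    gcongr
  have hεγ : ε ≤ d / 2 * γ1 := by
    have h1 : γ * (d / 2) ^ (Δ' + 1) = d / 2 * γ1 := by rw [hγ1]; ring
    rw [h1] at hε
    have : (0 : ℝ) ≤ Δ' * ε := by positivity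
    nlinarith
  have hΔε : Δ' * ε ≤ γ1 / 4 := by
    have h1 : γ * (d / 2) ^ (Δ' + 1) = d / 2 * γ1 := by rw [hγ1]; ring
    rw [h1] at hε
    nlinarith
  let cand := fun y => cn G f (nb H y ∩ E) (C0 y)
  let bad := fun (i j : ι) (Y : Finset V) =>
    (Cl i).filter fun v => ε * m < |(#(nb G v ∩ Y) : ℝ) - D i j * #Y|
  let B2 := ((nb H x ∩ T) \ E).biUnion fun y => bad (φ x) (φ y) (cand y)
  let good := (cand x \ E.image f) \ B2
  have hB2 : (#B2 : ℝ) ≤ Δ' * (ε * m) := by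
    have h1 : #B2 ≤ ∑ y ∈ (nb H x ∩ T) \ E, #(bad (φ x) (φ y) (cand y)) := card_biUnion_le
    calc (#B2 : ℝ) ≤ ∑ y ∈ (nb H x ∩ T) \ E, (#(bad (φ x) (φ y) (cand y)) : ℝ) := by
          exact_mod_cast h1
      _ ≤ ∑ y ∈ (nb H x ∩ T) \ E, ε * m := by
          apply sum_le_sum
          intro y hy
          simp only [mem_sdiff, mem_inter, mem_nb] at hy
          exact hR.reg _ _ (hom x hxT y hy.1.2 hy.1.1) _
            ((cn_subset _ _ _ _).trans (hC0 y hy.1.2))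
      _ = #((nb H x ∩ T) \ E) * (ε * m) := by simp
      _ ≤ Δ' * (ε * m) := by
          have : #((nb H x ∩ T) \ E) ≤ Δ' :=
            (card_le_card (sdiff_subset.trans inter_subset_left)).trans (hdeg x)
          have : (#((nb H x ∩ T) \ E) : ℝ) ≤ Δ' := by exact_mod_cast this
          gcongr
  have hgood : γ1 * m / 2 ≤ #good := by
    have h1 : #(cand x) ≤ #good + #(E.image f) + #B2 := by
      have : _ ≤ #good := le_card_sdiff B2 (cand x \ E.image f)
      have := le_card_sdiff (E.image f) (cand x)
      omega
    have h2 : (#(cand x) : ℝ) ≤ #good + #(E.image f) + #B2 := by exact_mod_cast h1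
    have h3 : (#(E.image f) : ℝ) ≤ #T := by
      exact_mod_cast card_image_le.trans (card_le_card hE)
    have h4 := hpow x hxT hxE
    have h5 : Δ' * (ε * m) ≤ γ1 / 4 * m := by nlinarith
    change γ1 * m ≤ (#(cand x) : ℝ) at h4
    linarith
  have hgood0 : good.Nonempty := by
    rw [← card_pos]
    have : (0 : ℝ) < #good := lt_of_lt_of_le (by positivity) hgood
    exact_mod_cast this
  let S := fun t => cn G f (nb H (bf t) ∩ E) (Y t)
  let isbad := fun t v => ε * m < |(#(nb G v ∩ S t) : ℝ) - D (φ x) (φ (bf t)) * #(S t)|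
  let badw := fun v => ∑ t ∈ τ.filter (fun t => H.Adj x (bf t)), if isbad t v then ω t else 0
  have hsum : ∑ v ∈ good, badw v ≤ ∑ v ∈ good, 2 * ε / γ1 := by
    have h1 : ∑ v ∈ good, badw v ≤ ε * m := by
      simp only [badw]
      rw [sum_comm]
      calc ∑ t ∈ τ.filter (fun t => H.Adj x (bf t)), ∑ v ∈ good, (if isbad t v then ω t else 0)
          ≤ ∑ t ∈ τ.filter (fun t => H.Adj x (bf t)), ω t * (ε * m) := by
            apply sum_le_sum
            intro t ht
            rw [mem_filter] at ht
            rw [← sum_filter, sum_const, nsmul_eq_mul, mul_comm]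
            apply mul_le_mul_of_nonneg_left _ (hω t ht.1)
            have h2 := hR.reg _ _ (homB x hxT _ (hbf t ht.1) ht.2) (S t)
              ((cn_subset _ _ _ _).trans (hY t ht.1))
            refine le_trans ?_ h2
            norm_cast
            apply card_le_card
            intro v hv
            rw [mem_filter] at hv ⊢
            refine ⟨?_, hv.2⟩
            have h3 : v ∈ cand x := (mem_sdiff.1 (mem_sdiff.1 hv.1).1).1
            exact hC0 x hxT (cn_subset _ _ _ _ h3)
        _ = (∑ t ∈ τ.filter (fun t => H.Adj x (bf t)), ω t) * (ε * m) := by rw [sum_mul]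
        _ ≤ 1 * (ε * m) := by
            apply mul_le_mul_of_nonneg_right _ (by positivity)
            rcases (τ.filter (fun t => H.Adj x (bf t))).eq_empty_or_nonempty with h | ⟨t0, ht0⟩
            · rw [h]; simp
            · rw [mem_filter] at ht0
              refine le_trans ?_ (hω1 _ (hbf t0 ht0.1))
              apply sum_le_sum_of_subset_of_nonneg
              · intro t ht
                rw [mem_filter] at ht ⊢
                exact ⟨ht.1, sep x hxT _ (hbf t ht.1) _ (hbf t0 ht0.1) ht.2 ht0.2⟩
              · intro t ht _
                exact hω t (mem_filter.1 ht).1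
        _ = _ := one_mul _
    have h2 : ε * m ≤ ∑ v ∈ good, 2 * ε / γ1 := by
      rw [sum_const, nsmul_eq_mul]
      calc ε * m = (γ1 * m / 2) * (2 * ε / γ1) := by field_simp
        _ ≤ _ := by gcongr
    exact h1.trans h2
  obtain ⟨v, hv, hvw⟩ := exists_le_of_sum_le hgood0 hsum
  have hvc : v ∈ cand x := (mem_sdiff.1 (mem_sdiff.1 hv).1).1
  have hvi : v ∉ E.image f := (mem_sdiff.1 (mem_sdiff.1 hv).1).2
  have hvB : v ∉ B2 := (mem_sdiff.1 hv).2
  have hne : ∀ y ∈ E, Function.update f x v y = f y := fun y hy =>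
    Function.update_of_ne (by rintro rfl; exact hxE hy) _ _
  have hself : Function.update f x v x = v := Function.update_self _ _ _
  have hadj : ∀ y ∈ E, H.Adj x y → G.Adj (f y) v := by
    intro y hy hxy
    exact (mem_filter.1 hvc).2 y (by simp [hy, hxy])
  have hcongr : ∀ S : Finset U, ∀ z ∈ S ∩ E, f z = Function.update f x v z :=
    fun S z hz => (hne z (mem_inter.1 hz).2).symm
  refine ⟨v, ?_, ?_, ?_, ?_, ?_⟩
  · intro y hy z hz hyz
    simp only [coe_insert, Set.mem_insert_iff, mem_coe] at hy hz
    rcases hy with rfl | hy <;> rcases hz with rfl | hz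
    · rfl
    · rw [hself, hne z hz] at hyz
      exact absurd (mem_image.2 ⟨z, hz, hyz.symm⟩) hvi
    · rw [hself, hne y hy] at hyz
      exact absurd (mem_image.2 ⟨y, hy, hyz⟩) hvi
    · rw [hne y hy, hne z hz] at hyz
      exact hf.inj hy hz hyz
  · intro y hy
    rcases mem_insert.1 hy with rfl | hy
    · rw [hself]; exact cn_subset _ _ _ _ hvc
    · rw [hne y hy]; exact hf.mem y hy
  · intro y hy z hz hyz
    rw [mem_insert] at hy hz
    rcases hy with rfl | hy <;> rcases hz with rfl | hz
    · exact absurd hyz (H.irrefl)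
    · rw [hself, hne z hz]; exact (hadj z hz hyz).symm
    · rw [hself, hne y hy]; exact hadj y hy hyz.symm
    · rw [hne y hy, hne z hz]; exact hf.edge y hy z hz hyz
  · intro y hy hyE
    have hyE : y ∉ E := fun h => hyE (mem_insert_of_mem h)
    by_cases hxy : H.Adj y x
    · have h1 : nb H y ∩ insert x E = insert x (nb H y ∩ E) := by
        rw [inter_insert_of_mem (by simpa using hxy)]
      have h2 : x ∉ nb H y ∩ E := fun h => hxE (mem_inter.1 h).2
      rw [h1, cn_insert_update G f h2, card_insert_of_notMem h2, pow_succ]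
      have h3 : v ∉ bad (φ x) (φ y) (cand y) := fun h => hvB (mem_biUnion.2 ⟨y, by
        simp [hyE, hy, hxy.symm], h⟩)
      have h4 : v ∈ Cl (φ x) := hC0 x hxT (cn_subset _ _ _ _ hvc)
      have h5 : |(#(nb G v ∩ cand y) : ℝ) - D (φ x) (φ y) * #(cand y)| ≤ ε * m := by
        by_contra h
        exact h3 (mem_filter.2 ⟨h4, not_le.1 h⟩)
      have h6 := (abs_le.1 h5).1
      have h7 := (hR.dens _ _ (hom x hxT y hy hxy.symm)).1
      have h8 := hpow y hy hyE
      have h9 := hf.cand y hy hyE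
      change γ1 * m ≤ (#(cand y) : ℝ) at h8
      change _ ≤ (#(nb G v ∩ cand y) : ℝ)
      have h10 : ε * m ≤ d / 2 * #(cand y) := by nlinarith
      have h11 : d * #(cand y) ≤ D (φ x) (φ y) * #(cand y) := by gcongr
      change _ ≤ (#(cand y) : ℝ) at h9
      nlinarith
    · have h1 : nb H y ∩ insert x E = nb H y ∩ E := by
        rw [inter_insert_of_notMem (by simpa using hxy)]
      rw [h1, ← cn_congr G (hcongr _)]
      exact hf.cand y hy hyE
  · intro b hb
    by_cases hxb : H.Adj b x
    · have h1 : nb H b ∩ insert x E = insert x (nb H b ∩ E) := by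
        rw [inter_insert_of_mem (by simpa using hxb)]
      have h2 : x ∉ nb H b ∩ E := fun h => hxE (mem_inter.1 h).2
      rw [h1, card_insert_of_notMem h2]
      push_cast
      rw [mul_add, mul_one]
      have hD := hR.dens _ _ (homB x hxT b hb hxb.symm)
      have h3 : (τ.filter fun t => bf t = b ∧ ¬ Pass G (Function.update f x v) D φ (ε * m)
          (insert x (nb H b ∩ E)) b (Y t)) ⊆ (τ.filter fun t => bf t = b ∧
          ¬ Pass G f D φ (ε * m) (nb H b ∩ E) b (Y t)) ∪
          ((τ.filter (fun t => H.Adj x (bf t))).filter fun t => isbad t v) := by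
        intro t ht
        simp only [mem_union, mem_filter] at ht ⊢
        obtain ⟨ht, rfl, hnp⟩ := ht
        by_cases hp : Pass G f D φ (ε * m) (nb H (bf t) ∩ E) (bf t) (Y t)
        · right
          refine ⟨⟨ht, hxb.symm⟩, ?_⟩
          by_contra hnb
          exact hnp (pass_insert h2 (hd.le.trans hD.1) hD.2 hp (not_lt.1 hnb))
        · exact Or.inl ⟨ht, rfl, hp⟩
      calc _ ≤ ∑ t ∈ (τ.filter fun t => bf t = b ∧
          ¬ Pass G f D φ (ε * m) (nb H b ∩ E) b (Y t)) ∪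
          ((τ.filter (fun t => H.Adj x (bf t))).filter fun t => isbad t v), ω t := by
            apply sum_le_sum_of_subset_of_nonneg h3
            intro t ht _
            apply hω
            simp only [mem_union, mem_filter] at ht
            tauto
        _ ≤ _ := by
            have h4 := hf.test b hb
            have h5 : ∑ t ∈ (τ.filter (fun t => H.Adj x (bf t))).filter (fun t => isbad t v), ω t
                ≤ 2 * ε / γ1 := by rw [sum_filter]; exact hvw
            have h6 := sum_union_inter (s₁ := τ.filter fun t => bf t = b ∧
              ¬ Pass G f D φ (ε * m) (nb H b ∩ E) b (Y t))
              (s₂ := (τ.filter (fun t => H.Adj x (bf t))).filter fun t => isbad t v) (f := ω)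
            have h7 : 0 ≤ ∑ t ∈ (τ.filter fun t => bf t = b ∧
              ¬ Pass G f D φ (ε * m) (nb H b ∩ E) b (Y t)) ∩
              ((τ.filter (fun t => H.Adj x (bf t))).filter fun t => isbad t v), ω t :=
              sum_nonneg fun t ht => hω t (mem_filter.1 (mem_inter.1 ht).1).1
            linarith
    · have h1 : nb H b ∩ insert x E = nb H b ∩ E := by
        rw [inter_insert_of_notMem (by simpa using hxb)]
      rw [h1]
      simp_rw [← pass_congr (hcongr (nb H b))]
      exact hf.test b hb

lemma piece_embed {G : SimpleGraph V} {H : SimpleGraph U} {Cl : ι → Finset V} {R : SimpleGraph ι}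
    {D : ι → ι → ℝ} {d ε m γ : ℝ} (hR : Reg G Cl R D d ε m) (Δ' : ℕ)
    (hdeg : ∀ x, #(nb H x) ≤ Δ') {T BT : Finset U} {φ : U → ι}
    (hom : ∀ x ∈ T, ∀ y ∈ T, H.Adj x y → R.Adj (φ x) (φ y))
    (homB : ∀ x ∈ T, ∀ b ∈ BT, H.Adj x b → R.Adj (φ x) (φ b))
    (sep : ∀ x ∈ T, ∀ b ∈ BT, ∀ b' ∈ BT, H.Adj x b → H.Adj x b' → b = b')
    {C0 : U → Finset V} (hC0 : ∀ x ∈ T, C0 x ⊆ Cl (φ x)) (hC0c : ∀ x ∈ T, γ * m ≤ #(C0 x))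
    {α : Type} {τ : Finset α} {bf : α → U} {Y : α → Finset V} {ω : α → ℝ}
    (hbf : ∀ t ∈ τ, bf t ∈ BT) (hY : ∀ t ∈ τ, Y t ⊆ Cl (φ (bf t))) (hω : ∀ t ∈ τ, 0 ≤ ω t)
    (hω1 : ∀ b ∈ BT, ∑ t ∈ τ.filter (fun t => bf t = b), ω t ≤ 1)
    (hw : (#T : ℝ) ≤ γ * (d / 2) ^ Δ' * m / 4)
    (hε : 4 * (Δ' + 1) * ε ≤ γ * (d / 2) ^ (Δ' + 1))
    (hd : 0 < d) (hd1 : d ≤ 1) (hγ : 0 < γ) (hm : 0 < m) (hε0 : 0 ≤ ε) (f₀ : U → V) :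
    ∃ f : U → V, PieceInv G H D φ d ε m γ (2 * ε / (γ * (d / 2) ^ Δ')) T BT C0 τ bf Y ω T f := by
  suffices h : ∀ E ⊆ T, ∃ f : U → V,
      PieceInv G H D φ d ε m γ (2 * ε / (γ * (d / 2) ^ Δ')) T BT C0 τ bf Y ω E f from
    h T Subset.rfl
  intro E
  induction E using Finset.induction_on with
  | empty =>
    refine fun _ => ⟨f₀, by simp, by simp, by simp, ?_, ?_⟩
    · intro y hy _
      simpa [cn_empty] using hC0c y hy
    · intro b _
      simp [pass_empty]
  | insert x E hxE ih =>
    intro hE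
    obtain ⟨f, hf⟩ := ih ((subset_insert _ _).trans hE)
    obtain ⟨v, hv⟩ := piece_step hR Δ' hdeg hom homB sep hC0 hbf hY hω hω1 hw hε hd hd1 hγ hm hε0
      ((subset_insert _ _).trans hE) (hE (mem_insert_self _ _)) hxE hf
    exact ⟨_, hv⟩

end Embedding

section Family
open Finset
set_option linter.unusedSectionVars false

variable {U V ι : Type} [Fintype U] [Fintype V] [Fintype ι]

lemma piece_embed_tests {G : SimpleGraph V} {H : SimpleGraph U} {Cl : ι → Finset V}
    {R : SimpleGraph ι}
    {D : ι → ι → ℝ} {d ε m γ : ℝ} (hR : Reg G Cl R D d ε m) (Δ' : ℕ)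
    (hdeg : ∀ x, #(nb H x) ≤ Δ') {T BT : Finset U} {φ : U → ι}
    (hom : ∀ x ∈ T, ∀ y ∈ T, H.Adj x y → R.Adj (φ x) (φ y))
    (homB : ∀ x ∈ T, ∀ b ∈ BT, H.Adj x b → R.Adj (φ x) (φ b))
    (sep : ∀ x ∈ T, ∀ b ∈ BT, ∀ b' ∈ BT, H.Adj x b → H.Adj x b' → b = b')
    {C0 : U → Finset V} (hC0 : ∀ x ∈ T, C0 x ⊆ Cl (φ x)) (hC0c : ∀ x ∈ T, γ * m ≤ #(C0 x))
    {β : Type} [Fintype β] {Y : U → β → Finset V} {ω : U → β → ℝ}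
    (hY : ∀ b o, Y b o ⊆ Cl (φ b)) (hω : ∀ b o, 0 ≤ ω b o) (hω1 : ∀ b ∈ BT, ∑ o, ω b o ≤ 1)
    (hw : (#T : ℝ) ≤ γ * (d / 2) ^ Δ' * m / 4)
    (hε : 4 * (Δ' + 1) * ε ≤ γ * (d / 2) ^ (Δ' + 1))
    (hd : 0 < d) (hd1 : d ≤ 1) (hγ : 0 < γ) (hm : 0 < m) (hε0 : 0 ≤ ε) (f₀ : U → V) :
    ∃ f : U → V, Set.InjOn f T ∧ (∀ x ∈ T, f x ∈ C0 x) ∧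
      (∀ x ∈ T, ∀ y ∈ T, H.Adj x y → G.Adj (f x) (f y)) ∧
      ∀ b ∈ BT, (∑ o ∈ univ.filter fun o => ¬ Pass G f D φ (ε * m) (nb H b ∩ T) b (Y b o), ω b o)
        ≤ (2 * ε / (γ * (d / 2) ^ Δ')) * Δ' := by
  have key : ∀ b ∈ BT, ∀ P : U → β → Prop,
      ∑ t ∈ (BT ×ˢ (univ : Finset β)).filter (fun t => t.1 = b ∧ P t.1 t.2), ω t.1 t.2 =
        ∑ o ∈ univ.filter (fun o => P b o), ω b o := by
    intro b hb P
    symm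
    apply sum_bij (fun o _ => (b, o))
    · intro o ho
      simpa [hb] using ho
    · intro o _ o' _ h
      simpa using h
    · rintro ⟨b', o⟩ h
      simp only [mem_filter, mem_product] at h
      obtain ⟨-, rfl, h⟩ := h
      exact ⟨o, by simpa using h, rfl⟩
    · intro o _
      rfl
  obtain ⟨f, hf⟩ := piece_embed hR Δ' hdeg hom homB sep hC0 hC0c (τ := BT ×ˢ (univ : Finset β))
    (bf := fun t => t.1) (Y := fun t => Y t.1 t.2) (ω := fun t => ω t.1 t.2)
    (fun t ht => (mem_product.1 ht).1) (fun t _ => hY _ _) (fun t _ => hω _ _)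
    (fun b hb => by simpa [hω1 b hb] using (key b hb (fun _ _ => True)).trans_le (by simpa using hω1 b hb))
    hw hε hd hd1 hγ hm hε0 f₀
  refine ⟨f, hf.inj, hf.mem, hf.edge, fun b hb => ?_⟩
  have h1 := hf.test b hb
  have h2 := key b hb (fun b' o => ¬ Pass G f D φ (ε * m) (nb H b ∩ T) b (Y b' o))
  have h4 : (∑ o ∈ univ.filter fun o => ¬ Pass G f D φ (ε * m) (nb H b ∩ T) b (Y b o), ω b o)
      ≤ 2 * ε / (γ * (d / 2) ^ Δ') * #(nb H b ∩ T) := by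
    convert h1 using 1
    convert h2.symm using 1
    · congr!
    · congr!
  refine h4.trans ?_
  have h3 : (#(nb H b ∩ T) : ℝ) ≤ Δ' := by
    exact_mod_cast (card_le_card inter_subset_left).trans (hdeg b)
  gcongr

/-- The candidate images of a buffer vertex `b` inside the cluster `i`. -/
noncomputable def bufC (G : SimpleGraph V) (H : SimpleGraph U) (Cl : ι → Finset V) (f : U → V)
    (i : ι) (b : U) : Finset V := cn G f (nb H b) (Cl i)

/-- Positive part of the pair correlation of two buffer vertices. -/
noncomputable def bufQ (G : SimpleGraph V) (H : SimpleGraph U) (Cl : ι → Finset V) (f : U → V)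
    (i : ι) (b b' : U) : ℝ :=
  max 0 ((#(bufC G H Cl f i b ∩ bufC G H Cl f i b') : ℝ) -
    #(bufC G H Cl f i b) * #(bufC G H Cl f i b') / #(Cl i))

lemma bufQ_comm (G : SimpleGraph V) (H : SimpleGraph U) (Cl : ι → Finset V) (f : U → V)
    (i : ι) (b b' : U) : bufQ G H Cl f i b b' = bufQ G H Cl f i b' b := by
  unfold bufQ
  rw [inter_comm, mul_comm (#(bufC G H Cl f i b) : ℝ)]

lemma bufQ_le (G : SimpleGraph V) (H : SimpleGraph U) (Cl : ι → Finset V) (f : U → V)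
    (i : ι) (b b' : U) : bufQ G H Cl f i b b' ≤ #(Cl i) := by
  apply max_le (by positivity)
  have h1 : (#(bufC G H Cl f i b ∩ bufC G H Cl f i b') : ℝ) ≤ #(Cl i) := by
    exact_mod_cast card_le_card (inter_subset_left.trans (cn_subset G f (nb H b) (Cl i)))
  have h2 : (0 : ℝ) ≤ #(bufC G H Cl f i b) * #(bufC G H Cl f i b') / #(Cl i) := by positivity
  linarith

lemma bufC_congr {G : SimpleGraph V} {H : SimpleGraph U} {Cl : ι → Finset V} {f g : U → V}
    {i : ι} {b : U} (h : ∀ x ∈ nb H b, f x = g x) : bufC G H Cl f i b = bufC G H Cl g i b :=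
  cn_congr G h _

lemma bufQ_congr {G : SimpleGraph V} {H : SimpleGraph U} {Cl : ι → Finset V} {f g : U → V}
    {i : ι} {b b' : U} (h : ∀ x ∈ nb H b, f x = g x) (h' : ∀ x ∈ nb H b', f x = g x) :
    bufQ G H Cl f i b b' = bufQ G H Cl g i b b' := by
  unfold bufQ
  rw [bufC_congr h, bufC_congr h']

lemma bufQ_le_of_pass {G : SimpleGraph V} {H : SimpleGraph U} {Cl : ι → Finset V} {f : U → V}
    {b b' : U} {D : ι → ι → ℝ} {φ : U → ι} {e : ℝ} (he : 0 ≤ e) {Δ' : ℕ}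
    (hdeg : #(nb H b) ≤ Δ')
    (h1 : Pass G f D φ e (nb H b) b (Cl (φ b)))
    (h2 : Pass G f D φ e (nb H b) b (bufC G H Cl f (φ b) b')) :
    bufQ G H Cl f (φ b) b b' ≤ 2 * (Δ' * e) := by
  apply max_le (by positivity)
  have h3 : bufC G H Cl f (φ b) b ∩ bufC G H Cl f (φ b) b' =
      cn G f (nb H b) (bufC G H Cl f (φ b) b') := by
    ext v
    simp only [bufC, cn, mem_inter, mem_filter]
    tauto
  rw [h3]
  unfold Pass at h1 h2
  set p := ∏ x ∈ nb H b, D (φ x) (φ b)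
  set y : ℝ := (#(bufC G H Cl f (φ b) b') : ℝ) with hy
  have hyc : y ≤ #(Cl (φ b)) := by
    rw [hy]
    exact_mod_cast card_le_card (cn_subset G f (nb H b') (Cl (φ b)))
  have hy0 : 0 ≤ y := by positivity
  change |(#(bufC G H Cl f (φ b) b) : ℝ) - p * #(Cl (φ b))| ≤ _ at h1
  set c : ℝ := (#(Cl (φ b)) : ℝ)
  set z : ℝ := (#(bufC G H Cl f (φ b) b) : ℝ)
  have h4 := (abs_le.1 h1).1
  have h5 := (abs_le.1 h2).2
  have h6 : (#(nb H b) : ℝ) * e ≤ Δ' * e := by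
    have : (#(nb H b) : ℝ) ≤ Δ' := by exact_mod_cast hdeg
    gcongr
  have h7 : p * y - Δ' * e ≤ z * y / c := by
    rcases hy0.eq_or_lt with h | h
    · rw [← h]; simp; positivity
    · have hc : 0 < c := h.trans_le hyc
      rw [le_div_iff₀ hc]
      have : (Δ' * e) * y ≤ (Δ' * e) * c := by gcongr
      have : (p * c - Δ' * e) * y ≤ z * y := by
        apply mul_le_mul_of_nonneg_right _ hy0
        linarith
      nlinarith
  linarith

/-- The state of a greedy embedding of a family of tiles. -/
structure FamInv (G : SimpleGraph V) (H : SimpleGraph U) (Cl : ι → Finset V) (A : ι → Finset V)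
    (D : ι → ι → ℝ) (φ : U → ι) (ε m w η : ℝ) (X Bf : Finset U) (Base : U → Finset V)
    (S : Finset U) (f : U → V) : Prop where
  inj : Set.InjOn f (S \ X : Finset U)
  mem : ∀ x ∈ S \ X, f x ∈ Base x
  edge : ∀ x ∈ S \ X, ∀ y ∈ S \ X, H.Adj x y → G.Adj (f x) (f y)
  passCl : ∀ b ∈ Bf ∩ S, Pass G f D φ (ε * m) (nb H b) b (Cl (φ b))
  passA : ∀ b ∈ Bf ∩ S, Pass G f D φ (ε * m) (nb H b) b (A (φ b))
  pair : ∀ i, (∑ b ∈ (Bf ∩ S).filter (fun b => φ b = i), ∑ b' ∈ (Bf ∩ S).filter (fun b => φ b = i),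
    bufQ G H Cl f i b b') ≤ m * (η * (#((Bf ∩ S).filter fun b => φ b = i) : ℝ) ^ 2 +
      2 * w * #((Bf ∩ S).filter fun b => φ b = i))

lemma family_step {G : SimpleGraph V} {H : SimpleGraph U} {Cl : ι → Finset V}
    {R : SimpleGraph ι}
    {D : ι → ι → ℝ} {d ε m γ : ℝ} (hR : Reg G Cl R D d ε m) (Δ' : ℕ)
    (hdeg : ∀ x, #(nb H x) ≤ Δ') {A : ι → Finset V} (hA : ∀ i, A i ⊆ Cl i)
    {T S X Bf : Finset U} {φ : U → ι} {w : ℝ}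
    (hTS : Disjoint T S) (hTc : ∀ x ∈ T, ∀ y, H.Adj x y → y ∈ T)
    (hTw : (#T : ℝ) ≤ w)
    (hom : ∀ x ∈ T, ∀ y ∈ T, H.Adj x y → R.Adj (φ x) (φ y))
    (hBX' : ∀ b ∈ Bf, ∀ x, H.Adj b x → x ∉ X)
    (sep : ∀ x, ∀ b ∈ Bf, ∀ b' ∈ Bf, H.Adj x b → H.Adj x b' → b = b')
    {Base : U → Finset V} {W : Finset U} (hSW : S ⊆ W) (hTW : T ⊆ W)
    (hBase : ∀ x ∈ W \ X, Base x ⊆ Cl (φ x))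
    (hBasec : ∀ x ∈ W \ X, γ * m + #((W \ X).filter fun y => φ y = φ x) ≤ #(Base x))
    (hSc : ∀ x ∈ S, ∀ y, H.Adj x y → y ∈ S)
    (hw : w ≤ γ * (d / 2) ^ Δ' * m / 4)
    (hε : 4 * (Δ' + 1) * ε ≤ γ * (d / 2) ^ (Δ' + 1))
    (hκ : (2 * ε / (γ * (d / 2) ^ Δ')) * Δ' < 1 / 3)
    (hd : 0 < d) (hd1 : d ≤ 1) (hγ : 0 < γ) (hm : 0 < m) (hε0 : 0 ≤ ε) {f₀ : U → V}
    (hf : FamInv G H Cl A D φ ε m w (2 * Δ' * ε + 6 * ((2 * ε / (γ * (d / 2) ^ Δ')) * Δ'))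
      X Bf Base S f₀) :
    ∃ f : U → V, FamInv G H Cl A D φ ε m w (2 * Δ' * ε + 6 * ((2 * ε / (γ * (d / 2) ^ Δ')) * Δ'))
      X Bf Base (S ∪ T) f := by
  set κ := (2 * ε / (γ * (d / 2) ^ Δ')) * Δ' with hκd
  have hκ0 : 0 ≤ κ := by positivity
  let used := (S \ X).image f₀
  let C0 := fun x => Base x \ used
  let old := fun i => (Bf ∩ S).filter fun b => φ b = i
  let Y : U → Option (Option U) → Finset V := fun b o =>
    o.elim (Cl (φ b)) fun o' => o'.elim (A (φ b)) fun b' => bufC G H Cl f₀ (φ b) b'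
  let ω : U → Option (Option U) → ℝ := fun b o =>
    o.elim (1 / 3) fun o' => o'.elim (1 / 3) fun b' =>
      if b' ∈ old (φ b) then 1 / (3 * #(old (φ b))) else 0
  have hTXsub : T \ X ⊆ W \ X := sdiff_subset_sdiff hTW Subset.rfl
  have hSXsub : S \ X ⊆ W \ X := sdiff_subset_sdiff hSW Subset.rfl
  have hnbT : ∀ b ∈ Bf ∩ T, nb H b ∩ (T \ X) = nb H b := by
    intro b hb
    rw [mem_inter] at hb
    apply inter_eq_left.2
    intro x hx
    rw [mem_nb] at hx
    exact mem_sdiff.2 ⟨hTc b hb.2 x hx, hBX' b hb.1 x hx⟩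
  obtain ⟨g, hginj, hgmem, hgedge, hgtest⟩ := piece_embed_tests hR Δ' hdeg (T := T \ X)
    (BT := Bf ∩ T) (φ := φ)
    (fun x hx y hy => hom x (mem_sdiff.1 hx).1 y (mem_sdiff.1 hy).1)
    (fun x hx b hb => hom x (mem_sdiff.1 hx).1 b (mem_inter.1 hb).2)
    (fun x _ b hb b' hb' => sep x b (mem_inter.1 hb).1 b' (mem_inter.1 hb').1)
    (C0 := C0) (γ := γ)
    (fun x hx => sdiff_subset.trans (hBase x (hTXsub hx)))
    (by
      intro x hx
      have h1 := hBasec x (hTXsub hx)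
      have h2 : Base x ⊆ C0 x ∪ ((W \ X).filter fun y => φ y = φ x).image f₀ := by
        intro v hv
        by_cases hvu : v ∈ used
        · apply mem_union_right
          obtain ⟨y, hy, rfl⟩ := mem_image.1 hvu
          refine mem_image.2 ⟨y, mem_filter.2 ⟨hSXsub hy, ?_⟩, rfl⟩
          by_contra hne
          exact disjoint_left.1 (hR.disj _ _ hne) (hBase y (hSXsub hy) (hf.mem y hy))
            (hBase x (hTXsub hx) hv)
        · exact mem_union_left _ (mem_sdiff.2 ⟨hv, hvu⟩)
      have h3 : #(Base x) ≤ #(C0 x) + #((W \ X).filter fun y => φ y = φ x) :=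
        (card_le_card h2).trans ((card_union_le _ _).trans (Nat.add_le_add_left card_image_le _))
      have h4 : (#(Base x) : ℝ) ≤ #(C0 x) + #((W \ X).filter fun y => φ y = φ x) := by
        exact_mod_cast h3
      linarith)
    (Y := Y) (ω := ω)
    (by
      rintro b (_ | _ | b')
      · exact Subset.rfl
      · exact hA _
      · exact cn_subset _ _ _ _)
    (by
      rintro b (_ | _ | b')
      · change (0 : ℝ) ≤ 1 / 3; norm_num
      · change (0 : ℝ) ≤ 1 / 3; norm_num
      · change (0 : ℝ) ≤ if b' ∈ old (φ b) then 1 / (3 * (#(old (φ b)) : ℝ)) else 0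
        split_ifs <;> positivity)
    (by
      intro b _
      rw [Fintype.sum_option, Fintype.sum_option]
      change (1 / 3 : ℝ) + (1 / 3 + ∑ b', if b' ∈ old (φ b) then 1 / (3 * (#(old (φ b)) : ℝ)) else 0)
        ≤ 1
      have : (∑ b', if b' ∈ old (φ b) then 1 / (3 * (#(old (φ b)) : ℝ)) else 0) ≤ 1 / 3 := by
        rw [← sum_filter, sum_const, filter_mem_eq_inter, univ_inter, nsmul_eq_mul]
        rcases (#(old (φ b))).eq_zero_or_pos with h | h
        · rw [h]; norm_num
        · have : (0 : ℝ) < #(old (φ b)) := by exact_mod_cast h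
          apply le_of_eq
          field_simp
      linarith)
    ((show (#(T \ X) : ℝ) ≤ #T by exact_mod_cast card_le_card sdiff_subset).trans
      (hTw.trans hw)) hε hd hd1 hγ hm hε0 f₀
  let f := fun x => if x ∈ T then g x else f₀ x
  have hfT : ∀ x ∈ T, f x = g x := fun x hx => if_pos hx
  have hfS : ∀ x ∈ S, f x = f₀ x := fun x hx => if_neg (disjoint_right.1 hTS hx)
  have hnbgT : ∀ b ∈ T, ∀ x ∈ nb H b, f x = g x := fun b hb x hx =>
    hfT x (hTc b hb x (mem_nb.1 hx))
  have hnbS : ∀ b ∈ S, ∀ x ∈ nb H b, f x = f₀ x := fun b hb x hx =>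
    hfS x (hSc b hb x (mem_nb.1 hx))
  have hω0 : ∀ b o, 0 ≤ ω b o := by
    rintro b (_ | _ | b')
    · change (0 : ℝ) ≤ 1 / 3; norm_num
    · change (0 : ℝ) ≤ 1 / 3; norm_num
    · change (0 : ℝ) ≤ if b' ∈ old (φ b) then 1 / (3 * (#(old (φ b)) : ℝ)) else 0
      split_ifs <;> positivity
  have hpass : ∀ b ∈ Bf ∩ T, ∀ o, 1 / 3 ≤ ω b o → Pass G f D φ (ε * m) (nb H b) b (Y b o) := by
    intro b hb o ho
    by_contra hnp
    have h1 := hgtest b hb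
    rw [hnbT b hb] at h1
    have h2 := single_le_sum (f := fun o => ω b o) (fun o _ => hω0 b o)
      (show o ∈ univ.filter (fun o => ¬ Pass G g D φ (ε * m) (nb H b) b (Y b o)) by
        rw [mem_filter]
        exact ⟨mem_univ _, fun h => hnp ((pass_congr (hnbgT b (mem_inter.1 hb).2)).2 h)⟩)
    have : ω b o ≤ κ := h2.trans h1
    linarith
  have hpassCl : ∀ b ∈ Bf ∩ T, Pass G f D φ (ε * m) (nb H b) b (Cl (φ b)) := fun b hb =>
    hpass b hb none le_rfl
  have hfail : ∀ b ∈ Bf ∩ T, (#((old (φ b)).filter fun b' =>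
      ¬ Pass G f D φ (ε * m) (nb H b) b (bufC G H Cl f (φ b) b')) : ℝ) ≤
      3 * κ * #(old (φ b)) := by
    intro b hb
    have h1 := hgtest b hb
    rw [hnbT b hb] at h1
    rcases (#(old (φ b))).eq_zero_or_pos with h | h
    · rw [card_eq_zero] at h
      simp [h]
    have h0 : (0 : ℝ) < #(old (φ b)) := by exact_mod_cast h
    have h2 : ∑ b' ∈ (old (φ b)).filter (fun b' =>
        ¬ Pass G f D φ (ε * m) (nb H b) b (bufC G H Cl f (φ b) b')), (1 / (3 * (#(old (φ b)) : ℝ)))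
        ≤ ∑ o ∈ univ.filter (fun o => ¬ Pass G g D φ (ε * m) (nb H b) b (Y b o)), ω b o := by
      have h3 : ∑ b' ∈ (old (φ b)).filter (fun b' =>
          ¬ Pass G f D φ (ε * m) (nb H b) b (bufC G H Cl f (φ b) b')),
          (1 / (3 * (#(old (φ b)) : ℝ))) = ∑ o ∈ ((old (φ b)).filter (fun b' =>
          ¬ Pass G f D φ (ε * m) (nb H b) b (bufC G H Cl f (φ b) b'))).image
            (fun b' => some (some b')), ω b o := by
        rw [sum_image (by intro x _ y _ h; simpa using h)]
        apply sum_congr rfl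
        intro b' hb'
        change _ = if b' ∈ old (φ b) then 1 / (3 * (#(old (φ b)) : ℝ)) else 0
        rw [if_pos (mem_filter.1 hb').1]
      rw [h3]
      apply sum_le_sum_of_subset_of_nonneg
      · intro o ho
        obtain ⟨b', hb', rfl⟩ := mem_image.1 ho
        rw [mem_filter] at hb' ⊢
        refine ⟨mem_univ _, fun h => hb'.2 ((pass_congr (hnbgT b (mem_inter.1 hb).2)).2 ?_)⟩
        have h4 : b' ∈ S := (mem_inter.1 (mem_filter.1 hb'.1).1).2
        rw [bufC_congr (hnbS b' h4)]
        exact h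
      · intro o _ _
        exact hω0 b o
    rw [sum_const, nsmul_eq_mul] at h2
    have h5 := h2.trans h1
    rw [mul_one_div, div_le_iff₀ (by positivity)] at h5
    linarith
  have hpair : ∀ b ∈ Bf ∩ T, ∑ b' ∈ old (φ b), bufQ G H Cl f (φ b) b b' ≤
      (2 * Δ' * ε + 6 * κ) * m * #(old (φ b)) := by
    intro b hb
    rw [← sum_filter_add_sum_filter_not (old (φ b))
      (fun b' => ¬ Pass G f D φ (ε * m) (nb H b) b (bufC G H Cl f (φ b) b'))]
    have h1 : ∑ b' ∈ (old (φ b)).filter (fun b' =>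
        ¬ Pass G f D φ (ε * m) (nb H b) b (bufC G H Cl f (φ b) b')), bufQ G H Cl f (φ b) b b' ≤
        6 * κ * m * #(old (φ b)) := by
      calc _ ≤ ∑ b' ∈ (old (φ b)).filter (fun b' =>
          ¬ Pass G f D φ (ε * m) (nb H b) b (bufC G H Cl f (φ b) b')), 2 * m :=
            sum_le_sum fun b' _ => (bufQ_le _ _ _ _ _ _ _).trans (hR.up _)
        _ ≤ (3 * κ * #(old (φ b))) * (2 * m) := by
            rw [sum_const, nsmul_eq_mul]
            exact mul_le_mul_of_nonneg_right (hfail b hb) (by positivity)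
        _ = _ := by ring
    have h2 : ∑ b' ∈ (old (φ b)).filter (fun b' =>
        ¬¬ Pass G f D φ (ε * m) (nb H b) b (bufC G H Cl f (φ b) b')), bufQ G H Cl f (φ b) b b' ≤
        2 * Δ' * ε * m * #(old (φ b)) := by
      calc _ ≤ ∑ b' ∈ (old (φ b)).filter (fun b' =>
          ¬¬ Pass G f D φ (ε * m) (nb H b) b (bufC G H Cl f (φ b) b')), 2 * (Δ' * (ε * m)) :=
            sum_le_sum fun b' hb' => bufQ_le_of_pass (by positivity) (hdeg b) (hpassCl b hb)
              (not_not.1 (mem_filter.1 hb').2)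
        _ ≤ #(old (φ b)) * (2 * (Δ' * (ε * m))) := by
            rw [sum_const, nsmul_eq_mul]
            have : (#((old (φ b)).filter (fun b' => ¬¬ Pass G f D φ (ε * m) (nb H b) b
              (bufC G H Cl f (φ b) b'))) : ℝ) ≤ #(old (φ b)) := by
              exact_mod_cast card_filter_le _ _
            gcongr
        _ = _ := by ring
    linarith
  refine ⟨f, ?_, ?_, ?_, ?_, ?_, ?_⟩
  · intro x hx y hy hxy
    simp only [coe_sdiff, coe_union, Set.mem_sdiff, Set.mem_union, mem_coe] at hx hy
    have hcross : ∀ a b, a ∈ S → a ∉ X → b ∈ T → b ∉ X → f a ≠ f b := by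
      intro a b ha haX hb hbX h
      rw [hfS a ha, hfT b hb] at h
      have h1 := hgmem b (mem_sdiff.2 ⟨hb, hbX⟩)
      exact (mem_sdiff.1 h1).2 (h ▸ mem_image_of_mem _ (mem_sdiff.2 ⟨ha, haX⟩))
    rcases hx with ⟨hx | hx, hxX⟩ <;> rcases hy with ⟨hy | hy, hyX⟩
    · rw [hfS x hx, hfS y hy] at hxy
      exact hf.inj (by simp [hx, hxX]) (by simp [hy, hyX]) hxy
    · exact absurd hxy (hcross x y hx hxX hy hyX)
    · exact absurd hxy.symm (hcross y x hy hyX hx hxX)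
    · rw [hfT x hx, hfT y hy] at hxy
      exact hginj (by simp [hx, hxX]) (by simp [hy, hyX]) hxy
  · intro x hx
    rw [mem_sdiff, mem_union] at hx
    rcases hx with ⟨hx | hx, hxX⟩
    · rw [hfS x hx]; exact hf.mem x (mem_sdiff.2 ⟨hx, hxX⟩)
    · rw [hfT x hx]; exact (mem_sdiff.1 (hgmem x (mem_sdiff.2 ⟨hx, hxX⟩))).1
  · intro x hx y hy hxy
    rw [mem_sdiff, mem_union] at hx hy
    rcases hx with ⟨hx | hx, hxX⟩
    · have hyS := hSc x hx y hxy
      rw [hfS x hx, hfS y hyS]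
      exact hf.edge x (mem_sdiff.2 ⟨hx, hxX⟩) y (mem_sdiff.2 ⟨hyS, hy.2⟩) hxy
    · have hyT := hTc x hx y hxy
      rw [hfT x hx, hfT y hyT]
      exact hgedge x (mem_sdiff.2 ⟨hx, hxX⟩) y (mem_sdiff.2 ⟨hyT, hy.2⟩) hxy
  · intro b hb
    rw [inter_union_distrib_left, mem_union] at hb
    rcases hb with hb | hb
    · exact (pass_congr (hnbS b (mem_inter.1 hb).2)).2 (hf.passCl b hb)
    · exact hpassCl b hb
  · intro b hb
    rw [inter_union_distrib_left, mem_union] at hb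
    rcases hb with hb | hb
    · exact (pass_congr (hnbS b (mem_inter.1 hb).2)).2 (hf.passA b hb)
    · exact hpass b hb (some none) le_rfl
  · intro i
    let new := (Bf ∩ T).filter fun b => φ b = i
    have hu : (Bf ∩ (S ∪ T)).filter (fun b => φ b = i) = old i ∪ new := by
      rw [inter_union_distrib_left, filter_union]
    have hdis : Disjoint (old i) new := by
      apply disjoint_of_subset_left (filter_subset _ _)
      apply disjoint_of_subset_right (filter_subset _ _)
      exact disjoint_of_subset_left inter_subset_right
        (disjoint_of_subset_right inter_subset_right hTS.symm)
    rw [hu, card_union_of_disjoint hdis, sum_union hdis]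
    simp_rw [sum_union hdis, sum_add_distrib]
    have h1 := hf.pair i
    have h1' : ∑ b ∈ old i, ∑ b' ∈ old i, bufQ G H Cl f i b b' =
        ∑ b ∈ old i, ∑ b' ∈ old i, bufQ G H Cl f₀ i b b' := by
      apply sum_congr rfl
      intro b hb
      apply sum_congr rfl
      intro b' hb'
      exact bufQ_congr (hnbS b (mem_inter.1 (mem_filter.1 hb).1).2)
        (hnbS b' (mem_inter.1 (mem_filter.1 hb').1).2)
    have h2 : ∑ b ∈ new, ∑ b' ∈ old i, bufQ G H Cl f i b b' ≤
        #new * ((2 * Δ' * ε + 6 * κ) * m * #(old i)) := by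
      rw [← nsmul_eq_mul]
      apply sum_le_card_nsmul
      intro b hb
      obtain ⟨hb1, rfl⟩ := mem_filter.1 hb
      exact hpair b hb1
    have h3 : ∑ b ∈ old i, ∑ b' ∈ new, bufQ G H Cl f i b b' =
        ∑ b ∈ new, ∑ b' ∈ old i, bufQ G H Cl f i b b' := by
      rw [sum_comm]
      simp_rw [bufQ_comm]
    have h4 : ∑ b ∈ new, ∑ b' ∈ new, bufQ G H Cl f i b b' ≤ #new * (#new * (2 * m)) := by
      rw [← nsmul_eq_mul, ← nsmul_eq_mul]
      apply sum_le_card_nsmul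
      intro b _
      apply sum_le_card_nsmul
      intro b' _
      exact (bufQ_le _ _ _ _ _ _ _).trans (hR.up _)
    have h5 : (#new : ℝ) ≤ w := by
      refine le_trans ?_ hTw
      exact_mod_cast card_le_card ((filter_subset _ _).trans inter_subset_right)
    rw [h1', h3]
    change ∑ b ∈ old i, ∑ b' ∈ old i, bufQ G H Cl f₀ i b b' ≤
      m * ((2 * Δ' * ε + 6 * κ) * (#(old i) : ℝ) ^ 2 + 2 * w * #(old i)) at h1
    push_cast
    have h6 : (#new : ℝ) * (#new * (2 * m)) ≤ #new * (w * (2 * m)) := by gcongr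
    have h7 : 0 ≤ m * ((2 * Δ' * ε + 6 * κ) * (#new : ℝ) ^ 2) := by positivity
    nlinarith

lemma family_embed {G : SimpleGraph V} {H : SimpleGraph U} {Cl : ι → Finset V}
    {R : SimpleGraph ι}
    {D : ι → ι → ℝ} {d ε m γ : ℝ} (hR : Reg G Cl R D d ε m) (Δ' : ℕ)
    (hdeg : ∀ x, #(nb H x) ≤ Δ') {A : ι → Finset V} (hA : ∀ i, A i ⊆ Cl i)
    {F : Finset (Finset U)} {X Bf : Finset U} {φ : U → ι} {w : ℝ}
    (hdis : (F : Set (Finset U)).PairwiseDisjoint id)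
    (hcl : ∀ T ∈ F, ∀ x ∈ T, ∀ y, H.Adj x y → y ∈ T)
    (hFw : ∀ T ∈ F, (#T : ℝ) ≤ w)
    (hom : ∀ T ∈ F, ∀ x ∈ T, ∀ y ∈ T, H.Adj x y → R.Adj (φ x) (φ y))
    (hBX' : ∀ b ∈ Bf, ∀ x, H.Adj b x → x ∉ X)
    (sep : ∀ x, ∀ b ∈ Bf, ∀ b' ∈ Bf, H.Adj x b → H.Adj x b' → b = b')
    {Base : U → Finset V}
    (hBase : ∀ x ∈ F.biUnion id \ X, Base x ⊆ Cl (φ x))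
    (hBasec : ∀ x ∈ F.biUnion id \ X,
      γ * m + #((F.biUnion id \ X).filter fun y => φ y = φ x) ≤ #(Base x))
    (hw : w ≤ γ * (d / 2) ^ Δ' * m / 4)
    (hε : 4 * (Δ' + 1) * ε ≤ γ * (d / 2) ^ (Δ' + 1))
    (hκ : (2 * ε / (γ * (d / 2) ^ Δ')) * Δ' < 1 / 3)
    (hd : 0 < d) (hd1 : d ≤ 1) (hγ : 0 < γ) (hm : 0 < m) (hε0 : 0 ≤ ε) (f₀ : U → V) :
    ∃ f : U → V, FamInv G H Cl A D φ ε m w (2 * Δ' * ε + 6 * ((2 * ε / (γ * (d / 2) ^ Δ')) * Δ'))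
      X Bf Base (F.biUnion id) f := by
  suffices h : ∀ F' ⊆ F, ∃ f : U → V, FamInv G H Cl A D φ ε m w
      (2 * Δ' * ε + 6 * ((2 * ε / (γ * (d / 2) ^ Δ')) * Δ')) X Bf Base (F'.biUnion id) f from
    h F Subset.rfl
  intro F'
  induction F' using Finset.induction_on with
  | empty =>
    refine fun _ => ⟨f₀, ?_⟩
    constructor <;> simp
  | insert T F' hT ih =>
    intro hF'
    obtain ⟨hTF, hF'F⟩ := insert_subset_iff.1 hF'
    obtain ⟨f, hf⟩ := ih hF'F
    rw [biUnion_insert, union_comm]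
    refine family_step hR Δ' hdeg hA ?_ (hcl T hTF) (hFw T hTF) (hom T hTF) hBX' sep
      (biUnion_subset_biUnion_of_subset_left _ hF'F) (subset_biUnion_of_mem id hTF) hBase hBasec
      ?_ hw hε hκ hd hd1 hγ hm hε0 hf
    · rw [disjoint_biUnion_right]
      intro T' hT'
      exact hdis hTF (hF'F hT') (by rintro rfl; exact hT hT')
    · intro x hx y hxy
      obtain ⟨T', hT', hx⟩ := mem_biUnion.1 hx
      exact mem_biUnion.2 ⟨T', hT', hcl T' (hF'F hT') x hx y hxy⟩

end Family

section Finish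
open Finset
set_option linter.unusedSectionVars false

variable {U V : Type}

lemma sum_pair_centered {Cl : Finset V} (hCl : 0 < #Cl) {C C' : Finset V} (hC : C ⊆ Cl)
    (hC' : C' ⊆ Cl) :
    ∑ v ∈ Cl, ((if v ∈ C then (1 : ℝ) else 0) - #C / #Cl) *
      ((if v ∈ C' then (1 : ℝ) else 0) - #C' / #Cl) =
    #(C ∩ C') - #C * #C' / #Cl := by
  have h0 : (#Cl : ℝ) ≠ 0 := by positivity
  have h1 : ∀ v, ((if v ∈ C then (1 : ℝ) else 0) - #C / #Cl) *
      ((if v ∈ C' then (1 : ℝ) else 0) - #C' / #Cl) =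
      (if v ∈ C ∩ C' then (1 : ℝ) else 0) - (#C' / #Cl) * (if v ∈ C then (1 : ℝ) else 0) -
      (#C / #Cl) * (if v ∈ C' then (1 : ℝ) else 0) + (#C / #Cl) * (#C' / #Cl) := by
    intro v
    by_cases h : v ∈ C <;> by_cases h' : v ∈ C' <;> simp [h, h'] <;> ring
  have h2 : ∀ D ⊆ Cl, ∑ v ∈ Cl, (if v ∈ D then (1 : ℝ) else 0) = #D := by
    intro D hD
    rw [sum_ite_mem, inter_eq_right.2 hD]
    simp
  simp_rw [h1]
  rw [sum_add_distrib, sum_sub_distrib, sum_sub_distrib, ← mul_sum, ← mul_sum, h2 _ hC, h2 _ hC',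
    h2 _ (inter_subset_left.trans hC), sum_const, nsmul_eq_mul]
  field_simp
  ring

lemma second_moment {Cl : Finset V} (hCl : 0 < #Cl) {S : Finset U} {C : U → Finset V}
    (hC : ∀ b ∈ S, C b ⊆ Cl) {p : ℝ} (hp0 : 0 ≤ p) (hp : ∀ b ∈ S, p * #Cl ≤ #(C b)) :
    (#(Cl.filter fun v => (#(S.filter fun b => v ∈ C b) : ℝ) ≤ p / 2 * #S) : ℝ) *
      (p * #S / 2) ^ 2 ≤
    ∑ b ∈ S, ∑ b' ∈ S, max 0 ((#(C b ∩ C b') : ℝ) - #(C b) * #(C b') / #Cl) := by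
  have h0 : (0 : ℝ) < #Cl := by exact_mod_cast hCl
  set X := Cl.filter fun v => (#(S.filter fun b => v ∈ C b) : ℝ) ≤ p / 2 * #S
  let g : V → ℝ := fun v => ∑ b ∈ S, ((if v ∈ C b then (1 : ℝ) else 0) - #(C b) / #Cl)
  have h1 : ∑ v ∈ Cl, g v ^ 2 =
      ∑ b ∈ S, ∑ b' ∈ S, ((#(C b ∩ C b') : ℝ) - #(C b) * #(C b') / #Cl) := by
    simp only [g, sq, sum_mul_sum]
    rw [sum_comm]
    apply sum_congr rfl
    intro b hb
    rw [sum_comm]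
    apply sum_congr rfl
    intro b' hb'
    exact sum_pair_centered hCl (hC b hb) (hC b' hb')
  have h2 : ∀ v ∈ X, (p * #S / 2) ^ 2 ≤ g v ^ 2 := by
    intro v hv
    have h3 := (mem_filter.1 hv).2
    have h4 : g v = #(S.filter fun b => v ∈ C b) - ∑ b ∈ S, (#(C b) : ℝ) / #Cl := by
      simp only [g]
      rw [sum_sub_distrib, ← sum_filter]
      simp
    have h5 : p * #S ≤ ∑ b ∈ S, (#(C b) : ℝ) / #Cl := by
      rw [mul_comm, ← nsmul_eq_mul]
      apply card_nsmul_le_sum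
      intro b hb
      rw [le_div_iff₀ h0]
      exact hp b hb
    rw [sq_le_sq, abs_of_nonneg (by positivity)]
    apply le_abs.2
    right
    linarith
  calc (#X : ℝ) * (p * #S / 2) ^ 2 = ∑ v ∈ X, (p * #S / 2) ^ 2 := by simp
    _ ≤ ∑ v ∈ X, g v ^ 2 := sum_le_sum h2
    _ ≤ ∑ v ∈ Cl, g v ^ 2 :=
        sum_le_sum_of_subset_of_nonneg (filter_subset _ _) fun _ _ _ => sq_nonneg _
    _ = _ := h1
    _ ≤ _ := sum_le_sum fun b _ => sum_le_sum fun b' _ => le_max_right _ _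

lemma hall_finish (v0 : U → V) {B : Finset U} {L : Finset V} (hcard : #L = #B) {C : U → Finset V} {δ : ℝ}
    (h1 : ∀ b ∈ B, δ ≤ #(C b ∩ L))
    (h2 : ∀ v ∈ L, δ ≤ #(B.filter fun b => v ∈ C b))
    (h3 : ∀ S ⊆ B, δ ≤ #S → (#(L.filter fun v => ∀ b ∈ S, v ∉ C b) : ℝ) < δ) :
    ∃ g : U → V, Set.InjOn g B ∧ ∀ b ∈ B, g b ∈ C b ∩ L := by
  have hall : ∀ S : Finset {b // b ∈ B}, #S ≤ #(S.biUnion fun b => C b ∩ L) := by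
    intro S
    set S' : Finset U := S.map (Function.Embedding.subtype _) with hS'
    have hS'B : S' ⊆ B := by
      intro b hb
      obtain ⟨b', -, rfl⟩ := mem_map.1 hb
      exact b'.2
    have hS'c : #S' = #S := card_map _
    have hU : (S.biUnion fun b => C b ∩ L) = S'.biUnion fun b => C b ∩ L := by
      ext v
      simp [hS']
    rw [hU, ← hS'c]
    have hN : S'.biUnion (fun b => C b ∩ L) = L \ (L.filter fun v => ∀ b ∈ S', v ∉ C b) := by
      ext v
      simp only [mem_biUnion, mem_inter, mem_sdiff, mem_filter, not_and, not_forall, not_not]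
      constructor
      · rintro ⟨b, hb, hv, hvL⟩
        exact ⟨hvL, fun _ => ⟨b, hb, hv⟩⟩
      · rintro ⟨hvL, h⟩
        obtain ⟨b, hb, hv⟩ := h hvL
        exact ⟨b, hb, hv, hvL⟩
    rcases S'.eq_empty_or_nonempty with h | ⟨b0, hb0⟩
    · simp [h]
    by_cases hs : (#S' : ℝ) < δ
    · have h4 : (#(C b0 ∩ L) : ℝ) ≤ #(S'.biUnion fun b => C b ∩ L) := by
        exact_mod_cast card_le_card (subset_biUnion_of_mem (fun b => C b ∩ L) hb0)
      have h5 := h1 b0 (hS'B hb0)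
      have : (#S' : ℝ) ≤ #(S'.biUnion fun b => C b ∩ L) := by linarith
      exact_mod_cast this
    · have h4 := h3 S' hS'B (not_lt.1 hs)
      set Z := L.filter fun v => ∀ b ∈ S', v ∉ C b
      have hZL : Z ⊆ L := filter_subset _ _
      rw [hN, card_sdiff_of_subset hZL, hcard]
      rcases Z.eq_empty_or_nonempty with h | ⟨v, hv⟩
      · rw [h]; simpa using card_le_card hS'B
      · have hv' := mem_filter.1 hv
        have h5 := h2 v hv'.1
        have h6 : (B.filter fun b => v ∈ C b) ⊆ B \ S' := by
          intro b hb
          rw [mem_filter] at hb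
          exact mem_sdiff.2 ⟨hb.1, fun h => hv'.2 b h hb.2⟩
        have h7 := card_le_card h6
        rw [card_sdiff_of_subset hS'B] at h7
        have h8 : #Z < #(B.filter fun b => v ∈ C b) := by
          have := h4.trans_le h5
          exact_mod_cast this
        have := card_le_card hS'B
        omega
  obtain ⟨g, hg, hg'⟩ := (Finset.all_card_le_biUnion_card_iff_exists_injective _).1 hall
  refine ⟨fun u => if h : u ∈ B then g ⟨u, h⟩ else v0 u, ?_, ?_⟩
  · intro a ha b hb hab
    simp only [mem_coe] at ha hb
    simp only [ha, hb, dite_true] at hab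
    simpa using hg hab
  · intro b hb
    simpa [hb] using hg' ⟨b, hb⟩

end Finish

section Alloc
open Finset
set_option linter.unusedSectionVars false

variable {U ι : Type} [Fintype U] [Fintype ι]

/-- `v` counts the fibres over `E` of some homomorphism from `H[E]` to `R`. -/
def Ach (H : SimpleGraph U) (R : SimpleGraph ι) (E : Finset U) (v : ι → ℤ) : Prop :=
  ∃ φ : U → ι, (∀ x ∈ E, ∀ y ∈ E, H.Adj x y → R.Adj (φ x) (φ y)) ∧
    ∀ j, (#(E.filter fun x => φ x = j) : ℤ) = v j

/-- `E` is a union of components of `H`. -/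
def Clsd (H : SimpleGraph U) (E : Finset U) : Prop := ∀ x ∈ E, ∀ y, H.Adj x y → y ∈ E

/-- The first `k` terms of `σ` form a clique. -/
def Clq (R : SimpleGraph ι) (k : ℕ) (σ : ℕ → ι) : Prop :=
  ∀ a < k, ∀ b < k, a ≠ b → R.Adj (σ a) (σ b)

lemma Ach.congr {H : SimpleGraph U} {R : SimpleGraph ι} {E : Finset U} {v v' : ι → ℤ}
    (h : Ach H R E v) (hv : ∀ j, v j = v' j) : Ach H R E v' := by
  have : v = v' := funext hv
  exact this ▸ h

lemma Ach.nonneg {H : SimpleGraph U} {R : SimpleGraph ι} {E : Finset U} {v : ι → ℤ}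
    (h : Ach H R E v) (j : ι) : 0 ≤ v j := by
  obtain ⟨φ, -, h⟩ := h
  rw [← h j]
  positivity

lemma Ach.sum {H : SimpleGraph U} {R : SimpleGraph ι} {E : Finset U} {v : ι → ℤ}
    (h : Ach H R E v) : ∑ j, v j = #E := by
  obtain ⟨φ, -, h⟩ := h
  simp_rw [← h]
  rw [card_eq_sum_card_fiberwise (f := φ) (t := univ) (fun _ _ => by simp)]
  push_cast
  rfl

lemma Ach.union {H : SimpleGraph U} {R : SimpleGraph ι} {E E' : Finset U} {v v' : ι → ℤ}
    (hE : Clsd H E) (hd : Disjoint E E') (h : Ach H R E v) (h' : Ach H R E' v') :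
    Ach H R (E ∪ E') (fun j => v j + v' j) := by
  obtain ⟨φ, h1, h2⟩ := h
  obtain ⟨φ', h1', h2'⟩ := h'
  have hE1 : ∀ x ∈ E, (if x ∈ E then φ x else φ' x) = φ x := fun x hx => if_pos hx
  have hE2 : ∀ x ∈ E', (if x ∈ E then φ x else φ' x) = φ' x := fun x hx =>
    if_neg (disjoint_right.1 hd hx)
  refine ⟨fun x => if x ∈ E then φ x else φ' x, ?_, ?_⟩
  · intro x hx y hy hxy
    dsimp only
    rcases mem_union.1 hx with hx | hx
    · have hy' := hE x hx y hxy
      rw [hE1 x hx, hE1 y hy']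
      exact h1 x hx y hy' hxy
    · have hx' := disjoint_right.1 hd hx
      have hy' : y ∉ E := fun h => hx' (hE y h x hxy.symm)
      have hy'' : y ∈ E' := (mem_union.1 hy).resolve_left hy'
      rw [hE2 x hx, hE2 y hy'']
      exact h1' x hx y hy'' hxy
  · intro j
    rw [filter_union, card_union_of_disjoint (disjoint_filter_filter hd)]
    push_cast
    rw [← h2 j, ← h2' j, filter_congr (fun x hx => by rw [hE1 x hx]),
      filter_congr (s := E') (fun x hx => by rw [hE2 x hx])]

lemma Ach.empty (H : SimpleGraph U) (R : SimpleGraph ι) [Nonempty ι] :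
    Ach H R (∅ : Finset U) (fun _ => 0) :=
  ⟨fun _ => Classical.arbitrary ι, by simp, by simp⟩

lemma Clsd.union {H : SimpleGraph U} {E E' : Finset U} (h : Clsd H E) (h' : Clsd H E') :
    Clsd H (E ∪ E') := by
  intro x hx y hxy
  rcases mem_union.1 hx with hx | hx
  · exact mem_union_left _ (h x hx y hxy)
  · exact mem_union_right _ (h' x hx y hxy)

lemma Clsd.biUnion {α : Type} {H : SimpleGraph U} {s : Finset α} {E : α → Finset U}
    (h : ∀ a ∈ s, Clsd H (E a)) : Clsd H (s.biUnion E) := by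
  intro x hx y hxy
  obtain ⟨a, ha, hx⟩ := mem_biUnion.1 hx
  exact mem_biUnion.2 ⟨a, ha, h a ha x hx y hxy⟩

lemma Ach.biUnion {α : Type} {H : SimpleGraph U} {R : SimpleGraph ι} [Nonempty ι] {s : Finset α}
    {E : α → Finset U} {v : α → ι → ℤ} (hE : ∀ a ∈ s, Clsd H (E a))
    (hd : (s : Set α).PairwiseDisjoint E) (h : ∀ a ∈ s, Ach H R (E a) (v a)) :
    Ach H R (s.biUnion E) (fun j => ∑ a ∈ s, v a j) := by
  induction s using Finset.induction_on with
  | empty => simpa using Ach.empty H R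
  | insert a s ha ih =>
    rw [biUnion_insert]
    simp_rw [sum_insert ha]
    refine Ach.union (hE a (mem_insert_self _ _)) ?_ (h a (mem_insert_self _ _))
      (ih (fun b hb => hE b (mem_insert_of_mem hb)) (hd.subset (by simp))
        (fun b hb => h b (mem_insert_of_mem hb)))
    rw [disjoint_biUnion_right]
    intro b hb
    exact hd (by simp) (by simp [hb]) (by rintro rfl; exact ha hb)

lemma Ach.of_col {H : SimpleGraph U} {R : SimpleGraph ι} {E : Finset U} {k : ℕ} {col : U → ℕ}
    (hk : ∀ x ∈ E, col x < k) (hc : ∀ x ∈ E, ∀ y ∈ E, H.Adj x y → col x ≠ col y) {σ : ℕ → ι}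
    (hσ : Clq R k σ) : Ach H R E (fun j => #(E.filter fun x => σ (col x) = j)) :=
  ⟨fun x => σ (col x), fun x hx y hy hxy => hσ _ (hk x hx) _ (hk y hy) (hc x hx y hy hxy),
    fun _ => rfl⟩

lemma sum_biUnion_le_sum {α β : Type} (s : Finset α) (u : α → Finset β) {f : β → ℝ}
    (hf : ∀ b, 0 ≤ f b) : ∑ b ∈ s.biUnion u, f b ≤ ∑ a ∈ s, ∑ b ∈ u a, f b := by
  induction s using Finset.induction_on with
  | empty => simp
  | insert a s ha ih =>
    rw [biUnion_insert, sum_insert ha]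
    have := sum_union_inter (s₁ := u a) (s₂ := s.biUnion u) (f := f)
    have h2 : 0 ≤ ∑ b ∈ u a ∩ s.biUnion u, f b := sum_nonneg fun b _ => hf b
    linarith

lemma greedy_seq (q : ℕ) {R : SimpleGraph ι} {t : ι → ℝ} (ht : ∀ j, 0 ≤ t j) (ht1 : ∑ j, t j = 1)
    {β : ℝ} (hβ0 : 0 ≤ β) (hβ : ∀ i, ∑ j ∈ univ.filter (fun j => ¬ R.Adj i j), t j ≤ β)
    (hq : (q : ℝ) * β < 1) (y : ι → ℝ) :
    ∃ i : ℕ → ι, ∀ l < q + 1, (∀ l' < l, R.Adj (i l') (i l)) ∧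
      ∀ j, (∀ l' < l, R.Adj (i l') j) → y j ≤ y (i l) := by
  have hne : Nonempty ι := by
    by_contra h
    rw [not_nonempty_iff] at h
    simp at ht1
  have step : ∀ (n : ℕ) (i : ℕ → ι), n ≤ q →
      ∃ j, (∀ l' < n, R.Adj (i l') j) ∧ ∀ j', (∀ l' < n, R.Adj (i l') j') → y j' ≤ y j := by
    intro n i hn
    have h1 : (univ.filter fun j => ∀ l' < n, R.Adj (i l') j).Nonempty := by
      by_contra h
      rw [not_nonempty_iff_eq_empty, filter_eq_empty_iff] at h
      have h2 : (univ : Finset ι) ⊆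
          (range n).biUnion fun l => univ.filter fun j => ¬ R.Adj (i l) j := by
        intro j _
        have := h (mem_univ j)
        push Not at this
        obtain ⟨l, hl, hj⟩ := this
        simp only [mem_biUnion, mem_range, mem_filter, mem_univ, true_and]
        exact ⟨l, hl, hj⟩
      have h3 : (1 : ℝ) ≤ n * β := by
        calc (1 : ℝ) = ∑ j, t j := ht1.symm
          _ ≤ ∑ j ∈ (range n).biUnion fun l => univ.filter fun j => ¬ R.Adj (i l) j, t j :=
              sum_le_sum_of_subset_of_nonneg h2 fun j _ _ => ht j
          _ ≤ ∑ l ∈ range n, ∑ j ∈ univ.filter (fun j => ¬ R.Adj (i l) j), t j :=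
              sum_biUnion_le_sum _ _ ht
          _ ≤ ∑ l ∈ range n, β := sum_le_sum fun l _ => hβ _
          _ = n * β := by simp
      have h4 : (n : ℝ) * β ≤ q * β := by gcongr
      linarith
    obtain ⟨j, hj, hmax⟩ := exists_max_image _ y h1
    refine ⟨j, (mem_filter.1 hj).2, fun j' hj' => hmax j' (by simpa using hj')⟩
  suffices h : ∀ n ≤ q + 1, ∃ i : ℕ → ι, ∀ l < n, (∀ l' < l, R.Adj (i l') (i l)) ∧
      ∀ j, (∀ l' < l, R.Adj (i l') j) → y j ≤ y (i l) from h _ le_rfl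
  intro n
  induction n with
  | zero => exact fun _ => ⟨fun _ => Classical.arbitrary ι, by simp⟩
  | succ n ih =>
    intro hn
    obtain ⟨i, hi⟩ := ih (by omega)
    obtain ⟨j, hj1, hj2⟩ := step n i (by omega)
    have hne : ∀ l, l < n → Function.update i n j l = i l := fun l hl =>
      Function.update_of_ne hl.ne _ _
    refine ⟨Function.update i n j, fun l hl => ?_⟩
    rcases Nat.lt_succ_iff_lt_or_eq.1 hl with hl | rfl
    · rw [hne l hl]
      refine ⟨fun l' hl' => ?_, fun j' hj' => (hi l hl).2 j' fun l' hl' => ?_⟩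
      · rw [hne l' (hl'.trans hl)]; exact (hi l hl).1 l' hl'
      · have := hj' l' hl'
        rwa [hne l' (hl'.trans hl)] at this
    · rw [Function.update_self]
      refine ⟨fun l' hl' => ?_, fun j' hj' => hj2 j' fun l' hl' => ?_⟩
      · rw [hne l' hl']; exact hj1 l' hl'
      · have := hj' l' hl'
        rwa [hne l' hl'] at this

lemma greedy_clique (q : ℕ) {R : SimpleGraph ι} {t : ι → ℝ} (ht : ∀ j, 0 ≤ t j)
    (ht1 : ∑ j, t j = 1)
    {β : ℝ} (hβ0 : 0 ≤ β) (hβ : ∀ i, ∑ j ∈ univ.filter (fun j => ¬ R.Adj i j), t j ≤ β)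
    (hq : (q : ℝ) * β < 1) (y : ι → ℝ) :
    ∃ i : ℕ → ι, Clq R (q + 1) i ∧ (∀ l < q, y (i q) ≤ y (i l)) ∧
      ∑ j, t j * y j ≤ y (i q) + β * ∑ l ∈ range q, (y (i l) - y (i q)) := by
  obtain ⟨i, hi⟩ := greedy_seq q ht ht1 hβ0 hβ hq y
  have hle : ∀ l < q, y (i q) ≤ y (i l) := fun l hl =>
    (hi l (by omega)).2 _ fun l' hl' => (hi q (by omega)).1 l' (by omega)
  refine ⟨i, ?_, hle, ?_⟩
  · intro a ha b hb hab
    rcases lt_or_gt_of_ne hab with h | h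
    · exact (hi b hb).1 a h
    · exact ((hi a ha).1 b h).symm
  have hj : ∀ j, y j - y (i q) ≤
      ∑ l ∈ range q, if ¬ R.Adj (i l) j then y (i l) - y (i q) else 0 := by
    intro j
    have hnn : ∀ l ∈ range q, 0 ≤ if ¬ R.Adj (i l) j then y (i l) - y (i q) else 0 := by
      intro l hl
      split_ifs
      · exact le_rfl
      · linarith [hle l (mem_range.1 hl)]
    by_cases h : ∃ l < q, ¬ R.Adj (i l) j
    · have h1 := Nat.find_spec h
      have h2 := fun l (hl : l < Nat.find h) => Nat.find_min h hl
      set l := Nat.find h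
      have h3 : y j ≤ y (i l) := by
        refine (hi l (by omega)).2 j fun l' hl' => ?_
        have := h2 l' hl'
        push Not at this
        exact this (by omega)
      calc y j - y (i q) ≤ y (i l) - y (i q) := by linarith
        _ = if ¬ R.Adj (i l) j then y (i l) - y (i q) else 0 := by rw [if_pos h1.2]
        _ ≤ _ := single_le_sum hnn (mem_range.2 h1.1)
    · push Not at h
      have h3 : y j ≤ y (i q) := (hi q (by omega)).2 j fun l' hl' => h l' hl'
      exact le_trans (by linarith) (sum_nonneg hnn)
  have h1 : ∑ j, t j * y j - y (i q) = ∑ j, t j * (y j - y (i q)) := by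
    simp_rw [mul_sub]
    rw [sum_sub_distrib, ← sum_mul, ht1, one_mul]
  have h2 : ∑ j, t j * (y j - y (i q)) ≤ β * ∑ l ∈ range q, (y (i l) - y (i q)) := by
    calc ∑ j, t j * (y j - y (i q)) ≤
        ∑ j, t j * ∑ l ∈ range q, (if ¬ R.Adj (i l) j then y (i l) - y (i q) else 0) :=
          sum_le_sum fun j _ => mul_le_mul_of_nonneg_left (hj j) (ht j)
      _ = ∑ l ∈ range q, (∑ j ∈ univ.filter (fun j => ¬ R.Adj (i l) j), t j) *
            (y (i l) - y (i q)) := by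
          simp_rw [mul_sum]
          rw [sum_comm]
          apply sum_congr rfl
          intro l _
          rw [sum_mul, sum_filter]
          apply sum_congr rfl
          intro j _
          split_ifs <;> simp
      _ ≤ ∑ l ∈ range q, β * (y (i l) - y (i q)) :=
          sum_le_sum fun l hl => mul_le_mul_of_nonneg_right (hβ _)
            (by linarith [hle l (mem_range.1 hl)])
      _ = _ := by rw [mul_sum]
  linarith

lemma exists_shift (p : ℕ) (c y : Fin (p + 1) → ℝ) :
    ∃ s : Fin (p + 1), (∑ l, c l) * (∑ l, y l) ≤ (p + 1) * ∑ l, c l * y (l + s) := by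
  by_contra! h
  have h1 : ∑ s : Fin (p + 1), ((p : ℝ) + 1) * ∑ l, c l * y (l + s) <
      ∑ s : Fin (p + 1), (∑ l, c l) * (∑ l, y l) :=
    sum_lt_sum_of_nonempty univ_nonempty fun s _ => h s
  have h2 : ∑ s : Fin (p + 1), ∑ l, c l * y (l + s) = (∑ l, c l) * (∑ l, y l) := by
    rw [sum_comm, sum_mul]
    apply sum_congr rfl
    intro l _
    rw [← mul_sum]
    congr 1
    exact Fintype.sum_equiv (Equiv.addLeft l) _ _ fun s => rfl
  rw [← mul_sum, h2] at h1
  simp at h1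

lemma block_step (p : ℕ) {H : SimpleGraph U} {R : SimpleGraph ι} {t : ι → ℝ} (ht : ∀ j, 0 ≤ t j)
    (ht1 : ∑ j, t j = 1)
    {β : ℝ} (hβ0 : 0 ≤ β) (hβ : ∀ i, ∑ j ∈ univ.filter (fun j => ¬ R.Adj i j), t j ≤ β)
    (hq : ((p : ℝ) + 1) * β < 1) (y : ι → ℝ) {E : Finset U} {col : U → ℕ}
    (hk : ∀ x ∈ E, col x < p + 2) (hc : ∀ x ∈ E, ∀ y ∈ E, H.Adj x y → col x ≠ col y)
    (h0 : (#(E.filter fun x => col x = 0) : ℝ) ≤ (1 - (p + 1) * β) * #E) :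
    ∃ v : ι → ℤ, Ach H R E v ∧ #E * ∑ j, t j * y j ≤ ∑ j, v j * y j := by
  obtain ⟨i, hi, hle, hbd⟩ := greedy_clique (p + 1) ht ht1 hβ0 hβ (by push_cast; exact hq) y
  let c : ℕ → ℝ := fun l => #(E.filter fun x => col x = l)
  obtain ⟨s, hs⟩ := exists_shift p (fun l => c (l + 1)) (fun l => y (i l) - y (i (p + 1)))
  let σ : ℕ → ι := fun a => if h : 1 ≤ a ∧ a < p + 2 then
    i ((⟨a - 1, by omega⟩ : Fin (p + 1)) + s : Fin (p + 1)) else i (p + 1)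
  have hσ0 : σ 0 = i (p + 1) := by simp [σ]
  have hσ : ∀ l : Fin (p + 1), σ (l + 1) = i ((l + s : Fin (p + 1)) : ℕ) := by
    intro l
    have : 1 ≤ (l : ℕ) + 1 ∧ (l : ℕ) + 1 < p + 2 := ⟨by omega, by omega⟩
    simp only [σ, dif_pos this]
    congr
  have hclq : Clq R (p + 2) σ := by
    intro a ha b hb hab
    rcases Nat.eq_zero_or_pos a with rfl | ha0
    · obtain ⟨l, rfl⟩ : ∃ l : Fin (p + 1), b = l + 1 := ⟨⟨b - 1, by omega⟩, by simp; omega⟩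
      rw [hσ0, hσ]
      have hlt := (l + s).isLt
      exact hi _ (by omega) _ (hlt.trans (by omega)) hlt.ne'
    · obtain ⟨l, rfl⟩ : ∃ l : Fin (p + 1), a = l + 1 := ⟨⟨a - 1, by omega⟩, by simp; omega⟩
      rcases Nat.eq_zero_or_pos b with rfl | hb0
      · rw [hσ0, hσ]
        have hlt := (l + s).isLt
        exact hi _ (hlt.trans (by omega)) _ (by omega) hlt.ne
      · obtain ⟨l', rfl⟩ : ∃ l : Fin (p + 1), b = l + 1 := ⟨⟨b - 1, by omega⟩, by simp; omega⟩
        rw [hσ, hσ]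
        refine hi _ ((l + s).isLt.trans (by omega)) _ ((l' + s).isLt.trans (by omega)) fun h => hab ?_
        have h1 := add_right_cancel (Fin.ext h)
        rw [h1]
  refine ⟨_, Ach.of_col hk hc hclq, ?_⟩
  have hsum : ∀ g : ℕ → ℝ, ∑ x ∈ E, g (col x) = c 0 * g 0 + ∑ l : Fin (p + 1), c (l + 1) * g (l + 1) := by
    intro g
    have h1 : ∑ x ∈ E, g (col x) = ∑ l ∈ range (p + 2), c l * g l := by
      rw [← sum_fiberwise_of_maps_to (t := range (p + 2)) (g := col)
        (fun x hx => mem_range.2 (hk x hx))]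
      apply sum_congr rfl
      intro l _
      rw [sum_congr rfl (g := fun _ => g l) (by
        intro x hx; rw [(mem_filter.1 hx).2]), sum_const, nsmul_eq_mul]
    rw [h1, sum_range_succ', add_comm, Finset.sum_range]
  have h1 : ∑ j, (((#(E.filter fun x => σ (col x) = j) : ℕ) : ℤ) : ℝ) * y j =
      ∑ x ∈ E, y (σ (col x)) := by
    rw [← sum_fiberwise (s := E) (g := fun x => σ (col x))]
    apply sum_congr rfl
    intro j _
    rw [sum_congr rfl (g := fun _ => y j) (by
      intro x hx; rw [(mem_filter.1 hx).2]), sum_const, nsmul_eq_mul]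
    simp
  rw [h1, hsum (fun a => y (σ a))]
  simp only [hσ0, hσ]
  have h2 : (#E : ℝ) = c 0 + ∑ l : Fin (p + 1), c (l + 1) := by
    have := hsum (fun _ => 1)
    simpa using this
  set yq := y (i (p + 1))
  set C := ∑ l : Fin (p + 1), c (l + 1)
  set S := ∑ l ∈ range (p + 1), (y (i l) - yq) with hS
  have hS' : ∑ l : Fin (p + 1), (y (i l) - yq) = S := by rw [hS, Finset.sum_range]
  rw [hS'] at hs
  have hS0 : 0 ≤ S := sum_nonneg fun l hl => by linarith [hle l (mem_range.1 hl)]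
  have h3 : ∑ l : Fin (p + 1), c (l + 1) * (y (i ((l + s : Fin (p + 1)) : ℕ)) - yq) =
      ∑ l : Fin (p + 1), c (l + 1) * y (i ((l + s : Fin (p + 1)) : ℕ)) - C * yq := by
    simp_rw [mul_sub]
    rw [sum_sub_distrib, ← sum_mul]
  rw [h3] at hs
  change c 0 ≤ _ at h0
  set Y := ∑ l : Fin (p + 1), c (l + 1) * y (i ((l + s : Fin (p + 1)) : ℕ))
  have hE0 : (0 : ℝ) ≤ #E := by positivity
  have h4 : (#E : ℝ) * ∑ j, t j * y j ≤ #E * (yq + β * S) := mul_le_mul_of_nonneg_left hbd hE0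
  have h5 : (p + 1) * β * #E ≤ C := by rw [h2] at h0 ⊢; linarith
  have h6 : (p + 1) * β * #E * S ≤ C * S := mul_le_mul_of_nonneg_right h5 hS0
  have h7 : ((p : ℝ) + 1) * (β * #E * S) ≤ (p + 1) * (Y - C * yq) := by linarith
  have h8 : β * #E * S ≤ Y - C * yq := le_of_mul_le_mul_left h7 (by positivity)
  rw [h2] at h4 h8 ⊢
  linarith

end Alloc

section Greedy
open Finset
set_option linter.unusedSectionVars false

variable {U ι : Type} [Fintype U] [Fintype ι]

lemma extract_block {α : Type} [DecidableEq α] (F : Finset α) (g s : α → ℝ) {w X : ℝ} (hw : 0 ≤ w)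
    (hs : ∀ a ∈ F, s a ≤ w) (hg : ∀ a ∈ F, |g a| ≤ w)
    (hF : ∑ a ∈ F, g a ≤ w) (hX : 0 ≤ X) (hXF : X ≤ ∑ a ∈ F, s a) :
    ∃ B ⊆ F, X ≤ ∑ a ∈ B, s a ∧ ∑ a ∈ B, s a ≤ X + w ∧ ∑ a ∈ B, g a ≤ 2 * w ∧
      ∑ a ∈ F \ B, g a ≤ w := by
  let P : Finset α → Prop := fun B => ∑ a ∈ F \ B, g a ≤ w ∧
    min (∑ a ∈ F, g a) (-w) ≤ ∑ a ∈ F \ B, g a ∧ ∑ a ∈ B, s a ≤ X + w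
  have hne : (F.powerset.filter P).Nonempty :=
    ⟨∅, by simp [P, hF]; positivity⟩
  obtain ⟨B, hB, hmax⟩ := exists_max_image (F.powerset.filter P) card hne
  obtain ⟨hBF, h1, h2, h3⟩ := mem_filter.1 hB
  rw [mem_powerset] at hBF
  have hsum : ∑ a ∈ F \ B, g a + ∑ a ∈ B, g a = ∑ a ∈ F, g a := sum_sdiff hBF
  refine ⟨B, hBF, ?_, h3, ?_, h1⟩
  · by_contra! hlt
    have hFB : (F \ B).Nonempty := by
      rw [nonempty_iff_ne_empty]
      intro h
      have : B = F := subset_antisymm hBF (sdiff_eq_empty_iff_subset.1 h)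
      subst this
      linarith
    have key : ∃ a ∈ F \ B, (∑ a ∈ F \ B, g a) - g a ≤ w ∧
        min (∑ a ∈ F, g a) (-w) ≤ (∑ a ∈ F \ B, g a) - g a := by
      by_cases hpos : 0 < ∑ a ∈ F \ B, g a
      · obtain ⟨a, ha, hga⟩ : ∃ a ∈ F \ B, 0 < g a := by
          by_contra! h
          exact absurd (sum_nonpos h) (not_le.2 hpos)
        refine ⟨a, ha, by linarith, (min_le_right _ _).trans ?_⟩
        have := (abs_le.1 (hg a (mem_sdiff.1 ha).1)).2
        linarith
      · obtain ⟨a, ha, hga⟩ : ∃ a ∈ F \ B, g a ≤ 0 := by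
          by_contra! h
          exact hpos (sum_pos h hFB)
        refine ⟨a, ha, ?_, by linarith⟩
        have := (abs_le.1 (hg a (mem_sdiff.1 ha).1)).1
        linarith
    obtain ⟨a, ha, h4, h5⟩ := key
    obtain ⟨haF, haB⟩ := mem_sdiff.1 ha
    have h6 : ∑ x ∈ F \ insert a B, g x = (∑ a ∈ F \ B, g a) - g a := by
      rw [← insert_erase ha, sum_insert (notMem_erase _ _), sdiff_insert]
      ring
    have h7 : insert a B ∈ F.powerset.filter P := by
      rw [mem_filter, mem_powerset]
      refine ⟨insert_subset haF hBF, ?_, ?_, ?_⟩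
      · rw [h6]; exact h4
      · rw [h6]; exact h5
      · rw [sum_insert haB]
        linarith [hs a haF]
    have := hmax _ h7
    rw [card_insert_of_notMem haB] at this
    omega
  · rcases le_total (∑ a ∈ F, g a) (-w) with h | h
    · rw [min_eq_left h] at h2
      linarith
    · rw [min_eq_right h] at h2
      linarith

lemma sq_diff_sum_le {b : ℝ} {τ : ι → ℝ} {u : ι → ℝ} (hτ : ∀ j, 0 ≤ τ j) (hu : ∀ j, 0 ≤ u j)
    (hτs : ∑ j, τ j = b) (hus : ∑ j, u j = b) : ∑ j, (τ j - u j) ^ 2 ≤ 2 * b ^ 2 := by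
  have h1 : ∀ j, (τ j - u j) ^ 2 ≤ b * (τ j + u j) := by
    intro j
    have h1 : τ j ≤ b := hτs ▸ single_le_sum (fun j _ => hτ j) (mem_univ j)
    have h2 : u j ≤ b := hus ▸ single_le_sum (fun j _ => hu j) (mem_univ j)
    nlinarith [hτ j, hu j, mul_nonneg (hτ j) (hu j)]
  calc _ ≤ ∑ j, b * (τ j + u j) := sum_le_sum fun j _ => h1 j
    _ = 2 * b ^ 2 := by rw [← mul_sum, sum_add_distrib, hτs, hus]; ring

lemma balance_step (p : ℕ) {H : SimpleGraph U} {R : SimpleGraph ι} {t : ι → ℝ}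
    {η : ℝ} (hη : 0 < η) (ht : ∀ j, η ≤ t j) (ht1 : ∑ j, t j = 1)
    {β : ℝ} (hβ0 : 0 ≤ β) (hβ : ∀ i, ∑ j ∈ univ.filter (fun j => ¬ R.Adj i j), t j ≤ β)
    (hq : ((p : ℝ) + 1) * (β + η) < 1) (y : ι → ℝ) (hy : ∑ j, y j = 0) {E : Finset U}
    {col : U → ℕ}
    (hk : ∀ x ∈ E, col x < p + 2) (hc : ∀ x ∈ E, ∀ y ∈ E, H.Adj x y → col x ≠ col y)
    (h0 : (#(E.filter fun x => col x = 0) : ℝ) ≤ (1 - (p + 1) * (β + η)) * #E) {W : ℝ}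
    (hW : (#E : ℝ) ≤ W)
    (hyb : ∑ j, y j ^ 2 ≤ Fintype.card ι * (W / η + W) ^ 2) :
    ∃ v : ι → ℤ, Ach H R E v ∧
      ∑ j, (y j + t j * #E - v j) ^ 2 ≤ Fintype.card ι * (W / η + W) ^ 2 := by
  have hne : Nonempty ι := by
    by_contra h
    rw [not_nonempty_iff] at h
    simp at ht1
  have hb0 : (0 : ℝ) ≤ #E := by positivity
  have hW0 : 0 ≤ W := hb0.trans hW
  obtain ⟨a, -, ha⟩ := exists_max_image univ y univ_nonempty
  obtain ⟨b, -, hb⟩ := exists_min_image univ y univ_nonempty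
  let t' : ι → ℝ := fun j => t j + η * ((if j = a then 1 else 0) - if j = b then 1 else 0)
  have hdot : ∀ z : ι → ℝ, ∑ j, t' j * z j = ∑ j, t j * z j + η * (z a - z b) := by
    intro z
    simp only [t', add_mul, sum_add_distrib, mul_assoc, ← mul_sum, sub_mul, sum_sub_distrib,
      ite_mul, one_mul, zero_mul, sum_ite_eq', mem_univ, if_true]
  obtain ⟨v, hv, hvy⟩ := block_step (H := H) (R := R) p (t := t') (β := β + η) (y := y) (E := E) (col := col) (by
      intro j
      have := ht j
      simp only [t']
      split_ifs <;> linarith) (by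
      have := hdot (fun _ => 1)
      simpa [ht1] using this) (by linarith) (by
      intro i
      calc _ ≤ ∑ j ∈ univ.filter (fun j => ¬ R.Adj i j), (t j + if j = a then η else 0) := by
            apply sum_le_sum
            intro j _
            simp only [t']
            split_ifs <;> linarith
        _ ≤ β + η := by
            rw [sum_add_distrib]
            refine add_le_add (hβ i) ?_
            rw [sum_ite_eq']
            split_ifs <;> linarith) hq hk hc h0
  refine ⟨v, hv, ?_⟩
  have hvs : ∑ j, (v j : ℝ) = #E := by exact_mod_cast hv.sum
  have hv0 : ∀ j, (0 : ℝ) ≤ v j := fun j => by exact_mod_cast hv.nonneg j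
  have hts : ∑ j, t j * #E = #E := by rw [← sum_mul, ht1, one_mul]
  have ht0 : ∀ j, 0 ≤ t j * #E := fun j => mul_nonneg (hη.le.trans (ht j)) hb0
  rw [hdot] at hvy
  have hge : y b ≤ 0 := by
    by_contra! h
    have := sum_pos (s := univ) (f := y) (fun j hj => h.trans_le (hb j hj)) univ_nonempty
    linarith
  have hle : 0 ≤ y a := by
    by_contra! h
    have := sum_neg (s := univ) (f := y) (fun j hj => (ha j hj).trans_lt h) univ_nonempty
    linarith
  by_cases hcase : W / η ≤ y a - y b
  · have h1 : ∑ j, (y j + t j * #E - v j) ^ 2 =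
        ∑ j, y j ^ 2 + 2 * (#E * ∑ j, t j * y j - ∑ j, v j * y j) +
          ∑ j, (t j * #E - v j) ^ 2 := by
      rw [mul_sum, ← sum_sub_distrib, mul_sum, ← sum_add_distrib, ← sum_add_distrib]
      exact sum_congr rfl fun j _ => by ring
    have h2 := sq_diff_sum_le ht0 hv0 hts hvs
    have h3 : W ≤ η * (y a - y b) := by
      rw [div_le_iff₀ hη] at hcase
      linarith
    have h4 : (#E : ℝ) * #E ≤ #E * (η * (y a - y b)) :=
      mul_le_mul_of_nonneg_left (hW.trans h3) hb0
    rw [h1]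
    nlinarith
  · push Not at hcase
    have h1 : ∀ j, (y j + t j * #E - v j) ^ 2 ≤ (W / η + W) ^ 2 := by
      intro j
      have h2 : v j ≤ (#E : ℝ) := hvs ▸ single_le_sum (fun j _ => hv0 j) (mem_univ j)
      have h3 : t j * #E ≤ #E := (single_le_sum (f := fun j => t j * (#E : ℝ)) (fun j _ => ht0 j)
        (mem_univ j)).trans hts.le
      have h4 := ht0 j
      have h5 := hv0 j
      have h6 := ha j (mem_univ j)
      have h7 := hb j (mem_univ j)
      apply sq_le_sq'
      · linarith
      · linarith
    calc _ ≤ ∑ j : ι, (W / η + W) ^ 2 := sum_le_sum fun j _ => h1 j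
      _ = _ := by simp

lemma card_biUnion_id {F : Finset (Finset U)} (hd : (F : Set (Finset U)).PairwiseDisjoint id)
    (P : U → Prop) [DecidablePred P] : #((F.biUnion id).filter P) = ∑ T ∈ F, #(T.filter P) := by
  rw [filter_biUnion, card_biUnion]
  · rfl
  · intro T hT T' hT' h
    exact disjoint_filter_filter (hd hT hT' h)

lemma card_biUnion_id' {F : Finset (Finset U)} (hd : (F : Set (Finset U)).PairwiseDisjoint id) :
    #(F.biUnion id) = ∑ T ∈ F, #T := by
  rw [card_biUnion fun T hT T' hT' h => hd hT hT' h]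
  rfl

lemma greedy_alloc (p : ℕ) {H : SimpleGraph U} {R : SimpleGraph ι} {t : ι → ℝ}
    {η : ℝ} (hη : 0 < η) (ht : ∀ j, η ≤ t j) (ht1 : ∑ j, t j = 1)
    {β : ℝ} (hβ0 : 0 ≤ β) (hβ : ∀ i, ∑ j ∈ univ.filter (fun j => ¬ R.Adj i j), t j ≤ β)
    (hq : ((p : ℝ) + 1) * (β + η) < 1) {col : U → ℕ}
    (hk : ∀ x, col x < p + 2) (hc : ∀ x y, H.Adj x y → col x ≠ col y)
    {α : ℝ} (hα0 : 0 ≤ α) (hα1 : α ≤ 1) {M' : ℝ} (hM' : 0 < M')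
    (hα : α + 2 / M' ≤ 1 - (p + 1) * (β + η)) {w : ℝ} (hw : 0 < w)
    (F : Finset (Finset U)) (hd : (F : Set (Finset U)).PairwiseDisjoint id)
    (hcl : ∀ T ∈ F, Clsd H T) (hFw : ∀ T ∈ F, (#T : ℝ) ≤ w)
    (hF0 : (#((F.biUnion id).filter fun x => col x = 0) : ℝ) ≤ α * #(F.biUnion id) + w) :
    ∃ v : ι → ℤ, Ach H R (F.biUnion id) v ∧
      ∀ j, |t j * #(F.biUnion id) - v j| ≤
        Fintype.card ι * ((M' + 1) * w / η + (M' + 1) * w) := by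
  have hne : Nonempty ι := by
    by_contra h
    rw [not_nonempty_iff] at h
    simp at ht1
  set W := (M' + 1) * w with hW
  have hW0 : 0 < W := by positivity
  suffices h : ∀ n, ∀ F : Finset (Finset U), #F = n →
      (F : Set (Finset U)).PairwiseDisjoint id → (∀ T ∈ F, Clsd H T) → (∀ T ∈ F, (#T : ℝ) ≤ w) →
      (∑ T ∈ F, ((#(T.filter fun x => col x = 0) : ℝ) - α * #T) ≤ w) →
      ∃ v : ι → ℤ, Ach H R (F.biUnion id) v ∧
        ∑ j, (t j * #(F.biUnion id) - v j) ^ 2 ≤ Fintype.card ι * (W / η + W) ^ 2 by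
    obtain ⟨v, hv, hb⟩ := h _ F rfl hd hcl hFw (by
      rw [card_biUnion_id hd, card_biUnion_id' hd] at hF0
      push_cast at hF0
      rw [sum_sub_distrib, ← mul_sum]
      linarith)
    refine ⟨v, hv, fun j => ?_⟩
    have h1 : (t j * #(F.biUnion id) - v j) ^ 2 ≤ (Fintype.card ι * (W / η + W)) ^ 2 := by
      refine (single_le_sum (f := fun j => (t j * #(F.biUnion id) - (v j : ℝ)) ^ 2)
        (fun j _ => sq_nonneg _) (mem_univ j)).trans (hb.trans ?_)
      rw [mul_pow]
      gcongr
      have : (1 : ℝ) ≤ Fintype.card ι := by exact_mod_cast Fintype.card_pos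
      nlinarith
    exact abs_le_of_sq_le_sq h1 (by positivity)
  intro n
  induction n using Nat.strong_induction_on with
  | _ n ih =>
  intro F hFn hd hcl hFw hg
  by_cases hsmall : ∑ T ∈ F, (#T : ℝ) < M' * w
  · obtain ⟨i, hi, -⟩ := greedy_clique (p + 1) (fun j => hη.le.trans (ht j)) ht1 hβ0 hβ
      (by push_cast; nlinarith) (fun _ => 0)
    have hA := Ach.of_col (E := F.biUnion id) (fun x _ => hk x) (fun x _ y _ h => hc x y h) hi
    set v : ι → ℤ := fun j => #((F.biUnion id).filter fun x => i (col x) = j)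
    refine ⟨v, hA, ?_⟩
    have h1 : ∀ j, (t j * #(F.biUnion id) - v j) ^ 2 ≤ (W / η + W) ^ 2 := by
      intro j
      have h2 : (#(F.biUnion id) : ℝ) ≤ W := by
        rw [card_biUnion_id' hd]; push_cast; rw [hW]; linarith
      have hvs : ∑ j, (v j : ℝ) = #(F.biUnion id) := by exact_mod_cast hA.sum
      have hv0 : ∀ j, (0 : ℝ) ≤ v j := fun j => by exact_mod_cast hA.nonneg j
      have h3 : (v j : ℝ) ≤ #(F.biUnion id) := hvs ▸ single_le_sum (fun j _ => hv0 j) (mem_univ j)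
      have h4 : t j ≤ 1 := ht1 ▸ single_le_sum (fun j _ => hη.le.trans (ht j)) (mem_univ j)
      have h5 : 0 ≤ t j := hη.le.trans (ht j)
      have h6 : t j * #(F.biUnion id) ≤ W := by nlinarith
      have h7 : 0 ≤ t j * #(F.biUnion id) := by positivity
      have h8 : 0 ≤ W / η := by positivity
      apply sq_le_sq' <;> linarith [hv0 j]
    calc _ ≤ ∑ j : ι, (W / η + W) ^ 2 := sum_le_sum fun j _ => h1 j
      _ = _ := by simp
  push Not at hsmall
  obtain ⟨B, hBF, h1, h2, h3, h4⟩ := extract_block F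
    (fun T => (#(T.filter fun x => col x = 0) : ℝ) - α * #T) (fun T => (#T : ℝ)) hw.le hFw
    (by
      intro T hT
      have h1 : (#(T.filter fun x => col x = 0) : ℝ) ≤ #T := by
        exact_mod_cast card_filter_le _ _
      have h2 := hFw T hT
      have h3 : α * (#T : ℝ) ≤ #T := by
        have : (0 : ℝ) ≤ #T := by positivity
        nlinarith
      have h4 : 0 ≤ α * (#T : ℝ) := by positivity
      have h5 : (0 : ℝ) ≤ #(T.filter fun x => col x = 0) := by positivity
      rw [abs_le]
      constructor <;> linarith)
    hg (by positivity) hsmall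
  have hBne : B.Nonempty := by
    rw [nonempty_iff_ne_empty]
    rintro rfl
    simp at h1
    nlinarith
  have hdB : (B : Set (Finset U)).PairwiseDisjoint id := hd.subset (by exact_mod_cast hBF)
  have hdF : ((F \ B : Finset (Finset U)) : Set (Finset U)).PairwiseDisjoint id :=
    hd.subset (by exact_mod_cast sdiff_subset)
  obtain ⟨v, hv, hvb⟩ := ih #(F \ B) (by
    rw [← hFn]
    exact card_lt_card (sdiff_ssubset hBF hBne)) (F \ B) rfl hdF
    (fun T hT => hcl T (mem_sdiff.1 hT).1) (fun T hT => hFw T (mem_sdiff.1 hT).1) h4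
  have hcB : (#(B.biUnion id) : ℝ) = ∑ T ∈ B, (#T : ℝ) := by
    rw [card_biUnion_id' hdB]; push_cast; rfl
  obtain ⟨u, hu, hub⟩ := balance_step p (H := H) hη ht ht1 hβ0 hβ hq
    (fun j => t j * #((F \ B).biUnion id) - v j) (by
      rw [sum_sub_distrib, ← sum_mul, ht1, one_mul, sub_eq_zero]
      exact_mod_cast hv.sum.symm) (E := B.biUnion id) (col := col)
    (fun x _ => hk x) (fun x _ y _ h => hc x y h) (by
      refine le_trans ?_ (mul_le_mul_of_nonneg_right hα (by positivity))
      rw [card_biUnion_id hdB, hcB]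
      push_cast
      rw [sum_sub_distrib, ← mul_sum] at h3
      have : 2 * w ≤ 2 / M' * ∑ T ∈ B, (#T : ℝ) := by
        rw [div_mul_eq_mul_div, le_div_iff₀ hM']
        linarith
      linarith) (W := W) (by rw [hcB, hW]; linarith) hvb
  have hFB : F.biUnion id = (F \ B).biUnion id ∪ B.biUnion id := by
    rw [← union_biUnion, sdiff_union_of_subset hBF]
  have hdis : Disjoint ((F \ B).biUnion id) (B.biUnion id) := by
    rw [disjoint_biUnion_left]
    intro T hT
    rw [disjoint_biUnion_right]
    intro T' hT'
    refine hd (mem_sdiff.1 hT).1 (hBF hT') ?_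
    rintro rfl
    exact (mem_sdiff.1 hT).2 hT'
  refine ⟨_, hFB ▸ Ach.union (Clsd.biUnion fun T hT => hcl T (mem_sdiff.1 hT).1) hdis hv hu, ?_⟩
  rw [hFB, card_union_of_disjoint hdis]
  refine le_trans (le_of_eq ?_) hub
  apply sum_congr rfl
  intro j _
  push_cast
  ring

end Greedy

section SubsetSums
open Finset
set_option linter.unusedSectionVars false

/-- Within the window `[0, L)`, the set `X` is invariant under translations by `±d`. -/
def WinInv (L : ℤ) (X : Finset ℤ) (d : ℤ) : Prop :=
  ∀ x ∈ X, (x + d < L → x + d ∈ X) ∧ (0 ≤ x - d → x - d ∈ X)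

lemma WinInv.sub {L : ℤ} {X : Finset ℤ} (hX : ∀ x ∈ X, 0 ≤ x ∧ x < L) {a b : ℤ}
    (hba : b ≤ a) (h : a + b ≤ L) (ha : WinInv L X a) (hb : WinInv L X b) :
    WinInv L X (a - b) := by
  intro x hx
  have hx' := hX x hx
  constructor
  · intro h1
    by_cases h2 : x + a < L
    · have := (hb _ ((ha x hx).1 h2)).2 (by omega)
      rwa [add_sub_assoc] at this
    · have := (ha _ ((hb x hx).2 (by omega))).1 (by omega)
      rwa [show x - b + a = x + (a - b) by ring] at this
  · intro h1
    by_cases h2 : 0 ≤ x - a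
    · have := (hb _ ((ha x hx).2 h2)).1 (by omega)
      rwa [show x - a + b = x - (a - b) by ring] at this
    · have := (ha _ ((hb x hx).1 (by omega))).2 (by omega)
      rwa [show x + b - a = x - (a - b) by ring] at this

lemma WinInv.gcd {L : ℤ} {X : Finset ℤ} (hX : ∀ x ∈ X, 0 ≤ x ∧ x < L) (n : ℕ) :
    ∀ a b : ℕ, a + b ≤ n → 2 * (a : ℤ) ≤ L → 2 * (b : ℤ) ≤ L → WinInv L X a → WinInv L X b →
      WinInv L X (Nat.gcd a b) := by
  induction n with
  | zero =>
    intro a b h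
    obtain rfl : a = 0 := by omega
    obtain rfl : b = 0 := by omega
    simp
  | succ n ih =>
    intro a b h ha hb hXa hXb
    rcases Nat.eq_zero_or_pos b with rfl | hb0
    · simpa using hXa
    rcases Nat.eq_zero_or_pos a with rfl | ha0
    · simpa using hXb
    rcases le_total b a with hle | hle
    · have h1 := WinInv.sub hX (by exact_mod_cast hle) (by omega) hXa hXb
      have h2 := ih (a - b) b (by omega) (by omega) hb (by rw [Nat.cast_sub hle]; exact h1) hXb
      rwa [Nat.gcd_sub_self_left hle] at h2
    · have h1 := WinInv.sub hX (by exact_mod_cast hle) (by omega) hXb hXa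
      have h2 := ih a (b - a) (by omega) ha (by omega) hXa (by rw [Nat.cast_sub hle]; exact h1)
      rwa [Nat.gcd_sub_self_right hle] at h2

lemma WinInv.finset_gcd {L : ℤ} {X : Finset ℤ} (hX : ∀ x ∈ X, 0 ≤ x ∧ x < L) (hL : 0 ≤ L)
    (D : Finset ℕ) (hD : ∀ d ∈ D, 2 * (d : ℤ) ≤ L) (h : ∀ d ∈ D, WinInv L X d) :
    WinInv L X ((D.gcd id : ℕ) : ℤ) ∧ 2 * ((D.gcd id : ℕ) : ℤ) ≤ L := by
  induction D using Finset.induction_on with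
  | empty => exact ⟨fun x hx => by simp [hx], by simpa using hL⟩
  | insert a D ha ih =>
    obtain ⟨h1, h2⟩ := ih (fun d hd => hD d (mem_insert_of_mem hd))
      (fun d hd => h d (mem_insert_of_mem hd))
    have hDa := hD a (mem_insert_self _ _)
    have hda := h a (mem_insert_self _ _)
    rw [gcd_insert]
    refine ⟨WinInv.gcd hX _ _ _ le_rfl hDa h2 hda h1, ?_⟩
    change 2 * ((Nat.gcd a (D.gcd id) : ℕ) : ℤ) ≤ L
    rcases Nat.eq_zero_or_pos a with rfl | ha0
    · simpa using h2
    · have := Nat.gcd_le_left (D.gcd id) ha0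
      omega

lemma exists_shift_of_ne {L : ℤ} {X : Finset ℤ} (hX : X ⊆ Ico 0 L) (h0 : (0 : ℤ) ∈ X)
    (hne : X ≠ Ico 0 L) {D : Finset ℕ} (hg : D.gcd id = 1) (hD : ∀ d ∈ D, 2 * (d : ℤ) ≤ L) :
    ∃ δ : ℤ, δ.natAbs ∈ D ∧ ∃ x ∈ X, x + δ ∈ Ico 0 L ∧ x + δ ∉ X := by
  by_contra! hcon
  have hX' : ∀ x ∈ X, 0 ≤ x ∧ x < L := fun x hx => mem_Ico.1 (hX hx)
  have hL : 0 ≤ L := (hX' 0 h0).2.le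
  obtain ⟨h1, -⟩ := WinInv.finset_gcd hX' hL D hD (by
    intro d hd x hx
    have hx' := hX' x hx
    constructor
    · intro h
      exact hcon d (by simpa using hd) x hx (mem_Ico.2 ⟨by omega, h⟩)
    · intro h
      have := hcon (-d) (by simpa using hd) x hx (mem_Ico.2 ⟨by omega, by omega⟩)
      rwa [← sub_eq_add_neg] at this)
  rw [hg] at h1
  apply hne
  refine subset_antisymm hX fun x hx => ?_
  obtain ⟨hx0, hxL⟩ := mem_Ico.1 hx
  obtain ⟨n, rfl⟩ := Int.eq_ofNat_of_zero_le hx0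
  clear hx hx0
  induction n with
  | zero => exact_mod_cast h0
  | succ n ih =>
    have := (h1 _ (ih (by push_cast at hxL; omega))).1 (by push_cast at hxL ⊢; omega)
    push_cast at this ⊢
    exact this

lemma subset_sums {α : Type} [DecidableEq α] (S : Finset α) (D : α → Finset ℕ) {L : ℕ}
    (hL : 0 < L) (hg : ∀ a ∈ S, (D a).gcd id = 1) (hD : ∀ a ∈ S, ∀ d ∈ D a, 2 * d ≤ L)
    (hS : L ≤ #S) :
    ∃ δ : α → ℤ, (∀ a ∈ S, (δ a).natAbs ∈ D a) ∧
      ∀ x : ℤ, 0 ≤ x → x < L → ∃ A ⊆ S, ∑ a ∈ A, δ a = x := by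
  suffices h : ∃ δ : α → ℤ, (∀ a ∈ S, (δ a).natAbs ∈ D a) ∧ ∃ X ⊆ Ico (0 : ℤ) L, 0 ∈ X ∧
      (∀ x ∈ X, ∃ A ⊆ S, ∑ a ∈ A, δ a = x) ∧ (X = Ico (0 : ℤ) L ∨ #S + 1 ≤ #X) by
    obtain ⟨δ, h1, X, hX, -, h2, h3⟩ := h
    refine ⟨δ, h1, fun x hx0 hxL => h2 x ?_⟩
    have : X = Ico (0 : ℤ) L := by
      rcases h3 with h3 | h3
      · exact h3
      · have h4 := card_le_card hX
        rw [Int.card_Ico] at h4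
        simp at h4
        omega
    rw [this]
    exact mem_Ico.2 ⟨hx0, hxL⟩
  clear hS
  induction S using Finset.induction_on with
  | empty =>
    refine ⟨fun _ => 0, by simp, {0}, by simp [hL], by simp, ?_, by simp⟩
    intro x hx
    exact ⟨∅, by simp, by simpa using (mem_singleton.1 hx).symm⟩
  | insert a S ha ih =>
    obtain ⟨δ, h1, X, hX, h0, h2, h3⟩ := ih (fun b hb => hg b (mem_insert_of_mem hb))
      (fun b hb => hD b (mem_insert_of_mem hb))
    have hga := hg a (mem_insert_self _ _)
    have hDa := hD a (mem_insert_self _ _)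
    have hupd : ∀ z : ℤ, ∀ A ⊆ S, ∑ b ∈ A, Function.update δ a z b = ∑ b ∈ A, δ b := by
      intro z A hA
      refine sum_congr rfl fun b hb => Function.update_of_ne ?_ _ _
      rintro rfl
      exact ha (hA hb)
    have hmem : ∀ z : ℤ, z.natAbs ∈ D a →
        ∀ b ∈ insert a S, (Function.update δ a z b).natAbs ∈ D b := by
      intro z hz b hb
      by_cases hba : b = a
      · subst hba; simpa using hz
      · rw [Function.update_of_ne hba]
        exact h1 b ((mem_insert.1 hb).resolve_left hba)
    by_cases hne : X = Ico (0 : ℤ) L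
    · have hDne : (D a).Nonempty := by
        rw [nonempty_iff_ne_empty]
        intro h
        rw [h] at hga
        simp at hga
      obtain ⟨d, hd⟩ := hDne
      refine ⟨Function.update δ a d, hmem d (by simpa using hd), X, hX, h0, ?_, Or.inl hne⟩
      intro x hx
      obtain ⟨A, hA, hAx⟩ := h2 x hx
      exact ⟨A, hA.trans (subset_insert _ _), by rw [hupd _ A hA, hAx]⟩
    · obtain ⟨z, hz, x, hx, hxz, hxn⟩ := exists_shift_of_ne hX h0 hne hga
        (fun d hd => by exact_mod_cast hDa d hd)
      refine ⟨Function.update δ a z, hmem z hz, insert (x + z) X, insert_subset hxz hX,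
        mem_insert_of_mem h0, ?_, Or.inr ?_⟩
      · intro y hy
        rcases mem_insert.1 hy with rfl | hy
        · obtain ⟨A, hA, hAx⟩ := h2 x hx
          refine ⟨insert a A, insert_subset_insert _ hA, ?_⟩
          rw [sum_insert (fun h => ha (hA h)), hupd _ A hA, hAx]
          simp [add_comm]
        · obtain ⟨A, hA, hAx⟩ := h2 y hy
          exact ⟨A, hA.trans (subset_insert _ _), by rw [hupd _ A hA, hAx]⟩
      · rw [card_insert_of_notMem hxn, card_insert_of_notMem ha]
        have := h3.resolve_left hne
        omega

variable {U ι : Type} [Fintype U] [Fintype ι]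

/-- The proper `k`-colourings of `H[T]` realise differences of the first two class sizes whose
greatest common divisor is `1`. -/
def FlexTile (H : SimpleGraph U) (k : ℕ) (T : Finset U) : Prop :=
  ∃ D : Finset ℕ, D.gcd id = 1 ∧ ∀ d ∈ D, ∃ c : U → ℕ, (∀ x ∈ T, c x < k) ∧
    (∀ x ∈ T, ∀ y ∈ T, H.Adj x y → c x ≠ c y) ∧
    ((#(T.filter fun x => c x = 0) : ℤ) - #(T.filter fun x => c x = 1)).natAbs = d

/-- The closed subsets of `T` have sizes whose greatest common divisor is `1`. -/
def SplitTile (H : SimpleGraph U) (T : Finset U) : Prop :=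
  ∃ D : Finset ℕ, D.gcd id = 1 ∧ ∀ d ∈ D, ∃ X ⊆ T, Clsd H X ∧ #X = d

lemma edge_toggle {H : SimpleGraph U} {R : SimpleGraph ι} {k : ℕ} (hk : 2 ≤ k) {σ : ℕ → ι}
    (hσ : Clq R k σ) {T : Finset U} {c : U → ℕ} (hc : ∀ x ∈ T, c x < k)
    (hcp : ∀ x ∈ T, ∀ y ∈ T, H.Adj x y → c x ≠ c y) {δ : ℤ}
    (hδ : ((#(T.filter fun x => c x = 0) : ℤ) - #(T.filter fun x => c x = 1)).natAbs = δ.natAbs) :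
    ∃ u : ι → ℤ, Ach H R T u ∧
      Ach H R T (fun j => u j + δ * ((if j = σ 0 then 1 else 0) - if j = σ 1 then 1 else 0)) := by
  have hinj : ∀ a < k, ∀ b < k, σ a = σ b → a = b := by
    intro a ha b hb h
    by_contra hab
    exact (hσ a ha b hb hab).ne h
  have h01 : σ 0 ≠ σ 1 := fun h => absurd (hinj 0 (by omega) 1 (by omega) h) (by omega)
  let c' : U → ℕ := fun x => Equiv.swap 0 1 (c x)
  have hswap : ∀ a < k, Equiv.swap 0 1 a < k := by
    intro a ha
    rw [Equiv.swap_apply_def]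
    split_ifs <;> omega
  have hc' : ∀ x ∈ T, c' x < k := fun x hx => hswap _ (hc x hx)
  have hcp' : ∀ x ∈ T, ∀ y ∈ T, H.Adj x y → c' x ≠ c' y := fun x hx y hy h h' =>
    hcp x hx y hy h ((Equiv.swap 0 1).injective h')
  have hA := Ach.of_col (R := R) hc hcp hσ
  have hA' := Ach.of_col (R := R) hc' hcp' hσ
  set Δ : ℤ := (#(T.filter fun x => c x = 0) : ℤ) - #(T.filter fun x => c x = 1) with hΔ
  have hcnt : ∀ j, (#(T.filter fun x => σ (c' x) = j) : ℤ) =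
      #(T.filter fun x => σ (c x) = j) +
        (-Δ) * ((if j = σ 0 then 1 else 0) - if j = σ 1 then 1 else 0) := by
    intro j
    have e0 : T.filter (fun x => σ (c x) = σ 0) = T.filter (fun x => c x = 0) :=
      filter_congr fun x hx => ⟨hinj _ (hc x hx) 0 (by omega), fun h => by rw [h]⟩
    have e1 : T.filter (fun x => σ (c x) = σ 1) = T.filter (fun x => c x = 1) :=
      filter_congr fun x hx => ⟨hinj _ (hc x hx) 1 (by omega), fun h => by rw [h]⟩
    have e0' : T.filter (fun x => σ (c' x) = σ 0) = T.filter (fun x => c x = 1) := by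
      refine filter_congr fun x hx => ⟨fun h => ?_, fun h => by simp [c', h]⟩
      have := hinj _ (hc' x hx) 0 (by omega) h
      simpa [c', Equiv.swap_apply_eq_iff] using this
    have e1' : T.filter (fun x => σ (c' x) = σ 1) = T.filter (fun x => c x = 0) := by
      refine filter_congr fun x hx => ⟨fun h => ?_, fun h => by simp [c', h]⟩
      have := hinj _ (hc' x hx) 1 (by omega) h
      simpa [c', Equiv.swap_apply_eq_iff] using this
    by_cases hj0 : j = σ 0
    · subst hj0
      rw [if_pos rfl, if_neg h01, e0, e0', hΔ]
      ring
    by_cases hj1 : j = σ 1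
    · subst hj1
      rw [if_pos rfl, if_neg h01.symm, e1, e1', hΔ]
      ring
    · rw [if_neg hj0, if_neg hj1]
      simp only [sub_zero, mul_zero, add_zero]
      congr 2
      refine filter_congr fun x hx => ?_
      by_cases h0 : c x = 0
      · simp only [c', h0, Equiv.swap_apply_left]
        exact ⟨fun h => absurd h.symm hj1, fun h => absurd h.symm hj0⟩
      by_cases h1 : c x = 1
      · simp only [c', h1, Equiv.swap_apply_right]
        exact ⟨fun h => absurd h.symm hj0, fun h => absurd h.symm hj1⟩
      · simp only [c', Equiv.swap_apply_of_ne_of_ne h0 h1]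
  rcases Int.natAbs_eq_natAbs_iff.1 hδ with h | h
  · refine ⟨_, hA', hA.congr fun j => ?_⟩
    rw [hcnt j, ← h]
    ring
  · refine ⟨_, hA, hA'.congr fun j => ?_⟩
    rw [hcnt j, h]
    ring

lemma edge_gadget {H : SimpleGraph U} {R : SimpleGraph ι} {k : ℕ} (hk : 2 ≤ k) {σ : ℕ → ι}
    (hσ : Clq R k σ) {F : Finset (Finset U)} (hd : (F : Set (Finset U)).PairwiseDisjoint id)
    (hcl : ∀ T ∈ F, Clsd H T) {L : ℕ} (hL : 0 < L) (hFw : ∀ T ∈ F, 2 * #T ≤ L) (hF : L ≤ #F)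
    (hflex : ∀ T ∈ F, FlexTile H k T) :
    ∃ b : ι → ℤ, ∀ x : ℤ, 0 ≤ x → x < L → Ach H R (F.biUnion id)
      (fun j => b j + x * ((if j = σ 0 then 1 else 0) - if j = σ 1 then 1 else 0)) := by
  have : Nonempty ι := ⟨σ 0⟩
  choose! D hD1 hD2 using hflex
  obtain ⟨δ, h1, h2⟩ := subset_sums F D hL hD1 (by
    intro T hT d hd
    obtain ⟨c, -, -, h⟩ := hD2 T hT d hd
    have h3 := card_filter_le T (fun x => c x = 0)
    have h4 := card_filter_le T (fun x => c x = 1)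
    have h5 := hFw T hT
    omega) hF
  have h3 : ∀ T ∈ F, ∃ u : ι → ℤ, Ach H R T u ∧ Ach H R T
      (fun j => u j + δ T * ((if j = σ 0 then 1 else 0) - if j = σ 1 then 1 else 0)) := by
    intro T hT
    obtain ⟨c, hc1, hc2, hc3⟩ := hD2 T hT _ (h1 T hT)
    exact edge_toggle hk hσ hc1 hc2 hc3
  choose! u hu1 hu2 using h3
  refine ⟨fun j => ∑ T ∈ F, u T j, fun x hx0 hxL => ?_⟩
  obtain ⟨A, hA, rfl⟩ := h2 x hx0 hxL
  refine (Ach.biUnion (E := id) (v := fun T j => u T j + (if T ∈ A then δ T else 0) *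
    ((if j = σ 0 then 1 else 0) - if j = σ 1 then 1 else 0)) hcl hd ?_).congr ?_
  · intro T hT
    by_cases hTA : T ∈ A
    · simp only [hTA, if_true]; exact hu2 T hT
    · simp only [hTA, if_false, zero_mul, add_zero]; exact hu1 T hT
  · intro j
    rw [sum_add_distrib, ← sum_mul, sum_ite_mem, inter_eq_right.2 hA]

lemma split_gadget {H : SimpleGraph U} {F : Finset (Finset U)}
    (hd : (F : Set (Finset U)).PairwiseDisjoint id)
    {L : ℕ} (hL : 0 < L) (hFw : ∀ T ∈ F, 2 * #T ≤ L) (hF : L ≤ #F)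
    (hsplit : ∀ T ∈ F, SplitTile H T) :
    ∃ b : ℤ, ∀ x : ℤ, 0 ≤ x → x < L → ∃ E ⊆ F.biUnion id, Clsd H E ∧ (#E : ℤ) = b + x := by
  choose! D hD1 hD2 using hsplit
  obtain ⟨δ, h1, h2⟩ := subset_sums F D hL hD1 (by
    intro T hT d hd
    obtain ⟨X, hX, -, rfl⟩ := hD2 T hT d hd
    exact (Nat.mul_le_mul_left 2 (card_le_card hX)).trans (hFw T hT)) hF
  have h3 : ∀ T ∈ F, ∃ X ⊆ T, ∃ Y ⊆ T, Clsd H X ∧ Clsd H Y ∧ (#Y : ℤ) = #X + δ T := by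
    intro T hT
    obtain ⟨X, hX, hX1, hX2⟩ := hD2 T hT _ (h1 T hT)
    have h0 : Clsd H (∅ : Finset U) := fun x hx => by simp at hx
    rcases Int.natAbs_eq (δ T) with h | h
    · exact ⟨∅, by simp, X, hX, h0, hX1, by rw [h, hX2]; simp⟩
    · exact ⟨X, hX, ∅, by simp, hX1, h0, by rw [h, hX2]; simp⟩
  choose! X hX Y hY hXc hYc hXY using h3
  refine ⟨∑ T ∈ F, (#(X T) : ℤ), fun x hx0 hxL => ?_⟩
  obtain ⟨A, hA, rfl⟩ := h2 x hx0 hxL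
  have hsub : ∀ T ∈ F, (if T ∈ A then Y T else X T) ⊆ T := by
    intro T hT
    split_ifs
    · exact hY T hT
    · exact hX T hT
  refine ⟨F.biUnion fun T => if T ∈ A then Y T else X T, ?_, ?_, ?_⟩
  · exact biUnion_mono hsub
  · apply Clsd.biUnion
    intro T hT
    split_ifs
    · exact hYc T hT
    · exact hXc T hT
  · rw [card_biUnion fun T hT T' hT' h => (hd hT hT' h).mono (hsub T hT) (hsub T' hT')]
    have h4 : ∀ T ∈ F, ((#(if T ∈ A then Y T else X T) : ℕ) : ℤ) =
        #(X T) + if T ∈ A then δ T else 0 := by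
      intro T hT
      split_ifs
      · exact hXY T hT
      · simp
    push_cast
    rw [sum_congr rfl h4, sum_add_distrib, sum_ite_mem, inter_eq_right.2 hA]

end SubsetSums

section Flow
open Finset
set_option linter.unusedSectionVars false

variable {U ι : Type} [Fintype U] [Fintype ι]

lemma unit_flow {R : SimpleGraph ι} {a b : ι} (p : R.Walk a b) :
    ∃ x : ι → ι → ℕ, (∀ i j, x i j ≠ 0 → R.Adj i j) ∧ (∀ i j, x i j ≤ p.length) ∧
      ∀ l, ∑ j, (x l j : ℤ) - ∑ i, (x i l : ℤ) = (if l = a then 1 else 0) - if l = b then 1 else 0 := by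
  induction p with
  | nil => exact ⟨fun _ _ => 0, by simp, by simp, by simp⟩
  | @cons a c b h p ih =>
    obtain ⟨x, h1, h2, h3⟩ := ih
    refine ⟨fun i j => x i j + if i = a ∧ j = c then 1 else 0, ?_, ?_, ?_⟩
    · intro i j hij
      by_cases hh : i = a ∧ j = c
      · rw [hh.1, hh.2]; exact h
      · simp only [if_neg hh, add_zero] at hij
        exact h1 i j hij
    · intro i j
      rw [SimpleGraph.Walk.length_cons]
      refine add_le_add (h2 i j) ?_
      split_ifs <;> omega
    · intro l
      push_cast
      rw [sum_add_distrib, sum_add_distrib]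
      have e1 : ∑ j, (if l = a ∧ j = c then (1 : ℤ) else 0) = if l = a then 1 else 0 := by
        by_cases hl : l = a <;> simp [hl]
      have e2 : ∑ i, (if i = a ∧ l = c then (1 : ℤ) else 0) = if l = c then 1 else 0 := by
        by_cases hl : l = c <;> simp [hl]
      rw [e1, e2]
      linarith [h3 l]

lemma exists_flow {R : SimpleGraph ι} (hR : R.Connected) {e : ι → ℤ} (he : ∑ j, e j = 0)
    {B : ℕ} (hB : ∀ j, |e j| ≤ B) :
    ∃ x : ι → ι → ℕ, (∀ i j, x i j ≠ 0 → R.Adj i j) ∧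
      (∀ i j, x i j ≤ Fintype.card ι * (B * Fintype.card ι)) ∧
      ∀ l, ∑ j, (x l j : ℤ) - ∑ i, (x i l : ℤ) = e l := by
  obtain ⟨o⟩ := hR.nonempty
  have h : ∀ a, ∃ x : ι → ι → ℕ, (∀ i j, x i j ≠ 0 → R.Adj i j) ∧
      (∀ i j, x i j ≤ Fintype.card ι) ∧
      ∀ l, ∑ j, (x l j : ℤ) - ∑ i, (x i l : ℤ) =
        (if l = a then 1 else 0) - if l = o then 1 else 0 := by
    intro a
    obtain ⟨p, hp⟩ := hR.preconnected.exists_isPath a o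
    obtain ⟨x, h1, h2, h3⟩ := unit_flow p
    exact ⟨x, h1, fun i j => (h2 i j).trans hp.length_lt.le, h3⟩
  choose x hx1 hx2 hx3 using h
  refine ⟨fun i j => ∑ a, ((e a).toNat * x a i j + (-e a).toNat * x a j i), ?_, ?_, ?_⟩
  · intro i j hij
    obtain ⟨a, -, ha⟩ := exists_ne_zero_of_sum_ne_zero hij
    by_cases h : x a i j = 0
    · rw [h, mul_zero, zero_add] at ha
      exact (hx1 a j i (right_ne_zero_of_mul ha)).symm
    · exact hx1 a i j h
  · intro i j
    calc _ ≤ ∑ a : ι, B * Fintype.card ι := by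
          apply sum_le_sum
          intro a _
          have h1 := abs_le.1 (hB a)
          have h2 : (e a).toNat + (-e a).toNat ≤ B := by omega
          calc _ ≤ (e a).toNat * Fintype.card ι + (-e a).toNat * Fintype.card ι := by
                gcongr
                · exact hx2 a i j
                · exact hx2 a j i
            _ = ((e a).toNat + (-e a).toNat) * Fintype.card ι := by ring
            _ ≤ _ := by gcongr
      _ = _ := by simp
  · intro l
    push_cast
    have h0 : ∑ j, ∑ a, (((e a).toNat : ℤ) * x a l j + ((-e a).toNat : ℤ) * x a j l) -
        ∑ i, ∑ a, (((e a).toNat : ℤ) * x a i l + ((-e a).toNat : ℤ) * x a l i) =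
        ∑ a, (∑ j, (((e a).toNat : ℤ) * x a l j + ((-e a).toNat : ℤ) * x a j l) -
        ∑ i, (((e a).toNat : ℤ) * x a i l + ((-e a).toNat : ℤ) * x a l i)) := by
      rw [sum_sub_distrib]
      congr 1 <;> exact sum_comm
    rw [h0]
    have h1 : ∀ a, ∑ j, (((e a).toNat : ℤ) * x a l j + ((-e a).toNat : ℤ) * x a j l) -
        ∑ i, (((e a).toNat : ℤ) * x a i l + ((-e a).toNat : ℤ) * x a l i) =
        e a * ((if l = a then 1 else 0) - if l = o then 1 else 0) := by
      intro a
      rw [← hx3 a l]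
      simp_rw [sum_add_distrib, ← mul_sum]
      have : e a = (e a).toNat - (-e a).toNat := by omega
      conv_rhs => rw [this]
      ring
    rw [sum_congr rfl fun a _ => h1 a]
    simp_rw [mul_sub]
    rw [sum_sub_distrib, ← sum_mul, he]
    simp

lemma exists_subfamilies {α β : Type} [DecidableEq β] (s : Finset α) (F : Finset β) (L : ℕ)
    (h : #s * L ≤ #F) : ∃ f : α → Finset β, (∀ a ∈ s, f a ⊆ F ∧ #(f a) = L) ∧
      (s : Set α).PairwiseDisjoint f := by
  induction s using Finset.induction_on with
  | empty => exact ⟨fun _ => ∅, by simp, by simp⟩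
  | insert a s ha ih =>
    rw [card_insert_of_notMem ha] at h
    obtain ⟨f, hf, hd⟩ := ih (by nlinarith)
    have h1 : L ≤ #(F \ s.biUnion f) := by
      have h2 : #(s.biUnion f) ≤ #s * L := by
        refine card_biUnion_le.trans ?_
        rw [sum_congr rfl fun b hb => (hf b hb).2]
        simp
      have := le_card_sdiff (s.biUnion f) F
      have h3 : (#s + 1) * L = #s * L + L := by ring
      omega
    obtain ⟨T, hT, hTL⟩ := exists_subset_card_eq h1
    have hupd : ∀ b ∈ s, Function.update f a T b = f b := fun b hb =>
      Function.update_of_ne (by rintro rfl; exact ha hb) _ _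
    refine ⟨Function.update f a T, ?_, ?_⟩
    · intro b hb
      rcases mem_insert.1 hb with rfl | hb
      · rw [Function.update_self]
        exact ⟨hT.trans sdiff_subset, hTL⟩
      · rw [hupd b hb]; exact hf b hb
    · rw [coe_insert]
      refine Set.PairwiseDisjoint.insert ?_ ?_
      · intro b hb c hc hbc
        change Disjoint (Function.update f a T b) (Function.update f a T c)
        rw [hupd b hb, hupd c hc]
        exact hd hb hc hbc
      · intro b hb hab
        rw [Function.update_self, hupd b hb]
        exact disjoint_of_subset_left hT
          (disjoint_of_subset_right (subset_biUnion_of_mem f hb) sdiff_disjoint)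

lemma exists_common_nbr {R : SimpleGraph ι} {t : ι → ℝ} (ht : ∀ j, 0 ≤ t j) (ht1 : ∑ j, t j = 1)
    {β : ℝ} (hβ : ∀ i, ∑ j ∈ univ.filter (fun j => ¬ R.Adj i j), t j ≤ β) {n : ℕ}
    (hq : (n : ℝ) * β < 1) (i : ℕ → ι) : ∃ j, ∀ l < n, R.Adj (i l) j := by
  by_contra! h
  have h2 : (univ : Finset ι) ⊆
      (range n).biUnion fun l => univ.filter fun j => ¬ R.Adj (i l) j := by
    intro j _
    obtain ⟨l, hl, hj⟩ := h j
    simp only [mem_biUnion, mem_range, mem_filter, mem_univ, true_and]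
    exact ⟨l, hl, hj⟩
  have h3 : (1 : ℝ) ≤ n * β := by
    calc (1 : ℝ) = ∑ j, t j := ht1.symm
      _ ≤ ∑ j ∈ (range n).biUnion fun l => univ.filter fun j => ¬ R.Adj (i l) j, t j :=
          sum_le_sum_of_subset_of_nonneg h2 fun j _ _ => ht j
      _ ≤ ∑ l ∈ range n, ∑ j ∈ univ.filter (fun j => ¬ R.Adj (i l) j), t j :=
          sum_biUnion_le_sum _ _ ht
      _ ≤ ∑ l ∈ range n, β := sum_le_sum fun l _ => hβ _
      _ = n * β := by simp
  linarith

lemma exists_clique_of_adj (p : ℕ) {R : SimpleGraph ι} {t : ι → ℝ} (ht : ∀ j, 0 ≤ t j)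
    (ht1 : ∑ j, t j = 1) {β : ℝ} (hβ0 : 0 ≤ β)
    (hβ : ∀ i, ∑ j ∈ univ.filter (fun j => ¬ R.Adj i j), t j ≤ β)
    (hq : ((p : ℝ) + 1) * β < 1) {i j : ι} (hij : R.Adj i j) :
    ∃ σ : ℕ → ι, Clq R (p + 2) σ ∧ σ 0 = i ∧ σ 1 = j := by
  suffices h : ∀ n ≤ p, ∃ σ : ℕ → ι, Clq R (n + 2) σ ∧ σ 0 = i ∧ σ 1 = j from h p le_rfl
  intro n
  induction n with
  | zero =>
    intro _
    refine ⟨fun a => if a = 0 then i else j, ?_, by simp, by simp⟩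
    intro a ha b hb hab
    have : (a = 0 ∧ b = 1) ∨ (a = 1 ∧ b = 0) := by omega
    rcases this with ⟨rfl, rfl⟩ | ⟨rfl, rfl⟩
    · simpa using hij
    · simpa using hij.symm
  | succ n ih =>
    intro hn
    obtain ⟨σ, h1, h2, h3⟩ := ih (by omega)
    obtain ⟨l, hl⟩ := exists_common_nbr ht ht1 hβ (n := n + 2) (by
      refine lt_of_le_of_lt ?_ hq
      gcongr
      push_cast
      have : (n : ℝ) + 1 ≤ p := by exact_mod_cast hn
      linarith) σ
    have hne : ∀ a, a < n + 2 → Function.update σ (n + 2) l a = σ a := fun a ha =>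
      Function.update_of_ne ha.ne _ _
    refine ⟨Function.update σ (n + 2) l, ?_, by rw [hne 0 (by omega), h2],
      by rw [hne 1 (by omega), h3]⟩
    intro a ha b hb hab
    by_cases ha' : a = n + 2
    · subst ha'
      rw [Function.update_self, hne b (by omega)]
      exact (hl b (by omega)).symm
    · rw [hne a (by omega)]
      by_cases hb' : b = n + 2
      · subst hb'
        rw [Function.update_self]
        exact hl a (by omega)
      · rw [hne b (by omega)]
        exact h1 a (by omega) b (by omega) hab

end Flow

section ConnAlloc
open Finset
set_option linter.unusedSectionVars false

lemma disjoint_biUnion_id {U : Type} {F A B : Finset (Finset U)}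
    (hd : (F : Set (Finset U)).PairwiseDisjoint id) (hA : A ⊆ F) (hB : B ⊆ F)
    (h : Disjoint A B) : Disjoint (A.biUnion id) (B.biUnion id) := by
  rw [disjoint_biUnion_left]
  intro T hT
  rw [disjoint_biUnion_right]
  intro T' hT'
  refine hd (hA hT) (hB hT') ?_
  rintro rfl
  exact disjoint_left.1 h hT hT'

lemma card_biUnion_id_le {U : Type} {F : Finset (Finset U)} {w : ℕ} (h : ∀ T ∈ F, #T ≤ w) :
    #(F.biUnion id) ≤ #F * w :=
  card_biUnion_le.trans ((sum_le_card_nsmul _ _ _ h).trans (by simp))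

set_option maxHeartbeats 4000000 in
lemma exact_alloc_conn (p r : ℕ) {ν c₀ κ : ℝ} (hν : 0 < ν) (hc₀ : 0 < c₀) (hκ : 0 ≤ κ) :
    ∃ K : ℝ, 0 < K ∧ ∀ {U ι : Type} [Fintype U] [Fintype ι] (H : SimpleGraph U)
      (R : SimpleGraph ι) (col : U → ℕ) (F : Finset (Finset U)) (J : Finset U) (cap : ι → ℕ)
      (w : ℕ) (α β : ℝ), Fintype.card ι ≤ r → R.Connected → (∀ x, col x < p + 2) →
      (∀ x y, H.Adj x y → col x ≠ col y) → (F : Set (Finset U)).PairwiseDisjoint id →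
      (∀ T ∈ F, Clsd H T) → (∀ T ∈ F, #T ≤ w) → (∀ T ∈ F, FlexTile H (p + 2) T) →
      Clsd H J → Disjoint (F.biUnion id) J → 1 ≤ w → 0 ≤ α → 0 ≤ β →
      α + (p + 1) * (β + ν) ≤ 1 → (#J : ℝ) ≤ κ * w ^ 2 →
      ∑ j, cap j = #(F.biUnion id) + #J → (∀ j, c₀ * (∑ j, cap j : ℕ) ≤ cap j) →
      (∀ i, (∑ j ∈ univ.filter (fun j => ¬ R.Adj i j), cap j : ℕ) ≤ β * (∑ j, cap j : ℕ)) →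
      ((#((F.biUnion id).filter fun x => col x = 0) : ℝ) ≤ α * #(F.biUnion id) + w) →
      K * w ^ 2 ≤ (∑ j, cap j : ℕ) →
      Ach H R (F.biUnion id ∪ J) (fun j => cap j) := by
  set η : ℝ := min (c₀ / 2) (ν / 4) with hη
  have hη0 : 0 < η := by positivity
  set M' : ℝ := 8 / ν with hM'
  have hM'0 : 0 < M' := by positivity
  set Kg : ℝ := r * ((M' + 1) / η + (M' + 1)) with hKg
  have hKg0 : 0 ≤ Kg := by positivity
  set B : ℕ := ⌈Kg⌉₊ with hB
  set K' : ℕ := r * r * B + 3 with hK'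
  set C : ℝ := κ + r * r * K' with hC
  have hC0 : 0 ≤ C := by positivity
  set ξ : ℝ := min (1 / 2) (min (c₀ / 2) (ν / 8)) with hξ
  have hξ0 : 0 < ξ := by positivity
  have hξ1 : ξ ≤ 1 / 2 := min_le_left _ _
  have hξ2 : ξ ≤ c₀ / 2 := (min_le_right _ _).trans (min_le_left _ _)
  have hξ3 : ξ ≤ ν / 8 := (min_le_right _ _).trans (min_le_right _ _)
  refine ⟨C / ξ + 1, by positivity, ?_⟩
  intro U ι _ _ H R col F J cap w α β hr hR hk hc hd hcl hFw hflex hJcl hFJ hw hα0 hβ0 hαβ hJ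
    hcap hcapc hcapβ hF0 hK
  have hne : Nonempty ι := hR.nonempty
  set N : ℝ := ((∑ j, cap j : ℕ) : ℝ) with hN
  have hw1 : (1 : ℝ) ≤ w := by exact_mod_cast hw
  have hw2 : (0 : ℝ) < (w : ℝ) ^ 2 := by positivity
  have hCN : C * w ^ 2 ≤ ξ * N := by
    have h1 : C / ξ * w ^ 2 ≤ N := by
      rw [add_mul] at hK
      linarith
    calc C * w ^ 2 = ξ * (C / ξ * w ^ 2) := by field_simp
      _ ≤ ξ * N := by gcongr
  have hN0 : 0 < N := by
    have : 0 < (C / ξ + 1) * (w : ℝ) ^ 2 := by positivity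
    linarith
  have hα1 : α ≤ 1 := by
    have : 0 ≤ ((p : ℝ) + 1) * (β + ν) := by positivity
    linarith
  have hpβ : ((p : ℝ) + 1) * (β + ν) ≤ 1 := by linarith
  have hβν : β + ν ≤ 1 := by
    have : (1 : ℝ) * (β + ν) ≤ (p + 1) * (β + ν) := by
      gcongr
      linarith [Nat.cast_nonneg (α := ℝ) p]
    linarith
  have hpν : ν ≤ (p + 1) * ν := by
    rw [add_mul]
    linarith [mul_nonneg (Nat.cast_nonneg (α := ℝ) p) hν.le]
  have hpβ0 : 0 ≤ ((p : ℝ) + 1) * β := by positivity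
  -- normalised capacities
  have hs0 : ∀ j, 0 ≤ (cap j : ℝ) / N := fun j => by positivity
  have hs1 : ∑ j, (cap j : ℝ) / N = 1 := by
    rw [← sum_div, hN]
    push_cast
    refine div_self ?_
    rw [hN] at hN0
    push_cast at hN0
    exact hN0.ne'
  have hsβ : ∀ i, ∑ j ∈ univ.filter (fun j => ¬ R.Adj i j), (cap j : ℝ) / N ≤ β := by
    intro i
    rw [← sum_div, div_le_iff₀ hN0]
    exact_mod_cast hcapβ i
  have hq : ((p : ℝ) + 1) * β < 1 := by
    rw [mul_add] at hpβ
    linarith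
  obtain ⟨σ₀, hσ₀, -⟩ := greedy_clique (p + 1) hs0 hs1 hβ0 hsβ (by push_cast; exact hq) (fun _ => 0)
  have hvJ := Ach.of_col (R := R) (E := J) (fun x _ => hk x) (fun x _ y _ h => hc x y h) hσ₀
  set vJ : ι → ℤ := fun j => #(J.filter fun x => σ₀ (col x) = j) with hvJdef
  -- reserved families
  set P : Finset (ι × ι) := univ.filter fun e => R.Adj e.1 e.2 with hP
  have hPr : #P ≤ r * r := by
    calc #P ≤ Fintype.card (ι × ι) := card_le_univ _
      _ = Fintype.card ι * Fintype.card ι := Fintype.card_prod _ _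
      _ ≤ _ := Nat.mul_le_mul hr hr
  set L : ℕ := K' * w with hL
  have hFbig : #P * L ≤ #F := by
    have h1 : (#(F.biUnion id) : ℝ) ≤ #F * w := by exact_mod_cast card_biUnion_id_le hFw
    have h2 : N = #(F.biUnion id) + #J := by rw [hN, hcap]; push_cast; rfl
    have h3 : (r : ℝ) * r * K' * w ^ 2 ≤ #F * w := by
      have : C * w ^ 2 ≤ N := hCN.trans (mul_le_of_le_one_left hN0.le (by linarith))
      rw [hC, add_mul] at this
      linarith
    have h4 : (r : ℝ) * r * (K' * w) ≤ #F := by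
      have : (r : ℝ) * r * (K' * w) * w ≤ #F * w := by linarith
      exact le_of_mul_le_mul_right this (by linarith)
    have h5 : r * r * (K' * w) ≤ #F := by exact_mod_cast h4
    exact (Nat.mul_le_mul_right _ hPr).trans h5
  obtain ⟨Fe, hFe, hFed⟩ := exists_subfamilies P F L hFbig
  have hL0 : 0 < L := by rw [hL, hK']; positivity
  have hgad : ∀ e ∈ P, ∃ b : ι → ℤ, ∀ x : ℤ, 0 ≤ x → x < L → Ach H R ((Fe e).biUnion id)
      (fun j => b j + x * ((if j = e.1 then 1 else 0) - if j = e.2 then 1 else 0)) := by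
    intro e he
    obtain ⟨σ, h1, h2, h3⟩ := exists_clique_of_adj p hs0 hs1 hβ0 hsβ hq (mem_filter.1 he).2
    obtain ⟨hsub, hcard⟩ := hFe e he
    have := edge_gadget (by omega) h1 (hd.subset (by exact_mod_cast hsub))
      (fun T hT => hcl T (hsub hT)) hL0 (fun T hT => by
        have := hFw T (hsub hT)
        calc 2 * #T ≤ 3 * w := by omega
          _ ≤ L := Nat.mul_le_mul_right _ (by omega)) hcard.ge
      (fun T hT => hflex T (hsub hT))
    rwa [h2, h3] at this
  choose! b hb using hgad
  have hb0 : ∀ e ∈ P, ∀ j, 0 ≤ b e j := by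
    intro e he j
    have := (hb e he 0 le_rfl (by exact_mod_cast hL0)).nonneg j
    simpa using this
  have hbs : ∀ e ∈ P, ∑ j, b e j = #((Fe e).biUnion id) := by
    intro e he
    have := (hb e he 0 le_rfl (by exact_mod_cast hL0)).sum
    simpa using this
  set Fr : Finset (Finset U) := F \ P.biUnion Fe with hFr
  have hPF : P.biUnion Fe ⊆ F := biUnion_subset.2 fun e he => (hFe e he).1
  have hFrF : Fr ⊆ F := sdiff_subset
  set E1 := P.biUnion fun e => (Fe e).biUnion id with hE1
  have hE1' : E1 = (P.biUnion Fe).biUnion id := by rw [hE1, biUnion_biUnion]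
  have hFE : F.biUnion id = E1 ∪ Fr.biUnion id := by
    rw [hE1', ← union_biUnion, hFr, union_sdiff_of_subset hPF]
  have hdisE : Disjoint E1 (Fr.biUnion id) := by
    rw [hE1']
    exact disjoint_biUnion_id hd hPF hFrF disjoint_sdiff
  have hdisP : (P : Set (ι × ι)).PairwiseDisjoint fun e => (Fe e).biUnion id := by
    intro e he e' he' hee
    exact disjoint_biUnion_id hd (hFe e he).1 (hFe e' he').1 (hFed he he' hee)
  have hE1card : #E1 ≤ r * r * (L * w) := by
    rw [hE1]
    calc _ ≤ #P * (L * w) := by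
          refine card_biUnion_le.trans ((sum_le_card_nsmul _ _ (L * w) ?_).trans (by simp))
          intro e he
          have := card_biUnion_id_le (w := w) fun T hT => hFw T ((hFe e he).1 hT)
          rwa [(hFe e he).2] at this
      _ ≤ _ := Nat.mul_le_mul_right _ hPr
  set N' : ℝ := ((#(Fr.biUnion id) : ℕ) : ℝ) with hN'
  have hmass : (#(F.biUnion id) : ℝ) = #E1 + N' := by
    rw [hFE, card_union_of_disjoint hdisE]; push_cast; rfl
  have hNN' : N = N' + (#E1 + #J) := by
    have : N = #(F.biUnion id) + #J := by rw [hN, hcap]; push_cast; rfl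
    rw [this, hmass]; ring
  have hrem : (#E1 : ℝ) + #J ≤ ξ * N := by
    refine le_trans ?_ hCN
    have h1 : (#E1 : ℝ) ≤ r * r * (L * w) := by exact_mod_cast hE1card
    rw [hL] at h1
    push_cast at h1
    rw [hC, add_mul]
    linarith
  have hξN : ξ * N ≤ 1 / 2 * N := mul_le_mul_of_nonneg_right hξ1 hN0.le
  have hξνN : ξ * N ≤ ν / 8 * N := mul_le_mul_of_nonneg_right hξ3 hN0.le
  have hN'N : N / 2 ≤ N' := by linarith
  have hN'0 : 0 < N' := by linarith
  have hN'le : N' ≤ N := by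
    have : (0 : ℝ) ≤ #E1 + #J := by positivity
    linarith
  -- residual capacities
  set cap' : ι → ℤ := fun j => cap j - vJ j - ∑ e ∈ P, b e j with hcap'
  have hsumb : ∑ j, ∑ e ∈ P, b e j = #E1 := by
    rw [sum_comm, sum_congr rfl hbs, hE1, card_biUnion fun e he e' he' h => hdisP he he' h]
    push_cast
    rfl
  have hcap's : (∑ j, (cap' j : ℝ)) = N' := by
    have h1 : ∑ j, cap' j = (∑ j, cap j : ℕ) - #J - #E1 := by
      rw [hcap', sum_sub_distrib, sum_sub_distrib, hsumb, hvJ.sum]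
      push_cast
      rfl
    have h2 : ((∑ j, cap' j : ℤ) : ℝ) = N - #J - #E1 := by
      rw [h1]; push_cast; rw [hN]; push_cast; rfl
    push_cast at h2
    rw [h2]
    linarith
  have hsub0 : ∀ j, 0 ≤ ∑ e ∈ P, b e j := fun j => sum_nonneg fun e he => hb0 e he j
  have hsubE : ∀ j, ((∑ e ∈ P, b e j : ℤ) : ℝ) ≤ #E1 := by
    intro j
    have : ∑ e ∈ P, b e j ≤ #E1 := hsumb ▸ single_le_sum (f := fun j => ∑ e ∈ P, b e j)
      (fun j _ => hsub0 j) (mem_univ j)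
    exact_mod_cast this
  have hvJle : ∀ j, (vJ j : ℝ) ≤ #J := by
    intro j
    have : vJ j ≤ #J := hvJ.sum ▸ single_le_sum (fun j _ => hvJ.nonneg j) (mem_univ j)
    exact_mod_cast this
  have hcap'le : ∀ j, (cap' j : ℝ) ≤ cap j := by
    intro j
    have h1 := hsub0 j
    have h2 := hvJ.nonneg j
    have : cap' j ≤ cap j := by simp only [hcap']; linarith
    exact_mod_cast this
  have hcap'ge : ∀ j, (c₀ / 2) * N ≤ cap' j := by
    intro j
    have h1 : (cap' j : ℝ) = cap j - vJ j - ((∑ e ∈ P, b e j : ℤ) : ℝ) := by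
      simp only [hcap']; push_cast; rfl
    have h2 := hvJle j
    have h3 := hsubE j
    have h4 := hcapc j
    have h5 : ξ * N ≤ c₀ / 2 * N := mul_le_mul_of_nonneg_right hξ2 hN0.le
    rw [h1]
    linarith
  set t : ι → ℝ := fun j => cap' j / N' with ht
  have ht1 : ∑ j, t j = 1 := by
    rw [ht, ← sum_div, hcap's, div_self hN'0.ne']
  have htη : ∀ j, η ≤ t j := by
    intro j
    rw [ht, le_div_iff₀ hN'0]
    have h1 : η ≤ c₀ / 2 := min_le_left _ _
    calc η * N' ≤ (c₀ / 2) * N := by gcongr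
      _ ≤ _ := hcap'ge j
  have htβ : ∀ i, ∑ j ∈ univ.filter (fun j => ¬ R.Adj i j), t j ≤ β + ν / 4 := by
    intro i
    rw [ht, ← sum_div, div_le_iff₀ hN'0]
    have h1 : ∑ j ∈ univ.filter (fun j => ¬ R.Adj i j), (cap' j : ℝ) ≤ β * N := by
      refine (sum_le_sum fun j _ => hcap'le j).trans ?_
      exact_mod_cast hcapβ i
    have h2 : β * (#E1 + #J) ≤ 1 * (ξ * N) := by
      gcongr
      linarith
    have h3 : ν * (N / 2) ≤ ν * N' := mul_le_mul_of_nonneg_left hN'N hν.le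
    have h4 : β * N = β * N' + β * (#E1 + #J) := by rw [hNN']; ring
    linarith
  have hFr0 : (#((Fr.biUnion id).filter fun x => col x = 0) : ℝ) ≤
      (α + ν / 4) * #(Fr.biUnion id) + w := by
    have h1 : (#((Fr.biUnion id).filter fun x => col x = 0) : ℝ) ≤
        #((F.biUnion id).filter fun x => col x = 0) := by
      exact_mod_cast card_le_card (filter_subset_filter _ (biUnion_subset_biUnion_of_subset_left _ hFrF))
    have h2 : α * #E1 ≤ 1 * (ξ * N) := by
      have : (0 : ℝ) ≤ #J := by positivity
      gcongr
      linarith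
    rw [hmass] at hF0
    have h3 : ν * (N / 2) ≤ ν * N' := mul_le_mul_of_nonneg_left hN'N hν.le
    rw [← hN']
    linarith
  have hηle : η ≤ ν / 4 := min_le_right _ _
  have hpη : ((p : ℝ) + 1) * (β + ν / 4 + η) ≤ (p + 1) * (β + ν / 2) :=
    mul_le_mul_of_nonneg_left (by linarith) (by positivity)
  have hp2 : ((p : ℝ) + 1) * (β + ν / 2) = (p + 1) * (β + ν) - (p + 1) * ν / 2 := by ring
  have h2M : 2 / M' = ν / 4 := by rw [hM']; field_simp; norm_num
  obtain ⟨v, hv, hvb⟩ := greedy_alloc p (H := H) (R := R) hη0 htη ht1 (by positivity) htβ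
    (by linarith) hk hc (α := α + ν / 4) (by positivity) (by linarith) hM'0
    (by rw [h2M]; linarith) (w := w) (by linarith) Fr (hd.subset (by exact_mod_cast hFrF))
    (fun T hT => hcl T (hFrF hT)) (fun T hT => by exact_mod_cast hFw T (hFrF hT)) hFr0
  set err : ι → ℤ := fun j => cap' j - v j with herr
  have herr0 : ∑ j, err j = 0 := by
    have h1 : ((∑ j, err j : ℤ) : ℝ) = 0 := by
      have h2 : (∑ j, (v j : ℝ)) = N' := by rw [hN']; exact_mod_cast hv.sum
      rw [herr]
      push_cast
      rw [sum_sub_distrib, hcap's, h2, sub_self]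
    exact_mod_cast h1
  have herrB : ∀ j, |err j| ≤ (B * w : ℕ) := by
    intro j
    have h1 := hvb j
    have h2 : t j * N' = cap' j := by rw [ht]; field_simp
    rw [← hN', h2] at h1
    have h3 : (Fintype.card ι : ℝ) * ((M' + 1) * w / η + (M' + 1) * w) ≤ B * w := by
      calc _ = (Fintype.card ι : ℝ) * ((M' + 1) / η + (M' + 1)) * w := by ring
        _ ≤ r * ((M' + 1) / η + (M' + 1)) * w := by gcongr
        _ ≤ B * w := by gcongr; exact Nat.le_ceil _
    have h4 : ((|err j| : ℤ) : ℝ) ≤ ((B * w : ℕ) : ℝ) := by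
      rw [herr]; push_cast; exact h1.trans h3
    exact_mod_cast h4
  obtain ⟨x, hx1, hx2, hx3⟩ := exists_flow hR herr0 herrB
  have hxL : ∀ i j, (x i j : ℤ) < L := by
    intro i j
    have h1 := hx2 i j
    have h2 : Fintype.card ι * (B * w * Fintype.card ι) ≤ r * (B * w * r) := by gcongr
    have h3 : r * (B * w * r) = r * r * B * w := by ring
    have h4 : L = r * r * B * w + 3 * w := by rw [hL, hK']; ring
    have : x i j < L := by omega
    exact_mod_cast this
  have hA1 : Ach H R E1 _ := Ach.biUnion
    (v := fun e j => b e j + (x e.1 e.2 : ℤ) * ((if j = e.1 then 1 else 0) - if j = e.2 then 1 else 0))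
    (fun e he => Clsd.biUnion fun T hT => hcl T ((hFe e he).1 hT)) hdisP
    (fun e he => hb e he _ (by positivity) (hxL _ _))
  have hE1cl : Clsd H E1 := Clsd.biUnion fun e he => Clsd.biUnion fun T hT => hcl T ((hFe e he).1 hT)
  have hFrcl : Clsd H (Fr.biUnion id) := Clsd.biUnion fun T hT => hcl T (hFrF hT)
  have hall := Ach.union (by rw [hFE]; exact hE1cl.union hFrcl) hFJ
    (by rw [hFE]; exact Ach.union hE1cl hdisE hA1 hv) hvJ
  refine hall.congr fun l => ?_
  have hflow : ∑ e ∈ P, (x e.1 e.2 : ℤ) * ((if l = e.1 then 1 else 0) - if l = e.2 then 1 else 0) =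
      err l := by
    have h1 : ∑ e ∈ P, (x e.1 e.2 : ℤ) * ((if l = e.1 then 1 else 0) - if l = e.2 then 1 else 0) =
        ∑ e : ι × ι, (x e.1 e.2 : ℤ) * ((if l = e.1 then 1 else 0) - if l = e.2 then 1 else 0) := by
      apply sum_subset (subset_univ _)
      intro e _ he
      have : x e.1 e.2 = 0 := by
        by_contra h
        exact he (mem_filter.2 ⟨mem_univ _, hx1 _ _ h⟩)
      simp [this]
    rw [h1, Fintype.sum_prod_type, ← hx3 l]
    simp_rw [mul_sub]
    simp_rw [sum_sub_distrib]
    congr 1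
    · rw [sum_comm]
      simp
    · simp
  rw [sum_add_distrib, hflow, herr, hcap']
  ring

end ConnAlloc

section CompAlloc
open Finset
set_option linter.unusedSectionVars false

lemma split_blocks {α γ : Type} [DecidableEq α] (s : Finset γ) (F : Finset α) (g m : α → ℝ)
    (X : γ → ℝ)
    {w : ℝ} (hw : 0 ≤ w) (hm : ∀ a ∈ F, m a ≤ w) (hg : ∀ a ∈ F, |g a| ≤ w)
    (hF : ∑ a ∈ F, g a ≤ w) (hX : ∀ c ∈ s, 0 ≤ X c)
    (hXF : ∑ c ∈ s, (X c + w) ≤ ∑ a ∈ F, m a) :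
    ∃ B : γ → Finset α, (∀ c ∈ s, B c ⊆ F ∧ X c ≤ ∑ a ∈ B c, m a ∧ ∑ a ∈ B c, m a ≤ X c + w ∧
      ∑ a ∈ B c, g a ≤ 2 * w) ∧ (s : Set γ).PairwiseDisjoint B ∧
      ∑ a ∈ F \ s.biUnion B, g a ≤ w := by
  induction s using Finset.induction_on with
  | empty => exact ⟨fun _ => ∅, by simp, by simp, by simpa using hF⟩
  | insert c s hc ih =>
    rw [sum_insert hc] at hXF
    have hXc := hX c (mem_insert_self _ _)
    obtain ⟨B, h1, h2, h3⟩ := ih (fun c hc => hX c (mem_insert_of_mem hc)) (by linarith)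
    have hsub : s.biUnion B ⊆ F := biUnion_subset.2 fun c hc => (h1 c hc).1
    have h4 : ∑ a ∈ s.biUnion B, m a ≤ ∑ c ∈ s, (X c + w) := by
      rw [sum_biUnion h2]
      exact sum_le_sum fun c hc => (h1 c hc).2.2.1
    have h5 : ∑ a ∈ F \ s.biUnion B, m a + ∑ a ∈ s.biUnion B, m a = ∑ a ∈ F, m a :=
      sum_sdiff hsub
    obtain ⟨T, hT, hT1, hT2, hT3, hT4⟩ := extract_block (F \ s.biUnion B) g m hw
      (fun a ha => hm a (mem_sdiff.1 ha).1) (fun a ha => hg a (mem_sdiff.1 ha).1) h3 hXc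
      (by linarith)
    have hupd : ∀ b ∈ s, Function.update B c T b = B b := fun b hb =>
      Function.update_of_ne (by rintro rfl; exact hc hb) _ _
    refine ⟨Function.update B c T, ?_, ?_, ?_⟩
    · intro b hb
      rcases mem_insert.1 hb with rfl | hb
      · rw [Function.update_self]
        exact ⟨hT.trans sdiff_subset, hT1, hT2, hT3⟩
      · rw [hupd b hb]; exact h1 b hb
    · rw [coe_insert]
      refine Set.PairwiseDisjoint.insert ?_ ?_
      · intro b hb b' hb' hbb
        change Disjoint (Function.update B c T b) (Function.update B c T b')
        rw [hupd b hb, hupd b' hb']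
        exact h2 hb hb' hbb
      · intro b hb hab
        rw [Function.update_self, hupd b hb]
        exact disjoint_of_subset_left hT
          (disjoint_of_subset_right (subset_biUnion_of_mem B hb) sdiff_disjoint)
    · rw [biUnion_insert, Function.update_self,
        biUnion_congr rfl hupd, union_comm, ← sup_eq_union, ← sdiff_sdiff_left]
      exact hT4

variable {U ι : Type} [Fintype U] [Fintype ι]

lemma Clsd.sdiff {H : SimpleGraph U} {E E' : Finset U} (h : Clsd H E) (h' : Clsd H E') :
    Clsd H (E \ E') := by
  intro x hx y hxy
  rw [mem_sdiff] at hx ⊢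
  exact ⟨h x hx.1 y hxy, fun hy => hx.2 (h' y hy x hxy.symm)⟩

lemma Ach.of_comp {H : SimpleGraph U} {R : SimpleGraph ι} {E : Finset U}
    {c : R.ConnectedComponent} {v : ι → ℤ} (h : Ach H (c.toSimpleGraph) E (fun j => v j)) :
    Ach H R E (fun j => if j ∈ c.supp then v j else 0) := by
  obtain ⟨φ, h1, h2⟩ := h
  refine ⟨fun x => φ x, fun x hx y hy hxy => h1 x hx y hy hxy, fun j => ?_⟩
  dsimp only
  split_ifs with hj
  · refine Eq.trans ?_ (h2 ⟨j, hj⟩)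
    congr 2
    ext x
    simp [Subtype.ext_iff]
  · rw [Nat.cast_eq_zero, card_eq_zero, filter_eq_empty_iff]
    rintro x - rfl
    exact hj (φ x).2

end CompAlloc

section ExactAlloc
open Finset
set_option linter.unusedSectionVars false

lemma exact_alloc_comp (r : ℕ) {ν c₀ κ : ℝ} (hν : 0 < ν) (hc₀ : 0 < c₀) (hκ : 0 ≤ κ) :
    ∃ K : ℝ, 0 < K ∧ ∀ {U ι : Type} [Fintype U] [Fintype ι] (H : SimpleGraph U)
      (R : SimpleGraph ι) (c : R.ConnectedComponent) (col : U → ℕ) (F : Finset (Finset U))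
      (J : Finset U) (cap : ι → ℕ)
      (w : ℕ) (α β : ℝ), Fintype.card ι ≤ r → (∀ x, col x < 2) →
      (∀ x y, H.Adj x y → col x ≠ col y) → (F : Set (Finset U)).PairwiseDisjoint id →
      (∀ T ∈ F, Clsd H T) → (∀ T ∈ F, #T ≤ w) → (∀ T ∈ F, FlexTile H 2 T) →
      Clsd H J → Disjoint (F.biUnion id) J → 1 ≤ w → 0 ≤ α → 0 ≤ β →
      α + (β + ν) ≤ 1 → (#J : ℝ) ≤ κ * w ^ 2 →
      ∑ j ∈ univ.filter (· ∈ c.supp), cap j = #(F.biUnion id) + #J →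
      (∀ j, c₀ * (∑ j, cap j : ℕ) ≤ cap j) →
      (∀ i, (∑ j ∈ univ.filter (fun j => ¬ R.Adj i j), cap j : ℕ) ≤ β * (∑ j, cap j : ℕ)) →
      ((#((F.biUnion id).filter fun x => col x = 0) : ℝ) ≤ α * #(F.biUnion id) + w) →
      K * w ^ 2 ≤ (∑ j ∈ univ.filter (· ∈ c.supp), cap j : ℕ) →
      Ach H R (F.biUnion id ∪ J) (fun j => if j ∈ c.supp then (cap j : ℤ) else 0) := by
  obtain ⟨K, hK, h⟩ := exact_alloc_conn 0 r hν hc₀ hκ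
  refine ⟨K, hK, ?_⟩
  intro U ι _ _ H R c col F J cap w α β hr hcol hprop hd hcl hw hflex hJ hFJ hw1 hα hβ hαβ hJc
    hcap hc hnon h0 hN
  have hsub : ∀ f : ι → ℕ, ∑ j ∈ univ.filter (· ∈ c.supp), f j = ∑ j : c, f j := fun f =>
    Finset.sum_subtype _ (fun x => by rw [mem_filter]; exact ⟨fun h => h.2, fun h => ⟨mem_univ _, h⟩⟩) f
  have hle : ∑ j : c, cap j ≤ ∑ j, cap j := by
    rw [← hsub]; exact sum_le_sum_of_subset (filter_subset _ _)
  rw [hsub] at hcap hN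
  refine Ach.of_comp (v := fun j => (cap j : ℤ)) ?_
  refine h H c.toSimpleGraph col F J (fun j : c => cap j) w α β
    ((Fintype.card_subtype_le _).trans hr)
    c.connected_toSimpleGraph hcol hprop hd hcl hw hflex hJ hFJ hw1 hα hβ
    (by push_cast; linarith) hJc hcap ?_ ?_ h0 hN
  · intro j
    refine le_trans ?_ (hc j)
    have : ((∑ j : c, cap j : ℕ) : ℝ) ≤ (∑ j, cap j : ℕ) := by exact_mod_cast hle
    exact mul_le_mul_of_nonneg_left this hc₀.le
  · intro i
    have e1 : ∑ j ∈ univ.filter (fun j : c => ¬ c.toSimpleGraph.Adj i j), cap j =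
        ∑ j ∈ univ.filter (· ∈ c.supp), if ¬ R.Adj i j then cap j else 0 := by
      rw [hsub, sum_filter]
      rfl
    have e2 : ∑ j ∈ univ.filter (fun j => ¬ R.Adj i j), cap j =
        (∑ j ∈ univ.filter (· ∈ c.supp), if ¬ R.Adj i j then cap j else 0) +
        ∑ j ∈ univ.filter (¬ · ∈ c.supp), cap j := by
      rw [sum_filter, ← sum_filter_add_sum_filter_not univ (· ∈ c.supp)]
      congr 1
      refine sum_congr rfl fun j hj => if_pos ?_
      intro hadj
      exact (mem_filter.1 hj).2 (SimpleGraph.ConnectedComponent.mem_supp_of_adj_mem_supp _ i.2 hadj)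
    have e3 := sum_filter_add_sum_filter_not univ (· ∈ c.supp) cap
    rw [hsub] at e3
    have := hnon i
    rw [e2, ← e3] at this
    rw [e1]
    push_cast at this ⊢
    set A : ℝ := ∑ j ∈ univ.filter (¬ · ∈ c.supp), (cap j : ℝ)
    have hA : 0 ≤ A := by positivity
    have hb : 0 ≤ (1 - β) * A := mul_nonneg (by linarith) hA
    linarith

set_option maxHeartbeats 2000000 in
lemma exact_alloc_two (r : ℕ) {ν c₀ : ℝ} (hν : 0 < ν) (hc₀ : 0 < c₀) :
    ∃ K : ℝ, 0 < K ∧ ∀ {U ι : Type} [Fintype U] [Fintype ι] (H : SimpleGraph U)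
      (R : SimpleGraph ι) (col : U → ℕ) (F : Finset (Finset U)) (cap : ι → ℕ)
      (w : ℕ) (α β : ℝ), Fintype.card ι ≤ r → (∀ x, col x < 2) →
      (∀ x y, H.Adj x y → col x ≠ col y) → (F : Set (Finset U)).PairwiseDisjoint id →
      (∀ T ∈ F, Clsd H T) → (∀ T ∈ F, #T ≤ w) → (∀ T ∈ F, FlexTile H 2 T) →
      (∀ T ∈ F, SplitTile H T) → 1 ≤ w → 0 ≤ α → 0 ≤ β →
      α + (β + ν) ≤ 1 →
      ∑ j, cap j = #(F.biUnion id) → (∀ j, c₀ * (∑ j, cap j : ℕ) ≤ cap j) →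
      (∀ i, (∑ j ∈ univ.filter (fun j => ¬ R.Adj i j), cap j : ℕ) ≤ β * (∑ j, cap j : ℕ)) →
      ((#((F.biUnion id).filter fun x => col x = 0) : ℝ) ≤ α * #(F.biUnion id)) →
      K * w ^ 2 ≤ (∑ j, cap j : ℕ) →
      Ach H R (F.biUnion id) (fun j => cap j) := by
  obtain ⟨K, hK, h⟩ := exact_alloc_comp r (ν := ν / 2) (c₀ := c₀) (κ := 3 * r) (by positivity) hc₀
    (by positivity)
  have hKb : 0 < (K + 3 * r + 4 + 4 / ν) / c₀ := by positivity
  refine ⟨(K + 3 * r + 4 + 4 / ν) / c₀ + 24 * r / ν + 3 * r, by positivity, ?_⟩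
  intro U ι _ _ H R col F cap w α β hr hcol hprop hd hcl hw hflex hsplit hw1 hα hβ hαβ
    hcap hc hnon h0 hN
  set N := ∑ j, cap j with hNdef
  have hw1' : (1 : ℝ) ≤ w := by exact_mod_cast hw1
  have hw2 : (w : ℝ) ≤ (w : ℝ) ^ 2 := by nlinarith
  have hw2p : (1 : ℝ) ≤ (w : ℝ) ^ 2 := by linarith
  have hr0 : (0 : ℝ) ≤ r := by positivity
  have hKw : 0 ≤ K * (w : ℝ) ^ 2 := by positivity
  have hrw : 0 ≤ (r : ℝ) * (w : ℝ) ^ 2 := by positivity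
  have hνw : 0 ≤ 4 / ν * (w : ℝ) ^ 2 := by positivity
  have hN1 : (K + 3 * r + 4 + 4 / ν) * w ^ 2 ≤ c₀ * N := by
    have h1 : (K + 3 * r + 4 + 4 / ν) / c₀ * w ^ 2 ≤ N := by
      refine le_trans ?_ hN
      exact mul_le_mul_of_nonneg_right (by
        have : 0 ≤ 24 * (r : ℝ) / ν := by positivity
        linarith) (by positivity)
    have h2 := mul_le_mul_of_nonneg_left h1 hc₀.le
    rwa [← mul_assoc, mul_div_cancel₀ _ hc₀.ne'] at h2
  have hN2 : 24 * r * w ^ 2 ≤ ν * N := by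
    have h1 : 24 * r / ν * w ^ 2 ≤ N := by
      refine le_trans ?_ hN
      exact mul_le_mul_of_nonneg_right (by linarith) (by positivity)
    have h2 := mul_le_mul_of_nonneg_left h1 hν.le
    rwa [← mul_assoc, mul_div_cancel₀ _ hν.ne'] at h2
  have hN3 : 3 * (r : ℝ) * w ^ 2 ≤ N := by
    refine le_trans ?_ hN
    refine mul_le_mul_of_nonneg_right ?_ (by positivity)
    have : 0 ≤ 24 * (r : ℝ) / ν := by positivity
    linarith
  have hNpos : (0 : ℝ) < N := by
    have : 0 < (K + 3 * r + 4 + 4 / ν) * (w : ℝ) ^ 2 := by positivity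
    by_contra hcon
    have : c₀ * (N : ℝ) ≤ 0 := mul_nonpos_of_nonneg_of_nonpos hc₀.le (by linarith)
    linarith
  have hne : Nonempty ι := by
    by_contra hcon
    rw [not_nonempty_iff] at hcon
    have : N = 0 := by simp [hNdef]
    rw [this] at hNpos
    simp at hNpos
  obtain ⟨i₀⟩ := hne
  set cs : R.ConnectedComponent := R.connectedComponentMk i₀
  set s : Finset R.ConnectedComponent := univ.erase cs
  have hcard : #s ≤ r :=
    ((card_le_univ s).trans (Fintype.card_le_of_surjective R.connectedComponentMk
      Quot.mk_surjective)).trans hr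
  have hcard' : (#s : ℝ) ≤ r := by exact_mod_cast hcard
  set capC : R.ConnectedComponent → ℕ := fun c => ∑ j ∈ univ.filter (· ∈ c.supp), cap j with hcapC
  have hcapsum : ∑ c, capC c = N := by
    rw [hNdef, ← sum_fiberwise univ R.connectedComponentMk]
    refine sum_congr rfl fun c _ => sum_congr (filter_congr fun j _ => ?_) fun _ _ => rfl
    exact SimpleGraph.ConnectedComponent.mem_supp_iff _ _
  have hcapc : ∀ c, c₀ * N ≤ capC c := by
    intro c
    obtain ⟨j, rfl⟩ := c.exists_rep
    refine (hc j).trans ?_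
    have : cap j ≤ capC (R.connectedComponentMk j) :=
      single_le_sum (f := cap) (fun _ _ => Nat.zero_le _) (by simp)
    exact_mod_cast this
  have hFw : N ≤ #F * w := by rw [hcap]; exact card_biUnion_id_le hw
  have hF3 : #s * (3 * w) ≤ #F := by
    have h1 : (3 : ℝ) * r * w ^ 2 ≤ #F * w := hN3.trans (by exact_mod_cast hFw)
    have h2 : 3 * r * w ≤ #F := by
      have : (3 * r * w * w : ℕ) ≤ #F * w := by
        have h3 : ((3 * r * w * w : ℕ) : ℝ) ≤ ((#F * w : ℕ) : ℝ) := by push_cast; linarith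
        exact_mod_cast h3
      exact Nat.le_of_mul_le_mul_right this hw1
    refine le_trans ?_ h2
    calc #s * (3 * w) ≤ r * (3 * w) := Nat.mul_le_mul_right _ hcard
      _ = 3 * r * w := by ring
  obtain ⟨Fs, hFs, hFsd⟩ := exists_subfamilies s F (3 * w) hF3
  have hFsub : ∀ c ∈ s, Fs c ⊆ F := fun c hc => (hFs c hc).1
  have hgad : ∀ c, ∃ b : ℤ, c ∈ s → ∀ x : ℤ, 0 ≤ x → x < (3 * w : ℕ) →
      ∃ E ⊆ (Fs c).biUnion id, Clsd H E ∧ (#E : ℤ) = b + x := by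
    intro c
    by_cases hcs : c ∈ s
    · obtain ⟨b, hb⟩ := split_gadget (H := H) (F := Fs c) (L := 3 * w)
        (hd.subset (coe_subset.2 (hFsub c hcs))) (by omega)
        (fun T hT => by have := hw T (hFsub c hcs hT); omega) (hFs c hcs).2.ge
        (fun T hT => hsplit T (hFsub c hcs hT))
      exact ⟨b, fun _ => hb⟩
    · exact ⟨0, fun h => absurd h hcs⟩
  choose b hb using hgad
  have hFsc : ∀ c ∈ s, (#((Fs c).biUnion id) : ℝ) ≤ 3 * w ^ 2 := by
    intro c hcs
    have h1 := card_biUnion_id_le (F := Fs c) fun T hT => hw T (hFsub c hcs hT)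
    rw [(hFs c hcs).2] at h1
    have h2 : (#((Fs c).biUnion id) : ℝ) ≤ ((3 * w * w : ℕ) : ℝ) := Nat.cast_le.2 h1
    push_cast at h2
    linarith
  have hb0 : ∀ c ∈ s, (0 : ℝ) ≤ b c ∧ (b c : ℝ) ≤ 3 * w ^ 2 := by
    intro c hcs
    obtain ⟨E, hE, -, hEb⟩ := hb c hcs 0 le_rfl (by push_cast; omega)
    have h1 : (#E : ℝ) = b c := by
      have : ((#E : ℤ) : ℝ) = ((b c + 0 : ℤ) : ℝ) := by rw [hEb]
      push_cast at this
      linarith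
    rw [← h1]
    exact ⟨by positivity, le_trans (Nat.cast_le.2 (card_le_card hE)) (hFsc c hcs)⟩
  set F0 := F \ s.biUnion Fs with hF0
  have hF0F : F0 ⊆ F := sdiff_subset
  have hd0 : (F0 : Set (Finset U)).PairwiseDisjoint id := hd.subset (coe_subset.2 hF0F)
  have hbsub : s.biUnion Fs ⊆ F := biUnion_subset.2 hFsub
  set mass : Finset U → ℝ := fun T => (#T : ℝ) with hmass
  have hmassd : ∀ A ⊆ F, ∑ T ∈ A, mass T = #(A.biUnion id) := by
    intro A hA
    rw [card_biUnion_id' (hd.subset (coe_subset.2 hA))]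
    push_cast
    rfl
  have hmass0 : ∑ T ∈ F0, mass T + ∑ c ∈ s, ∑ T ∈ Fs c, mass T = N := by
    rw [hcap, ← hmassd F Subset.rfl, ← sum_biUnion hFsd, hF0, sum_sdiff hbsub]
  have hmassF : ∑ c ∈ s, ∑ T ∈ Fs c, mass T ≤ 3 * r * w ^ 2 := by
    calc ∑ c ∈ s, ∑ T ∈ Fs c, mass T ≤ ∑ c ∈ s, 3 * (w : ℝ) ^ 2 := by
          refine sum_le_sum fun c hcs => ?_
          rw [hmassd _ (hFsub c hcs)]
          exact hFsc c hcs
      _ = #s * (3 * w ^ 2) := by simp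
      _ ≤ r * (3 * w ^ 2) := mul_le_mul_of_nonneg_right hcard' (by positivity)
      _ = 3 * r * w ^ 2 := by ring
  set g : Finset U → ℝ := fun T => #(T.filter fun x => col x = 0) - (α + ν / 4) * #T with hg
  have hgsum : ∀ A ⊆ F, ∑ T ∈ A, g T =
      #((A.biUnion id).filter fun x => col x = 0) - (α + ν / 4) * #(A.biUnion id) := by
    intro A hA
    rw [hg, sum_sub_distrib, ← mul_sum, card_biUnion_id (hd.subset (coe_subset.2 hA)),
      ← hmassd A hA]
    push_cast
    rfl
  have hF0g : ∑ T ∈ F0, g T ≤ w := by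
    rw [hgsum F0 hF0F, ← hmassd F0 hF0F]
    have h1 : (#((F0.biUnion id).filter fun x => col x = 0) : ℝ) ≤
        #((F.biUnion id).filter fun x => col x = 0) :=
      Nat.cast_le.2 (card_le_card (filter_subset_filter _ (biUnion_subset_biUnion_of_subset_left _ hF0F)))
    rw [← hcap] at h0
    have h2 : (α + ν / 4) * (N - 3 * r * w ^ 2) ≤ (α + ν / 4) * ∑ T ∈ F0, mass T :=
      mul_le_mul_of_nonneg_left (by linarith) (by linarith)
    have h3 : (α + ν / 4) * (3 * r * w ^ 2) ≤ 1 * (3 * r * w ^ 2) :=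
      mul_le_mul_of_nonneg_right (by linarith) (by positivity)
    linarith
  have hmw : ∀ T ∈ F0, mass T ≤ w := fun T hT => Nat.cast_le.2 (hw T (hF0F hT))
  have hgw : ∀ T ∈ F0, |g T| ≤ w := by
    intro T hT
    have h1 : (#(T.filter fun x => col x = 0) : ℝ) ≤ #T :=
      Nat.cast_le.2 (card_le_card (filter_subset _ _))
    have h2 := hmw T hT
    have h3 : (α + ν / 4) * (#T : ℝ) ≤ 1 * #T :=
      mul_le_mul_of_nonneg_right (by linarith) (by positivity)
    have h4 : 0 ≤ (α + ν / 4) * (#T : ℝ) := by positivity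
    have h5 : (0 : ℝ) ≤ #(T.filter fun x => col x = 0) := by positivity
    rw [abs_le]
    simp only [hmass] at h2
    constructor <;> simp only [hg] <;> linarith
  have hwc : ∀ c, (K + 3 * r + 4 + 4 / ν) * w ^ 2 ≤ capC c := fun c => hN1.trans (hcapc c)
  obtain ⟨B, hB, hBd, hBg⟩ := split_blocks s F0 g mass (fun c => capC c - b c - w)
    (by positivity : (0 : ℝ) ≤ w) hmw hgw hF0g
    (by
      intro c hcs
      have h1 := (hb0 c hcs).2
      have h2 := hwc c
      linarith)
    (by
      have h1 : ∑ c ∈ s, ((capC c : ℝ) - b c - w + w) ≤ ∑ c ∈ s, (capC c : ℝ) :=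
        sum_le_sum fun c hcs => by have := (hb0 c hcs).1; linarith
      have h2 : (capC cs : ℝ) + ∑ c ∈ s, (capC c : ℝ) = N := by
        have : capC cs + ∑ c ∈ s, capC c = N := by
          rw [← hcapsum]; exact add_sum_erase _ _ (mem_univ _)
        exact_mod_cast this
      have h3 := hwc cs
      linarith)
  have hBF : ∀ c ∈ s, B c ⊆ F := fun c hcs => (hB c hcs).1.trans hF0F
  have hE : ∀ c, ∃ E : Finset U, c ∈ s → E ⊆ (Fs c).biUnion id ∧ Clsd H E ∧
      #((B c).biUnion id) + #E = capC c := by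
    intro c
    by_cases hcs : c ∈ s
    · obtain ⟨h1, h2, h3, -⟩ := hB c hcs
      rw [hmassd _ (hBF c hcs)] at h2 h3
      have h2' : (capC c : ℤ) - b c - w ≤ #((B c).biUnion id) := by exact_mod_cast h2
      have h3' : (#((B c).biUnion id) : ℤ) ≤ (capC c : ℤ) - b c - w + w := by exact_mod_cast h3
      obtain ⟨E, hE1, hE2, hE3⟩ := hb c hcs (capC c - b c - #((B c).biUnion id)) (by linarith)
        (by push_cast; linarith)
      exact ⟨E, fun _ => ⟨hE1, hE2, by omega⟩⟩
    · exact ⟨∅, fun h => absurd h hcs⟩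
  choose E hE using hE
  set P : R.ConnectedComponent → Finset U := fun c => (B c).biUnion id ∪ E c with hP
  have hFsB : ∀ c ∈ s, ∀ c' ∈ s, Disjoint (B c) (Fs c') := by
    intro c hcs c' hcs'
    refine disjoint_of_subset_left (hB c hcs).1 ?_
    exact disjoint_of_subset_right (subset_biUnion_of_mem Fs hcs') sdiff_disjoint
  have hclA : ∀ A ⊆ F, Clsd H (A.biUnion id) := fun A hA =>
    Clsd.biUnion fun T hT => hcl T (hA hT)
  have hPF : ∀ c ∈ s, P c ⊆ (B c ∪ Fs c).biUnion id := by
    intro c hcs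
    rw [hP, union_biUnion]
    exact union_subset_union Subset.rfl (hE c hcs).1
  have hQd : ∀ c ∈ s, ∀ c' ∈ s, c ≠ c' → Disjoint (B c ∪ Fs c) (B c' ∪ Fs c') := by
    intro c hcs c' hcs' hcc
    rw [disjoint_union_left, disjoint_union_right, disjoint_union_right]
    exact ⟨⟨hBd hcs hcs' hcc, hFsB c hcs c' hcs'⟩, (hFsB c' hcs' c hcs).symm, hFsd hcs hcs' hcc⟩
  have hPd : (s : Set R.ConnectedComponent).PairwiseDisjoint P := by
    intro c hcs c' hcs' hcc
    exact disjoint_of_subset_left (hPF c hcs) (disjoint_of_subset_right (hPF c' hcs')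
      (disjoint_biUnion_id hd (union_subset (hBF c hcs) (hFsub c hcs))
        (union_subset (hBF c' hcs') (hFsub c' hcs')) (hQd c hcs c' hcs' hcc)))
  have hBE : ∀ c ∈ s, Disjoint ((B c).biUnion id) (E c) := fun c hcs =>
    disjoint_of_subset_right (hE c hcs).1
      (disjoint_biUnion_id hd (hBF c hcs) (hFsub c hcs) (hFsB c hcs c hcs))
  have hPcl : ∀ c ∈ s, Clsd H (P c) := fun c hcs => (hclA _ (hBF c hcs)).union (hE c hcs).2.1
  have hPF' : s.biUnion P ⊆ F.biUnion id := biUnion_subset.2 fun c hcs =>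
    (hPF c hcs).trans (biUnion_subset_biUnion_of_subset_left _
      (union_subset (hBF c hcs) (hFsub c hcs)))
  have app : ∀ c, ∀ A ⊆ F, ∀ J, Clsd H J → Disjoint (A.biUnion id) J →
      (#J : ℝ) ≤ 3 * r * w ^ 2 → #(A.biUnion id) + #J = capC c → ∑ T ∈ A, g T ≤ 2 * w →
      Ach H R (A.biUnion id ∪ J) (fun j => if j ∈ c.supp then (cap j : ℤ) else 0) := by
    intro c A hA J hJ hAJ hJc hAc hAg
    have h2 := hwc c
    have h3 : (capC c : ℝ) = #(A.biUnion id) + #J := by rw [← hAc]; push_cast; rfl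
    refine h H R c col A J cap w (α + ν / 2) β hr hcol hprop (hd.subset (coe_subset.2 hA))
      (fun T hT => hcl T (hA hT)) (fun T hT => hw T (hA hT)) (fun T hT => hflex T (hA hT)) hJ hAJ
      hw1 (by positivity) hβ (by linarith) hJc hAc.symm hc hnon ?_ ?_
    · rw [hgsum A hA] at hAg
      have h4 : 4 / ν * (w : ℝ) ^ 2 ≤ #(A.biUnion id) := by linarith
      have h5 : ν / 4 * (4 / ν * (w : ℝ) ^ 2) ≤ ν / 4 * #(A.biUnion id) :=
        mul_le_mul_of_nonneg_left h4 (by positivity)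
      have h6 : ν / 4 * (4 / ν * (w : ℝ) ^ 2) = w ^ 2 := by field_simp
      linarith
    · have h4 : K * (w : ℝ) ^ 2 ≤ capC c := by linarith
      exact h4
  have hmain : Ach H R (s.biUnion P)
      (fun j => ∑ c ∈ s, if j ∈ c.supp then (cap j : ℤ) else 0) := by
    have : Nonempty ι := ⟨i₀⟩
    refine Ach.biUnion (v := fun c j => if j ∈ c.supp then (cap j : ℤ) else 0) hPcl hPd ?_
    intro c hcs
    refine app c (B c) (hBF c hcs) (E c) (hE c hcs).2.1 (hBE c hcs) ?_ (hE c hcs).2.2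
      (hB c hcs).2.2.2
    have h1 : (#(E c) : ℝ) ≤ #((Fs c).biUnion id) := Nat.cast_le.2 (card_le_card (hE c hcs).1)
    have h2 : (1 : ℝ) ≤ r := by
      have : 1 ≤ #s := card_pos.2 ⟨c, hcs⟩
      exact_mod_cast this.trans hcard
    have h3 : 3 * (1 : ℝ) * w ^ 2 ≤ 3 * r * w ^ 2 := by
      refine mul_le_mul_of_nonneg_right (by linarith) (by positivity)
    linarith [hFsc c hcs]
  set A := F0 \ s.biUnion B with hA
  have hAF : A ⊆ F := sdiff_subset.trans hF0F
  set J := (F.biUnion id \ s.biUnion P) \ A.biUnion id with hJ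
  have hAQ : ∀ c ∈ s, Disjoint A (B c ∪ Fs c) := by
    intro c hcs
    rw [disjoint_union_right]
    exact ⟨disjoint_of_subset_right (subset_biUnion_of_mem B hcs) sdiff_disjoint,
      disjoint_of_subset_left sdiff_subset
        (disjoint_of_subset_right (subset_biUnion_of_mem Fs hcs) sdiff_disjoint)⟩
  have hAP : Disjoint (A.biUnion id) (s.biUnion P) := by
    rw [disjoint_biUnion_right]
    intro c hcs
    exact disjoint_of_subset_right (hPF c hcs) (disjoint_biUnion_id hd hAF
      (union_subset (hBF c hcs) (hFsub c hcs)) (hAQ c hcs))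
  have hAJ : A.biUnion id ∪ J = F.biUnion id \ s.biUnion P := by
    rw [hJ, union_sdiff_of_subset]
    intro x hx
    rw [mem_sdiff]
    exact ⟨biUnion_subset_biUnion_of_subset_left _ hAF hx, disjoint_left.1 hAP hx⟩
  have hJF : J ⊆ s.biUnion fun c => (Fs c).biUnion id := by
    intro x hx
    rw [hJ, mem_sdiff, mem_sdiff, mem_biUnion] at hx
    obtain ⟨⟨⟨T, hT, hxT⟩, hxP⟩, hxA⟩ := hx
    by_cases hTF : T ∈ s.biUnion Fs
    · obtain ⟨c, hcs, hTc⟩ := mem_biUnion.1 hTF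
      exact mem_biUnion.2 ⟨c, hcs, mem_biUnion.2 ⟨T, hTc, hxT⟩⟩
    · exfalso
      by_cases hTB : T ∈ s.biUnion B
      · obtain ⟨c, hcs, hTc⟩ := mem_biUnion.1 hTB
        exact hxP (mem_biUnion.2 ⟨c, hcs, mem_union_left _ (mem_biUnion.2 ⟨T, hTc, hxT⟩)⟩)
      · exact hxA (mem_biUnion.2 ⟨T, mem_sdiff.2 ⟨mem_sdiff.2 ⟨hT, hTF⟩, hTB⟩, hxT⟩)
  have hJc : (#J : ℝ) ≤ 3 * r * w ^ 2 := by
    refine le_trans ?_ hmassF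
    have h1 : #J ≤ ∑ c ∈ s, #((Fs c).biUnion id) := (card_le_card hJF).trans card_biUnion_le
    calc (#J : ℝ) ≤ ((∑ c ∈ s, #((Fs c).biUnion id) : ℕ) : ℝ) := Nat.cast_le.2 h1
      _ = ∑ c ∈ s, ∑ T ∈ Fs c, mass T := by
        push_cast
        exact sum_congr rfl fun c hcs => (hmassd _ (hFsub c hcs)).symm
  have hPc : #(s.biUnion P) = ∑ c ∈ s, capC c := by
    rw [card_biUnion hPd]
    exact sum_congr rfl fun c hcs => (card_union_of_disjoint (hBE c hcs)).trans (hE c hcs).2.2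
  have hAJc : #(A.biUnion id) + #J = capC cs := by
    have h1 : #(A.biUnion id ∪ J) = #(A.biUnion id) + #J :=
      card_union_of_disjoint disjoint_sdiff
    have h2 := card_sdiff_add_card_eq_card hPF'
    have h3 : capC cs + ∑ c ∈ s, capC c = N := by
      rw [← hcapsum]; exact add_sum_erase _ _ (mem_univ _)
    rw [← hAJ] at h2
    omega
  have hstar := app cs A hAF J (((hclA F Subset.rfl).sdiff (Clsd.biUnion hPcl)).sdiff
    (hclA A hAF)) disjoint_sdiff hJc hAJc (by linarith)
  have hfin := Ach.union (Clsd.biUnion hPcl) (by rw [hAJ]; exact disjoint_sdiff) hmain hstar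
  rw [hAJ, union_sdiff_of_subset hPF'] at hfin
  refine hfin.congr fun j => ?_
  rw [add_comm, add_sum_erase univ (fun c => if j ∈ c.supp then (cap j : ℤ) else 0)
    (mem_univ cs)]
  simp [SimpleGraph.ConnectedComponent.mem_supp_iff]

lemma exact_alloc (p r : ℕ) {ν c₀ : ℝ} (hν : 0 < ν) (hc₀ : 0 < c₀) :
    ∃ K : ℝ, 0 < K ∧ ∀ {U ι : Type} [Fintype U] [Fintype ι] (H : SimpleGraph U)
      (R : SimpleGraph ι) (col : U → ℕ) (F : Finset (Finset U)) (cap : ι → ℕ)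
      (w : ℕ) (α β : ℝ), Fintype.card ι ≤ r → (∀ x, col x < p + 2) →
      (∀ x y, H.Adj x y → col x ≠ col y) → (F : Set (Finset U)).PairwiseDisjoint id →
      (∀ T ∈ F, Clsd H T) → (∀ T ∈ F, #T ≤ w) → (∀ T ∈ F, FlexTile H (p + 2) T) →
      (p = 0 → ∀ T ∈ F, SplitTile H T) → 1 ≤ w → 0 ≤ α → 0 ≤ β →
      α + (p + 1) * (β + ν) ≤ 1 →
      ∑ j, cap j = #(F.biUnion id) → (∀ j, c₀ * (∑ j, cap j : ℕ) ≤ cap j) →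
      (∀ i, (∑ j ∈ univ.filter (fun j => ¬ R.Adj i j), cap j : ℕ) ≤ β * (∑ j, cap j : ℕ)) →
      ((#((F.biUnion id).filter fun x => col x = 0) : ℝ) ≤ α * #(F.biUnion id)) →
      K * w ^ 2 ≤ (∑ j, cap j : ℕ) →
      Ach H R (F.biUnion id) (fun j => cap j) := by
  rcases Nat.eq_zero_or_pos p with rfl | hp
  · obtain ⟨K, hK, h⟩ := exact_alloc_two r hν hc₀
    refine ⟨K, hK, ?_⟩
    intro U ι _ _ H R col F cap w α β hr hcol hprop hd hcl hw hflex hsplit hw1 hα hβ hαβ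
      hcap hc hnon h0 hN
    exact h H R col F cap w α β hr hcol hprop hd hcl hw hflex (hsplit rfl) hw1 hα hβ
      (by push_cast at hαβ; linarith) hcap hc hnon h0 hN
  · obtain ⟨K, hK, h⟩ := exact_alloc_conn p r hν hc₀ le_rfl
    refine ⟨K, hK, ?_⟩
    intro U ι _ _ H R col F cap w α β hr hcol hprop hd hcl hw hflex hsplit hw1 hα hβ hαβ
      hcap hc hnon h0 hN
    have hNpos : (0 : ℝ) < (∑ j, cap j : ℕ) := by
      refine lt_of_lt_of_le ?_ hN
      have : (0 : ℝ) < w := by exact_mod_cast hw1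
      positivity
    have hne : Nonempty ι := by
      by_contra hcon
      rw [not_nonempty_iff] at hcon
      simp at hNpos
    have hp' : (1 : ℝ) ≤ p := by exact_mod_cast hp
    have hconn : R.Connected := by
      refine { preconnected := fun i j => ?_, nonempty := hne }
      obtain ⟨l, hl⟩ := exists_common_nbr (R := R)
        (t := fun j => (cap j : ℝ) / (∑ j, cap j : ℕ)) (fun j => by positivity)
        (by rw [← sum_div, div_eq_one_iff_eq hNpos.ne']; push_cast; rfl) (β := β)
        (fun i => by
          rw [← sum_div, div_le_iff₀ hNpos]
          have := hnon i
          push_cast at this ⊢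
          exact this) (n := 2)
        (by
          have : 1 * (β + ν) ≤ p * (β + ν) := mul_le_mul_of_nonneg_right hp' (by linarith)
          push_cast
          linarith) (fun l => if l = 0 then i else j)
      have h0 := hl 0 (by norm_num)
      have h1 := hl 1 (by norm_num)
      simp only [if_true] at h0
      rw [if_neg (by norm_num)] at h1
      exact h0.reachable.trans h1.symm.reachable
    have := h H R col F ∅ cap w α β hr hconn hcol hprop hd hcl hw hflex (by simp [Clsd]) (by simp)
      hw1 hα hβ hαβ (by simp) (by simpa using hcap) hc hnon
      (h0.trans (by have : (0 : ℝ) ≤ w := by positivity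
                    linarith)) hN
    simpa using this

end ExactAlloc

section Loads
open Finset
set_option linter.unusedSectionVars false

variable {U V ι : Type} [Fintype U] [Fintype V] [Fintype ι]

lemma clique_choice (p : ℕ) {R : SimpleGraph ι} {s : ι → ℝ} (hs : ∀ j, 0 ≤ s j) {n h θ : ℝ}
    (hn : 0 ≤ n) (hsn : ∑ j, s j ≤ n)
    (hR : ∀ i, h * n ≤ ∑ j ∈ univ.filter (fun j => R.Adj i j), s j)
    (hθ : p + θ ≤ (p + 1) * h) {Nb Bad : Finset ι} (hN : h * n ≤ ∑ j ∈ Nb, s j)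
    (hBad : ∑ j ∈ Bad, s j < θ * n) :
    ∃ σ : ℕ → ι, Clq R (p + 2) σ ∧ (∀ l < p + 2, σ l ∉ Bad) ∧ ∀ l < p + 1, σ l ∈ Nb := by
  set S := ∑ j, s j with hS
  have hne : Nonempty ι := by
    by_contra hcon
    rw [not_nonempty_iff] at hcon
    have h1 : θ * n ≤ 0 := by
      have h2 : h * n ≤ 0 := hN.trans (by rw [Finset.eq_empty_of_isEmpty Nb]; simp)
      have h3 := mul_le_mul_of_nonneg_right hθ hn
      have h4 : 0 ≤ (p : ℝ) * n := by positivity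
      have h5 : ((p : ℝ) + 1) * h * n ≤ 0 := by
        rw [mul_assoc]
        exact mul_nonpos_of_nonneg_of_nonpos (by positivity) h2
      linarith
    rw [Finset.eq_empty_of_isEmpty Bad] at hBad
    simp at hBad
    linarith
  have key : ∀ t ≤ p + 2, ∃ σ : ℕ → ι, Clq R t σ ∧ (∀ l < t, σ l ∉ Bad) ∧
      ∀ l < t, l < p + 1 → σ l ∈ Nb := by
    intro t
    induction t with
    | zero => exact fun _ => ⟨fun _ => hne.some, fun a ha => absurd ha (by omega), by simp, by simp⟩
    | succ t ih =>
      intro ht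
      obtain ⟨σ, h1, h2, h3⟩ := ih (by omega)
      have hco : ∀ P : ι → Prop, h * n ≤ ∑ j ∈ univ.filter P, s j →
          ∑ j ∈ univ.filter (fun j => ¬ P j), s j ≤ S - h * n := by
        intro P hP
        have := sum_filter_add_sum_filter_not univ P s
        linarith
      set E : Finset ι := if t < p + 1 then univ.filter (· ∉ Nb) else ∅ with hE
      set W : Finset ι := ((range t).biUnion fun l => univ.filter fun j => ¬ R.Adj (σ l) j) ∪
        E ∪ Bad with hW
      have hSn : 0 ≤ S - h * n := by
        have : ∑ j ∈ Nb, s j ≤ S := sum_le_sum_of_subset_of_nonneg (subset_univ _) fun j _ _ => hs j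
        linarith
      have hun : ∀ A B : Finset ι, ∑ j ∈ A ∪ B, s j ≤ ∑ j ∈ A, s j + ∑ j ∈ B, s j := by
        intro A B
        rw [← sum_union_inter]
        linarith [sum_nonneg fun j (_ : j ∈ A ∩ B) => hs j]
      have hWm : ∑ j ∈ W, s j < S := by
        have e1 : ∑ j ∈ (range t).biUnion fun l => univ.filter fun j => ¬ R.Adj (σ l) j, s j ≤
            t * (S - h * n) := by
          refine (sum_biUnion_le_sum _ _ hs).trans ?_
          calc _ ≤ ∑ l ∈ range t, (S - h * n) := sum_le_sum fun l _ => hco _ (hR _)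
            _ = _ := by rw [sum_const, card_range, nsmul_eq_mul]
        have e2 : t * (S - h * n) + ∑ j ∈ E, s j ≤ (p + 1) * (S - h * n) := by
          by_cases htp : t < p + 1
          · rw [hE, if_pos htp]
            have : ∑ j ∈ univ.filter (· ∉ Nb), s j ≤ S - h * n := by
              have := hco (· ∈ Nb) (by simpa using hN)
              convert this
            have h4 : ((t : ℝ) + 1) * (S - h * n) ≤ (p + 1) * (S - h * n) :=
              mul_le_mul_of_nonneg_right (by exact_mod_cast htp) hSn
            linarith
          · rw [hE, if_neg htp, sum_empty, add_zero]
            exact mul_le_mul_of_nonneg_right (by exact_mod_cast (by omega : t ≤ p + 1)) hSn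
        have e3 := hun (((range t).biUnion fun l => univ.filter fun j => ¬ R.Adj (σ l) j) ∪ E) Bad
        have e4 := hun ((range t).biUnion fun l => univ.filter fun j => ¬ R.Adj (σ l) j) E
        have e5 := mul_le_mul_of_nonneg_right hθ hn
        have e6 : (p : ℝ) * S ≤ p * n := mul_le_mul_of_nonneg_left hsn (by positivity)
        linarith
      obtain ⟨j, hj⟩ : ∃ j, j ∉ W := by
        by_contra! hcon
        rw [eq_univ_iff_forall.2 hcon] at hWm
        exact lt_irrefl _ hWm
      rw [hW, mem_union, mem_union, mem_biUnion] at hj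
      push Not at hj
      obtain ⟨⟨hj1, hj2⟩, hj3⟩ := hj
      have hadj : ∀ l < t, R.Adj (σ l) j := by
        intro l hl
        by_contra hcon
        exact hj1 l (mem_range.2 hl) (by simpa using hcon)
      refine ⟨Function.update σ t j, ?_, ?_, ?_⟩
      · intro a ha b hb hab
        rcases Nat.lt_succ_iff_lt_or_eq.1 ha with ha' | rfl <;>
          rcases Nat.lt_succ_iff_lt_or_eq.1 hb with hb' | rfl
        · rw [Function.update_of_ne ha'.ne, Function.update_of_ne hb'.ne]
          exact h1 a ha' b hb' hab
        · rw [Function.update_of_ne ha'.ne, Function.update_self]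
          exact hadj a ha'
        · rw [Function.update_of_ne hb'.ne, Function.update_self]
          exact (hadj b hb').symm
        · exact absurd rfl hab
      · intro l hl
        rcases Nat.lt_succ_iff_lt_or_eq.1 hl with hl' | rfl
        · rw [Function.update_of_ne hl'.ne]; exact h2 l hl'
        · rw [Function.update_self]; exact hj3
      · intro l hl hlp
        rcases Nat.lt_succ_iff_lt_or_eq.1 hl with hl' | rfl
        · rw [Function.update_of_ne hl'.ne]; exact h3 l hl' hlp
        · rw [Function.update_self]
          rw [hE, if_pos hlp] at hj2
          simpa using hj2
  obtain ⟨σ, h1, h2, h3⟩ := key (p + 2) le_rfl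
  exact ⟨σ, h1, h2, fun l hl => h3 l (by omega) hl⟩

lemma clique_loads {α : Type} [Nonempty ι] (p : ℕ) {R : SimpleGraph ι} {s : ι → ℝ} (hs : ∀ j, 0 ≤ s j)
    {n h θ B : ℝ} (hsB : ∀ j, s j ≤ B) (hB : 0 ≤ B)
    (hn : 0 ≤ n) (hsn : ∑ j, s j ≤ n)
    (hR : ∀ i, h * n ≤ ∑ j ∈ univ.filter (fun j => R.Adj i j), s j)
    (hθ : p + θ ≤ (p + 1) * h) (S : Finset α) {Nb : α → Finset ι}
    (hN : ∀ a ∈ S, h * n ≤ ∑ j ∈ Nb a, s j) {Cap : ℕ}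
    (hCap : (p + 2) * #S * B < Cap * (θ * n)) :
    ∃ σ : α → ℕ → ι, (∀ a ∈ S, Clq R (p + 2) (σ a) ∧ ∀ l < p + 1, σ a l ∈ Nb a) ∧
      ∀ j, #(S.filter fun a => ∃ l < p + 2, σ a l = j) ≤ Cap := by
  induction S using Finset.induction_on with
  | empty => exact ⟨fun _ _ => Classical.arbitrary ι, by simp, by simp⟩
  | insert a S ha ih =>
    rw [card_insert_of_notMem ha] at hCap
    push_cast at hCap
    have hCap' : (p + 2) * #S * B < Cap * (θ * n) := by
      have : 0 ≤ ((p : ℝ) + 2) * B := by positivity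
      linarith
    obtain ⟨σ, h1, h2⟩ := ih (fun a ha => hN a (mem_insert_of_mem ha)) hCap'
    set load : ι → ℕ := fun j => #(S.filter fun a => ∃ l < p + 2, σ a l = j) with hload
    set Bad : Finset ι := univ.filter fun j => Cap ≤ load j with hBad
    have hl1 : ∑ j, load j ≤ (p + 2) * #S := by
      have e1 : ∑ j, load j = ∑ a ∈ S, #(univ.filter fun j => ∃ l < p + 2, σ a l = j) := by
        simp only [hload, card_filter]
        exact sum_comm
      rw [e1, mul_comm, ← smul_eq_mul]
      refine sum_le_card_nsmul _ _ _ fun a _ => ?_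
      have : (univ.filter fun j => ∃ l < p + 2, σ a l = j) ⊆ (range (p + 2)).image (σ a) := by
        intro j hj
        obtain ⟨l, hl, rfl⟩ := (mem_filter.1 hj).2
        exact mem_image_of_mem _ (mem_range.2 hl)
      exact (card_le_card this).trans (card_image_le.trans (by simp))
    have hl2 : Cap * #Bad ≤ (p + 2) * #S := by
      refine le_trans ?_ hl1
      rw [mul_comm, ← smul_eq_mul]
      exact (card_nsmul_le_sum Bad _ _ fun j hj => (mem_filter.1 hj).2).trans
        (sum_le_sum_of_subset (subset_univ _))
    have hBm : ∑ j ∈ Bad, s j < θ * n := by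
      have e1 : ∑ j ∈ Bad, s j ≤ #Bad * B := by
        calc _ ≤ ∑ j ∈ Bad, B := sum_le_sum fun j _ => hsB j
          _ = _ := by rw [sum_const, nsmul_eq_mul]
      have e2 : ((Cap * #Bad : ℕ) : ℝ) ≤ (((p + 2) * #S : ℕ) : ℝ) := Nat.cast_le.2 hl2
      push_cast at e2
      by_contra! hcon
      have e3 := mul_le_mul_of_nonneg_left (hcon.trans e1) (Nat.cast_nonneg (α := ℝ) Cap)
      have e4 := mul_le_mul_of_nonneg_right e2 hB
      linarith
    obtain ⟨τ, h3, h4, h5⟩ := clique_choice p hs hn hsn hR hθ (hN a (mem_insert_self _ _)) hBm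
    have hupd : ∀ b ∈ S, Function.update σ a τ b = σ b := fun b hb =>
      Function.update_of_ne (by rintro rfl; exact ha hb) _ _
    refine ⟨Function.update σ a τ, ?_, ?_⟩
    · intro b hb
      rcases mem_insert.1 hb with rfl | hb
      · rw [Function.update_self]; exact ⟨h3, h5⟩
      · rw [hupd b hb]; exact h1 b hb
    · intro j
      have e1 : (S.filter fun b => ∃ l < p + 2, Function.update σ a τ b l = j) =
          S.filter fun b => ∃ l < p + 2, σ b l = j :=
        filter_congr fun b hb => by rw [hupd b hb]
      rw [filter_insert, e1, Function.update_self]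
      split_ifs with hj
      · obtain ⟨l, hl, rfl⟩ := hj
        have := h4 l hl
        rw [hBad, mem_filter, not_and, not_le] at this
        exact (card_insert_le _ _).trans (this (mem_univ _))
      · exact h2 j

end Loads

section RegularityOutput
open Finset
set_option linter.unusedSectionVars false

variable {U V ι : Type} [Fintype U] [Fintype V] [Fintype ι]

lemma sum_nb_inter (G : SimpleGraph V) (S Y : Finset V) :
    ∑ x ∈ S, (#(nb G x ∩ Y) : ℝ) = (G.edgeDensity S Y : ℝ) * (#S * #Y) := by
  have h1 : #(G.interedges S Y) = ∑ x ∈ S, #(nb G x ∩ Y) := by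
    rw [SimpleGraph.interedges_def, card_filter, sum_product]
    refine sum_congr rfl fun x _ => ?_
    rw [← card_filter]
    congr 1
    ext v
    simp [and_comm]
  have h2 : ((#(G.interedges S Y) : ℕ) : ℝ) = ∑ x ∈ S, (#(nb G x ∩ Y) : ℝ) := by
    rw [h1]; push_cast; rfl
  rw [← h2, SimpleGraph.edgeDensity_def]
  push_cast
  by_cases h : ((#S : ℝ) * #Y) = 0
  · rw [h, mul_zero]
    have : #(G.interedges S Y) ≤ #S * #Y := G.card_interedges_le_mul S Y
    have h3 : #S * #Y = 0 := by exact_mod_cast h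
    rw [h3] at this
    simp only [Nat.le_zero] at this
    exact_mod_cast this
  · rw [div_mul_cancel₀ _ h]

lemma card_irregular_le {G : SimpleGraph V} {S T : Finset V} {ε ε₁ m : ℝ}
    (hu : G.IsUniform ε₁ S T) (hε₁ : 0 < ε₁) (h : 4 * ε₁ ≤ ε) (hm : 0 < m)
    (hS0 : (0 : ℝ) < #S) (hS : (#S : ℝ) ≤ 2 * m) (hT : (#T : ℝ) ≤ 2 * m) {Y : Finset V}
    (hY : Y ⊆ T) :
    (#(S.filter fun x => ε * m < |(#(nb G x ∩ Y) : ℝ) - (G.edgeDensity S T : ℝ) * #Y|) : ℝ)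
      ≤ ε * m := by
  have hD0 : (0 : ℝ) ≤ G.edgeDensity S T := by exact_mod_cast G.edgeDensity_nonneg S T
  have hD1 : (G.edgeDensity S T : ℝ) ≤ 1 := by exact_mod_cast G.edgeDensity_le_one S T
  set D : ℝ := (G.edgeDensity S T : ℝ) with hD
  have hεm : 4 * (ε₁ * m) ≤ ε * m := by
    have := mul_le_mul_of_nonneg_right h hm.le
    linarith
  have hε₁m : 0 < ε₁ * m := mul_pos hε₁ hm
  have hT' : (#T : ℝ) * ε₁ ≤ 2 * (ε₁ * m) := by
    have := mul_le_mul_of_nonneg_right hT hε₁.le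
    linarith
  have hS' : (#S : ℝ) * ε₁ ≤ 2 * (ε₁ * m) := by
    have := mul_le_mul_of_nonneg_right hS hε₁.le
    linarith
  by_cases hYs : (#Y : ℝ) < #T * ε₁
  · rw [filter_eq_empty_iff.2]
    · simp only [card_empty, Nat.cast_zero]; linarith
    intro x _
    rw [not_lt, abs_le]
    have h1 : (#(nb G x ∩ Y) : ℝ) ≤ #Y := Nat.cast_le.2 (card_le_card inter_subset_right)
    have h0 : (0 : ℝ) ≤ #(nb G x ∩ Y) := Nat.cast_nonneg _
    have h2 : D * #Y ≤ #Y := mul_le_of_le_one_left (Nat.cast_nonneg _) hD1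
    have h3 : 0 ≤ D * #Y := mul_nonneg hD0 (Nat.cast_nonneg _)
    constructor <;> linarith
  push Not at hYs
  have hYT : (#Y : ℝ) ≤ #T := Nat.cast_le.2 (card_le_card hY)
  have hside : ∀ P ⊆ S, (#S : ℝ) * ε₁ ≤ #P →
      |∑ x ∈ P, (#(nb G x ∩ Y) : ℝ) - D * (#P * #Y)| ≤ ε₁ * (#P * #Y) := by
    intro P hP hPc
    rw [sum_nb_inter, ← sub_mul, abs_mul, abs_of_nonneg (by positivity : (0 : ℝ) ≤ #P * #Y)]
    exact mul_le_mul_of_nonneg_right (hu hP hY hPc hYs).le (by positivity)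
  have hfin : ∀ P ⊆ S, (∀ x ∈ P, ε * m < (#(nb G x ∩ Y) : ℝ) - D * #Y) ∨
      (∀ x ∈ P, ε * m < -((#(nb G x ∩ Y) : ℝ) - D * #Y)) → (#P : ℝ) < #S * ε₁ := by
    intro P hP hPx
    by_contra hcon
    push Not at hcon
    have hP0 : (0 : ℝ) < #P := lt_of_lt_of_le (mul_pos hS0 hε₁) hcon
    have h1 := abs_le.1 (hside P hP hcon)
    have h2 : ∑ x ∈ P, (#(nb G x ∩ Y) : ℝ) - D * (#P * #Y)
        = ∑ x ∈ P, ((#(nb G x ∩ Y) : ℝ) - D * #Y) := by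
      rw [sum_sub_distrib, sum_const, nsmul_eq_mul]; ring
    have h3 : ε₁ * (#P * #Y) ≤ #P * (2 * (ε₁ * m)) := by
      have : ε₁ * #P * #Y ≤ ε₁ * #P * (2 * m) :=
        mul_le_mul_of_nonneg_left (hYT.trans hT) (by positivity)
      linarith
    have h4 : (#P : ℝ) * (2 * (ε₁ * m)) < #P * (ε * m) :=
      mul_lt_mul_of_pos_left (by linarith) hP0
    rcases hPx with hPx | hPx
    · have h5 := card_nsmul_le_sum P _ _ (fun x hx => (hPx x hx).le)
      rw [nsmul_eq_mul, ← h2] at h5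
      linarith [h1.2]
    · have h5 := card_nsmul_le_sum P _ _ (fun x hx => (hPx x hx).le)
      rw [nsmul_eq_mul, sum_neg_distrib, ← h2] at h5
      linarith [h1.1]
  have hA := hfin (S.filter fun x => ε * m < (#(nb G x ∩ Y) : ℝ) - D * #Y) (filter_subset _ _)
    (Or.inl fun x hx => (mem_filter.1 hx).2)
  have hB := hfin (S.filter fun x => ε * m < -((#(nb G x ∩ Y) : ℝ) - D * #Y)) (filter_subset _ _)
    (Or.inr fun x hx => (mem_filter.1 hx).2)
  have hU : #(S.filter fun x => ε * m < |(#(nb G x ∩ Y) : ℝ) - D * #Y|) ≤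
      #(S.filter fun x => ε * m < (#(nb G x ∩ Y) : ℝ) - D * #Y) +
      #(S.filter fun x => ε * m < -((#(nb G x ∩ Y) : ℝ) - D * #Y)) := by
    refine (card_le_card ?_).trans (card_union_le _ _)
    intro x hx
    rw [mem_filter] at hx
    rw [mem_union, mem_filter, mem_filter]
    rcases lt_abs.1 hx.2 with h | h
    · exact Or.inl ⟨hx.1, h⟩
    · exact Or.inr ⟨hx.1, h⟩
  have hU' : (#(S.filter fun x => ε * m < |(#(nb G x ∩ Y) : ℝ) - D * #Y|) : ℝ) ≤
      (#(S.filter fun x => ε * m < (#(nb G x ∩ Y) : ℝ) - D * #Y) : ℝ) +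
      #(S.filter fun x => ε * m < -((#(nb G x ∩ Y) : ℝ) - D * #Y)) := by exact_mod_cast hU
  linarith

/-- The sum of part sizes in a partition into a set of parts chosen by a predicate. -/
lemma sum_subtype_filter {I : Finset (Finset V)} (p : Finset V → Prop) (f : Finset V → ℝ) :
    ∑ j ∈ univ.filter (fun j : I => p j.1), f j.1 = ∑ Q ∈ I.filter p, f Q := by
  rw [sum_filter, sum_filter, ← sum_coe_sort I]

end RegularityOutput

section RegularityOutput
open Finset
set_option linter.unusedSectionVars false

variable {U V ι : Type} [Fintype U] [Fintype V] [Fintype ι]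

lemma sum_card_nb_inter (G : SimpleGraph V) (P : Finpartition (univ : Finset V)) (x : V) :
    ∑ Q ∈ P.parts, (#(nb G x ∩ Q) : ℝ) = ndeg G x := by
  rw [ndeg_eq_card_nb]
  have h : nb G x = P.parts.biUnion fun Q => nb G x ∩ Q := by
    have hb : (P.parts.biUnion fun Q => Q) = univ := P.biUnion_parts
    rw [← inter_biUnion, hb, inter_univ]
  have hc := congrArg Finset.card h
  rw [card_biUnion] at hc
  · rw [hc]; push_cast; rfl
  · intro Q hQ Q' hQ' hne
    exact (P.disjoint hQ hQ' hne).mono inter_subset_right inter_subset_right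

lemma sum_card_parts (P : Finpartition (univ : Finset V)) :
    ∑ Q ∈ P.parts, (#Q : ℝ) = Fintype.card V := by
  have := P.sum_card_parts
  rw [card_univ] at this
  exact_mod_cast this

lemma sum_ite_card_le (P : Finpartition (univ : Finset V)) (p : Finset V → Prop)
    [DecidablePred p] {m : ℝ}
    (hP : ∀ Q ∈ P.parts, (#Q : ℝ) ≤ 2 * m) :
    ∑ Q ∈ P.parts, (if p Q then (#Q : ℝ) else 0) ≤ #(P.parts.filter p) * (2 * m) := by
  rw [← sum_filter, ← nsmul_eq_mul]
  exact sum_le_card_nsmul _ _ _ fun Q hQ => hP Q (mem_filter.1 hQ).1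

/-- Szemerédi's regularity lemma in the form of a reduced graph of large weighted degree. -/
lemma regularity_output {μ ε : ℝ} (hμ : 0 < μ) (hμ1 : μ ≤ 1) (hε : 0 < ε) (hεμ : ε ≤ μ / 8) :
    ∃ M : ℕ, 0 < M ∧ ∀ {V : Type} [Fintype V] (G : SimpleGraph V) (h : ℝ),
      2 * M ≤ Fintype.card V → (∀ v, (h + μ) * Fintype.card V ≤ ndeg G v) →
      ∃ (ι : Type) (_ : Fintype ι) (Cl : ι → Finset V) (R : SimpleGraph ι) (D : ι → ι → ℝ) (m : ℝ),
        Fintype.card ι ≤ M ∧ 0 < m ∧ Reg G Cl R D (μ / 8) ε m ∧ (Fintype.card V : ℝ) ≤ 2 * M * m ∧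
        (Fintype.card V : ℝ) - ∑ i, (#(Cl i) : ℝ) ≤ ε * Fintype.card V ∧
        (∀ i, (h + μ / 2) * Fintype.card V ≤
          ∑ j ∈ univ.filter (fun j => R.Adj i j), (#(Cl j) : ℝ)) ∧
        (∀ z, (h + μ / 2) * Fintype.card V ≤
          ∑ j ∈ univ.filter (fun j => μ / 8 * #(Cl j) ≤ (#(nb G z ∩ Cl j) : ℝ)), (#(Cl j) : ℝ)) := by
  set ε₁ : ℝ := ε * μ / 32 with hε₁d
  have hε₁ : 0 < ε₁ := by positivity
  set l : ℕ := ⌈32 / μ⌉₊ with hl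
  have hl32 : 32 / μ ≤ l := Nat.le_ceil _
  have hlpos : 0 < l := by
    have : (0 : ℝ) < l := lt_of_lt_of_le (by positivity) hl32
    exact_mod_cast this
  refine ⟨SzemerediRegularity.bound ε₁ l + l, by omega, ?_⟩
  set M := SzemerediRegularity.bound ε₁ l + l with hM
  intro V _ G h hcard hdeg
  obtain ⟨P, hPe, hlP, hPb, hPu⟩ := szemeredi_regularity G hε₁ (l := l) (by omega)
  set n : ℕ := Fintype.card V with hn
  set q : ℕ := #P.parts with hq
  have hqM : q ≤ M := by omega
  have hq0 : 0 < q := by omega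
  have hav1 : ∀ Q ∈ P.parts, n / q ≤ #Q := fun Q hQ => by
    have := hPe.average_le_card_part hQ
    rwa [card_univ] at this
  have hav2 : ∀ Q ∈ P.parts, #Q ≤ n / q + 1 := fun Q hQ => by
    have := hPe.card_part_le_average_add_one hQ
    rwa [card_univ] at this
  have hnq2 : 2 ≤ n / q := by
    rw [Nat.le_div_iff_mul_le hq0]
    have := Nat.mul_le_mul_left 2 hqM
    omega
  set m : ℝ := ((n / q : ℕ) : ℝ) with hm
  have hm2 : 2 ≤ m := by rw [hm]; exact_mod_cast hnq2
  have hlow : ∀ Q ∈ P.parts, m ≤ #Q := fun Q hQ => Nat.cast_le.2 (hav1 Q hQ)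
  have hup : ∀ Q ∈ P.parts, (#Q : ℝ) ≤ 2 * m := fun Q hQ => by
    have : (#Q : ℝ) ≤ ((n / q + 1 : ℕ) : ℝ) := Nat.cast_le.2 (hav2 Q hQ)
    push_cast at this
    linarith
  have hmq : m * q ≤ n := by
    rw [hm]
    exact_mod_cast Nat.div_mul_le_self n q
  have hnm : (n : ℝ) ≤ 2 * M * m := by
    have h1 : n < q * (n / q + 1) := Nat.lt_mul_div_succ n hq0
    have h2 : n ≤ M * (2 * (n / q)) :=
      h1.le.trans (Nat.mul_le_mul hqM (by omega))
    have h3 : (n : ℝ) ≤ ((M * (2 * (n / q)) : ℕ) : ℝ) := Nat.cast_le.2 h2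
    rw [Nat.cast_mul, Nat.cast_mul, ← hm] at h3
    push_cast at h3
    linarith
  have hmn : 2 * m ≤ μ / 16 * n := by
    have h1 : 32 / μ * m ≤ n := by
      have : 32 / μ * m ≤ q * m := mul_le_mul_of_nonneg_right
        (hl32.trans (Nat.cast_le.2 hlP)) (by linarith)
      linarith
    have h2 : 32 * m ≤ μ * n := by
      have := mul_le_mul_of_nonneg_left h1 hμ.le
      rw [← mul_assoc, mul_div_cancel₀ _ hμ.ne'] at this
      exact this
    linarith
  set nu : Finset V → Finset (Finset V) := fun S =>
    P.parts.filter fun Q => S ≠ Q ∧ ¬G.IsUniform ε₁ S Q with hnu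
  set I : Finset (Finset V) := P.parts.filter fun S => (#(nu S) : ℝ) ≤ μ / 16 * q with hI
  have hIP : I ⊆ P.parts := filter_subset _ _
  have hn0 : (0 : ℝ) ≤ n := Nat.cast_nonneg _
  have hbad : ∑ Q ∈ P.parts, (if Q ∉ I then (#Q : ℝ) else 0) ≤ ε * n := by
    refine (sum_ite_card_le P (fun Q => Q ∉ I) hup).trans ?_
    set bad := P.parts.filter fun Q => Q ∉ I with hbd
    have h1 : (#bad : ℝ) * (μ / 16 * q) ≤ q * q * ε₁ := by
      have h2 : (#bad : ℝ) * (μ / 16 * q) ≤ ∑ S ∈ bad, (#(nu S) : ℝ) := by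
        rw [← nsmul_eq_mul]
        refine card_nsmul_le_sum _ _ _ fun S hS => ?_
        rw [hbd, mem_filter, hI, mem_filter, not_and, not_le] at hS
        exact (hS.2 hS.1).le
      have h3 : ∑ S ∈ bad, #(nu S) ≤ #(P.nonUniforms G ε₁) := by
        rw [← card_sigma]
        refine card_le_card_of_injOn (fun a => (a.1, a.2)) ?_ ?_
        · rintro ⟨S, Q⟩ hSQ
          rw [mem_coe, mem_sigma] at hSQ
          have h4 := (mem_filter.1 hSQ.2)
          rw [mem_coe, Finpartition.mk_mem_nonUniforms]
          exact ⟨(mem_filter.1 hSQ.1).1, h4.1, h4.2⟩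
        · rintro ⟨S, Q⟩ _ ⟨S', Q'⟩ _ heq
          simp only [Prod.mk.injEq] at heq
          rw [heq.1, heq.2]
      have h4 : (#(P.nonUniforms G ε₁) : ℝ) ≤ q * q * ε₁ := by
        refine hPu.trans (mul_le_mul_of_nonneg_right ?_ hε₁.le)
        have : q * (q - 1) ≤ q * q := Nat.mul_le_mul_left _ (Nat.sub_le _ _)
        exact_mod_cast this
      have h3' : ∑ S ∈ bad, (#(nu S) : ℝ) ≤ (#(P.nonUniforms G ε₁) : ℝ) := by exact_mod_cast h3
      linarith
    have h5 : (#bad : ℝ) * (μ / 16) ≤ q * ε₁ := by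
      have hq0' : (0 : ℝ) < q := by exact_mod_cast hq0
      refine le_of_mul_le_mul_right ?_ hq0'
      linarith
    have h6 : (#bad : ℝ) * 2 ≤ q * ε := by
      refine le_of_mul_le_mul_right ?_ hμ
      rw [hε₁d] at h5
      linarith
    have h7 : (#bad : ℝ) * 2 * m ≤ q * ε * m := mul_le_mul_of_nonneg_right h6 (by linarith)
    have h8 : ε * (m * q) ≤ ε * n := mul_le_mul_of_nonneg_left hmq hε.le
    linarith
  have hbad' : ∑ Q ∈ P.parts, (if Q ∉ I then (#Q : ℝ) else 0) ≤ μ / 8 * n :=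
    hbad.trans (mul_le_mul_of_nonneg_right hεμ hn0)
  have hsplit : ∀ p : Finset V → Prop, ∑ Q ∈ P.parts, (if Q ∈ I ∧ p Q then (#Q : ℝ) else 0) =
      ∑ j ∈ univ.filter (fun j : I => p j.1), (#j.1 : ℝ) := by
    intro p
    rw [sum_subtype_filter p (fun Q => (#Q : ℝ)), ← sum_filter]
    congr 1
    ext Q
    simp only [mem_filter]
    exact ⟨fun hh => hh.2, fun hh => ⟨hIP hh.1, hh⟩⟩
  let R : SimpleGraph I :=
    { Adj := fun i j => i ≠ j ∧ G.IsUniform ε₁ i.1 j.1 ∧ μ / 8 ≤ (G.edgeDensity i.1 j.1 : ℝ)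
      symm := ⟨fun i j hh => ⟨hh.1.symm, hh.2.1.symm, by
        rw [G.edgeDensity_comm]; exact hh.2.2⟩⟩
      loopless := ⟨fun i hh => hh.1 rfl⟩ }
  refine ⟨I, inferInstance, fun i => i.1, R, fun i j => (G.edgeDensity i.1 j.1 : ℝ), m, ?_,
    by linarith, ?_, hnm, ?_, ?_, ?_⟩
  · rw [Fintype.card_coe]
    exact (card_le_card hIP).trans hqM
  · refine ⟨?_, ?_, ?_, ?_, ?_⟩
    · intro i j hij
      exact P.disjoint (hIP i.2) (hIP j.2) (fun hh => hij (Subtype.ext hh))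
    · intro i j hij
      exact ⟨hij.2.2, by exact_mod_cast G.edgeDensity_le_one i.1 j.1⟩
    · intro i j hij Y hY
      refine card_irregular_le hij.2.1 hε₁ ?_ (by linarith) ?_ (hup _ (hIP i.2)) (hup _ (hIP j.2)) hY
      · rw [hε₁d]
        have : ε * μ ≤ ε * 1 := mul_le_mul_of_nonneg_left hμ1 hε.le
        linarith
      · have := hlow _ (hIP i.2)
        linarith
    · exact fun i => hlow _ (hIP i.2)
    · exact fun i => hup _ (hIP i.2)
  · obtain ⟨pT, hpT⟩ : ∃ p : Finset V → Prop, ∀ Q, p Q := ⟨fun _ => True, fun _ => trivial⟩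
    have h1 : (n : ℝ) = ∑ Q ∈ P.parts, (if Q ∉ I then (#Q : ℝ) else 0) +
        ∑ Q ∈ P.parts, (if Q ∈ I ∧ pT Q then (#Q : ℝ) else 0) := by
      rw [← sum_card_parts P, ← sum_add_distrib]
      refine sum_congr rfl fun Q _ => ?_
      by_cases hQ : Q ∈ I <;> simp [hQ, hpT]
    have h2 := hsplit pT
    rw [h2, filter_true_of_mem (fun j _ => hpT j.1)] at h1
    beta_reduce
    linarith
  · intro i
    beta_reduce
    obtain ⟨pR, hpR⟩ : ∃ pR : Finset V → Prop, ∀ Q, pR Q ↔ ∃ hQ : Q ∈ I, R.Adj i ⟨Q, hQ⟩ :=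
      ⟨_, fun _ => Iff.rfl⟩
    refine le_of_le_of_eq ?_ ((hsplit pR).trans (sum_congr (by ext j; simp [hpR]) fun _ _ => rfl))
    have hi0 : (0 : ℝ) < #i.1 := by
      have := hlow _ (hIP i.2)
      linarith
    have hdsum : (h + μ) * n ≤ ∑ Q ∈ P.parts, (G.edgeDensity i.1 Q : ℝ) * #Q := by
      have h1 : #i.1 * ((h + μ) * n) ≤ ∑ x ∈ i.1, (ndeg G x : ℝ) := by
        rw [← nsmul_eq_mul]
        exact card_nsmul_le_sum _ _ _ fun x _ => hdeg x
      have h2 : ∑ x ∈ i.1, (ndeg G x : ℝ) = #i.1 * ∑ Q ∈ P.parts, (G.edgeDensity i.1 Q : ℝ) * #Q := by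
        rw [mul_sum]
        simp only [← sum_card_nb_inter G P]
        rw [sum_comm]
        refine sum_congr rfl fun Q _ => ?_
        rw [sum_nb_inter]; ring
      rw [h2] at h1
      exact le_of_mul_le_mul_left h1 hi0
    have hpt : ∀ Q ∈ P.parts, (G.edgeDensity i.1 Q : ℝ) * #Q ≤
        (if Q ∈ I ∧ pR Q then (#Q : ℝ) else 0) +
        (if Q ∉ I then (#Q : ℝ) else 0) + μ / 8 * #Q + (if Q = i.1 then (#Q : ℝ) else 0) +
        (if i.1 ≠ Q ∧ ¬G.IsUniform ε₁ i.1 Q then (#Q : ℝ) else 0) := by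
      intro Q hQ
      have hc0 : (0 : ℝ) ≤ #Q := Nat.cast_nonneg _
      have hd1 : (G.edgeDensity i.1 Q : ℝ) * #Q ≤ #Q :=
        mul_le_of_le_one_left hc0 (by exact_mod_cast G.edgeDensity_le_one i.1 Q)
      have hpos : 0 ≤ μ / 8 * #Q := by positivity
      have hz : ∀ (p : Prop) [Decidable p], (0 : ℝ) ≤ if p then (#Q : ℝ) else 0 := fun p _ => by
        split_ifs <;> simp
      have z1 := hz (Q ∈ I ∧ pR Q)
      have z2 := hz (Q ∉ I)
      have z3 := hz (Q = i.1)
      have z4 := hz (i.1 ≠ Q ∧ ¬G.IsUniform ε₁ i.1 Q)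
      by_cases hQI : Q ∈ I
      · by_cases hQi : Q = i.1
        · rw [if_pos hQi] at z3 ⊢; linarith
        · by_cases hu : G.IsUniform ε₁ i.1 Q
          · by_cases hdd : μ / 8 ≤ (G.edgeDensity i.1 Q : ℝ)
            · have hA : Q ∈ I ∧ pR Q :=
                ⟨hQI, (hpR Q).2 ⟨hQI, fun hh => hQi (by rw [hh]), hu, hdd⟩⟩
              rw [if_pos hA] at z1 ⊢; linarith
            · push Not at hdd
              have := mul_le_mul_of_nonneg_right hdd.le hc0
              linarith
          · have hA : i.1 ≠ Q ∧ ¬G.IsUniform ε₁ i.1 Q := ⟨fun hh => hQi hh.symm, hu⟩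
            rw [if_pos hA] at z4 ⊢; linarith
      · rw [if_pos hQI] at z2 ⊢; linarith
    have hsum := sum_le_sum hpt
    simp only [sum_add_distrib] at hsum
    rw [← mul_sum, sum_card_parts P] at hsum
    have hself : ∑ Q ∈ P.parts, (if Q = i.1 then (#Q : ℝ) else 0) ≤ 2 * m := by
      rw [sum_ite_eq' P.parts i.1 (fun Q => (#Q : ℝ)), if_pos (hIP i.2)]
      exact hup _ (hIP i.2)
    have hnon : ∑ Q ∈ P.parts, (if i.1 ≠ Q ∧ ¬G.IsUniform ε₁ i.1 Q then (#Q : ℝ) else 0)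
        ≤ μ / 8 * n := by
      refine (sum_ite_card_le P _ hup).trans ?_
      have h1 : (#(nu i.1) : ℝ) ≤ μ / 16 * q := (mem_filter.1 i.2).2
      have h2 := mul_le_mul_of_nonneg_right h1 (by linarith : (0 : ℝ) ≤ 2 * m)
      refine h2.trans ?_
      have h3 := mul_le_mul_of_nonneg_left hmq (by linarith : (0 : ℝ) ≤ μ / 8)
      linarith
    have hμn : 0 ≤ μ * n := by positivity
    linarith
  · intro z
    beta_reduce
    rw [← hsplit fun Q => μ / 8 * #Q ≤ (#(nb G z ∩ Q) : ℝ)]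
    have hdz := hdeg z
    rw [← sum_card_nb_inter G P z] at hdz
    have hpt : ∀ Q ∈ P.parts, (#(nb G z ∩ Q) : ℝ) ≤
        (if Q ∈ I ∧ μ / 8 * #Q ≤ (#(nb G z ∩ Q) : ℝ) then (#Q : ℝ) else 0) +
        (if Q ∉ I then (#Q : ℝ) else 0) + μ / 8 * #Q := by
      intro Q hQ
      have hc0 : (0 : ℝ) ≤ #Q := Nat.cast_nonneg _
      have hc1 : (#(nb G z ∩ Q) : ℝ) ≤ #Q := Nat.cast_le.2 (card_le_card inter_subset_right)
      have hpos : 0 ≤ μ / 8 * #Q := by positivity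
      by_cases hQI : Q ∈ I
      · rw [if_neg (not_not.2 hQI)]
        by_cases hd : μ / 8 * #Q ≤ (#(nb G z ∩ Q) : ℝ)
        · rw [if_pos ⟨hQI, hd⟩]; linarith
        · rw [if_neg fun hh => hd hh.2]
          push Not at hd
          linarith
      · rw [if_pos hQI, if_neg fun hh => hQI hh.1]; linarith
    have hsum := sum_le_sum hpt
    simp only [sum_add_distrib] at hsum
    rw [← mul_sum, sum_card_parts P] at hsum
    have hμn : 0 ≤ μ * n := by positivity
    linarith

end RegularityOutput

section Select
open Finset
set_option linter.unusedSectionVars false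

variable {U V ι : Type} [Fintype U] [Fintype V] [Fintype ι]

/-- A large subset no two members of which share a neighbour. -/
lemma exists_sep_subset (H : SimpleGraph U) {Δ : ℕ} (hdeg : ∀ x, #(nb H x) ≤ Δ) (L : Finset U) :
    ∃ B ⊆ L, (∀ x, ∀ b ∈ B, ∀ b' ∈ B, H.Adj x b → H.Adj x b' → b = b') ∧
      #L ≤ (Δ ^ 2 + 1) * #B := by
  let good : Finset U → Prop := fun B => ∀ x, ∀ b ∈ B, ∀ b' ∈ B, H.Adj x b → H.Adj x b' → b = b'
  obtain ⟨B, hB, hmax⟩ := exists_max_image (L.powerset.filter good) card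
    ⟨∅, by simp [good]⟩
  rw [mem_filter, mem_powerset] at hB
  refine ⟨B, hB.1, hB.2, ?_⟩
  have hcov : L ⊆ B.biUnion fun b => insert b ((nb H b).biUnion fun y => nb H y) := by
    intro x hx
    rw [mem_biUnion]
    by_contra hcon
    push Not at hcon
    have hxB : x ∉ B := fun h => hcon x h (mem_insert_self _ _)
    have hno : ∀ b ∈ B, ∀ y, H.Adj y b → H.Adj y x → False := fun b hb y h1 h2 =>
      hcon b hb (mem_insert_of_mem (mem_biUnion.2 ⟨y, mem_nb.2 h1.symm, mem_nb.2 h2⟩))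
    have := hmax (insert x B) (by
      rw [mem_filter, mem_powerset]
      refine ⟨insert_subset hx hB.1, ?_⟩
      intro y b hb b' hb' h1 h2
      rcases mem_insert.1 hb with rfl | hbB
      · rcases mem_insert.1 hb' with rfl | hbB'
        · rfl
        · exact (hno _ hbB' y h2 h1).elim
      · rcases mem_insert.1 hb' with rfl | hbB'
        · exact (hno _ hbB y h1 h2).elim
        · exact hB.2 y b hbB b' hbB' h1 h2)
    rw [card_insert_of_notMem hxB] at this
    omega
  refine (card_le_card hcov).trans ?_
  rw [mul_comm]
  refine card_biUnion_le_card_mul _ _ _ fun b _ => (card_insert_le _ _).trans ?_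
  refine Nat.add_le_add_right ?_ 1
  rw [pow_two]
  exact (card_biUnion_le_card_mul _ _ _ fun y _ => hdeg y).trans
    (Nat.mul_le_mul_right _ (hdeg b))

lemma exists_large_colour {k : ℕ} {col : U → ℕ} (hk : 0 < k) (hcol : ∀ x, col x < k)
    (T : Finset U) : ∃ c < k, #T ≤ k * #(T.filter fun x => col x = c) := by
  have h1 : #T = ∑ c ∈ range k, #(T.filter fun x => col x = c) :=
    card_eq_sum_card_fiberwise fun x _ => by simpa using hcol x
  obtain ⟨c, hc, hmax⟩ := exists_max_image (range k) (fun c => #(T.filter fun x => col x = c))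
    ⟨0, mem_range.2 hk⟩
  refine ⟨c, mem_range.1 hc, ?_⟩
  rw [h1]
  refine (sum_le_card_nsmul _ _ _ hmax).trans ?_
  rw [card_range, smul_eq_mul]

/-- Choosing pairwise disjoint blocks of tiles, mapped onto prescribed cliques, each containing
prescribed numbers of well-separated vertices in the last clique vertex. -/
lemma select_blocks [Nonempty ι] {H : SimpleGraph U} {R : SimpleGraph ι} {Δ w k : ℕ}
    (hdeg : ∀ x, #(nb H x) ≤ Δ) (hk : 0 < k) {col : U → ℕ} (hcol : ∀ x, col x < k)
    (hproper : ∀ x y, H.Adj x y → col x ≠ col y) {F : Finset (Finset U)}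
    (hdis : (F : Set (Finset U)).PairwiseDisjoint id) (hcl : ∀ T ∈ F, Clsd H T)
    (hw : ∀ T ∈ F, #T ≤ w) {Q : Type} (Qs : Finset Q) (a : Q → ℕ) (σ : Q → ℕ → ι)
    (hσ : ∀ q ∈ Qs, Clq R k (σ q))
    (hmass : ∑ q ∈ Qs, ((k * (Δ ^ 2 + 1) * a q : ℕ) + (w : ℝ)) ≤ #(F.biUnion id)) :
    ∃ (Fq : Q → Finset (Finset U)) (φ : U → ι) (B : Q → Finset U),
      (Qs : Set Q).PairwiseDisjoint Fq ∧
      (∀ q ∈ Qs, Fq q ⊆ F ∧ (#((Fq q).biUnion id) : ℝ) ≤ (k * (Δ ^ 2 + 1) * a q : ℕ) + (w : ℝ) ∧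
        (∀ T ∈ Fq q, ∀ x ∈ T, ∀ y ∈ T, H.Adj x y → R.Adj (φ x) (φ y)) ∧
        (∀ x ∈ (Fq q).biUnion id, ∃ l < k, φ x = σ q l) ∧
        B q ⊆ (Fq q).biUnion id ∧ #(B q) = a q ∧ (∀ b ∈ B q, φ b = σ q (k - 1)) ∧
        (∀ b ∈ B q, ∀ x, H.Adj b x → ∃ l < k - 1, φ x = σ q l)) ∧
      (∀ x, ∀ b ∈ Qs.biUnion B, ∀ b' ∈ Qs.biUnion B, H.Adj x b → H.Adj x b' → b = b') := by
  choose big hbig1 hbig2 using fun T : Finset U => exists_large_colour hk hcol T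
  have hcd : ∀ A ⊆ F, (#(A.biUnion id) : ℝ) = ∑ T ∈ A, (#T : ℝ) := by
    intro A hA
    rw [card_biUnion_id' (hdis.subset (coe_subset.2 hA))]
    push_cast; rfl
  obtain ⟨Fq, hFq, hFd, -⟩ := split_blocks Qs F (fun _ => 0) (fun T => (#T : ℝ))
    (fun q => ((k * (Δ ^ 2 + 1) * a q : ℕ) : ℝ)) (w := (w : ℝ)) (Nat.cast_nonneg _)
    (fun T hT => Nat.cast_le.2 (hw T hT)) (by simp) (by simp) (fun q _ => Nat.cast_nonneg _)
    (by rw [← hcd F subset_rfl]; exact hmass)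
  have huniq : ∀ q ∈ Qs, ∀ q' ∈ Qs, ∀ T ∈ Fq q, ∀ T' ∈ Fq q', ∀ x, x ∈ T → x ∈ T' →
      q = q' ∧ T = T' := by
    intro q hq q' hq' T hT T' hT' x hx hx'
    have hTT : T = T' := by
      by_contra hne
      exact disjoint_left.1 (hdis ((hFq q hq).1 hT) ((hFq q' hq').1 hT') hne) hx hx'
    refine ⟨?_, hTT⟩
    by_contra hne
    exact disjoint_left.1 (hFd hq hq' hne) hT (hTT ▸ hT')
  have hφ : ∀ x, ∃ i : ι, ∀ q ∈ Qs, ∀ T ∈ Fq q, x ∈ T →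
      i = σ q (Equiv.swap (big T) (k - 1) (col x)) := by
    intro x
    by_cases h : ∃ q ∈ Qs, ∃ T ∈ Fq q, x ∈ T
    · obtain ⟨q, hq, T, hT, hx⟩ := h
      refine ⟨σ q (Equiv.swap (big T) (k - 1) (col x)), fun q' hq' T' hT' hx' => ?_⟩
      obtain ⟨e1, e2⟩ := huniq q hq q' hq' T hT T' hT' x hx hx'
      rw [e1, e2]
    · exact ⟨Classical.arbitrary ι, fun q hq T hT hx => (h ⟨q, hq, T, hT, hx⟩).elim⟩
  choose φ hφ' using hφ
  have hφ : ∀ q ∈ Qs, ∀ T ∈ Fq q, ∀ x ∈ T, φ x = σ q (Equiv.swap (big T) (k - 1) (col x)) :=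
    fun q hq T hT x hx => hφ' x q hq T hT hx
  have hswap : ∀ T c, c < k → Equiv.swap (big T) (k - 1) c < k := by
    intro T c hc
    rw [Equiv.swap_apply_def]
    have := hbig1 T
    split_ifs <;> omega
  have hB : ∀ q ∈ Qs, ∃ B ⊆ (Fq q).biUnion fun T => T.filter fun x => col x = big T,
      (∀ x, ∀ b ∈ B, ∀ b' ∈ B, H.Adj x b → H.Adj x b' → b = b') ∧ #B = a q := by
    intro q hq
    set L := (Fq q).biUnion fun T => T.filter fun x => col x = big T with hL
    obtain ⟨B, hBL, hsep, hBc⟩ := exists_sep_subset H hdeg L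
    have h1 : #((Fq q).biUnion id) ≤ k * #L := by
      have h2 : #L = ∑ T ∈ Fq q, #(T.filter fun x => col x = big T) := by
        rw [hL, card_biUnion]
        intro T hT T' hT' hne
        exact (hdis ((hFq q hq).1 hT) ((hFq q hq).1 hT') hne).mono (filter_subset _ _)
          (filter_subset _ _)
      rw [h2, mul_sum]
      exact card_biUnion_le.trans (sum_le_sum fun T _ => hbig2 T)
    have h3 : k * (Δ ^ 2 + 1) * a q ≤ #((Fq q).biUnion id) := by
      have := (hFq q hq).2.1
      rw [← hcd _ (hFq q hq).1] at this
      exact Nat.cast_le.1 this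
    have h4 : (k * (Δ ^ 2 + 1)) * a q ≤ (k * (Δ ^ 2 + 1)) * #B := by
      calc _ ≤ k * #L := h3.trans h1
        _ ≤ k * ((Δ ^ 2 + 1) * #B) := Nat.mul_le_mul_left _ hBc
        _ = _ := by ring
    have h5 : a q ≤ #B := Nat.le_of_mul_le_mul_left h4 (by positivity)
    obtain ⟨B', hB', hB'c⟩ := exists_subset_card_eq h5
    exact ⟨B', hB'.trans hBL, fun x b hb b' hb' => hsep x b (hB' hb) b' (hB' hb'), hB'c⟩
  choose! B hBL hBsep hBc using hB
  have hBmem : ∀ q ∈ Qs, ∀ b ∈ B q, ∃ T ∈ Fq q, b ∈ T ∧ col b = big T := by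
    intro q hq b hb
    obtain ⟨T, hT, hbT⟩ := mem_biUnion.1 (hBL q hq hb)
    exact ⟨T, hT, (mem_filter.1 hbT).1, (mem_filter.1 hbT).2⟩
  refine ⟨Fq, φ, B, hFd, fun q hq => ⟨(hFq q hq).1, ?_, ?_, ?_, ?_, hBc q hq, ?_, ?_⟩, ?_⟩
  · rw [hcd _ (hFq q hq).1]
    exact (hFq q hq).2.2.1
  · intro T hT x hx y hy hxy
    rw [hφ q hq T hT x hx, hφ q hq T hT y hy]
    exact hσ q hq _ (hswap _ _ (hcol x)) _ (hswap _ _ (hcol y))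
      (fun h => hproper x y hxy ((Equiv.swap _ _).injective h))
  · intro x hx
    obtain ⟨T, hT, hxT⟩ := mem_biUnion.1 hx
    exact ⟨_, hswap T _ (hcol x), hφ q hq T hT x hxT⟩
  · intro b hb
    obtain ⟨T, hT, hbT, -⟩ := hBmem q hq b hb
    exact mem_biUnion.2 ⟨T, hT, hbT⟩
  · intro b hb
    obtain ⟨T, hT, hbT, hc⟩ := hBmem q hq b hb
    rw [hφ q hq T hT b hbT, hc, Equiv.swap_apply_left]
  · intro b hb x hbx
    obtain ⟨T, hT, hbT, hc⟩ := hBmem q hq b hb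
    have hxT := hcl T ((hFq q hq).1 hT) b hbT x hbx
    refine ⟨Equiv.swap (big T) (k - 1) (col x), ?_, hφ q hq T hT x hxT⟩
    have h1 := hswap T _ (hcol x)
    have h2 : Equiv.swap (big T) (k - 1) (col x) ≠ k - 1 := by
      intro h
      rw [Equiv.swap_apply_eq_iff, Equiv.swap_apply_right] at h
      exact hproper b x hbx (hc.trans h.symm)
    omega
  · intro x b hb b' hb' h1 h2
    obtain ⟨q, hq, hbq⟩ := mem_biUnion.1 hb
    obtain ⟨q', hq', hbq'⟩ := mem_biUnion.1 hb'
    obtain ⟨T, hT, hbT, -⟩ := hBmem q hq b hbq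
    obtain ⟨T', hT', hbT', -⟩ := hBmem q' hq' b' hbq'
    have e := (huniq q hq q' hq' T hT T' hT' x (hcl T ((hFq q hq).1 hT) b hbT x h1.symm)
      (hcl T' ((hFq q' hq').1 hT') b' hbT' x h2.symm)).1
    subst e
    exact hBsep q hq x b hbq b' hbq' h1 h2

end Select

section TilingData
open Finset
set_option linter.unusedSectionVars false

variable {U V ι : Type} [Fintype U] [Fintype V] [Fintype ι]

lemma exists_properCol_of_colorable {W : Type} {F : SimpleGraph W} {k : ℕ} (h : F.Colorable k) :
    ∃ C : W → ℕ, (∀ v, C v < k) ∧ ∀ ⦃u v⦄, F.Adj u v → C u ≠ C v := by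
  obtain ⟨c⟩ := h
  exact ⟨fun v => c v, fun v => (c v).2, fun u v huv heq => c.valid huv (Fin.ext heq)⟩

lemma colorable_of_properCol {W : Type} {F : SimpleGraph W} {k : ℕ} (C : W → ℕ)
    (h1 : ∀ v, C v < k) (h2 : ∀ ⦃u v⦄, F.Adj u v → C u ≠ C v) : F.Colorable k :=
  ⟨SimpleGraph.Coloring.mk (fun v => (⟨C v, h1 v⟩ : Fin k)) fun {_ _} huv heq =>
    h2 huv (congrArg Fin.val heq)⟩

lemma chromNum_le {W : Type} {F : SimpleGraph W} {k : ℕ} (h : F.Colorable k) :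
    chromNum F ≤ k := by
  have := h.chromaticNumber_le
  exact ENat.toNat_le_of_le_natCast this

lemma colorable_chromNum {W : Type} {F : SimpleGraph W} {k : ℕ} (h : F.Colorable k) :
    F.Colorable (chromNum F) := by
  exact SimpleGraph.colorable_chromaticNumber h

lemma card_filter_extend {T : Finset U} (C : ↥(T : Set U) → ℕ) (i : ℕ) :
    classCard C i = #(T.filter fun x => (if h : x ∈ (T : Set U) then C ⟨x, h⟩ else 0) = i) := by
  rw [classCard, ← Set.ncard_coe_finset, ← Set.ncard_image_of_injective _ Subtype.val_injective]
  congr 1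
  ext x
  simp only [Set.mem_image, Set.mem_ofPred_eq, coe_filter]
  constructor
  · rintro ⟨⟨y, hy⟩, hC, rfl⟩
    exact ⟨hy, by rw [dif_pos hy]; exact hC⟩
  · rintro ⟨hx, hC⟩
    rw [dif_pos (mem_coe.2 hx)] at hC
    exact ⟨⟨x, hx⟩, hC, rfl⟩

lemma flexTile_of_isFcr {H : SimpleGraph U} {k : ℕ} {T : Finset U}
    (hF : GcdOne (DSet (H.induce (T : Set U)))) (hk : (H.induce (T : Set U)).Colorable k) :
    FlexTile H k T := by
  obtain ⟨D, hD, hgcd⟩ := hF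
  refine ⟨D, hgcd, fun d hd => ?_⟩
  obtain ⟨C, ⟨hC1, hC2⟩, hdC⟩ := hD hd
  refine ⟨fun x => if h : x ∈ (T : Set U) then C ⟨x, h⟩ else 0, ?_, ?_, ?_⟩
  · intro x hx
    beta_reduce
    rw [dif_pos (mem_coe.2 hx)]
    exact (hC1 _).trans_le (chromNum_le hk)
  · intro x hx y hy hxy
    beta_reduce
    rw [dif_pos (mem_coe.2 hx), dif_pos (mem_coe.2 hy)]
    exact hC2 (by simpa using hxy)
  · rw [hdC, card_filter_extend, card_filter_extend]

lemma splitTile_of_gcdOne {H : SimpleGraph U} {T : Finset U} (hcl : Clsd H T)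
    (hF : GcdOne (compOrders (H.induce (T : Set U)))) : SplitTile H T := by
  obtain ⟨D, hD, hgcd⟩ := hF
  refine ⟨D, hgcd, fun d hd => ?_⟩
  obtain ⟨c, hc⟩ := hD hd
  refine ⟨T.filter fun x => ∃ h : x ∈ (T : Set U), (⟨x, h⟩ : ↥(T : Set U)) ∈ c.supp,
    filter_subset _ _, ?_, ?_⟩
  · intro x hx y hxy
    rw [mem_filter] at hx ⊢
    obtain ⟨hxT, h, hxc⟩ := hx
    have hy := hcl x hxT y hxy
    refine ⟨hy, mem_coe.2 hy, ?_⟩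
    rw [SimpleGraph.ConnectedComponent.mem_supp_iff] at hxc ⊢
    rw [← hxc]
    refine SimpleGraph.ConnectedComponent.sound (SimpleGraph.Adj.reachable ?_)
    simpa using hxy.symm
  · rw [hc, ← Set.ncard_coe_finset, ← Set.ncard_image_of_injective _ Subtype.val_injective]
    congr 1
    ext x
    simp only [coe_filter, Set.mem_ofPred_eq, Set.mem_image]
    constructor
    · rintro ⟨_, h, hx⟩
      exact ⟨⟨x, h⟩, hx, rfl⟩
    · rintro ⟨⟨y, hy⟩, hyc, rfl⟩
      exact ⟨hy, hy, hyc⟩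

/-- A colouring with `⌈χ⌉` colours in which colour `0` is as rare as the critical chromatic
number allows. -/
lemma exists_rare_colour [Nonempty U] {H : SimpleGraph U} {k : ℕ} {χ : ℝ} (hχ : 1 < χ)
    (hk : k = ⌈χ⌉₊) (hH : H.Colorable k) (hcrit : critR H ≤ χ) :
    ∃ col : U → ℕ, (∀ x, col x < k) ∧ (∀ x y, H.Adj x y → col x ≠ col y) ∧
      (#(univ.filter fun x => col x = 0) : ℝ) ≤ (1 - (k - 1) / χ) * Fintype.card U := by
  have hχ0 : 0 < χ := by linarith
  have hkχ : (k : ℝ) - 1 < χ := by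
    have := Nat.ceil_lt_add_one hχ0.le
    rw [← hk] at this
    linarith
  have hk2 : 2 ≤ k := by
    by_contra hcon
    have h1 : ⌈χ⌉₊ ≤ 1 := by
      rw [← hk]
      omega
    have := Nat.ceil_le.1 h1
    push_cast at this
    linarith
  obtain ⟨C₀, hC₀⟩ := exists_properCol_of_colorable (colorable_chromNum hH)
  have hne : {a | ∃ C, ProperCol H (chromNum H) C ∧ a = minClassCard C (chromNum H)}.Nonempty :=
    ⟨_, C₀, hC₀, rfl⟩
  obtain ⟨C, ⟨hC1, hC2⟩, hCa⟩ := Nat.sInf_mem hne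
  rcases (chromNum_le hH).lt_or_eq with hlt | heq
  · refine ⟨fun x => C x + 1, fun x => ?_, fun x y hxy h => hC2 hxy (by simpa using h), ?_⟩
    · have := hC1 x
      beta_reduce
      omega
    · rw [filter_false_of_mem (by simp)]
      simp only [card_empty, Nat.cast_zero]
      refine mul_nonneg ?_ (Nat.cast_nonneg _)
      rw [sub_nonneg, div_le_one hχ0]
      exact hkχ.le
  · rw [heq] at hC1 hCa
    have hne2 : {a | ∃ i < k, a = classCard C i}.Nonempty := ⟨_, 0, by omega, rfl⟩
    obtain ⟨i, hik, hi⟩ := Nat.sInf_mem hne2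
    have hclass : ∀ j, classCard C j = #(univ.filter fun x => C x = j) := by
      intro j
      rw [classCard, ← Set.ncard_coe_finset]
      congr 1
      ext x
      simp
    have hα : alphaNat H = #(univ.filter fun x => C x = i) := by
      rw [← hclass, ← hi]
      unfold alphaNat
      rw [heq]
      exact hCa
    have hα2 : 2 * alphaNat H ≤ Fintype.card U := by
      have h0 : alphaNat H ≤ classCard C 0 := by
        unfold alphaNat
        rw [heq, hCa]
        exact Nat.sInf_le ⟨0, by omega, rfl⟩
      have h1 : alphaNat H ≤ classCard C 1 := by
        unfold alphaNat
        rw [heq, hCa]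
        exact Nat.sInf_le ⟨1, by omega, rfl⟩
      rw [hclass] at h0 h1
      have h2 : #(univ.filter fun x => C x = 0) + #(univ.filter fun x => C x = 1)
          ≤ Fintype.card U := by
        rw [← card_union_of_disjoint]
        · exact card_le_univ _
        · rw [disjoint_filter]
          intro x _ h h'
          omega
      omega
    have hn : (0 : ℝ) < Fintype.card U := by exact_mod_cast Fintype.card_pos
    have hα2' : 2 * (alphaNat H : ℝ) ≤ Fintype.card U := by exact_mod_cast hα2
    have hαR : 0 < 1 - alphaR H := by
      rw [sub_pos, alphaR, div_lt_one hn]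
      linarith
    rw [critR, heq, div_le_iff₀ hαR] at hcrit
    refine ⟨fun x => Equiv.swap i 0 (C x), fun x => ?_, fun x y hxy h =>
      hC2 hxy ((Equiv.swap _ _).injective h), ?_⟩
    · have := hC1 x
      beta_reduce
      rw [Equiv.swap_apply_def]
      split_ifs <;> omega
    · have hset : (univ.filter fun x => Equiv.swap i 0 (C x) = 0) =
          univ.filter fun x => C x = i := by
        ext x
        simp only [mem_filter, mem_univ, true_and]
        rw [Equiv.swap_apply_eq_iff, Equiv.swap_apply_right]
      rw [hset, ← hα]
      have h1 : (alphaNat H : ℝ) = alphaR H * Fintype.card U := by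
        rw [alphaR, div_mul_cancel₀ _ hn.ne']
      rw [h1]
      refine mul_le_mul_of_nonneg_right ?_ hn.le
      have h2 : ((k : ℝ) - 1) / χ ≤ 1 - alphaR H := by
        rw [div_le_iff₀ hχ0]
        linarith
      linarith

lemma tiling_data [Nonempty U] {H : SimpleGraph U} {k : ℕ} {χ wr : ℝ} (hχ : 1 < χ)
    (hk : k = ⌈χ⌉₊) (hT : IsTiling H (TileFcr k wr)) (hcrit : critR H ≤ χ) :
    ∃ (F : Finset (Finset U)) (col : U → ℕ), (F : Set (Finset U)).PairwiseDisjoint id ∧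
      F.biUnion id = univ ∧ (∀ T ∈ F, Clsd H T) ∧ (∀ T ∈ F, (#T : ℝ) ≤ wr) ∧
      (∀ T ∈ F, FlexTile H k T) ∧ (k = 2 → ∀ T ∈ F, SplitTile H T) ∧
      (∀ x, col x < k) ∧ (∀ x y, H.Adj x y → col x ≠ col y) ∧
      (#(univ.filter fun x => col x = 0) : ℝ) ≤ (1 - (k - 1) / χ) * Fintype.card U := by
  obtain ⟨P, hP, hPe, hPt⟩ := hT
  set F : Finset (Finset U) := univ.filter fun T => (T : Set U) ∈ P with hF
  have hmemF : ∀ T, T ∈ F ↔ (T : Set U) ∈ P := fun T => by simp [hF]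
  have hcover : ∀ x, ∃ T ∈ F, x ∈ T := by
    intro x
    obtain ⟨p, ⟨hp, hxp⟩, -⟩ := hP.2 x
    refine ⟨p.toFinset, (hmemF _).2 (by simpa using hp), by simpa using hxp⟩
  have hcl : ∀ T ∈ F, Clsd H T := by
    intro T hT x hx y hxy
    obtain ⟨T', hT', hy⟩ := hcover y
    by_contra hcon
    refine hPe T ((hmemF T).1 hT) T' ((hmemF T').1 hT') ?_ x hx y hy hxy
    intro h
    rw [coe_inj] at h
    exact hcon (h ▸ hy)
  have htile : ∀ T ∈ F, IsFcr (H.induce (T : Set U)) ∧ (H.induce (T : Set U)).Colorable k ∧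
      (#T : ℝ) ≤ wr := by
    intro T hT
    obtain ⟨h1, h2, h3⟩ := hPt T ((hmemF T).1 hT)
    refine ⟨h1, h2, le_trans (le_of_eq ?_) h3⟩
    refine congrArg _ (Eq.symm ?_)
    convert Fintype.card_of_finset' (p := (T : Set U)) T (fun x => (mem_coe (s := T)).symm)
  have hcolT : ∀ T : Finset U, ∃ C : U → ℕ, T ∈ F → (∀ x ∈ T, C x < k) ∧
      ∀ x ∈ T, ∀ y ∈ T, H.Adj x y → C x ≠ C y := by
    intro T
    by_cases hT : T ∈ F
    · obtain ⟨C, hC1, hC2⟩ := exists_properCol_of_colorable (htile T hT).2.1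
      refine ⟨fun x => if h : x ∈ (T : Set U) then C ⟨x, h⟩ else 0, fun _ => ⟨?_, ?_⟩⟩
      · intro x hx
        beta_reduce
        rw [dif_pos (mem_coe.2 hx)]
        exact hC1 _
      · intro x hx y hy hxy
        beta_reduce
        rw [dif_pos (mem_coe.2 hx), dif_pos (mem_coe.2 hy)]
        exact hC2 (by simpa using hxy)
    · exact ⟨fun _ => 0, fun h => (hT h).elim⟩
  have hdis : (F : Set (Finset U)).PairwiseDisjoint id := by
    intro T hT T' hT' hne
    rw [Function.onFun, disjoint_left]
    intro x hx hx'
    have := (hP.2 x).unique ⟨(hmemF T).1 hT, hx⟩ ⟨(hmemF T').1 hT', hx'⟩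
    exact hne (coe_inj.1 this)
  have hHk : H.Colorable k := by
    choose C hC using hcolT
    choose t htF hxt using hcover
    refine colorable_of_properCol (fun x => C (t x) x) (fun x => (hC _ (htF x)).1 x (hxt x)) ?_
    intro x y hxy
    have hy : y ∈ t x := hcl _ (htF x) x (hxt x) y hxy
    have hxy' : t y = t x := by
      by_contra hne
      exact disjoint_left.1 (hdis (htF y) (htF x) hne) (hxt y) hy
    rw [hxy']
    exact (hC _ (htF x)).2 x (hxt x) y hy hxy
  obtain ⟨col, hcol1, hcol2, hcol3⟩ := exists_rare_colour hχ hk hHk hcrit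
  refine ⟨F, col, hdis, ?_, hcl, fun T hT => (htile T hT).2.2, ?_, ?_, hcol1, hcol2, hcol3⟩
  · ext x
    obtain ⟨T, hT, hx⟩ := hcover x
    simp only [mem_biUnion, mem_univ, iff_true]
    exact ⟨T, hT, hx⟩
  · intro T hT
    refine flexTile_of_isFcr ?_ (htile T hT).2.1
    rcases (htile T hT).1 with h | h
    · exact h.2.1
    · exact h.2
  · intro hk2 T hT
    refine splitTile_of_gcdOne (hcl T hT) ?_
    rcases (htile T hT).1 with h | h
    · exact h.2.2
    · have h1 := (htile T hT).2.1.chromaticNumber_le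
      have h2 := h.1.trans h1
      rw [hk2] at h2
      norm_cast at h2

end TilingData

section Stages
open Finset
set_option linter.unusedSectionVars false

variable {U V ι : Type} [Fintype U] [Fintype V] [Fintype ι]

/-- Blocks of tiles are mapped onto prescribed cliques, with well separated distinguished
vertices, and the load of every cluster is controlled. -/
lemma select_stage [Nonempty ι] {H : SimpleGraph U} {R : SimpleGraph ι} {Δ w k : ℕ}
    (hdeg : ∀ x, #(nb H x) ≤ Δ) (hk : 0 < k) {col : U → ℕ} (hcol : ∀ x, col x < k)
    (hproper : ∀ x y, H.Adj x y → col x ≠ col y) {F : Finset (Finset U)}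
    (hdis : (F : Set (Finset U)).PairwiseDisjoint id) (hcl : ∀ T ∈ F, Clsd H T)
    (hw : ∀ T ∈ F, #T ≤ w) {Q : Type} (Qs : Finset Q) (a : Q → ℕ) (σ : Q → ℕ → ι)
    (hσ : ∀ q ∈ Qs, Clq R k (σ q))
    (hmass : ∑ q ∈ Qs, ((k * (Δ ^ 2 + 1) * a q : ℕ) + (w : ℝ)) ≤ #(F.biUnion id)) :
    ∃ (F' : Finset (Finset U)) (φ : U → ι) (B : Q → Finset U), F' ⊆ F ∧
      (∀ T ∈ F', ∀ x ∈ T, ∀ y ∈ T, H.Adj x y → R.Adj (φ x) (φ y)) ∧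
      (Qs : Set Q).PairwiseDisjoint B ∧ (Qs.biUnion B ⊆ F'.biUnion id) ∧
      (∀ q ∈ Qs, #(B q) = a q ∧ (∀ b ∈ B q, φ b = σ q (k - 1)) ∧
        (∀ b ∈ B q, ∀ x, H.Adj b x → ∃ l < k - 1, φ x = σ q l)) ∧
      (∀ x, ∀ b ∈ Qs.biUnion B, ∀ b' ∈ Qs.biUnion B, H.Adj x b → H.Adj x b' → b = b') ∧
      (∀ b ∈ Qs.biUnion B, ∀ x, H.Adj b x → x ∉ Qs.biUnion B) ∧
      (∀ j, (#((F'.biUnion id).filter fun x => φ x = j) : ℝ) ≤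
        ∑ q ∈ Qs.filter (fun q => ∃ l < k, σ q l = j), ((k * (Δ ^ 2 + 1) * a q : ℕ) + (w : ℝ))) := by
  obtain ⟨Fq, φ, B, hFd, hq, hsep⟩ := select_blocks hdeg hk hcol hproper hdis hcl hw Qs a σ hσ hmass
  have huniq : ∀ q ∈ Qs, ∀ q' ∈ Qs, ∀ T ∈ Fq q, ∀ T' ∈ Fq q', ∀ x, x ∈ T → x ∈ T' → q = q' := by
    intro q hq1 q' hq' T hT T' hT' x hx hx'
    have hTT : T = T' := by
      by_contra hne
      exact disjoint_left.1 (hdis ((hq q hq1).1 hT) ((hq q' hq').1 hT') hne) hx hx'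
    by_contra hne
    exact disjoint_left.1 (hFd hq1 hq' hne) hT (hTT ▸ hT')
  have hBT : ∀ q ∈ Qs, ∀ b ∈ B q, ∃ T ∈ Fq q, b ∈ T := by
    intro q hq1 b hb
    have := (hq q hq1).2.2.2.2.1 hb
    simpa using this
  refine ⟨Qs.biUnion Fq, φ, B, ?_, ?_, ?_, ?_, ?_, hsep, ?_, ?_⟩
  · exact biUnion_subset.2 fun q hq1 => (hq q hq1).1
  · intro T hT
    obtain ⟨q, hq1, hT⟩ := mem_biUnion.1 hT
    exact (hq q hq1).2.2.1 T hT
  · intro q hq1 q' hq' hne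
    rw [Function.onFun, disjoint_left]
    intro b hb hb'
    obtain ⟨T, hT, hbT⟩ := hBT q hq1 b hb
    obtain ⟨T', hT', hbT'⟩ := hBT q' hq' b hb'
    exact hne (huniq q hq1 q' hq' T hT T' hT' b hbT hbT')
  · intro b hb
    obtain ⟨q, hq1, hb⟩ := mem_biUnion.1 hb
    obtain ⟨T, hT, hbT⟩ := hBT q hq1 b hb
    exact mem_biUnion.2 ⟨T, mem_biUnion.2 ⟨q, hq1, hT⟩, hbT⟩
  · intro q hq1
    obtain ⟨-, -, -, -, -, h1, h2, h3⟩ := hq q hq1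
    exact ⟨h1, h2, h3⟩
  · intro b hb x hbx hx
    obtain ⟨q, hq1, hb⟩ := mem_biUnion.1 hb
    obtain ⟨q', hq', hx⟩ := mem_biUnion.1 hx
    obtain ⟨T, hT, hbT⟩ := hBT q hq1 b hb
    obtain ⟨T', hT', hxT'⟩ := hBT q' hq' x hx
    have hxT := hcl T ((hq q hq1).1 hT) b hbT x hbx
    have := huniq q hq1 q' hq' T hT T' hT' x hxT hxT'
    subst this
    obtain ⟨l, hl, hφ⟩ := (hq q hq1).2.2.2.2.2.2.2 b hb x hbx
    have h2 := (hq q hq1).2.2.2.2.2.2.1 x hx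
    have h3 := hσ q hq1 l (by omega) (k - 1) (by omega) (by omega)
    rw [← hφ, ← h2] at h3
    exact R.loopless.irrefl _ h3
  · intro j
    have h1 : ((Qs.biUnion Fq).biUnion id).filter (fun x => φ x = j) ⊆
        (Qs.filter fun q => ∃ l < k, σ q l = j).biUnion fun q => (Fq q).biUnion id := by
      intro x hx
      rw [mem_filter, mem_biUnion] at hx
      obtain ⟨⟨T, hT, hxT⟩, hxj⟩ := hx
      obtain ⟨q, hq1, hT⟩ := mem_biUnion.1 hT
      have hx2 : x ∈ (Fq q).biUnion id := mem_biUnion.2 ⟨T, hT, hxT⟩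
      obtain ⟨l, hl, hl2⟩ := (hq q hq1).2.2.2.1 x hx2
      refine mem_biUnion.2 ⟨q, mem_filter.2 ⟨hq1, l, hl, ?_⟩, hx2⟩
      rw [← hl2, hxj]
    refine (Nat.cast_le.2 ((card_le_card h1).trans card_biUnion_le)).trans ?_
    push_cast
    refine sum_le_sum fun q hq1 => ?_
    have := (hq q (mem_of_mem_filter q hq1)).2.1
    push_cast at this
    exact this

/-- A family of closed sets is embedded when `f` is injective and edge-preserving on it. -/
def EmbOn (G : SimpleGraph V) (H : SimpleGraph U) (S : Finset U) (f : U → V) : Prop :=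
  Set.InjOn f S ∧ ∀ x ∈ S, ∀ y ∈ S, H.Adj x y → G.Adj (f x) (f y)

lemma EmbOn.glue {G : SimpleGraph V} {H : SimpleGraph U} {S T : Finset U} {f g : U → V}
    (hS : Clsd H S) (hf : EmbOn G H S f) (hg : EmbOn G H T g)
    (hd : ∀ x ∈ S, ∀ y ∈ T, f x ≠ g y) :
    EmbOn G H (S ∪ T) (fun x => if x ∈ S then f x else g x) := by
  refine ⟨?_, ?_⟩
  · intro x hx y hy hxy
    simp only [coe_union, Set.mem_union, mem_coe] at hx hy
    beta_reduce at hxy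
    by_cases h1 : x ∈ S <;> by_cases h2 : y ∈ S
    · rw [if_pos h1, if_pos h2] at hxy
      exact hf.1 h1 h2 hxy
    · rw [if_pos h1, if_neg h2] at hxy
      exact (hd x h1 y (hy.resolve_left h2) hxy).elim
    · rw [if_neg h1, if_pos h2] at hxy
      exact (hd y h2 x (hx.resolve_left h1) hxy.symm).elim
    · rw [if_neg h1, if_neg h2] at hxy
      exact hg.1 (hx.resolve_left h1) (hy.resolve_left h2) hxy
  · intro x hx y hy hxy
    rw [mem_union] at hx hy
    beta_reduce
    by_cases h1 : x ∈ S
    · rw [if_pos h1, if_pos (hS x h1 y hxy)]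
      exact hf.2 x h1 y (hS x h1 y hxy) hxy
    · have h2 : y ∉ S := fun h => h1 (hS y h x hxy.symm)
      rw [if_neg h1, if_neg h2]
      exact hg.2 x (hx.resolve_left h1) y (hy.resolve_left h2) hxy

/-- Completion of an embedding by distinguished, pairwise nonadjacent vertices. -/
lemma EmbOn.extend {G : SimpleGraph V} {H : SimpleGraph U} {S B : Finset U} {f g : U → V}
    (hf : EmbOn G H (S \ B) f) (hg : Set.InjOn g B)
    (hB : ∀ b ∈ B, ∀ x, H.Adj b x → x ∉ B)
    (hadj : ∀ b ∈ B, ∀ x ∈ S, H.Adj b x → G.Adj (g b) (f x))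
    (hd : ∀ x ∈ S \ B, ∀ b ∈ B, f x ≠ g b) :
    EmbOn G H S (fun x => if x ∈ B then g x else f x) := by
  refine ⟨?_, ?_⟩
  · intro x hx y hy hxy
    rw [mem_coe] at hx hy
    beta_reduce at hxy
    by_cases h1 : x ∈ B <;> by_cases h2 : y ∈ B
    · rw [if_pos h1, if_pos h2] at hxy
      exact hg h1 h2 hxy
    · rw [if_pos h1, if_neg h2] at hxy
      exact (hd y (mem_sdiff.2 ⟨hy, h2⟩) x h1 hxy.symm).elim
    · rw [if_neg h1, if_pos h2] at hxy
      exact (hd x (mem_sdiff.2 ⟨hx, h1⟩) y h2 hxy).elim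
    · rw [if_neg h1, if_neg h2] at hxy
      exact hf.1 (mem_coe.2 (mem_sdiff.2 ⟨hx, h1⟩)) (mem_coe.2 (mem_sdiff.2 ⟨hy, h2⟩)) hxy
  · intro x hx y hy hxy
    beta_reduce
    by_cases h1 : x ∈ B
    · rw [if_pos h1, if_neg (hB x h1 y hxy)]
      exact hadj x h1 y hy hxy
    · rw [if_neg h1]
      by_cases h2 : y ∈ B
      · rw [if_pos h2]
        exact (hadj y h2 x hx hxy.symm).symm
      · rw [if_neg h2]
        exact hf.2 x (mem_sdiff.2 ⟨hx, h1⟩) y (mem_sdiff.2 ⟨hy, h2⟩) hxy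

/-- Distinguished vertices are matched to targets of the same type. -/
lemma exists_typed_bij {Q : Type} {Qs : Finset Q} {B : Q → Finset U} {Z : Finset V} {ty : V → Q}
    (v0 : U → V) (hB : (Qs : Set Q).PairwiseDisjoint B) (hty : ∀ z ∈ Z, ty z ∈ Qs)
    (hcard : ∀ q ∈ Qs, #(B q) = #(Z.filter fun z => ty z = q)) :
    ∃ g : U → V, Set.InjOn g (Qs.biUnion B) ∧ (∀ q ∈ Qs, ∀ b ∈ B q, g b ∈ Z ∧ ty (g b) = q) ∧
      Z = (Qs.biUnion B).image g := by
  have h1 : ∀ q, ∃ e : U → V, q ∈ Qs →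
      Set.BijOn e (B q : Set U) (Z.filter fun z => ty z = q : Finset V) := by
    intro q
    by_cases hq : q ∈ Qs
    · let e := equivOfCardEq (hcard q hq)
      refine ⟨fun x => if h : x ∈ B q then e ⟨x, h⟩ else v0 x, fun _ => ⟨?_, ?_, ?_⟩⟩
      · intro x hx
        have hx' : x ∈ B q := hx
        simp only [hx', dif_pos]
        exact (e ⟨x, hx'⟩).2
      · intro x hx y hy hxy
        have hx' : x ∈ B q := hx
        have hy' : y ∈ B q := hy
        simp only [hx', hy', dif_pos] at hxy
        have := e.injective (Subtype.ext hxy)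
        exact congrArg Subtype.val this
      · intro z hz
        refine ⟨(e.symm ⟨z, hz⟩ : _), (e.symm ⟨z, hz⟩).2, ?_⟩
        simp
    · exact ⟨v0, fun h => (hq h).elim⟩
  choose e he using h1
  have h2 : ∀ b, ∃ q, b ∈ Qs.biUnion B → q ∈ Qs ∧ b ∈ B q := by
    intro b
    by_cases hb : b ∈ Qs.biUnion B
    · obtain ⟨q, hq⟩ := mem_biUnion.1 hb
      exact ⟨q, fun _ => hq⟩
    · by_cases hQ : Nonempty Q
      · exact ⟨hQ.some, fun h => (hb h).elim⟩
      · exact ⟨ty (v0 b), fun h => (hb h).elim⟩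
  choose qq hqq using h2
  have hqu : ∀ q ∈ Qs, ∀ b ∈ B q, qq b = q := by
    intro q hq b hb
    have := hqq b (mem_biUnion.2 ⟨q, hq, hb⟩)
    by_contra hne
    exact disjoint_left.1 (hB this.1 hq hne) this.2 hb
  have hg : ∀ q ∈ Qs, ∀ b ∈ B q, e (qq b) b ∈ Z ∧ ty (e (qq b) b) = q := by
    intro q hq b hb
    rw [hqu q hq b hb]
    have := (he q hq).1 (mem_coe.2 hb)
    rwa [mem_coe, mem_filter] at this
  refine ⟨fun b => e (qq b) b, ?_, hg, ?_⟩
  · intro x hx y hy hxy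
    obtain ⟨q, hq, hxq⟩ := mem_biUnion.1 (mem_coe.1 hx)
    obtain ⟨q', hq', hyq⟩ := mem_biUnion.1 (mem_coe.1 hy)
    beta_reduce at hxy
    have h3 := (hg q hq x hxq).2
    have h4 := (hg q' hq' y hyq).2
    rw [hxy, h4] at h3
    subst h3
    rw [hqu _ hq x hxq, hqu _ hq y hyq] at hxy
    exact (he _ hq).2.1 (mem_coe.2 hxq) (mem_coe.2 hyq) hxy
  · ext z
    simp only [mem_image]
    constructor
    · intro hz
      have hq := hty z hz
      obtain ⟨b, hb, hbz⟩ := (he _ hq).2.2 (mem_coe.2 (mem_filter.2 ⟨hz, rfl⟩))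
      refine ⟨b, mem_biUnion.2 ⟨_, hq, hb⟩, ?_⟩
      rw [hqu _ hq b hb, hbz]
    · rintro ⟨b, hb, rfl⟩
      obtain ⟨q, hq, hbq⟩ := mem_biUnion.1 hb
      exact (hg q hq b hbq).1

end Stages

section Cover
open Finset
set_option linter.unusedSectionVars false

variable {U V ι : Type} [Fintype U] [Fintype V] [Fintype ι]

/-- The numerical hypotheses under which families of tiles of order at most `w` can be embedded
greedily. -/
structure Fits (Δ' : ℕ) (d ε γ m w : ℝ) : Prop where
  size : w ≤ γ * (d / 2) ^ Δ' * m / 4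
  eps : 4 * (Δ' + 1) * ε ≤ γ * (d / 2) ^ (Δ' + 1)
  weight : (2 * ε / (γ * (d / 2) ^ Δ')) * Δ' < 1 / 3
  d_pos : 0 < d
  d_le : d ≤ 1
  γ_pos : 0 < γ
  m_pos : 0 < m
  ε_nonneg : 0 ≤ ε

lemma sum_typed {Q : Type} (Z : Finset V) (ty : V → Q) (P : Finset Q) (C : ℕ) (w : ℝ) :
    ∑ q ∈ P, ((C * #(Z.filter fun z => ty z = q) : ℕ) + w) =
      (C * #(Z.filter fun z => ty z ∈ P) : ℕ) + #P * w := by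
  rw [sum_add_distrib, sum_const, nsmul_eq_mul]
  congr 1
  norm_cast
  rw [← mul_sum]
  congr 1
  rw [card_eq_sum_card_fiberwise (s := Z.filter fun z => ty z ∈ P) (t := P) (f := ty)]
  · refine sum_congr rfl fun q hq => ?_
    congr 1
    ext z
    simp only [mem_filter]
    constructor
    · rintro ⟨h1, h2⟩
      exact ⟨⟨h1, h2 ▸ hq⟩, h2⟩
    · rintro ⟨⟨h1, -⟩, h2⟩
      exact ⟨h1, h2⟩
  · intro z hz
    exact (mem_filter.1 hz).2

/-- A given set `Z` of vertices with large degree into suitable clusters can be covered by few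
tiles. -/
lemma cover_stage [Nonempty ι] {G : SimpleGraph V} {H : SimpleGraph U} {Cl : ι → Finset V}
    {R : SimpleGraph ι} {D : ι → ι → ℝ} {d ε m γ : ℝ} (hR : Reg G Cl R D d ε m) {Δ' w k : ℕ}
    (hdeg : ∀ x, #(nb H x) ≤ Δ') (hfit : Fits Δ' d ε γ m w) (hk : 0 < k) {col : U → ℕ}
    (hcol : ∀ x, col x < k) (hproper : ∀ x y, H.Adj x y → col x ≠ col y) {F : Finset (Finset U)}
    (hdis : (F : Set (Finset U)).PairwiseDisjoint id) (hcl : ∀ T ∈ F, Clsd H T)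
    (hw : ∀ T ∈ F, #T ≤ w) {Z Av : Finset V} {σ : V → ℕ → ι}
    (hσ : ∀ z ∈ Z, Clq R k (σ z))
    (hN : ∀ z ∈ Z, ∀ l < k - 1, d * m ≤ #(nb G z ∩ Cl (σ z l))) {Cap : ℕ}
    (hCap : ∀ j, #(Z.filter fun z => ∃ l < k, σ z l = j) ≤ Cap) {s : ℝ}
    (hs : (k * (Δ' ^ 2 + 1) * Cap : ℕ) + (Fintype.card ι : ℝ) ^ k * w ≤ s)
    (hAv : ∀ j, #(Cl j ∩ (Av ∪ Z)) + γ * m + s ≤ d * m)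
    (hmass : (k * (Δ' ^ 2 + 1) * #Z : ℕ) + (Fintype.card ι : ℝ) ^ k * w ≤ #(F.biUnion id))
    (v0 : U → V) :
    ∃ F2 ⊆ F, ∃ f : U → V, EmbOn G H (F2.biUnion id) f ∧ Z ⊆ (F2.biUnion id).image f ∧
      ((F2.biUnion id).image f ∩ Av ⊆ Z) ∧
      ∀ j, (#(((F2.biUnion id).image f ∩ Cl j) \ Z) : ℝ) ≤ s := by
  obtain ⟨Q, ty, σ', hσty, hcardP⟩ : ∃ (Q : Type) (ty : V → Q) (σ' : Q → ℕ → ι),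
      (∀ z, ∀ l < k, σ' (ty z) l = σ z l) ∧
      ∀ P : Finset Q, (#P : ℝ) * w ≤ (Fintype.card ι : ℝ) ^ k * w := by
    refine ⟨Fin k → ι, fun z l => σ z l,
      fun q l => if h : l < k then q ⟨l, h⟩ else Classical.arbitrary ι, ?_, ?_⟩
    · intro z l hl
      simp only [dif_pos hl]
    · intro P
      refine mul_le_mul_of_nonneg_right ?_ (Nat.cast_nonneg _)
      have h1 := card_le_univ P
      rw [Fintype.card_fun, Fintype.card_fin] at h1
      exact_mod_cast h1
  obtain ⟨F2, φ, B, hF2, hom, hBd, hBsub, hB, hsep, hBB, hload⟩ := select_stage hdeg hk hcol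
    hproper hdis hcl hw (Z.image ty) (fun q => #(Z.filter fun z => ty z = q)) σ' (by
      intro q hq
      obtain ⟨z, hz, rfl⟩ := mem_image.1 hq
      intro a ha b hb hab
      rw [hσty z a ha, hσty z b hb]
      exact hσ z hz a ha b hb hab) (by
      rw [sum_typed]
      refine le_trans (add_le_add ?_ (hcardP _)) hmass
      exact_mod_cast Nat.mul_le_mul_left _ (card_le_card (filter_subset _ _)))
  set Bf := (Z.image ty).biUnion B with hBf
  set S := F2.biUnion id with hS
  have hload' : ∀ j, (#(S.filter fun x => φ x = j) : ℝ) ≤ s := by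
    intro j
    refine (hload j).trans ?_
    rw [sum_typed]
    refine le_trans (add_le_add ?_ (hcardP _)) hs
    refine Nat.cast_le.2 (Nat.mul_le_mul_left _ ((card_le_card ?_).trans (hCap j)))
    intro z hz
    rw [mem_filter, mem_filter] at hz
    obtain ⟨hz, -, l, hl, hl2⟩ := hz
    rw [hσty z l hl] at hl2
    exact mem_filter.2 ⟨hz, l, hl, hl2⟩
  obtain ⟨g, hginj, hgB, hgZ⟩ := exists_typed_bij (Qs := Z.image ty) (B := B) (Z := Z) (ty := ty) v0
    hBd (fun z hz => mem_image_of_mem _ hz) (fun q hq => (hB q hq).1)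
  have hd2 : d * m ≤ m := by
    have := mul_le_mul_of_nonneg_right hfit.d_le hfit.m_pos.le
    linarith
  have hbig : ∀ x, ∃ Y ⊆ Cl (φ x), d * m ≤ (#Y : ℝ) ∧
      ∀ v ∈ Y, ∀ b ∈ Bf, H.Adj x b → G.Adj (g b) v := by
    intro x
    by_cases hx : ∃ b ∈ Bf, H.Adj x b
    · obtain ⟨b, hb, hxb⟩ := hx
      obtain ⟨q, hq, hbq⟩ := mem_biUnion.1 hb
      obtain ⟨l, hl, hφ⟩ := (hB q hq).2.2 b hbq x hxb.symm
      obtain ⟨hgZ1, hgq⟩ := hgB q hq b hbq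
      refine ⟨nb G (g b) ∩ Cl (φ x), inter_subset_right, ?_, ?_⟩
      · have := hN (g b) hgZ1 l hl
        rw [← hσty _ l (by omega), hgq, ← hφ] at this
        exact this
      · intro v hv b' hb' hxb'
        have := hsep x b hb b' hb' hxb hxb'
        subst this
        exact mem_nb.1 (mem_inter.1 hv).1
    · refine ⟨Cl (φ x), subset_rfl, hd2.trans (hR.low _), ?_⟩
      intro v _ b hb hxb
      exact (hx ⟨b, hb, hxb⟩).elim
  choose Y hYsub hYcard hYadj using hbig
  obtain ⟨f, hf⟩ := family_embed hR Δ' hdeg (A := Cl) (fun i => subset_rfl) (F := F2) (X := Bf)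
    (Bf := ∅) (φ := φ) (w := w) (hdis.subset (coe_subset.2 hF2))
    (fun T hT => hcl T (hF2 hT)) (fun T hT => Nat.cast_le.2 (hw T (hF2 hT))) hom (by simp) (by simp)
    (Base := fun x => Y x \ (Av ∪ Z)) (fun x _ => sdiff_subset.trans (hYsub x)) (by
      intro x _
      have h1 := hAv (φ x)
      have h2 : (#((S \ Bf).filter fun y => φ y = φ x) : ℝ) ≤ s :=
        le_trans (Nat.cast_le.2 (card_le_card (filter_subset_filter _ sdiff_subset)))
          (hload' (φ x))
      have h3 : #(Y x) ≤ #(Y x \ (Av ∪ Z)) + #(Cl (φ x) ∩ (Av ∪ Z)) := by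
        rw [← card_sdiff_add_card_inter (Y x) (Av ∪ Z)]
        exact Nat.add_le_add_left (card_le_card (inter_subset_inter_right (hYsub x))) _
      have h4 : (#(Y x) : ℝ) ≤ #(Y x \ (Av ∪ Z)) + #(Cl (φ x) ∩ (Av ∪ Z)) := by exact_mod_cast h3
      have h5 := hYcard x
      linarith)
    hfit.size hfit.eps hfit.weight hfit.d_pos hfit.d_le hfit.γ_pos hfit.m_pos hfit.ε_nonneg v0
  have hmem : ∀ x ∈ S \ Bf, f x ∈ Y x ∧ f x ∉ Av ∧ f x ∉ Z := by
    intro x hx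
    have := hf.mem x hx
    rw [mem_sdiff, mem_union, not_or] at this
    exact this
  have hgmem : ∀ b ∈ Bf, g b ∈ Z := by
    intro b hb
    obtain ⟨q, hq, hbq⟩ := mem_biUnion.1 hb
    exact (hgB q hq b hbq).1
  refine ⟨F2, hF2, fun x => if x ∈ Bf then g x else f x, ?_, ?_, ?_, ?_⟩
  · refine EmbOn.extend ⟨hf.inj, hf.edge⟩ hginj hBB ?_ ?_
    · intro b hb x hx hbx
      have hx' : x ∈ S \ Bf := mem_sdiff.2 ⟨hx, hBB b hb x hbx⟩
      exact hYadj x (f x) (hmem x hx').1 b hb hbx.symm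
    · intro x hx b hb h
      exact (hmem x hx).2.2 (h ▸ hgmem b hb)
  · intro z hz
    rw [hgZ] at hz
    obtain ⟨b, hb, rfl⟩ := mem_image.1 hz
    refine mem_image.2 ⟨b, hBsub hb, ?_⟩
    rw [if_pos hb]
  · intro v hv
    rw [mem_inter, mem_image] at hv
    obtain ⟨⟨x, hx, rfl⟩, hA⟩ := hv
    by_cases hxB : x ∈ Bf
    · rw [if_pos hxB]
      exact hgmem x hxB
    · rw [if_neg hxB] at hA
      exact ((hmem x (mem_sdiff.2 ⟨hx, hxB⟩)).2.1 hA).elim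
  · intro j
    refine le_trans (Nat.cast_le.2 ?_) (hload' j)
    refine (card_le_card (t := ((S.filter fun x => φ x = j)).image f) ?_).trans card_image_le
    intro v hv
    rw [mem_sdiff, mem_inter, mem_image] at hv
    obtain ⟨⟨⟨x, hx, rfl⟩, hj⟩, hZ⟩ := hv
    by_cases hxB : x ∈ Bf
    · rw [if_pos hxB] at hZ
      exact (hZ (hgmem x hxB)).elim
    · rw [if_neg hxB] at hj ⊢
      refine mem_image.2 ⟨x, mem_filter.2 ⟨hx, ?_⟩, rfl⟩
      by_contra hne
      exact disjoint_left.1 (hR.disj _ _ hne)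
        (hYsub x (hmem x (mem_sdiff.2 ⟨hx, hxB⟩)).1) hj

/-- Tiles whose cluster loads match the available space are embedded. -/
lemma exact_stage {G : SimpleGraph V} {H : SimpleGraph U} {Cl : ι → Finset V}
    {R : SimpleGraph ι} {D : ι → ι → ℝ} {d ε m γ : ℝ} (hR : Reg G Cl R D d ε m) {Δ' w : ℕ}
    (hdeg : ∀ x, #(nb H x) ≤ Δ') (hfit : Fits Δ' d ε γ m w) {F : Finset (Finset U)}
    (hdis : (F : Set (Finset U)).PairwiseDisjoint id) (hcl : ∀ T ∈ F, Clsd H T)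
    (hw : ∀ T ∈ F, #T ≤ w) {cap : ι → ℕ} {free : ι → Finset V} (hfree : ∀ j, free j ⊆ Cl j)
    (hach : Ach H R (F.biUnion id) fun j => (cap j : ℤ))
    (hcap : ∀ j, γ * m + cap j ≤ #(free j)) (v0 : U → V) :
    ∃ f : U → V, EmbOn G H (F.biUnion id) f ∧ (∀ x ∈ F.biUnion id, ∃ j, f x ∈ free j) ∧
      ∀ j, #((F.biUnion id).image f ∩ Cl j) = cap j := by
  obtain ⟨φ, hom, hcnt⟩ := hach
  have hcnt' : ∀ j, #((F.biUnion id).filter fun x => φ x = j) = cap j := by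
    intro j
    have := hcnt j
    beta_reduce at this
    exact_mod_cast this
  obtain ⟨f, hf⟩ := family_embed hR Δ' hdeg (A := Cl) (fun i => subset_rfl) (F := F) (X := ∅)
    (Bf := ∅) (φ := φ) (w := w) hdis
    (fun T hT => hcl T hT) (fun T hT => Nat.cast_le.2 (hw T hT))
    (fun T hT x hx y hy hxy => hom x (mem_biUnion.2 ⟨T, hT, hx⟩) y (mem_biUnion.2 ⟨T, hT, hy⟩) hxy)
    (by simp) (by simp) (Base := fun x => free (φ x)) (fun x _ => hfree (φ x)) (by
      intro x _
      rw [sdiff_empty, hcnt']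
      exact hcap (φ x))
    hfit.size hfit.eps hfit.weight hfit.d_pos hfit.d_le hfit.γ_pos hfit.m_pos hfit.ε_nonneg v0
  have hinj := hf.inj
  have hmem := hf.mem
  have hedge := hf.edge
  rw [sdiff_empty] at hinj hmem hedge
  refine ⟨f, ⟨hinj, hedge⟩, fun x hx => ⟨_, hmem x hx⟩, fun j => ?_⟩
  rw [← hcnt' j, ← card_image_of_injOn (hinj.mono (coe_subset.2 (filter_subset (fun x => φ x = j) _)))]
  congr 1
  ext v
  simp only [mem_inter, mem_image, mem_filter]
  constructor
  · rintro ⟨⟨x, hx, rfl⟩, hj⟩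
    refine ⟨x, ⟨hx, ?_⟩, rfl⟩
    by_contra hne
    exact disjoint_left.1 (hR.disj _ _ hne) (hfree _ (hmem x hx)) hj
  · rintro ⟨x, ⟨hx, rfl⟩, rfl⟩
    exact ⟨⟨x, hx, rfl⟩, hfree _ (hmem x hx)⟩

end Cover

section Buffers
open Finset
set_option linter.unusedSectionVars false

variable {U V ι : Type} [Fintype U] [Fintype V] [Fintype ι]

/-- From pseudorandom pair correlations to expansion of the candidate sets. -/
lemma expansion_of_pairs {Y : Finset V} {B : Finset U} {C : U → Finset V} {m η w β p₀ : ℝ}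
    (hm : 0 < m) (hp₀ : 0 < p₀) (hβ : 0 < β) (hη : 0 ≤ η)
    (hYm : m ≤ #Y) (hCY : ∀ b ∈ B, C b ⊆ Y) (hC : ∀ b ∈ B, p₀ / 2 * #Y ≤ #(C b))
    (hpair : ∑ b ∈ B, ∑ b' ∈ B, max 0 ((#(C b ∩ C b') : ℝ) - #(C b) * #(C b') / #Y) ≤
      m * (η * (#B : ℝ) ^ 2 + 2 * w * #B))
    (hB : β * m ≤ #B) (hB2 : (#B : ℝ) ≤ 2 * m) (hw : 2 * w ≤ η * (β * m)) :
    (#(Y.filter fun v => (#(B.filter fun b => v ∈ C b) : ℝ) ≤ p₀ / 4 * #B) : ℝ) ≤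
        32 * η / p₀ ^ 2 * m ∧
      ∀ δ : ℝ, 0 < δ → 256 * η ≤ p₀ ^ 2 * δ ^ 3 → ∀ S ⊆ B, δ * m ≤ #S →
        (#(Y.filter fun v => ∀ b ∈ S, v ∉ C b) : ℝ) < δ * m := by
  have hY : 0 < #Y := by
    have : (0 : ℝ) < #Y := hm.trans_le hYm
    exact_mod_cast this
  have hB0 : (0 : ℝ) < #B := (mul_pos hβ hm).trans_le hB
  have hpair' : ∑ b ∈ B, ∑ b' ∈ B, max 0 ((#(C b ∩ C b') : ℝ) - #(C b) * #(C b') / #Y) ≤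
      2 * η * m * (#B : ℝ) ^ 2 := by
    refine hpair.trans ?_
    have h1 : 2 * w * #B ≤ η * (#B : ℝ) * #B := by
      refine mul_le_mul_of_nonneg_right (hw.trans (mul_le_mul_of_nonneg_left hB hη)) hB0.le
    have h2 := mul_le_mul_of_nonneg_left h1 hm.le
    nlinarith
  have hsub : ∀ S ⊆ B,
      ∑ b ∈ S, ∑ b' ∈ S, max 0 ((#(C b ∩ C b') : ℝ) - #(C b) * #(C b') / #Y) ≤
        2 * η * m * (#B : ℝ) ^ 2 := by
    intro S hS
    refine le_trans ?_ hpair'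
    refine le_trans (sum_le_sum fun b _ =>
      sum_le_sum_of_subset_of_nonneg hS fun _ _ _ => le_max_left _ _) ?_
    exact sum_le_sum_of_subset_of_nonneg hS fun _ _ _ =>
      sum_nonneg fun _ _ => le_max_left _ _
  constructor
  · have h1 := (second_moment hY hCY (by positivity : (0 : ℝ) ≤ p₀ / 2) hC).trans hpair'
    have h2 : p₀ / 2 / 2 = p₀ / 4 := by ring
    rw [h2] at h1
    set X := (#(Y.filter fun v => (#(B.filter fun b => v ∈ C b) : ℝ) ≤ p₀ / 4 * #B) : ℝ)
    have h3 : X * (p₀ / 2 * #B / 2) ^ 2 = X * p₀ ^ 2 / 16 * (#B : ℝ) ^ 2 := by ring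
    rw [h3] at h1
    have h4 : X * p₀ ^ 2 / 16 ≤ 2 * η * m := le_of_mul_le_mul_right h1 (by positivity)
    rw [div_mul_eq_mul_div, le_div_iff₀ (by positivity)]
    linarith
  · intro δ hδ hηδ S hS hSδ
    have hδm : 0 < δ * m := mul_pos hδ hm
    have h1 := (second_moment hY (fun b hb => hCY b (hS hb)) (by positivity : (0 : ℝ) ≤ p₀ / 2)
      (fun b hb => hC b (hS hb))).trans (hsub S hS)
    have h2 : (#(Y.filter fun v => ∀ b ∈ S, v ∉ C b) : ℝ) ≤
        #(Y.filter fun v => (#(S.filter fun b => v ∈ C b) : ℝ) ≤ p₀ / 2 / 2 * #S) := by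
      refine Nat.cast_le.2 (card_le_card fun v hv => ?_)
      rw [mem_filter] at hv ⊢
      refine ⟨hv.1, ?_⟩
      rw [filter_false_of_mem hv.2, card_empty, Nat.cast_zero]
      positivity
    refine h2.trans_lt ?_
    set X := (#(Y.filter fun v => (#(S.filter fun b => v ∈ C b) : ℝ) ≤ p₀ / 2 / 2 * #S) : ℝ)
    by_contra hcon
    push Not at hcon
    have h3 : p₀ / 2 * (δ * m) / 2 ≤ p₀ / 2 * #S / 2 := by
      have := mul_le_mul_of_nonneg_left hSδ hp₀.le
      linarith
    have h4 : δ * m * (p₀ / 2 * (δ * m) / 2) ^ 2 ≤ X * (p₀ / 2 * #S / 2) ^ 2 :=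
      mul_le_mul hcon (pow_le_pow_left₀ (by positivity) h3 2) (by positivity) (hδm.le.trans hcon)
    have h5 : 2 * η * m * (#B : ℝ) ^ 2 ≤ 2 * η * m * (2 * m) ^ 2 :=
      mul_le_mul_of_nonneg_left (pow_le_pow_left₀ hB0.le hB2 2) (by positivity)
    have h6 : δ * m * (p₀ / 2 * (δ * m) / 2) ^ 2 = p₀ ^ 2 * δ ^ 3 * m ^ 3 / 16 := by ring
    have h7 : 2 * η * m * (2 * m) ^ 2 = 8 * η * m ^ 3 := by ring
    have h8 : p₀ ^ 2 * δ ^ 3 * m ^ 3 / 16 ≤ 8 * η * m ^ 3 := by linarith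
    have hm3 : 0 < m ^ 3 := by positivity
    have h9 : p₀ ^ 2 * δ ^ 3 ≤ 128 * η := by
      refine le_of_mul_le_mul_right ?_ hm3
      linarith
    have h10 : 0 < p₀ ^ 2 * δ ^ 3 := by positivity
    linarith

/-- The pseudorandomness parameter produced by the greedy embedding. -/
noncomputable def pairErr (Δ' : ℕ) (d ε γ : ℝ) : ℝ :=
  2 * Δ' * ε + 6 * ((2 * ε / (γ * (d / 2) ^ Δ')) * Δ')

/-- Every cluster receives a set of buffer vertices with well expanding candidate sets. -/
lemma buffer_stage [Nonempty ι] {G : SimpleGraph V} {H : SimpleGraph U} {Cl : ι → Finset V}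
    {R : SimpleGraph ι} {D : ι → ι → ℝ} {d ε m γ : ℝ} (hR : Reg G Cl R D d ε m) {Δ' w k : ℕ}
    (hdeg : ∀ x, #(nb H x) ≤ Δ') (hfit : Fits Δ' d ε γ m w) (hk : 0 < k) {col : U → ℕ}
    (hcol : ∀ x, col x < k) (hproper : ∀ x y, H.Adj x y → col x ≠ col y) {F : Finset (Finset U)}
    (hdis : (F : Set (Finset U)).PairwiseDisjoint id) (hcl : ∀ T ∈ F, Clsd H T)
    (hw : ∀ T ∈ F, #T ≤ w) {A : ι → Finset V} (hA : ∀ i, A i ⊆ Cl i) {NB : ℕ} {β η : ℝ}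
    (hβ : 0 < β) (hNB : β * m ≤ NB) (hNB2 : (NB : ℝ) ≤ 2 * m) (hA1 : ∀ i, β * m / 4 ≤ #(A i))
    {σ : ι → ℕ → ι} (hσ : ∀ i, Clq R k (σ i)) (hσi : ∀ i, σ i (k - 1) = i) {Cap : ℕ}
    (hCap : ∀ j, #(univ.filter fun i => ∃ l < k, σ i l = j) ≤ Cap) {s : ℝ}
    (hs : (Cap : ℝ) * ((k * (Δ' ^ 2 + 1) * NB : ℕ) + (w : ℝ)) ≤ s)
    (hbase : ∀ i, γ * m + s + #(A i) ≤ m)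
    (hmass : (Fintype.card ι : ℝ) * ((k * (Δ' ^ 2 + 1) * NB : ℕ) + (w : ℝ)) ≤ #(F.biUnion id))
    (hε1 : Δ' * ε ≤ d ^ Δ' / 2) (hε2 : Δ' * ε ≤ d ^ Δ' * β / 8) (hη : pairErr Δ' d ε γ ≤ η)
    (hη0 : 0 ≤ η) (hwη : 2 * w ≤ η * (β * m)) (v0 : U → V) :
    ∃ F1 ⊆ F, ∃ (B : ι → Finset U) (f : U → V) (C : U → Finset V),
      (∀ i j, i ≠ j → Disjoint (B i) (B j)) ∧ (univ.biUnion B ⊆ F1.biUnion id) ∧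
      (∀ i, #(B i) = NB) ∧ EmbOn G H (F1.biUnion id \ univ.biUnion B) f ∧
      (∀ b ∈ univ.biUnion B, ∀ x, H.Adj b x → x ∉ univ.biUnion B) ∧
      (∀ x ∈ F1.biUnion id \ univ.biUnion B, ∃ j, f x ∈ Cl j \ A j) ∧
      (∀ j, (#((F1.biUnion id \ univ.biUnion B).image f ∩ Cl j) : ℝ) ≤ s) ∧
      (∀ i, ∀ b ∈ B i, C b ⊆ Cl i ∧ ∀ v ∈ C b, ∀ x, H.Adj b x → G.Adj v (f x)) ∧
      (∀ i, ∀ b ∈ B i, d ^ Δ' * β / 8 * m ≤ #(C b ∩ A i)) ∧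
      (∀ i, (#((Cl i).filter fun v => (#((B i).filter fun b => v ∈ C b) : ℝ) ≤
        d ^ Δ' / 4 * NB) : ℝ) ≤ 32 * η / (d ^ Δ') ^ 2 * m) ∧
      (∀ i, ∀ δ : ℝ, 0 < δ → 256 * η ≤ (d ^ Δ') ^ 2 * δ ^ 3 → ∀ S ⊆ B i, δ * m ≤ #S →
        (#((Cl i).filter fun v => ∀ b ∈ S, v ∉ C b) : ℝ) < δ * m) := by
  obtain ⟨F1, φ, B, hF1, hom, hBd, hBsub, hB, hsep, hBB, hload⟩ := select_stage hdeg hk hcol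
    hproper hdis hcl hw (univ : Finset ι) (fun _ => NB) σ (fun i _ => hσ i) (by
      rw [sum_const, nsmul_eq_mul]
      exact hmass)
  set Bf := (univ : Finset ι).biUnion B with hBf
  set S := F1.biUnion id with hS
  have hload' : ∀ j, (#(S.filter fun x => φ x = j) : ℝ) ≤ s := by
    intro j
    refine (hload j).trans (le_trans ?_ hs)
    rw [sum_const, nsmul_eq_mul]
    refine mul_le_mul_of_nonneg_right (Nat.cast_le.2 (hCap j)) (by positivity)
  obtain ⟨f, hf⟩ := family_embed hR Δ' hdeg hA (F := F1) (X := Bf)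
    (Bf := Bf) (φ := φ) (w := w) (hdis.subset (coe_subset.2 hF1))
    (fun T hT => hcl T (hF1 hT)) (fun T hT => Nat.cast_le.2 (hw T (hF1 hT))) hom hBB hsep
    (Base := fun x => Cl (φ x) \ A (φ x)) (fun x _ => sdiff_subset) (by
      intro x _
      have h1 := hbase (φ x)
      have h2 : (#((S \ Bf).filter fun y => φ y = φ x) : ℝ) ≤ s :=
        le_trans (Nat.cast_le.2 (card_le_card (filter_subset_filter _ sdiff_subset)))
          (hload' (φ x))
      have h3 : (#(Cl (φ x) \ A (φ x)) : ℝ) + #(A (φ x)) = #(Cl (φ x)) := by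
        exact_mod_cast card_sdiff_add_card_eq_card (hA (φ x))
      have h5 := hR.low (φ x)
      linarith)
    hfit.size hfit.eps hfit.weight hfit.d_pos hfit.d_le hfit.γ_pos hfit.m_pos hfit.ε_nonneg v0
  have hd0 := hfit.d_pos
  have hm0 := hfit.m_pos
  have hφB : ∀ i, ∀ b ∈ B i, φ b = i := by
    intro i b hb
    rw [(hB i (mem_univ i)).2.1 b hb, hσi]
  have hfilt : ∀ i, (Bf ∩ S).filter (fun b => φ b = i) = B i := by
    intro i
    ext b
    rw [mem_filter, mem_inter, mem_biUnion]
    constructor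
    · rintro ⟨⟨⟨j, -, hb⟩, -⟩, hφ⟩
      rwa [← hφ, hφB j b hb]
    · intro hb
      exact ⟨⟨⟨i, mem_univ _, hb⟩, hBsub (mem_biUnion.2 ⟨i, mem_univ _, hb⟩)⟩, hφB i b hb⟩
  have hpow : ∀ i, ∀ b ∈ B i, ∀ Y : Finset V, d ^ Δ' * #Y ≤
      (∏ x ∈ nb H b, D (φ x) (φ b)) * #Y := by
    intro i b hb Y
    refine mul_le_mul_of_nonneg_right ?_ (Nat.cast_nonneg _)
    have hbS : b ∈ S := hBsub (mem_biUnion.2 ⟨i, mem_univ _, hb⟩)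
    obtain ⟨T, hT, hbT⟩ := mem_biUnion.1 hbS
    have h1 : ∀ x ∈ nb H b, d ≤ D (φ x) (φ b) := by
      intro x hx
      rw [mem_nb] at hx
      exact (hR.dens _ _ (hom T hT x (hcl T (hF1 hT) b hbT x hx) b hbT hx.symm)).1
    calc d ^ Δ' ≤ d ^ #(nb H b) := pow_le_pow_of_le_one hd0.le hfit.d_le (hdeg b)
      _ = ∏ x ∈ nb H b, d := by rw [prod_const]
      _ ≤ _ := prod_le_prod (fun _ _ => hd0.le) h1
  have herr : ∀ b, (#(nb H b) : ℝ) * (ε * m) ≤ Δ' * ε * m := by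
    intro b
    have h1 : (#(nb H b) : ℝ) ≤ Δ' := Nat.cast_le.2 (hdeg b)
    have h2 := mul_le_mul_of_nonneg_right h1 (mul_nonneg hfit.ε_nonneg hm0.le)
    linarith
  have hBmem : ∀ i, ∀ b ∈ B i, b ∈ Bf ∩ S := fun i b hb =>
    mem_inter.2 ⟨mem_biUnion.2 ⟨i, mem_univ _, hb⟩, hBsub (mem_biUnion.2 ⟨i, mem_univ _, hb⟩)⟩
  have hexp := fun i => expansion_of_pairs (Y := Cl i) (B := B i)
    (C := fun b => bufC G H Cl f (φ b) b) (m := m) (η := η) (w := w) (β := β) (p₀ := d ^ Δ')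
    hm0 (by positivity) hβ hη0 (hR.low i)
    (by
      intro b hb
      rw [hφB i b hb]
      exact cn_subset _ _ _ _)
    (by
      intro b hb
      have h1 := (abs_le.1 (hf.passCl b (hBmem i b hb))).1
      have h2 := hpow i b hb (Cl (φ b))
      have h3 := herr b
      rw [bufC]
      rw [hφB i b hb] at *
      have h4 := mul_le_mul_of_nonneg_right hε1 hm0.le
      have h5 := mul_le_mul_of_nonneg_left (hR.low i) (by positivity : 0 ≤ d ^ Δ' / 2)
      linarith)
    (by
      have h1 := hf.pair i
      rw [hfilt] at h1
      have h2 : ∑ b ∈ B i, ∑ b' ∈ B i, max 0 ((#(bufC G H Cl f (φ b) b ∩ bufC G H Cl f (φ b') b') : ℝ)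
          - #(bufC G H Cl f (φ b) b) * #(bufC G H Cl f (φ b') b') / #(Cl i)) =
          ∑ b ∈ B i, ∑ b' ∈ B i, bufQ G H Cl f i b b' := by
        refine sum_congr rfl fun b hb => sum_congr rfl fun b' hb' => ?_
        rw [hφB i b hb, hφB i b' hb', bufQ]
      rw [h2]
      refine h1.trans (mul_le_mul_of_nonneg_left ?_ hm0.le)
      have := mul_le_mul_of_nonneg_right hη (sq_nonneg (#(B i) : ℝ))
      rw [pairErr] at this
      linarith)
    (by rw [(hB i (mem_univ i)).1]; exact hNB)
    (by rw [(hB i (mem_univ i)).1]; exact hNB2) hwη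
  refine ⟨F1, hF1, B, f, fun b => bufC G H Cl f (φ b) b,
    fun i j hij => hBd (mem_coe.2 (mem_univ i)) (mem_coe.2 (mem_univ j)) hij, hBsub,
    fun i => (hB i (mem_univ i)).1, ⟨hf.inj, hf.edge⟩, hBB, fun x hx => ⟨φ x, hf.mem x hx⟩,
    ?_, ?_, ?_, ?_, fun i => (hexp i).2⟩
  · intro j
    refine le_trans (Nat.cast_le.2 ?_) (hload' j)
    refine (card_le_card (t := (S.filter fun x => φ x = j).image f) ?_).trans card_image_le
    intro v hv
    rw [mem_inter, mem_image] at hv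
    obtain ⟨⟨x, hx, rfl⟩, hj⟩ := hv
    refine mem_image.2 ⟨x, mem_filter.2 ⟨(mem_sdiff.1 hx).1, ?_⟩, rfl⟩
    by_contra hne
    exact disjoint_left.1 (hR.disj _ _ hne) (mem_sdiff.1 (hf.mem x hx)).1 hj
  · intro i b hb
    beta_reduce
    rw [hφB i b hb]
    refine ⟨cn_subset _ _ _ _, fun v hv x hbx => ?_⟩
    exact ((mem_filter.1 hv).2 x (mem_nb.2 hbx)).symm
  · intro i b hb
    have h1 := (abs_le.1 (hf.passA b (hBmem i b hb))).1
    have h2 := hpow i b hb (A (φ b))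
    have h3 := herr b
    beta_reduce
    have h6 : bufC G H Cl f (φ b) b ∩ A i = cn G f (nb H b) (A (φ b)) := by
      rw [hφB i b hb]
      ext v
      simp only [bufC, cn, mem_inter, mem_filter]
      constructor
      · rintro ⟨⟨-, h⟩, h'⟩
        exact ⟨h', h⟩
      · rintro ⟨h', h⟩
        exact ⟨⟨hA i h', h⟩, h'⟩
    rw [h6]
    have h4 := mul_le_mul_of_nonneg_right hε2 hm0.le
    have h5 := mul_le_mul_of_nonneg_left (hA1 (φ b)) (by positivity : 0 ≤ d ^ Δ')
    linarith
  · intro i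
    have := (hexp i).1
    rw [(hB i (mem_univ i)).1] at this
    exact this

end Buffers

section Finish
open Finset
set_option linter.unusedSectionVars false

variable {U V ι : Type} [Fintype U] [Fintype V] [Fintype ι]

/-- The buffer vertices are matched to the remaining vertices and the pieces are glued. -/
lemma finish_embedding {G : SimpleGraph V} {H : SimpleGraph U} {S1 S2 S3 : Finset U}
    (hS1 : Clsd H S1) (hS2 : Clsd H S2) (hS : S1 ∪ S2 ∪ S3 = univ) {B : ι → Finset U}
    (hBd : ∀ i j, i ≠ j → Disjoint (B i) (B j)) {f1 f2 f3 : U → V}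
    (hf1 : EmbOn G H (S1 \ univ.biUnion B) f1)
    (hBB : ∀ b ∈ univ.biUnion B, ∀ x, H.Adj b x → x ∉ univ.biUnion B)
    (hf2 : EmbOn G H S2 f2) (hf3 : EmbOn G H S3 f3)
    (h12 : Disjoint ((S1 \ univ.biUnion B).image f1) (S2.image f2))
    (h13 : Disjoint ((S1 \ univ.biUnion B).image f1) (S3.image f3))
    (h23 : Disjoint (S2.image f2) (S3.image f3))
    {L : ι → Finset V} (hLd : ∀ i j, i ≠ j → Disjoint (L i) (L j)) (hL : ∀ i, #(L i) = #(B i))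
    (hL1 : ∀ i, Disjoint (L i) ((S1 \ univ.biUnion B).image f1))
    (hL2 : ∀ i, Disjoint (L i) (S2.image f2)) (hL3 : ∀ i, Disjoint (L i) (S3.image f3))
    {C : U → Finset V} (hC : ∀ i, ∀ b ∈ B i, ∀ v ∈ C b, ∀ x, H.Adj b x → G.Adj v (f1 x)) {δ : ℝ}
    (h1 : ∀ i, ∀ b ∈ B i, δ ≤ #(C b ∩ L i))
    (h2 : ∀ i, ∀ v ∈ L i, δ ≤ #((B i).filter fun b => v ∈ C b))
    (h3 : ∀ i, ∀ S ⊆ B i, δ ≤ #S → (#((L i).filter fun v => ∀ b ∈ S, v ∉ C b) : ℝ) < δ) :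
    ∃ f : U → V, EmbOn G H univ f := by
  choose g hginj hgmem using fun i => hall_finish f1 (hL i) (h1 i) (h2 i)
    (fun S hS h => by convert h3 i S hS h)
  have hix : ∀ b, b ∈ univ.biUnion B → ∃ i, b ∈ B i := by
    intro b hb
    obtain ⟨i, -, hi⟩ := mem_biUnion.1 hb
    exact ⟨i, hi⟩
  obtain ⟨g', hg'⟩ : ∃ g' : U → V, ∀ i, ∀ b ∈ B i, g' b = g i b := by
    refine ⟨fun b => if h : ∃ i, b ∈ B i then g h.choose b else f1 b, fun i b hb => ?_⟩
    have h : ∃ i, b ∈ B i := ⟨i, hb⟩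
    beta_reduce
    rw [dif_pos h]
    have : h.choose = i := by
      by_contra hne
      exact disjoint_left.1 (hBd _ _ hne) h.choose_spec hb
    rw [this]
  have hg'L : ∀ i, ∀ b ∈ B i, g' b ∈ C b ∩ L i := fun i b hb => by
    rw [hg' i b hb]
    exact hgmem i b hb
  have hg'inj : Set.InjOn g' (univ.biUnion B : Finset U) := by
    intro x hx y hy hxy
    obtain ⟨i, hi⟩ := hix x hx
    obtain ⟨j, hj⟩ := hix y hy
    by_cases hij : i = j
    · subst hij
      rw [hg' i x hi, hg' i y hj] at hxy
      exact hginj i (mem_coe.2 hi) (mem_coe.2 hj) hxy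
    · have h4 := (mem_inter.1 (hg'L i x hi)).2
      rw [hxy] at h4
      exact (disjoint_left.1 (hLd i j hij) h4 (mem_inter.1 (hg'L j y hj)).2).elim
  have he1 := EmbOn.extend hf1 hg'inj hBB (by
      intro b hb x _ hbx
      obtain ⟨i, hi⟩ := hix b hb
      exact hC i b hi _ (mem_inter.1 (hg'L i b hi)).1 x hbx) (by
      intro x hx b hb h
      obtain ⟨i, hi⟩ := hix b hb
      refine disjoint_left.1 (hL1 i) (mem_inter.1 (hg'L i b hi)).2 ?_
      rw [← h]
      exact mem_image_of_mem _ hx)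
  have he1mem : ∀ x ∈ S1, (fun x => if x ∈ univ.biUnion B then g' x else f1 x) x ∈
      (S1 \ univ.biUnion B).image f1 ∪ univ.biUnion L := by
    intro x hx
    beta_reduce
    by_cases hxB : x ∈ univ.biUnion B
    · rw [if_pos hxB]
      obtain ⟨i, hi⟩ := hix x hxB
      exact mem_union_right _ (mem_biUnion.2 ⟨i, mem_univ _, (mem_inter.1 (hg'L i x hi)).2⟩)
    · rw [if_neg hxB]
      exact mem_union_left _ (mem_image_of_mem _ (mem_sdiff.2 ⟨hx, hxB⟩))
  have hdisj : ∀ T : Finset V, Disjoint ((S1 \ univ.biUnion B).image f1) T →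
      (∀ i, Disjoint (L i) T) → Disjoint ((S1 \ univ.biUnion B).image f1 ∪ univ.biUnion L) T := by
    intro T hT1 hT2
    rw [disjoint_union_left]
    exact ⟨hT1, (disjoint_biUnion_left _ _ _).2 fun i _ => hT2 i⟩
  have he2 := EmbOn.glue hS1 he1 hf2 (by
    intro x hx y hy h
    refine disjoint_left.1 (hdisj _ h12 hL2) (he1mem x hx) ?_
    beta_reduce
    rw [h]
    exact mem_image_of_mem _ hy)
  have he3 := EmbOn.glue (hS1.union hS2) he2 hf3 (by
    intro x hx y hy h
    by_cases hx1 : x ∈ S1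
    · rw [if_pos hx1] at h
      refine disjoint_left.1 (hdisj _ h13 hL3) (he1mem x hx1) ?_
      beta_reduce
      rw [h]
      exact mem_image_of_mem _ hy
    · rw [if_neg hx1] at h
      refine disjoint_left.1 h23 (mem_image_of_mem f2 ((mem_union.1 hx).resolve_left hx1)) ?_
      rw [h]
      exact mem_image_of_mem _ hy)
  rw [hS] at he3
  exact ⟨_, he3⟩

lemma containsCopy_of_embOn {n : ℕ} {G H : SimpleGraph (Fin n)} {f : Fin n → Fin n}
    (hf : EmbOn G H univ f) : ContainsCopy G H := by
  refine ⟨f, fun x y hxy => hf.1 (by simp) (by simp) hxy, fun {u v} huv => ?_⟩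
  exact hf.2 u (mem_univ _) v (mem_univ _) huv

/-- Every cluster lies in a clique of the reduced graph, with bounded loads. -/
lemma cluster_cliques [Nonempty ι] (p : ℕ) {R : SimpleGraph ι} {s : ι → ℝ} (hs : ∀ j, 0 ≤ s j)
    {n h θ B : ℝ} (hsB : ∀ j, s j ≤ B) (hB : 0 ≤ B) (hn : 0 ≤ n) (hsn : ∑ j, s j ≤ n)
    (hR : ∀ i, h * n ≤ ∑ j ∈ univ.filter (fun j => R.Adj i j), s j)
    (hθ : p + θ ≤ (p + 1) * h) {Cap : ℕ}
    (hCap : (p + 2) * Fintype.card ι * B < Cap * (θ * n)) :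
    ∃ σ : ι → ℕ → ι, (∀ i, Clq R (p + 2) (σ i)) ∧ (∀ i, σ i (p + 1) = i) ∧
      ∀ j, #(univ.filter fun i => ∃ l < p + 2, σ i l = j) ≤ Cap + 1 := by
  obtain ⟨σ, hσ, hload⟩ := clique_loads p hs hsB hB hn hsn hR hθ (univ : Finset ι)
    (Nb := fun i => univ.filter fun j => R.Adj i j) (fun i _ => hR i) (Cap := Cap)
    (by rw [card_univ]; exact hCap)
  have hnb : ∀ i, ∀ l < p + 1, R.Adj i (σ i l) := by
    intro i l hl
    have := (hσ i (mem_univ i)).2 l hl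
    exact (mem_filter.1 this).2
  refine ⟨fun i l => if l = p + 1 then i else σ i l, ?_, ?_, ?_⟩
  · intro i a ha b hb hab
    beta_reduce
    by_cases h1 : a = p + 1 <;> by_cases h2 : b = p + 1
    · omega
    · rw [if_pos h1, if_neg h2]
      exact hnb i b (by omega)
    · rw [if_neg h1, if_pos h2]
      exact (hnb i a (by omega)).symm
    · rw [if_neg h1, if_neg h2]
      exact (hσ i (mem_univ i)).1 a ha b hb hab
  · intro i
    simp
  · intro j
    refine (card_le_card (t := insert j (univ.filter fun i => ∃ l < p + 2, σ i l = j)) ?_).trans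
      ((card_insert_le _ _).trans (Nat.add_le_add_right (hload j) 1))
    intro i hi
    obtain ⟨-, l, hl, hl2⟩ := mem_filter.1 hi
    beta_reduce at hl2
    by_cases h1 : l = p + 1
    · rw [if_pos h1] at hl2
      exact mem_insert.2 (Or.inl hl2)
    · rw [if_neg h1] at hl2
      exact mem_insert_of_mem (mem_filter.2 ⟨mem_univ _, l, hl, hl2⟩)

end Finish

section Partial
open Finset
set_option linter.unusedSectionVars false

variable {U V ι : Type} [Fintype U] [Fintype V] [Fintype ι]

lemma exists_reserved {Cl : ι → Finset V} {m β : ℝ} (hlow : ∀ i, m ≤ #(Cl i)) (hβ : 0 < β)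
    (hβ1 : β ≤ 1) (hβm : 4 ≤ β * m) :
    ∃ A : ι → Finset V, (∀ i, A i ⊆ Cl i) ∧ (∀ i, β * m / 4 ≤ #(A i)) ∧
      ∀ i, (#(A i) : ℝ) ≤ β * m / 2 := by
  have hm : 0 < m := by
    by_contra h
    have := mul_nonneg hβ.le (neg_nonneg.2 (not_lt.1 h))
    linarith
  have hf1 : ((⌊β * m / 2⌋₊ : ℕ) : ℝ) ≤ β * m / 2 := Nat.floor_le (by linarith)
  have hf2 := Nat.lt_floor_add_one (β * m / 2)
  have h : ∀ i, ∃ A ⊆ Cl i, #A = ⌊β * m / 2⌋₊ := fun i => by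
    refine exists_subset_card_eq ?_
    have h1 : β * m / 2 ≤ m := by
      have := mul_le_mul_of_nonneg_right hβ1 hm.le
      linarith
    exact_mod_cast (hf1.trans h1).trans (hlow i)
  choose A hA hAc using h
  refine ⟨A, hA, fun i => ?_, fun i => ?_⟩
  · rw [hAc]
    linarith
  · rw [hAc]
    exact hf1

/-- Sizes of the clusters add up. -/
lemma Reg.card_mul_le {G : SimpleGraph V} {Cl : ι → Finset V} {R : SimpleGraph ι} {D : ι → ι → ℝ}
    {d ε m : ℝ} (hR : Reg G Cl R D d ε m) : Fintype.card ι * m ≤ Fintype.card V := by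
  have h1 : #(univ.biUnion Cl) = ∑ i, #(Cl i) := card_biUnion fun i _ j _ hij => hR.disj i j hij
  have h2 : ∑ _i : ι, m ≤ ∑ i, (#(Cl i) : ℝ) := sum_le_sum fun i _ => hR.low i
  rw [sum_const, card_univ, nsmul_eq_mul] at h2
  have h3 : #(univ.biUnion Cl) ≤ Fintype.card V := card_le_univ _
  rw [h1] at h3
  have h4 : (∑ i, (#(Cl i) : ℝ)) ≤ Fintype.card V := by exact_mod_cast h3
  linarith

/-- Everything except the bulk of the tiles and the buffer vertices has been embedded. -/
structure Partial (G : SimpleGraph V) (H : SimpleGraph U) (Cl : ι → Finset V)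
    (F : Finset (Finset U)) (A : ι → Finset V) (NB : ℕ) (F1 F2 : Finset (Finset U))
    (B : ι → Finset U) (f1 f2 : U → V) (C : U → Finset V) (β t δ m : ℝ) : Prop where
  F1_sub : F1 ⊆ F
  F2_sub : F2 ⊆ F \ F1
  A_sub : ∀ i, A i ⊆ Cl i
  A_card : ∀ i, (#(A i) : ℝ) ≤ β * m / 2
  NB_low : β * m ≤ NB
  NB_up : (NB : ℝ) ≤ t * m
  B_disj : ∀ i j, i ≠ j → Disjoint (B i) (B j)
  B_sub : univ.biUnion B ⊆ F1.biUnion id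
  B_card : ∀ i, #(B i) = NB
  emb1 : EmbOn G H (F1.biUnion id \ univ.biUnion B) f1
  B_indep : ∀ b ∈ univ.biUnion B, ∀ x, H.Adj b x → x ∉ univ.biUnion B
  im1_mem : ∀ x ∈ F1.biUnion id \ univ.biUnion B, ∃ j, f1 x ∈ Cl j \ A j
  im1_card : ∀ j, (#((F1.biUnion id \ univ.biUnion B).image f1 ∩ Cl j) : ℝ) ≤ t * m
  emb2 : EmbOn G H (F2.biUnion id) f2
  im_disj : Disjoint ((F1.biUnion id \ univ.biUnion B).image f1) ((F2.biUnion id).image f2)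
  im2_card : ∀ j, (#((F2.biUnion id).image f2 ∩ Cl j) : ℝ) ≤ 2 * t * m
  im2_card_all : (#((F2.biUnion id).image f2) : ℝ) ≤ 2 * t * Fintype.card V
  rest_sub : univ \ univ.biUnion Cl ⊆ (F2.biUnion id).image f2
  C_adj : ∀ i, ∀ b ∈ B i, ∀ v ∈ C b, ∀ x, H.Adj b x → G.Adj v (f1 x)
  C_card : ∀ i, ∀ b ∈ B i, δ * m ≤ #((C b ∩ A i) \ (F2.biUnion id).image f2)
  B_comp : ∀ i, ∀ v ∈ Cl i, v ∉ (F1.biUnion id \ univ.biUnion B).image f1 →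
    v ∉ (F2.biUnion id).image f2 → δ * m ≤ #((B i).filter fun b => v ∈ C b)
  spread : ∀ i, ∀ S ⊆ B i, δ * m ≤ #S → (#((Cl i).filter fun v => ∀ b ∈ S, v ∉ C b) : ℝ) < δ * m

set_option maxHeartbeats 1000000 in
lemma exists_partial [Nonempty ι] {G : SimpleGraph V} {H : SimpleGraph U} {Cl : ι → Finset V}
    {R : SimpleGraph ι} {D : ι → ι → ℝ} {d ε m β t δ η : ℝ} (hR : Reg G Cl R D d ε m)
    {Δ' w k : ℕ} (hcardUV : Fintype.card U = Fintype.card V)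
    (hdeg : ∀ x, #(nb H x) ≤ Δ') (hfit : Fits Δ' d ε (β / 2) m w) (hk : 0 < k) {col : U → ℕ}
    (hcol : ∀ x, col x < k) (hproper : ∀ x y, H.Adj x y → col x ≠ col y) {F : Finset (Finset U)}
    (hdis : (F : Set (Finset U)).PairwiseDisjoint id) (hcl : ∀ T ∈ F, Clsd H T)
    (hw : ∀ T ∈ F, #T ≤ w) (huniv : F.biUnion id = univ)
    {σ : ι → ℕ → ι} (hσ : ∀ i, Clq R k (σ i)) (hσi : ∀ i, σ i (k - 1) = i) {Cap1 : ℕ}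
    (hCap1 : ∀ j, #(univ.filter fun i => ∃ l < k, σ i l = j) ≤ Cap1) (hCap11 : 1 ≤ Cap1)
    {Cap2 : ℕ} (hσz : ∀ Z : Finset V, (#Z : ℝ) ≤ (ε + δ) * Fintype.card V →
      ∃ σ : V → ℕ → ι, (∀ z ∈ Z, Clq R k (σ z)) ∧
        (∀ z ∈ Z, ∀ l < k - 1, d * m ≤ #(nb G z ∩ Cl (σ z l))) ∧
        ∀ j, #(Z.filter fun z => ∃ l < k, σ z l = j) ≤ Cap2)
    (hV0 : (Fintype.card V : ℝ) - ∑ i, (#(Cl i) : ℝ) ≤ ε * Fintype.card V)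
    (hβ : 0 < β) (hβm : 4 ≤ β * m) (hβt : β ≤ t) (htd : 16 * t ≤ d)
    (hs1 : (Cap1 : ℝ) * (((k * (Δ' ^ 2 + 1) : ℕ) : ℝ) * (2 * β * m) + w) ≤ t * m)
    (hε1 : Δ' * ε ≤ d ^ Δ' / 2) (hε2 : Δ' * ε ≤ d ^ Δ' * β / 8) (hη : pairErr Δ' d ε (β / 2) ≤ η)
    (hη0 : 0 ≤ η) (hwη : 2 * w ≤ η * (β * m)) (hδ : 0 < δ) (hδη : 256 * η ≤ (d ^ Δ') ^ 2 * δ ^ 3)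
    (hδβ : δ ≤ d ^ Δ' * β / 16) (hζ : ((k * (Δ' ^ 2 + 1) : ℕ) : ℝ) * (ε + δ) ≤ t)
    (hs2 : ((k * (Δ' ^ 2 + 1) : ℕ) : ℝ) * Cap2 + (Fintype.card ι : ℝ) ^ k * w ≤ t * m) (v0 : U → V) :
    ∃ A NB F1 F2 B f1 f2 C, Partial G H Cl F A NB F1 F2 B f1 f2 C β t δ m := by
  have hm := hfit.m_pos
  have hd := hfit.d_pos
  have hd1 := hfit.d_le
  have hε0 := hfit.ε_nonneg
  have ht : 0 < t := hβ.trans_le hβt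
  have hβ1 : β ≤ 1 := by linarith
  have hrm := hR.card_mul_le
  have hr1 : (1 : ℝ) ≤ Fintype.card ι := by exact_mod_cast Fintype.card_pos
  have hmn : m ≤ Fintype.card V := le_trans (by
    have := mul_le_mul_of_nonneg_right hr1 hm.le
    linarith) hrm
  have hn0 : (0 : ℝ) ≤ Fintype.card V := by positivity
  have hp0 : 0 < d ^ Δ' := by positivity
  have hp1 : d ^ Δ' ≤ 1 := pow_le_one₀ hd.le hd1
  have hw0 : (0 : ℝ) ≤ w := by positivity
  obtain ⟨C', hC'⟩ : ∃ C' : ℕ, C' = k * (Δ' ^ 2 + 1) := ⟨_, rfl⟩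
  have hC1 : (1 : ℝ) ≤ C' := by
    rw [hC']
    exact_mod_cast Nat.mul_pos hk (by positivity)
  rw [← hC'] at hs1 hζ hs2
  have hδβ' : δ ≤ β / 16 := by
    have := mul_le_mul_of_nonneg_right hp1 hβ.le
    linarith
  have hεδ : ε + δ ≤ t := by
    have := mul_le_mul_of_nonneg_right hC1 (by linarith : 0 ≤ ε + δ)
    linarith
  obtain ⟨A, hA, hA1, hA2⟩ := exists_reserved hR.low hβ hβ1 hβm
  obtain ⟨NB, hNBdef⟩ : ∃ NB : ℕ, NB = ⌈β * m⌉₊ := ⟨_, rfl⟩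
  have hNB : β * m ≤ NB := hNBdef ▸ Nat.le_ceil _
  have hNBup : (NB : ℝ) ≤ 2 * β * m := by
    have := Nat.ceil_lt_add_one (by linarith : 0 ≤ β * m)
    rw [← hNBdef] at this
    linarith
  have hCN : ((k * (Δ' ^ 2 + 1) * NB : ℕ) : ℝ) ≤ C' * (2 * β * m) := by
    rw [← hC']
    push_cast
    exact mul_le_mul_of_nonneg_left hNBup (by positivity)
  have hX0 : 0 ≤ (C' : ℝ) * (2 * β * m) + w := by positivity
  have hX : (C' : ℝ) * (2 * β * m) + w ≤ t * m := by
    have : (1 : ℝ) ≤ Cap1 := by exact_mod_cast hCap11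
    have := mul_le_mul_of_nonneg_right this hX0
    linarith
  have hNBt : (NB : ℝ) ≤ t * m := by
    have : 2 * β * m ≤ C' * (2 * β * m) := le_mul_of_one_le_left (by positivity) hC1
    linarith
  have hβmm : β * m ≤ t * m := mul_le_mul_of_nonneg_right hβt hm.le
  have htm : 16 * (t * m) ≤ d * m := by
    have := mul_le_mul_of_nonneg_right htd hm.le
    linarith
  have hdm : d * m ≤ m := by
    have := mul_le_mul_of_nonneg_right hd1 hm.le
    linarith
  have hδm : δ * m ≤ β * m / 16 := by
    have := mul_le_mul_of_nonneg_right hδβ' hm.le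
    linarith
  obtain ⟨F1, hF1, B, f1, C, hBd, hBS, hBc, hemb1, hBB, him1, him1c, hC, hCA, htyp, hspread⟩ :=
    buffer_stage hR hdeg hfit hk hcol hproper hdis hcl hw hA hβ hNB (by linarith) hA1 hσ hσi hCap1
      (s := t * m) (by
        refine le_trans (mul_le_mul_of_nonneg_left ?_ (by positivity)) hs1
        linarith) (fun i => by
        have := hA2 i
        linarith) (by
        rw [huniv, card_univ, hcardUV]
        refine le_trans (mul_le_mul_of_nonneg_left
          ((add_le_add_left hCN _).trans hX) (by positivity)) ?_
        have : (Fintype.card ι : ℝ) * (t * m) ≤ t * Fintype.card V := by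
          have := mul_le_mul_of_nonneg_left hrm ht.le
          linarith
        have h1 : t * Fintype.card V ≤ 1 * Fintype.card V :=
          mul_le_mul_of_nonneg_right (by linarith) hn0
        linarith) hε1 hε2 hη hη0 hwη v0
  obtain ⟨im1, him1d⟩ : ∃ X, X = (F1.biUnion id \ univ.biUnion B).image f1 := ⟨_, rfl⟩
  rw [← him1d] at him1c
  have him1m : ∀ v ∈ im1, ∃ j, v ∈ Cl j \ A j := by
    intro v hv
    rw [him1d] at hv
    obtain ⟨x, hx, rfl⟩ := mem_image.1 hv
    exact him1 x hx
  obtain ⟨bad, hbad⟩ : ∃ bad : ι → Finset V, ∀ i v, v ∈ bad i ↔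
      v ∈ Cl i ∧ (#((B i).filter fun b => v ∈ C b) : ℝ) ≤ d ^ Δ' / 4 * NB :=
    ⟨fun i => (Cl i).filter fun v => (#((B i).filter fun b => v ∈ C b) : ℝ) ≤ d ^ Δ' / 4 * NB,
      fun i v => by simp⟩
  have hδ3 : δ ^ 3 ≤ δ := by
    have h1 : δ ≤ 1 := by linarith
    calc δ ^ 3 = δ ^ 2 * δ := by ring
      _ ≤ 1 * δ := mul_le_mul_of_nonneg_right (pow_le_one₀ hδ.le h1) hδ.le
      _ = δ := one_mul _
  have hbadc : ∀ i, (#(bad i) : ℝ) ≤ δ * m := by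
    intro i
    have h1 : 32 * η / (d ^ Δ') ^ 2 ≤ δ := by
      rw [div_le_iff₀ (by positivity)]
      have := mul_le_mul_of_nonneg_left hδ3 (by positivity : 0 ≤ (d ^ Δ') ^ 2)
      linarith
    refine le_trans ?_ ((htyp i).trans (mul_le_mul_of_nonneg_right h1 hm.le))
    refine Nat.cast_le.2 (card_le_card fun v hv => ?_)
    exact mem_filter.2 ((hbad i v).1 hv)
  obtain ⟨Z, hZ⟩ : ∃ Z : Finset V, ∀ v, v ∈ Z ↔ v ∉ im1 ∧ ((∀ i, v ∉ Cl i) ∨ ∃ i, v ∈ bad i) :=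
    ⟨univ.filter fun v => v ∉ im1 ∧ ((∀ i, v ∉ Cl i) ∨ ∃ i, v ∈ bad i), fun v => by simp⟩
  have hZCl : ∀ j, (#(Z ∩ Cl j) : ℝ) ≤ δ * m := by
    intro j
    refine (Nat.cast_le.2 (card_le_card fun v hv => ?_)).trans (hbadc j)
    obtain ⟨h1, h2⟩ := mem_inter.1 hv
    rcases ((hZ v).1 h1).2 with h3 | ⟨i, h3⟩
    · exact (h3 j h2).elim
    · have : i = j := by
        by_contra hne
        exact disjoint_left.1 (hR.disj i j hne) ((hbad i v).1 h3).1 h2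
      exact this ▸ h3
  have hClc : #(univ.biUnion Cl) = ∑ i, #(Cl i) := card_biUnion fun i _ j _ hij => hR.disj i j hij
  have hZn : (#Z : ℝ) ≤ (ε + δ) * Fintype.card V := by
    have h1 : Z ⊆ (univ \ univ.biUnion Cl) ∪ univ.biUnion bad := by
      intro v hv
      rcases ((hZ v).1 hv).2 with h3 | ⟨i, h3⟩
      · refine mem_union_left _ (mem_sdiff.2 ⟨mem_univ _, fun h => ?_⟩)
        obtain ⟨i, -, hi⟩ := mem_biUnion.1 h
        exact h3 i hi
      · exact mem_union_right _ (mem_biUnion.2 ⟨i, mem_univ _, h3⟩)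
    have h2 : (#Z : ℝ) ≤ #(univ \ univ.biUnion Cl) + #(univ.biUnion bad) := by
      exact_mod_cast (card_le_card h1).trans (card_union_le _ _)
    have h3 : (#(univ.biUnion bad) : ℝ) ≤ Fintype.card ι * (δ * m) := by
      calc (#(univ.biUnion bad) : ℝ) ≤ ((∑ i, #(bad i) : ℕ) : ℝ) := Nat.cast_le.2 card_biUnion_le
        _ = ∑ i, (#(bad i) : ℝ) := by push_cast; rfl
        _ ≤ ∑ _i : ι, δ * m := sum_le_sum fun i _ => hbadc i
        _ = _ := by rw [sum_const, card_univ, nsmul_eq_mul]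
    have h4 : (#(univ \ univ.biUnion Cl) : ℝ) = Fintype.card V - ∑ i, (#(Cl i) : ℝ) := by
      have h5 := card_sdiff_add_card_eq_card (subset_univ (univ.biUnion Cl))
      rw [hClc, card_univ] at h5
      have h6 : (#(univ \ univ.biUnion Cl) : ℝ) + ∑ i, (#(Cl i) : ℝ) = Fintype.card V := by
        exact_mod_cast h5
      linarith
    have h5 := mul_le_mul_of_nonneg_left hrm hδ.le
    linarith
  obtain ⟨σz, hσz1, hσz2, hσz3⟩ := hσz Z hZn
  have hS1c : (#(F1.biUnion id) : ℝ) ≤ 2 * t * Fintype.card V := by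
    have h1 := card_sdiff_add_card_eq_card hBS
    have h2 : #(F1.biUnion id \ univ.biUnion B) = #im1 := by
      rw [him1d, card_image_of_injOn hemb1.1]
    have h3 : (#(univ.biUnion B) : ℝ) ≤ Fintype.card ι * (t * m) := by
      calc (#(univ.biUnion B) : ℝ) ≤ ((∑ i, #(B i) : ℕ) : ℝ) := Nat.cast_le.2 card_biUnion_le
        _ = ∑ i, (#(B i) : ℝ) := by push_cast; rfl
        _ ≤ ∑ _i : ι, t * m := sum_le_sum fun i _ => by rw [hBc]; exact hNBt
        _ = _ := by rw [sum_const, card_univ, nsmul_eq_mul]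
    have h4 : (#im1 : ℝ) ≤ Fintype.card ι * (t * m) := by
      have h5 : im1 ⊆ univ.biUnion fun j => im1 ∩ Cl j := by
        intro v hv
        obtain ⟨j, hj⟩ := him1m v hv
        exact mem_biUnion.2 ⟨j, mem_univ _, mem_inter.2 ⟨hv, (mem_sdiff.1 hj).1⟩⟩
      calc (#im1 : ℝ) ≤ ((∑ j, #(im1 ∩ Cl j) : ℕ) : ℝ) :=
            Nat.cast_le.2 ((card_le_card h5).trans card_biUnion_le)
        _ = ∑ j, (#(im1 ∩ Cl j) : ℝ) := by push_cast; rfl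
        _ ≤ ∑ _i : ι, t * m := sum_le_sum fun j _ => him1c j
        _ = _ := by rw [sum_const, card_univ, nsmul_eq_mul]
    have h5 : (#(F1.biUnion id) : ℝ) = #im1 + #(univ.biUnion B) := by
      rw [← h2]
      exact_mod_cast h1.symm
    have h6 := mul_le_mul_of_nonneg_left hrm ht.le
    linarith
  have hF'c : (Fintype.card V : ℝ) - 2 * t * Fintype.card V ≤ #((F \ F1).biUnion id) := by
    have h1 : F.biUnion id ⊆ F1.biUnion id ∪ (F \ F1).biUnion id := by
      rw [← union_biUnion, union_sdiff_of_subset hF1]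
    rw [huniv] at h1
    have h2 := (card_le_card h1).trans (card_union_le _ _)
    rw [card_univ, hcardUV] at h2
    have h3 : (Fintype.card V : ℝ) ≤ #(F1.biUnion id) + #((F \ F1).biUnion id) := by
      exact_mod_cast h2
    linarith
  have htn : 16 * (t * Fintype.card V) ≤ Fintype.card V := by
    have := mul_le_mul_of_nonneg_right (htd.trans hd1) hn0
    linarith
  obtain ⟨F2, hF2, f2, hemb2, hZim, hAvZ, him2c⟩ := cover_stage hR hdeg hfit hk hcol hproper
    (F := F \ F1) (Z := Z) (Av := univ.biUnion A ∪ im1)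
    (hdis.subset (by exact_mod_cast sdiff_subset)) (fun T hT => hcl T (mem_sdiff.1 hT).1)
    (fun T hT => hw T (mem_sdiff.1 hT).1) hσz1 hσz2 hσz3 (s := t * m) (by
      rw [← hC']
      push_cast
      exact hs2) (fun j => by
      have h1 : Cl j ∩ ((univ.biUnion A ∪ im1) ∪ Z) ⊆ A j ∪ (im1 ∩ Cl j) ∪ (Z ∩ Cl j) := by
        intro v hv
        obtain ⟨hv1, hv2⟩ := mem_inter.1 hv
        rcases mem_union.1 hv2 with h | h
        · rcases mem_union.1 h with h | h
          · obtain ⟨i, -, hi⟩ := mem_biUnion.1 h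
            have : i = j := by
              by_contra hne
              exact disjoint_left.1 (hR.disj i j hne) (hA i hi) hv1
            subst this
            exact mem_union_left _ (mem_union_left _ hi)
          · exact mem_union_left _ (mem_union_right _ (mem_inter.2 ⟨h, hv1⟩))
        · exact mem_union_right _ (mem_inter.2 ⟨h, hv1⟩)
      have h2 : (#(Cl j ∩ ((univ.biUnion A ∪ im1) ∪ Z)) : ℝ) ≤
          #(A j) + #(im1 ∩ Cl j) + #(Z ∩ Cl j) := by
        exact_mod_cast (card_le_card h1).trans ((card_union_le _ _).trans
          (Nat.add_le_add_right (card_union_le _ _) _))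
      have h3 := hA2 j
      have h4 := him1c j
      have h5 := hZCl j
      linarith) (by
      rw [← hC']
      push_cast
      have h1 : (C' : ℝ) * #Z ≤ t * Fintype.card V := by
        refine (mul_le_mul_of_nonneg_left hZn (by positivity)).trans ?_
        have := mul_le_mul_of_nonneg_right hζ hn0
        linarith
      have h2 : (Fintype.card ι : ℝ) ^ k * w ≤ t * m := by
        have : 0 ≤ (C' : ℝ) * Cap2 := by positivity
        linarith
      have h3 := mul_le_mul_of_nonneg_left hmn ht.le
      linarith) v0
  obtain ⟨im2, him2d⟩ : ∃ X, X = (F2.biUnion id).image f2 := ⟨_, rfl⟩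
  rw [← him2d] at hZim hAvZ him2c
  have him2Cl : ∀ j, (#(im2 ∩ Cl j) : ℝ) ≤ #(Z ∩ Cl j) + t * m := by
    intro j
    have h1 : im2 ∩ Cl j ⊆ (Z ∩ Cl j) ∪ ((im2 ∩ Cl j) \ Z) := by
      intro v hv
      by_cases hvZ : v ∈ Z
      · exact mem_union_left _ (mem_inter.2 ⟨hvZ, (mem_inter.1 hv).2⟩)
      · exact mem_union_right _ (mem_sdiff.2 ⟨hv, hvZ⟩)
    have h2 : (#(im2 ∩ Cl j) : ℝ) ≤ #(Z ∩ Cl j) + #((im2 ∩ Cl j) \ Z) := by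
      exact_mod_cast (card_le_card h1).trans (card_union_le _ _)
    have := him2c j
    linarith
  have hdis12 : Disjoint im1 im2 := by
    rw [disjoint_left]
    intro v hv1 hv2
    have := hAvZ (mem_inter.2 ⟨hv2, mem_union_right _ hv1⟩)
    exact ((hZ v).1 this).1 hv1
  have hrest : univ \ univ.biUnion Cl ⊆ im2 := by
    intro v hv
    have h1 : ∀ i, v ∉ Cl i := fun i hi =>
      (mem_sdiff.1 hv).2 (mem_biUnion.2 ⟨i, mem_univ _, hi⟩)
    refine hZim ((hZ v).2 ⟨fun h => ?_, Or.inl h1⟩)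
    obtain ⟨j, hj⟩ := him1m v h
    exact h1 j (mem_sdiff.1 hj).1
  have him2all : (#im2 : ℝ) ≤ 2 * t * Fintype.card V := by
    have h5 : im2 ⊆ Z ∪ univ.biUnion fun j => (im2 ∩ Cl j) \ Z := by
      intro v hv
      by_cases hvZ : v ∈ Z
      · exact mem_union_left _ hvZ
      · by_cases hvC : v ∈ univ.biUnion Cl
        · obtain ⟨j, -, hj⟩ := mem_biUnion.1 hvC
          exact mem_union_right _ (mem_biUnion.2 ⟨j, mem_univ _,
            mem_sdiff.2 ⟨mem_inter.2 ⟨hv, hj⟩, hvZ⟩⟩)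
        · exfalso
          refine hvZ ((hZ v).2 ⟨fun h => disjoint_left.1 hdis12 h hv, Or.inl fun i hi => ?_⟩)
          exact hvC (mem_biUnion.2 ⟨i, mem_univ _, hi⟩)
    have h6 : (#(univ.biUnion fun j => (im2 ∩ Cl j) \ Z) : ℝ) ≤ Fintype.card ι * (t * m) := by
      calc (#(univ.biUnion fun j => (im2 ∩ Cl j) \ Z) : ℝ)
          ≤ ((∑ j, #((im2 ∩ Cl j) \ Z) : ℕ) : ℝ) := Nat.cast_le.2 card_biUnion_le
        _ = ∑ j, (#((im2 ∩ Cl j) \ Z) : ℝ) := by push_cast; rfl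
        _ ≤ ∑ _i : ι, t * m := sum_le_sum fun j _ => him2c j
        _ = _ := by rw [sum_const, card_univ, nsmul_eq_mul]
    have h7 : (#im2 : ℝ) ≤ #Z + #(univ.biUnion fun j => (im2 ∩ Cl j) \ Z) := by
      exact_mod_cast (card_le_card h5).trans (card_union_le _ _)
    have h8 := mul_le_mul_of_nonneg_left hrm ht.le
    have h9 := mul_le_mul_of_nonneg_right hεδ hn0
    linarith
  refine ⟨A, NB, F1, F2, B, f1, f2, C, hF1, hF2, hA, hA2, hNB, hNBt, hBd, hBS, hBc, hemb1, hBB,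
    him1, ?_, hemb2, ?_, ?_, ?_, ?_, fun i b hb => (hC i b hb).2, ?_, ?_, ?_⟩
  · rw [← him1d]
    exact him1c
  · rw [← him1d, ← him2d]
    exact hdis12
  · intro j
    rw [← him2d]
    have h1 := him2Cl j
    have h2 := hZCl j
    linarith
  · rw [← him2d]
    exact him2all
  · rw [← him2d]
    exact hrest
  · intro i b hb
    rw [← him2d]
    have h1 : C b ∩ A i ⊆ ((C b ∩ A i) \ im2) ∪ (Z ∩ Cl i) := by
      intro v hv
      by_cases hv2 : v ∈ im2
      · have hvA := (mem_inter.1 hv).2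
        have := hAvZ (mem_inter.2 ⟨hv2, mem_union_left _ (mem_biUnion.2 ⟨i, mem_univ _, hvA⟩)⟩)
        exact mem_union_right _ (mem_inter.2 ⟨this, hA i hvA⟩)
      · exact mem_union_left _ (mem_sdiff.2 ⟨hv, hv2⟩)
    have h2 : (#(C b ∩ A i) : ℝ) ≤ #((C b ∩ A i) \ im2) + #(Z ∩ Cl i) := by
      exact_mod_cast (card_le_card h1).trans (card_union_le _ _)
    have h3 := hCA i b hb
    have h4 := hZCl i
    have h5 := mul_le_mul_of_nonneg_right hδβ hm.le
    linarith
  · intro i v hv hv1 hv2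
    rw [← him1d] at hv1
    rw [← him2d] at hv2
    have h1 : ¬ (#((B i).filter fun b => v ∈ C b) : ℝ) ≤ d ^ Δ' / 4 * NB := by
      intro h
      exact hv2 (hZim ((hZ v).2 ⟨hv1, Or.inr ⟨i, (hbad i v).2 ⟨hv, h⟩⟩⟩))
    refine le_trans ?_ (not_le.1 h1).le
    have h2 := mul_le_mul_of_nonneg_left hNB (by positivity : 0 ≤ d ^ Δ' / 4)
    have h3 := mul_le_mul_of_nonneg_right hδβ hm.le
    have h4 : 0 ≤ d ^ Δ' * (β * m) := by positivity
    linarith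
  · intro i S hS hδS
    exact hspread i δ hδ hδη S hS hδS

end Partial

section Reduce
open Finset
set_option linter.unusedSectionVars false

variable {U V ι : Type} [Fintype U] [Fintype V] [Fintype ι]

set_option maxHeartbeats 1000000 in
/-- A partial embedding reduces the problem to an exact embedding of the remaining tiles. -/
lemma Partial.reduce {G : SimpleGraph V} {H : SimpleGraph U} {Cl : ι → Finset V}
    {F : Finset (Finset U)} {A : ι → Finset V} {NB : ℕ} {F1 F2 : Finset (Finset U)}
    {B : ι → Finset U} {f1 f2 : U → V} {C : U → Finset V} {β t δ m : ℝ}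
    (hP : Partial G H Cl F A NB F1 F2 B f1 f2 C β t δ m)
    (hcardUV : Fintype.card U = Fintype.card V) (hCld : ∀ i j, i ≠ j → Disjoint (Cl i) (Cl j))
    (hlow : ∀ i, m ≤ #(Cl i)) (hrm : Fintype.card ι * m ≤ Fintype.card V)
    (hdis : (F : Set (Finset U)).PairwiseDisjoint id) (hcl : ∀ T ∈ F, Clsd H T)
    (huniv : F.biUnion id = univ) (hm : 0 < m) (ht : 0 ≤ t) (ht1 : 16 * t ≤ 1) :
    ∃ F3 ⊆ F, ∃ (free : ι → Finset V) (cap : ι → ℕ), (∀ j, free j ⊆ Cl j) ∧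
      (∀ j, β / 2 * m + cap j ≤ #(free j)) ∧ ∑ j, cap j = #(F3.biUnion id) ∧
      (Fintype.card V : ℝ) - 4 * t * Fintype.card V ≤ #(F3.biUnion id) ∧
      (∀ j, m / 4 ≤ cap j) ∧ (∀ j, cap j ≤ #(Cl j)) ∧
      ∀ f3 : U → V, EmbOn G H (F3.biUnion id) f3 → (∀ x ∈ F3.biUnion id, ∃ j, f3 x ∈ free j) →
        (∀ j, #((F3.biUnion id).image f3 ∩ Cl j) = cap j) → ∃ f : U → V, EmbOn G H univ f := by
  obtain ⟨im1, him1d⟩ : ∃ X, X = (F1.biUnion id \ univ.biUnion B).image f1 := ⟨_, rfl⟩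
  obtain ⟨im2, him2d⟩ : ∃ X, X = (F2.biUnion id).image f2 := ⟨_, rfl⟩
  have h12 : Disjoint im1 im2 := by
    rw [him1d, him2d]
    exact hP.im_disj
  have him1m : ∀ v ∈ im1, ∃ j, v ∈ Cl j \ A j := by
    intro v hv
    rw [him1d] at hv
    obtain ⟨x, hx, rfl⟩ := mem_image.1 hv
    exact hP.im1_mem x hx
  have hrest := hP.rest_sub
  have him1c := hP.im1_card
  have him2c := hP.im2_card
  have him2a := hP.im2_card_all
  rw [← him2d] at hrest him2c him2a
  rw [← him1d] at him1c
  obtain ⟨free0, hfree0⟩ : ∃ f0 : ι → Finset V, ∀ j, f0 j = Cl j \ (im1 ∪ im2) :=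
    ⟨_, fun _ => rfl⟩
  have hfree0m : ∀ j v, v ∈ free0 j ↔ v ∈ Cl j ∧ v ∉ im1 ∧ v ∉ im2 := by
    intro j v
    rw [hfree0, mem_sdiff, mem_union, not_or]
  have hF0c : ∀ j, m - 3 * (t * m) ≤ #(free0 j) := by
    intro j
    have h1 : Cl j ⊆ free0 j ∪ (im1 ∩ Cl j) ∪ (im2 ∩ Cl j) := by
      intro v hv
      by_cases hv1 : v ∈ im1
      · exact mem_union_left _ (mem_union_right _ (mem_inter.2 ⟨hv1, hv⟩))
      by_cases hv2 : v ∈ im2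
      · exact mem_union_right _ (mem_inter.2 ⟨hv2, hv⟩)
      exact mem_union_left _ (mem_union_left _ ((hfree0m j v).2 ⟨hv, hv1, hv2⟩))
    have h2 : (#(Cl j) : ℝ) ≤ #(free0 j) + #(im1 ∩ Cl j) + #(im2 ∩ Cl j) := by
      exact_mod_cast (card_le_card h1).trans ((card_union_le _ _).trans
        (Nat.add_le_add_right (card_union_le _ _) _))
    have h3 := hlow j
    have h4 := him1c j
    have h5 := him2c j
    linarith
  have htm : 16 * (t * m) ≤ m := by
    have := mul_le_mul_of_nonneg_right ht1 hm.le
    linarith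
  have hNBle : ∀ j, NB ≤ #(free0 j) := by
    intro j
    have h1 := hF0c j
    have h2 := hP.NB_up
    exact_mod_cast (by linarith : (NB : ℝ) ≤ #(free0 j))
  have hcapc : ∀ j, ((#(free0 j) - NB : ℕ) : ℝ) = #(free0 j) - NB := fun j => Nat.cast_sub (hNBle j)
  have hF1d : ∀ T ∈ F1, T ∈ F := fun T hT => hP.F1_sub hT
  have hF2d : ∀ T ∈ F2, T ∈ F ∧ T ∉ F1 := fun T hT => mem_sdiff.1 (hP.F2_sub hT)
  obtain ⟨S1, hS1⟩ : ∃ S, S = F1.biUnion id := ⟨_, rfl⟩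
  obtain ⟨S2, hS2⟩ : ∃ S, S = F2.biUnion id := ⟨_, rfl⟩
  obtain ⟨S3, hS3⟩ : ∃ S, S = ((F \ F1) \ F2).biUnion id := ⟨_, rfl⟩
  have hcl1 : Clsd H S1 := by
    rw [hS1]
    exact Clsd.biUnion fun T hT => hcl T (hF1d T hT)
  have hcl2 : Clsd H S2 := by
    rw [hS2]
    exact Clsd.biUnion fun T hT => hcl T (hF2d T hT).1
  have hSu : S1 ∪ S2 ∪ S3 = univ := by
    rw [hS1, hS2, hS3, ← union_biUnion, ← union_biUnion, ← huniv]
    congr 1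
    ext T
    simp only [mem_union, mem_sdiff]
    constructor
    · rintro ((h | h) | h)
      exacts [hF1d T h, (hF2d T h).1, h.1.1]
    · tauto
  have hd12 : Disjoint S1 S2 := by
    rw [hS1, hS2]
    exact disjoint_biUnion_id hdis hP.F1_sub (fun T hT => (hF2d T hT).1)
      (disjoint_left.2 fun T h1 h2 => (hF2d T h2).2 h1)
  have hd123 : Disjoint (S1 ∪ S2) S3 := by
    rw [hS1, hS2, hS3, ← union_biUnion]
    refine disjoint_biUnion_id hdis ?_ ?_ ?_
    · intro T hT
      rcases mem_union.1 hT with h | h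
      exacts [hF1d T h, (hF2d T h).1]
    · intro T hT
      exact (mem_sdiff.1 (mem_sdiff.1 hT).1).1
    · rw [disjoint_left]
      intro T hT hT2
      obtain ⟨h3, h4⟩ := mem_sdiff.1 hT2
      rcases mem_union.1 hT with h | h
      exacts [(mem_sdiff.1 h3).2 h, h4 h]
  have hScard : #S1 + #S2 + #S3 = Fintype.card V := by
    rw [← hcardUV, ← card_univ, ← hSu, card_union_of_disjoint hd123, card_union_of_disjoint hd12]
  have hBc : #(univ.biUnion B) = Fintype.card ι * NB := by
    rw [card_biUnion fun i _ j _ hij => hP.B_disj i j hij, sum_congr rfl fun i _ => hP.B_card i,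
      sum_const, card_univ, smul_eq_mul]
  have hS1c : #im1 + Fintype.card ι * NB = #S1 := by
    rw [← hBc, him1d, card_image_of_injOn hP.emb1.1, hS1]
    exact card_sdiff_add_card_eq_card hP.B_sub
  have hS2c : #im2 = #S2 := by
    rw [him2d, card_image_of_injOn hP.emb2.1, hS2]
  have hfree0d : ∀ i j, i ≠ j → Disjoint (free0 i) (free0 j) := fun i j hij =>
    disjoint_left.2 fun v h1 h2 =>
      disjoint_left.1 (hCld i j hij) ((hfree0m i v).1 h1).1 ((hfree0m j v).1 h2).1
  have hfree0s : ∑ j, #(free0 j) + #im1 + #im2 = Fintype.card V := by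
    rw [← card_biUnion fun i _ j _ hij => hfree0d i j hij]
    rw [← card_univ (α := V), add_assoc, ← card_union_of_disjoint h12]
    have h1 : univ.biUnion free0 = univ \ (im1 ∪ im2) := by
      ext v
      rw [mem_biUnion, mem_sdiff, mem_union, not_or]
      constructor
      · rintro ⟨j, -, hj⟩
        exact ⟨mem_univ _, ((hfree0m j v).1 hj).2⟩
      · rintro ⟨-, hv⟩
        have h2 : v ∈ univ.biUnion Cl := by
          by_contra h
          exact hv.2 (hrest (mem_sdiff.2 ⟨mem_univ _, h⟩))
        obtain ⟨j, -, hj⟩ := mem_biUnion.1 h2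
        exact ⟨j, mem_univ _, (hfree0m j v).2 ⟨hj, hv⟩⟩
    rw [h1]
    exact card_sdiff_add_card_eq_card (subset_univ _)
  have hcaps : ∑ j, (#(free0 j) - NB) = #S3 := by
    have h1 : ∑ j, (#(free0 j) - NB) + Fintype.card ι * NB = ∑ j, #(free0 j) := by
      have : Fintype.card ι * NB = ∑ _j : ι, NB := by
        rw [sum_const, card_univ, smul_eq_mul]
      rw [this, ← sum_add_distrib]
      exact sum_congr rfl fun j _ => Nat.sub_add_cancel (hNBle j)
    omega
  refine ⟨(F \ F1) \ F2, fun T hT => (mem_sdiff.1 (mem_sdiff.1 hT).1).1,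
    fun j => free0 j \ A j, fun j => #(free0 j) - NB, ?_, ?_, ?_, ?_, ?_, ?_, ?_⟩
  · intro j v hv
    exact ((hfree0m j v).1 (mem_sdiff.1 hv).1).1
  · intro j
    beta_reduce
    rw [hcapc]
    have h1 : (#(free0 j) : ℝ) ≤ #(free0 j \ A j) + #(A j) := by
      have := card_le_card_sdiff_add_card (s := free0 j) (t := A j)
      exact_mod_cast this
    have h2 := hP.A_card j
    have h3 := hP.NB_low
    linarith
  · rw [← hS3]
    exact hcaps
  · rw [← hS3]
    have h1 : (#im1 : ℝ) ≤ Fintype.card ι * (t * m) := by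
      have h5 : im1 ⊆ univ.biUnion fun j => im1 ∩ Cl j := by
        intro v hv
        obtain ⟨j, hj⟩ := him1m v hv
        exact mem_biUnion.2 ⟨j, mem_univ _, mem_inter.2 ⟨hv, (mem_sdiff.1 hj).1⟩⟩
      calc (#im1 : ℝ) ≤ ((∑ j, #(im1 ∩ Cl j) : ℕ) : ℝ) :=
            Nat.cast_le.2 ((card_le_card h5).trans card_biUnion_le)
        _ = ∑ j, (#(im1 ∩ Cl j) : ℝ) := by push_cast; rfl
        _ ≤ ∑ _i : ι, t * m := sum_le_sum fun j _ => him1c j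
        _ = _ := by rw [sum_const, card_univ, nsmul_eq_mul]
    have h2 : (Fintype.card ι : ℝ) * NB ≤ Fintype.card ι * (t * m) :=
      mul_le_mul_of_nonneg_left hP.NB_up (by positivity)
    have h3 := mul_le_mul_of_nonneg_left hrm ht
    have h4 : (#im1 : ℝ) + Fintype.card ι * NB = #S1 := by exact_mod_cast hS1c
    have h5 : (#S1 : ℝ) + #S2 + #S3 = Fintype.card V := by exact_mod_cast hScard
    rw [hS2c] at him2a
    linarith
  · intro j
    beta_reduce
    rw [hcapc]
    have h1 := hF0c j
    have h2 := hP.NB_up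
    linarith
  · intro j
    exact (Nat.sub_le _ _).trans (card_le_card fun v hv => ((hfree0m j v).1 hv).1)
  · intro f3 hemb3 hmem hc
    rw [← hS3] at hemb3 hmem hc
    obtain ⟨im3, him3d⟩ : ∃ X, X = S3.image f3 := ⟨_, rfl⟩
    rw [← him3d] at hc
    have him3m : ∀ v ∈ im3, ∃ j, v ∈ free0 j \ A j := by
      intro v hv
      rw [him3d] at hv
      obtain ⟨x, hx, rfl⟩ := mem_image.1 hv
      exact hmem x hx
    have huq : ∀ i j v, v ∈ Cl i → v ∈ Cl j → i = j := by
      intro i j v h1 h2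
      by_contra hne
      exact disjoint_left.1 (hCld i j hne) h1 h2
    have him3f : ∀ j v, v ∈ im3 → v ∈ Cl j → v ∈ free0 j ∧ v ∉ A j := by
      intro j v hv hvj
      obtain ⟨i, hi⟩ := him3m v hv
      obtain ⟨h1, h2⟩ := mem_sdiff.1 hi
      have := huq i j v ((hfree0m i v).1 h1).1 hvj
      exact this ▸ ⟨h1, h2⟩
    have hLsub : ∀ i, free0 i \ im3 ⊆ Cl i := fun i v hv =>
      ((hfree0m i v).1 (mem_sdiff.1 hv).1).1
    rw [hS1] at hcl1
    rw [hS2] at hcl2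
    refine finish_embedding (L := fun i => free0 i \ im3) (δ := δ * m) hcl1 hcl2
      (by rw [← hS1, ← hS2]; exact hSu) hP.B_disj hP.emb1 hP.B_indep hP.emb2 hemb3
      hP.im_disj ?_ ?_ ?_ ?_ ?_ ?_ ?_ hP.C_adj ?_ ?_ ?_
    · rw [← him1d, ← him3d, disjoint_left]
      intro v h1 h3
      obtain ⟨j, hj⟩ := him3m v h3
      exact ((hfree0m j v).1 (mem_sdiff.1 hj).1).2.1 h1
    · rw [← him2d, ← him3d, disjoint_left]
      intro v h1 h3
      obtain ⟨j, hj⟩ := him3m v h3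
      exact ((hfree0m j v).1 (mem_sdiff.1 hj).1).2.2 h1
    · intro i j hij
      exact (hCld i j hij).mono (hLsub i) (hLsub j)
    · intro i
      rw [hP.B_card]
      have h1 : free0 i ∩ im3 = im3 ∩ Cl i := by
        ext v
        rw [mem_inter, mem_inter]
        exact ⟨fun h => ⟨h.2, ((hfree0m i v).1 h.1).1⟩, fun h => ⟨(him3f i v h.1 h.2).1, h.1⟩⟩
      have h2 := card_sdiff_add_card_inter (free0 i) im3
      rw [h1, hc i] at h2
      beta_reduce at h2
      have := hNBle i
      omega
    · intro i
      rw [← him1d, disjoint_left]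
      intro v hv h1
      exact ((hfree0m i v).1 (mem_sdiff.1 hv).1).2.1 h1
    · intro i
      rw [← him2d, disjoint_left]
      intro v hv h1
      exact ((hfree0m i v).1 (mem_sdiff.1 hv).1).2.2 h1
    · intro i
      rw [← him3d]
      exact sdiff_disjoint
    · intro i b hb
      refine (hP.C_card i b hb).trans (Nat.cast_le.2 (card_le_card fun v hv => ?_))
      rw [← him2d] at hv
      obtain ⟨h1, h2⟩ := mem_sdiff.1 hv
      obtain ⟨h3, h4⟩ := mem_inter.1 h1
      have h5 := hP.A_sub i h4
      refine mem_inter.2 ⟨h3, mem_sdiff.2 ⟨(hfree0m i v).2 ⟨h5, fun h => ?_, h2⟩, fun h => ?_⟩⟩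
      · obtain ⟨j, hj⟩ := him1m v h
        obtain ⟨h6, h7⟩ := mem_sdiff.1 hj
        have := huq i j v h5 h6
        exact h7 (this ▸ h4)
      · exact (him3f i v h h5).2 h4
    · intro i v hv
      obtain ⟨h1, h2, h3⟩ := (hfree0m i v).1 (mem_sdiff.1 hv).1
      exact hP.B_comp i v h1 (by rw [← him1d]; exact h2) (by rw [← him2d]; exact h3)
    · intro i S hS hδS
      refine lt_of_le_of_lt (Nat.cast_le.2 (card_le_card fun v hv => ?_)) (hP.spread i S hS hδS)
      obtain ⟨h1, h2⟩ := mem_filter.1 hv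
      exact mem_filter.2 ⟨hLsub i h1, h2⟩

end Reduce

section Constants
open Finset
set_option linter.unusedSectionVars false

lemma eventually_mul_le (c : ℝ) {b : ℝ} (hb : 0 < b) :
    ∀ᶠ x : ℝ in nhdsWithin 0 (Set.Ioi 0), c * x ≤ b := by
  have h : Filter.Tendsto (fun x : ℝ => c * x) (nhds 0) (nhds (c * 0)) :=
    (continuous_const.mul continuous_id).tendsto 0
  rw [mul_zero] at h
  have h1 : ∀ᶠ x : ℝ in nhds 0, c * x ≤ b := (h.eventually (gt_mem_nhds hb)).mono fun x hx => hx.le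
  exact h1.filter_mono nhdsWithin_le_nhds

/-- The hierarchy of constants used in the embedding. -/
lemma exists_constants (k Δ' : ℕ) {μ : ℝ} (hμ : 0 < μ) (hμ1 : μ ≤ 1) :
    ∃ (Cap : ℕ) (β δ η ε : ℝ), 4 * k / μ < Cap ∧ 0 < β ∧ β ≤ μ / 128 ∧
      ((Cap : ℝ) + 1) * (((k * (Δ' ^ 2 + 1) : ℕ) : ℝ) * (2 * β)) ≤ μ / 128 / 2 ∧ 0 < δ ∧
      δ ≤ (μ / 8) ^ Δ' * β / 16 ∧ ((k * (Δ' ^ 2 + 1) : ℕ) : ℝ) * (4 * k / μ) * δ ≤ μ / 128 / 8 ∧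
      0 < η ∧ 256 * η ≤ ((μ / 8) ^ Δ') ^ 2 * δ ^ 3 ∧ 0 < ε ∧ ε ≤ μ / 8 ∧
      4 * ((Δ' : ℝ) + 1) * ε ≤ β / 2 * (μ / 8 / 2) ^ (Δ' + 1) ∧
      (2 * ε / (β / 2 * (μ / 8 / 2) ^ Δ')) * Δ' < 1 / 3 ∧ Δ' * ε ≤ (μ / 8) ^ Δ' / 2 ∧
      Δ' * ε ≤ (μ / 8) ^ Δ' * β / 8 ∧ pairErr Δ' (μ / 8) ε (β / 2) ≤ η ∧
      ((k * (Δ' ^ 2 + 1) : ℕ) : ℝ) * (4 * k / μ) * ε ≤ μ / 128 / 8 := by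
  obtain ⟨C', hC'⟩ : ∃ C' : ℝ, C' = ((k * (Δ' ^ 2 + 1) : ℕ) : ℝ) := ⟨_, rfl⟩
  rw [← hC']
  obtain ⟨Cap, hCap⟩ := exists_nat_gt (4 * k / μ)
  have hμ2 : 0 < μ / 128 := by positivity
  obtain ⟨β, ⟨hβ1, hβ2⟩, hβ⟩ := (((eventually_mul_le 1 hμ2).and
    (eventually_mul_le (((Cap : ℝ) + 1) * (C' * 2)) (half_pos hμ2))).and
    self_mem_nhdsWithin).exists
  have hβ0 : (0 : ℝ) < β := hβ
  have hp0 : 0 < (μ / 8) ^ Δ' := by positivity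
  obtain ⟨δ, ⟨hδ1, hδ2⟩, hδ⟩ := (((eventually_mul_le 1 (b := (μ / 8) ^ Δ' * β / 16)
    (by positivity)).and (eventually_mul_le (C' * (4 * k / μ)) (b := μ / 128 / 8)
    (by positivity))).and self_mem_nhdsWithin).exists
  have hδ0 : (0 : ℝ) < δ := hδ
  obtain ⟨η, hη⟩ : ∃ η, η = ((μ / 8) ^ Δ') ^ 2 * δ ^ 3 / 256 := ⟨_, rfl⟩
  have hη0 : 0 < η := by
    rw [hη]
    positivity
  obtain ⟨q, hq⟩ : ∃ q, q = 2 / (β / 2 * (μ / 8 / 2) ^ Δ') * Δ' := ⟨_, rfl⟩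
  have hqe : ∀ ε, (2 * ε / (β / 2 * (μ / 8 / 2) ^ Δ')) * Δ' = q * ε := fun ε => by
    rw [hq]
    ring
  obtain ⟨ε, ⟨⟨⟨⟨⟨⟨h1, h2⟩, h3⟩, h4⟩, h5⟩, h6⟩, h7⟩, hε⟩ := ((((((((eventually_mul_le 1
    (b := μ / 8) (by positivity)).and
    (eventually_mul_le (4 * ((Δ' : ℝ) + 1)) (b := β / 2 * (μ / 8 / 2) ^ (Δ' + 1))
      (by positivity))).and
    (eventually_mul_le q (b := 1 / 6) (by norm_num))).and
    (eventually_mul_le Δ' (b := (μ / 8) ^ Δ' / 2) (by positivity))).and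
    (eventually_mul_le Δ' (b := (μ / 8) ^ Δ' * β / 8) (by positivity))).and
    (eventually_mul_le (2 * Δ' + 6 * q) hη0)).and
    (eventually_mul_le (C' * (4 * k / μ)) (b := μ / 128 / 8) (by positivity))).and
    self_mem_nhdsWithin).exists
  refine ⟨Cap, β, δ, η, ε, hCap, hβ0, by linarith, by linarith, hδ0, by linarith, hδ2, hη0,
    by rw [hη]; linarith, hε, by linarith, h2, ?_, h4, h5, ?_, h7⟩
  · rw [hqe]
    linarith
  · rw [pairErr, hqe]
    linarith

end Constants

section Core
open Finset
set_option linter.unusedSectionVars false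

set_option maxHeartbeats 1000000 in
/-- The quantitative form of the embedding theorem. -/
lemma exists_embedding (p Δ' : ℕ) {χ μ : ℝ} (hχ : 1 < χ) (hpχ : (p : ℝ) + 1 ≤ χ) (hμ : 0 < μ)
    (hμχ : μ ≤ 1 / χ) :
    ∃ c K N : ℝ, 0 < c ∧ 0 < K ∧ ∀ {U V : Type} [Fintype U] [Fintype V] (H : SimpleGraph U)
      (G : SimpleGraph V) (col : U → ℕ) (F : Finset (Finset U)) (w : ℕ),
      N ≤ Fintype.card V → Fintype.card U = Fintype.card V → (∀ x, #(nb H x) ≤ Δ') →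
      (∀ v, (1 - 1 / χ + μ) * Fintype.card V ≤ ndeg G v) → (∀ x, col x < p + 2) →
      (∀ x y, H.Adj x y → col x ≠ col y) → (F : Set (Finset U)).PairwiseDisjoint id →
      F.biUnion id = univ → (∀ T ∈ F, Clsd H T) → (∀ T ∈ F, #T ≤ w) →
      (∀ T ∈ F, FlexTile H (p + 2) T) → (p = 0 → ∀ T ∈ F, SplitTile H T) →
      (#(univ.filter fun x => col x = 0) : ℝ) ≤ (1 - (p + 1) / χ) * Fintype.card U →
      1 ≤ w → (w : ℝ) ≤ c * Fintype.card V → K * w ^ 2 ≤ Fintype.card V → Nonempty V →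
      ∃ f : U → V, EmbOn G H univ f := by
  have hχ0 : 0 < χ := by linarith
  have hχ1 : 1 / χ ≤ 1 := by
    rw [div_le_one hχ0]
    exact hχ.le
  have hμ1 : μ ≤ 1 := hμχ.trans hχ1
  obtain ⟨Cap, β, δ, η, ε, hCap, hβ, hβt, hCapβ, hδ, hδβ, hδC, hη, hδη, hε, hεμ, heps, hweight,
    hε1, hε2, hpair, hεC⟩ := exists_constants (p + 2) Δ' hμ hμ1
  obtain ⟨M, hM, hreg⟩ := regularity_output hμ hμ1 hε hεμ
  have hM0 : (0 : ℝ) < M := by exact_mod_cast hM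
  obtain ⟨K, hK, halloc⟩ := exact_alloc p M (ν := μ / 8) (c₀ := 1 / (8 * M)) (by positivity)
    (by positivity)
  obtain ⟨d, hd⟩ : ∃ d, d = μ / 8 := ⟨_, rfl⟩
  obtain ⟨t, ht⟩ : ∃ t, t = μ / 128 := ⟨_, rfl⟩
  obtain ⟨C', hC'⟩ : ∃ C' : ℕ, C' = (p + 2) * (Δ' ^ 2 + 1) := ⟨_, rfl⟩
  rw [← hC', ← ht] at hCapβ hδC hεC
  rw [← hd] at hδβ hδη heps hweight hε1 hε2 hpair
  rw [← ht] at hβt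
  have ht0 : 0 < t := by rw [ht]; positivity
  have hd0 : 0 < d := by rw [hd]; positivity
  obtain ⟨c1, ⟨⟨⟨hc1, hc2⟩, hc3⟩, hc4⟩, hc⟩ := (((((eventually_mul_le 1
    (b := β / 2 * (d / 2) ^ Δ' / 4) (by positivity)).and
    (eventually_mul_le ((Cap : ℝ) + 1) (half_pos ht0))).and
    (eventually_mul_le 2 (b := η * β) (by positivity))).and
    (eventually_mul_le ((M : ℝ) ^ (p + 2)) (half_pos ht0))).and self_mem_nhdsWithin).exists
  have hc0 : (0 : ℝ) < c1 := hc
  refine ⟨c1 / (2 * M), 2 * K, 2 * M * (4 / β + 4 * C' / t) + 2 * M, by positivity, by positivity,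
    ?_⟩
  intro U V _ _ H G col F w hN hcardUV hdeg hG hcol hproper hdis huniv hcl hw hflex hsplit hcol0
    hw1 hwc hwK _
  have hn0 : (0 : ℝ) < Fintype.card V := by exact_mod_cast Fintype.card_pos
  have hn2M : 2 * M ≤ Fintype.card V := by
    have : (0 : ℝ) ≤ 2 * M * (4 / β + 4 * C' / t) := by positivity
    exact_mod_cast (by linarith : (2 : ℝ) * M ≤ Fintype.card V)
  obtain ⟨ι, _, Cl, R, D, m, hιM, hm, hR, hnm, hV0, hRw, hzw⟩ := hreg G (1 - 1 / χ) hn2M hG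
  rw [← hd] at hR hzw
  obtain ⟨n, hn⟩ : ∃ n : ℝ, n = Fintype.card V := ⟨_, rfl⟩
  have hrm := hR.card_mul_le
  rw [← hn] at hN hwc hwK hn0 hnm hV0 hRw hzw hrm
  have hClc : #(univ.biUnion Cl) = ∑ i, #(Cl i) := card_biUnion fun i _ j _ hij => hR.disj i j hij
  have hCln : ∑ i, (#(Cl i) : ℝ) ≤ n := by
    have h3 : #(univ.biUnion Cl) ≤ Fintype.card V := card_le_univ _
    rw [hClc] at h3
    rw [hn]
    exact_mod_cast h3
  have hι : Nonempty ι := by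
    by_contra h
    rw [not_nonempty_iff] at h
    have h1 : ∑ i, (#(Cl i) : ℝ) = 0 := by
      rw [univ_eq_empty, sum_empty]
    rw [h1] at hV0
    have h2 := mul_le_mul_of_nonneg_right (hεμ.trans (by linarith : μ / 8 ≤ 1 / 2)) hn0.le
    linarith
  have hmm0 : 4 / β + 4 * C' / t ≤ m := by
    have h1 : 2 * M * (4 / β + 4 * C' / t) ≤ 2 * M * m := by
      have : (0 : ℝ) ≤ 2 * M := by positivity
      linarith
    exact le_of_mul_le_mul_left h1 (by positivity)
  have hβm : 4 ≤ β * m := by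
    have h1 : 4 / β ≤ m := by
      have : 0 ≤ 4 * C' / t := by positivity
      linarith
    rw [div_le_iff₀ hβ] at h1
    linarith
  have hCm : 4 * C' ≤ t * m := by
    have h1 : 4 * C' / t ≤ m := by
      have : 0 ≤ 4 / β := by positivity
      linarith
    rw [div_le_iff₀ ht0] at h1
    linarith
  have hwm : (w : ℝ) ≤ c1 * m := by
    have h1 : c1 / (2 * M) * n ≤ c1 / (2 * M) * (2 * M * m) :=
      mul_le_mul_of_nonneg_left hnm (by positivity)
    have h2 : c1 / (2 * M) * (2 * M * m) = c1 * m := by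
      field_simp
    linarith
  have hfit : Fits Δ' d ε (β / 2) m w := by
    refine ⟨?_, heps, hweight, hd0, by rw [hd]; linarith, by positivity, hm, hε.le⟩
    have := mul_le_mul_of_nonneg_right hc1 hm.le
    linarith
  have hcast : ((p + 2 : ℕ) : ℝ) = p + 2 := by push_cast; rfl
  rw [hcast] at hCap hδC hεC
  have hθ : (p : ℝ) + μ / 2 ≤ (p + 1) * (1 - 1 / χ + μ / 2) := by
    have h1 : ((p : ℝ) + 1) / χ ≤ 1 := by
      rw [div_le_one hχ0]
      exact hpχ
    have h2 : ((p : ℝ) + 1) * (1 / χ) = (p + 1) / χ := by ring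
    have h3 : 0 ≤ (p : ℝ) * μ := by positivity
    linarith
  have hs0 : ∀ j, (0 : ℝ) ≤ #(Cl j) := fun j => by positivity
  obtain ⟨σ, hσ, hσi, hσc⟩ := cluster_cliques p hs0 hR.up (by positivity) hn0.le hCln hRw hθ
    (Cap := Cap) (by
      have h1 : ((p : ℝ) + 2) * Fintype.card ι * (2 * m) ≤ (p + 2) * 2 * n := by
        have := mul_le_mul_of_nonneg_left hrm (by positivity : 0 ≤ ((p : ℝ) + 2) * 2)
        linarith
      rw [div_lt_iff₀ hμ] at hCap
      have h2 := mul_lt_mul_of_pos_right hCap hn0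
      linarith)
  have hσz : ∀ Z : Finset V, (#Z : ℝ) ≤ (ε + δ) * Fintype.card V →
      ∃ σ : V → ℕ → ι, (∀ z ∈ Z, Clq R (p + 2) (σ z)) ∧
        (∀ z ∈ Z, ∀ l < p + 2 - 1, d * m ≤ #(nb G z ∩ Cl (σ z l))) ∧
        ∀ j, #(Z.filter fun z => ∃ l < p + 2, σ z l = j) ≤
          ⌊4 * (p + 2) / μ * ((ε + δ) * m)⌋₊ + 1 := by
    intro Z hZ
    rw [← hn] at hZ
    obtain ⟨σ, hσ, hσc⟩ := clique_loads p hs0 hR.up (by positivity) hn0.le hCln hRw hθ Z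
      (Nb := fun z => univ.filter fun j => d * #(Cl j) ≤ (#(nb G z ∩ Cl j) : ℝ))
      (fun z _ => hzw z) (Cap := ⌊4 * (p + 2) / μ * ((ε + δ) * m)⌋₊ + 1) (by
        have h1 := Nat.lt_floor_add_one (4 * (p + 2) / μ * ((ε + δ) * m))
        have h2 : 4 * (p + 2) / μ * ((ε + δ) * m) * (μ / 2 * n) =
            (p + 2) * ((ε + δ) * n) * (2 * m) := by
          field_simp
          ring
        have h3 : ((p : ℝ) + 2) * #Z * (2 * m) ≤ (p + 2) * ((ε + δ) * n) * (2 * m) :=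
          mul_le_mul_of_nonneg_right (mul_le_mul_of_nonneg_left hZ (by positivity))
            (by positivity)
        have h4 := mul_lt_mul_of_pos_right h1 (by positivity : 0 < μ / 2 * n)
        push_cast
        linarith)
    refine ⟨σ, fun z hz => (hσ z hz).1, fun z hz l hl => ?_, hσc⟩
    have h1 := (mem_filter.1 ((hσ z hz).2 l (by omega))).2
    exact (mul_le_mul_of_nonneg_left (hR.low _) hd0.le).trans h1
  have hUne : Nonempty U := by
    rw [← Fintype.card_pos_iff, hcardUV]
    exact Fintype.card_pos
  have v0 : U → V := fun _ => Classical.arbitrary V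
  have hC1 : (1 : ℝ) ≤ C' := by
    rw [hC']
    exact_mod_cast Nat.mul_pos (by omega : 0 < p + 2) (by positivity)
  have hq1 : 1 ≤ 4 * ((p : ℝ) + 2) / μ := by
    rw [le_div_iff₀ hμ]
    have : (0 : ℝ) ≤ p := by positivity
    linarith
  obtain ⟨A, NB, F1, F2, B, f1, f2, C, hP⟩ := exists_partial hR hcardUV hdeg hfit
    (by omega : 0 < p + 2) hcol hproper hdis hcl hw huniv hσ hσi hσc (by omega) hσz
    (by rw [← hn]; exact hV0) hβ hβm hβt (by rw [ht, hd]; linarith) (t := t) (η := η) (by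
      rw [← hC']
      push_cast
      have h1 := mul_le_mul_of_nonneg_right hCapβ hm.le
      have h2 := mul_le_mul_of_nonneg_right hc2 hm.le
      have h3 := mul_le_mul_of_nonneg_left hwm (by positivity : 0 ≤ (Cap : ℝ) + 1)
      linarith) hε1 hε2 hpair hη.le (by
      have := mul_le_mul_of_nonneg_right hc3 hm.le
      linarith) hδ hδη hδβ (by
      rw [← hC']
      have h1 : (C' : ℝ) * (ε + δ) * 1 ≤ C' * (ε + δ) * (4 * (p + 2) / μ) :=
        mul_le_mul_of_nonneg_left hq1 (by positivity)
      linarith) (by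
      rw [← hC']
      have h1 := Nat.floor_le (by positivity : 0 ≤ 4 * ((p : ℝ) + 2) / μ * ((ε + δ) * m))
      have h2 := mul_le_mul_of_nonneg_left h1 (by positivity : (0 : ℝ) ≤ C')
      have h3 := mul_le_mul_of_nonneg_right (add_le_add hεC hδC) hm.le
      have h4 : (Fintype.card ι : ℝ) ^ (p + 2) * w ≤ M ^ (p + 2) * (c1 * m) := by
        have h5 : (Fintype.card ι : ℝ) ≤ M := by exact_mod_cast hιM
        exact mul_le_mul (pow_le_pow_left₀ (by positivity) h5 _) hwm (by positivity)
          (by positivity)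
      have h5 := mul_le_mul_of_nonneg_right hc4 hm.le
      have h6 : (C' : ℝ) * ((⌊4 * ((p : ℝ) + 2) / μ * ((ε + δ) * m)⌋₊ + 1 : ℕ) : ℝ) =
          C' * ⌊4 * ((p : ℝ) + 2) / μ * ((ε + δ) * m)⌋₊ + C' := by
        push_cast
        ring
      rw [h6]
      have h7 : (C' : ℝ) * (4 * (p + 2) / μ * ((ε + δ) * m)) =
          (C' * (4 * (p + 2) / μ) * ε + C' * (4 * (p + 2) / μ) * δ) * m := by ring
      linarith) v0
  obtain ⟨F3, hF3, free, cap, hfree, hfreec, hcaps, hF3n, hcapm, hcapCl, hfinish⟩ :=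
    hP.reduce hcardUV hR.disj hR.low (by rw [← hn]; exact hrm) hdis hcl huniv hm ht0.le
      (by rw [ht]; linarith)
  rw [← hn] at hF3n
  obtain ⟨N3, hN3⟩ : ∃ N3 : ℝ, N3 = #(F3.biUnion id) := ⟨_, rfl⟩
  have hsumN3 : ((∑ j, cap j : ℕ) : ℝ) = N3 := by rw [hcaps, hN3]
  have hN3n : N3 ≤ n := by
    rw [hN3, hn, ← hcardUV]
    exact_mod_cast card_le_univ _
  rw [← hN3] at hF3n
  have htn : 128 * (t * n) = μ * n := by
    rw [ht]
    ring
  have hμn : μ * n ≤ n := by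
    have := mul_le_mul_of_nonneg_right hμ1 hn0.le
    linarith
  have hach : Ach H R (F3.biUnion id) fun j => (cap j : ℤ) := by
    have hsub : (F3 : Set (Finset U)) ⊆ F := by exact_mod_cast hF3
    refine halloc H R col F3 cap w (1 - (p + 1) / χ + 8 * t) (1 / χ - μ / 4) hιM hcol hproper
      (hdis.subset hsub) (fun T hT => hcl T (hF3 hT))
      (fun T hT => hw T (hF3 hT)) (fun T hT => hflex T (hF3 hT))
      (fun hp T hT => hsplit hp T (hF3 hT)) hw1 ?_ ?_ ?_ hcaps ?_ ?_ ?_ ?_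
    · have h1 : ((p : ℝ) + 1) / χ ≤ 1 := by
        rw [div_le_one hχ0]
        exact hpχ
      linarith
    · linarith
    · have h1 : ((p : ℝ) + 1) * (1 / χ) = (p + 1) / χ := by ring
      have h2 : 0 ≤ (p : ℝ) * μ := by positivity
      rw [ht]
      linarith
    · intro j
      rw [hsumN3]
      have h1 := hcapm j
      have h2 : 1 / (8 * M) * N3 ≤ 1 / (8 * M) * (2 * M * m) :=
        mul_le_mul_of_nonneg_left (hN3n.trans hnm) (by positivity)
      have h3 : 1 / (8 * M) * (2 * M * m) = m / 4 := by
        field_simp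
        ring
      linarith
    · intro i
      rw [hsumN3]
      have h1 : ((∑ j ∈ univ.filter (fun j => ¬ R.Adj i j), cap j : ℕ) : ℝ) ≤
          ∑ j ∈ univ.filter (fun j => ¬ R.Adj i j), (#(Cl j) : ℝ) := by
        push_cast
        exact sum_le_sum fun j _ => Nat.cast_le.2 (hcapCl j)
      have h2 := sum_filter_add_sum_filter_not univ (fun j => R.Adj i j) fun j => (#(Cl j) : ℝ)
      have h3 := hRw i
      have h4 : (1 / χ - μ / 4) * (n - 4 * t * n) ≤ (1 / χ - μ / 4) * N3 :=
        mul_le_mul_of_nonneg_left hF3n (by linarith)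
      have h5 : (1 / χ - μ / 4) * (4 * t * n) ≤ 1 * (4 * t * n) :=
        mul_le_mul_of_nonneg_right (by linarith) (by positivity)
      linarith
    · rw [← hN3]
      have h1 : (#((F3.biUnion id).filter fun x => col x = 0) : ℝ) ≤
          #(univ.filter fun x => col x = 0) :=
        Nat.cast_le.2 (card_le_card (filter_subset_filter _ (subset_univ _)))
      rw [hcardUV, ← hn] at hcol0
      have h0 : ((p : ℝ) + 1) / χ ≤ 1 := by
        rw [div_le_one hχ0]
        exact hpχ
      have h00 : 0 ≤ ((p : ℝ) + 1) / χ := by positivity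
      have h2 : (1 - ((p : ℝ) + 1) / χ) * (n - N3) ≤ 1 * (n - N3) :=
        mul_le_mul_of_nonneg_right (by linarith) (by linarith)
      have h3 : 8 * t * (n - 4 * t * n) ≤ 8 * t * N3 :=
        mul_le_mul_of_nonneg_left hF3n (by positivity)
      have h4 : 8 * t * (4 * t * n) ≤ 4 * t * n := by
        have : 8 * t ≤ 1 := by rw [ht]; linarith
        have := mul_le_mul_of_nonneg_right this (by positivity : 0 ≤ 4 * t * n)
        linarith
      linarith
    · rw [hsumN3]
      linarith
  obtain ⟨f3, hf3, hmem, hcnt⟩ := exact_stage hR hdeg hfit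
    (hdis.subset (by exact_mod_cast hF3)) (fun T hT => hcl T (hF3 hT))
    (fun T hT => hw T (hF3 hT)) hfree hach hfreec v0
  exact hfinish f3 hf3 hmem hcnt

end Core

section Growth
set_option linter.unusedSectionVars false

/-- The growth of the tile size compared to `n`. -/
lemma tile_size_bounds {c K : ℝ} (N : ℝ) (hc : 0 < c) (hK : 0 < K) :
    ∃ n₀ : ℕ, ∀ n : ℕ, n₀ ≤ n → 1 ≤ n ∧ N ≤ n ∧
      ((⌊√(n : ℝ) / Real.log n⌋₊ + 1 : ℕ) : ℝ) ≤ c * n ∧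
      K * ((⌊√(n : ℝ) / Real.log n⌋₊ + 1 : ℕ) : ℝ) ^ 2 ≤ n := by
  have hcast := tendsto_natCast_atTop_atTop (R := ℝ)
  have hlog := Real.tendsto_log_atTop.comp hcast
  have h1 := hcast.eventually_ge_atTop (max (max 1 N) (max (4 / c ^ 2) (4 * K)))
  have h2 := hlog.eventually_ge_atTop (1 + 4 * K)
  obtain ⟨n₀, hn₀⟩ := Filter.eventually_atTop.1 (h1.and h2)
  refine ⟨n₀, fun n hn => ?_⟩
  obtain ⟨h3, h4⟩ := hn₀ n hn
  rw [max_le_iff, max_le_iff, max_le_iff] at h3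
  obtain ⟨⟨hn1, hN⟩, hn2, hn3⟩ := h3
  have hL : 1 + 4 * K ≤ Real.log n := h4
  have hL1 : 1 ≤ Real.log n := by linarith
  have hs0 : 0 ≤ √(n : ℝ) := Real.sqrt_nonneg _
  have hs1 : 1 ≤ √(n : ℝ) := Real.one_le_sqrt.2 hn1
  have hss : √(n : ℝ) ^ 2 = n := Real.sq_sqrt (by linarith)
  obtain ⟨q, hq⟩ : ∃ q, q = √(n : ℝ) / Real.log n := ⟨_, rfl⟩
  have hq0 : 0 ≤ q := hq ▸ div_nonneg hs0 (by linarith)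
  have hqL : q * Real.log n = √(n : ℝ) := by
    rw [hq]
    field_simp
  have hqs : q ≤ √(n : ℝ) := by
    rw [← hqL]
    exact le_mul_of_one_le_right hq0 hL1
  rw [← hq]
  have hf := Nat.floor_le hq0
  have hw : ((⌊q⌋₊ + 1 : ℕ) : ℝ) ≤ q + 1 := by
    push_cast
    linarith
  refine ⟨by exact_mod_cast hn1, hN, ?_, ?_⟩
  · have h5 : 2 / c ≤ √(n : ℝ) := by
      refine Real.le_sqrt_of_sq_le ?_
      rw [div_pow]
      norm_num
      exact hn2
    rw [div_le_iff₀ hc] at h5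
    have h6 := mul_le_mul_of_nonneg_left h5 hs0
    have h7 : √(n : ℝ) * (√(n : ℝ) * c) = c * n := by
      calc √(n : ℝ) * (√(n : ℝ) * c) = c * √(n : ℝ) ^ 2 := by ring
        _ = c * n := by rw [hss]
    linarith
  · have h5 : ((⌊q⌋₊ + 1 : ℕ) : ℝ) ^ 2 ≤ (q + 1) ^ 2 := pow_le_pow_left₀ (by positivity) hw 2
    have h6 : (q + 1) ^ 2 ≤ 2 * q ^ 2 + 2 := by linarith [sq_nonneg (q - 1)]
    have h7 : 4 * K * q ^ 2 ≤ n := by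
      rw [← hss, ← hqL, mul_pow]
      have h8 : 4 * K ≤ Real.log n ^ 2 := by
        have := mul_le_mul_of_nonneg_left hL1 (by linarith : 0 ≤ Real.log n)
        rw [pow_two]
        linarith
      have := mul_le_mul_of_nonneg_right h8 (sq_nonneg q)
      linarith
    have h9 := mul_le_mul_of_nonneg_left (h5.trans h6) hK.le
    linarith

end Growth

/-- Theorem 1.1 (extended Kühn–Osthus theorem for mixed tilings). -/
theorem extended_KO (χ Δ μ : ℝ) (hχ : 1 < χ) (hΔ : 1 < Δ) (hμ : 0 < μ) :
    ∃ n₀ : ℕ, ∀ n : ℕ, n₀ ≤ n → ∀ H G : SimpleGraph (Fin n),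
      IsTiling H (TileFcr ⌈χ⌉₊ (Real.sqrt n / Real.log n)) →
      critR H ≤ χ →
      (∀ v, (ndeg H v : ℝ) ≤ Δ) →
      (∀ v, (1 - 1 / χ + μ) * n ≤ (ndeg G v : ℝ)) →
      ContainsCopy G H := by
  have hk2 : 2 ≤ ⌈χ⌉₊ := Nat.lt_ceil.2 (by exact_mod_cast hχ)
  obtain ⟨p, hp⟩ := Nat.exists_eq_add_of_le' hk2
  have hpχ : (p : ℝ) + 1 ≤ χ := by
    have h1 := Nat.ceil_lt_add_one (by linarith : 0 ≤ χ)
    rw [hp] at h1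
    push_cast at h1
    linarith
  obtain ⟨c, K, N, hc, hK, hemb⟩ := exists_embedding p ⌊Δ⌋₊ hχ hpχ
    (lt_min hμ (by positivity : 0 < 1 / χ)) (min_le_right μ (1 / χ))
  obtain ⟨n₀, hn₀⟩ := tile_size_bounds N hc hK
  refine ⟨n₀, fun n hn H G hT hcrit hH hG => ?_⟩
  obtain ⟨hn1, hN, hw1, hw2⟩ := hn₀ n hn
  have hne : Nonempty (Fin n) := ⟨⟨0, hn1⟩⟩
  obtain ⟨F, col, hdis, huniv, hcl, hw, hflex, hsplit, hcol, hproper, hcol0⟩ :=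
    tiling_data hχ rfl hT hcrit
  have hkc : ((⌈χ⌉₊ : ℕ) : ℝ) - 1 = p + 1 := by
    rw [hp]
    push_cast
    ring
  rw [hkc] at hcol0
  rw [hp] at hflex hsplit hcol
  have hcn : (Fintype.card (Fin n) : ℝ) = n := by rw [Fintype.card_fin]
  obtain ⟨f, hf⟩ := hemb H G col F (⌊√(n : ℝ) / Real.log n⌋₊ + 1) (by rw [hcn]; exact hN) rfl
    (fun x => by
      rw [← ndeg_eq_card_nb]
      exact Nat.le_floor (hH x))
    (fun v => by
      rw [hcn]
      refine le_trans (mul_le_mul_of_nonneg_right ?_ (by positivity)) (hG v)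
      have := min_le_left μ (1 / χ)
      linarith) hcol hproper hdis huniv hcl
    (fun T hT => (Nat.le_floor (hw T hT)).trans (Nat.le_succ _)) hflex
    (fun h0 => hsplit (by omega)) hcol0 (Nat.le_add_left 1 _) (by rw [hcn]; exact hw1)
    (by rw [hcn]; exact hw2) hne
  exact containsCopy_of_embOn hf

end Paper
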